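/- (Approximate extended Ghirlanda–Guerra identities.) Let ψ be the (σ,λ)-GFF on V_N, let β ∈ ℬ, and let α < α' be scales with λ^{j−1} < α < α' < λ^{j + (m−j)·1_{{j = l_β}}} for some j ∈ {1,...,l_β}. Set S_{α,α'} = (𝒥̄_{σ²}(α), 𝒥̄_{σ²}(α')]. Then for every s ∈ ℕ, every k ∈ {1,...,s}, and every family of functions h : V_N^s → ℝ with sup_N ‖h‖_∞ < ∞, writing v = (v^1,...,v^s), one has lim_{N→∞} | E𝒢_{β,N}^{×(s+1)}[∫_{S_{α,α'}} 1_{{r < q^N(v^k,v^{s+1})}} dr · h(v)] − (1/s) E𝒢_{β,N}^{×2}[∫_{S_{α,α'}} 1_{{r < q^N(v^1,v^2)}} dr] · E𝒢_{β,N}^{×s}[h(v)] − (1/s) Σ_{l≠k, l≤s} E𝒢_{β,N}^{×s}[∫_{S_{α,α'}} 1_{{r < q^N(v^k,v^l)}} dr · h(v)] | = 0. -/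

import Mathlib

open Filter
open scoped Classical

noncomputable section GFFCommon

abbrev Vtx : Type := ℤ × ℤ

abbrev FieldSp : Type := Vtx → ℝ

def VN (N : ℕ) : Finset Vtx := Finset.Icc (0, 0) ((N : ℤ), (N : ℤ))

def bdry (B : Finset Vtx) : Finset Vtx :=
  B.filter fun v =>
    ¬((v.1 + 1, v.2) ∈ B ∧ (v.1 - 1, v.2) ∈ B ∧ (v.1, v.2 + 1) ∈ B ∧ (v.1, v.2 - 1) ∈ B)

def intr (B : Finset Vtx) : Finset Vtx := B \ bdry B

def nbhd (N : ℕ) (lam : ℝ) (v : Vtx) : Finset Vtx :=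
  if lam = 0 then VN N
  else if lam = 1 then {v}
  else (VN N).filter fun w =>
    |(w.1 : ℝ) - (v.1 : ℝ)| ≤ (N : ℝ) ^ ((1 : ℝ) - lam) / 2 ∧
    |(w.2 : ℝ) - (v.2 : ℝ)| ≤ (N : ℝ) ^ ((1 : ℝ) - lam) / 2

def scaleAlg (N : ℕ) (lam : ℝ) (v : Vtx) : MeasurableSpace FieldSp :=
  ⨆ w ∈ {w : Vtx | w ∈ VN N ∧ w ∉ intr (nbhd N lam v)},
    MeasurableSpace.comap (fun ω : FieldSp => ω w) inferInstance

def IsGreenFn (B : Finset Vtx) (G : Vtx → Vtx → ℝ) : Prop :=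
  (∀ x y : Vtx, x ∉ intr B ∨ y ∉ intr B → G x y = 0) ∧
  ∀ y ∈ intr B, ∀ x ∈ intr B,
    G x y = (G (x.1 + 1, x.2) y + G (x.1 - 1, x.2) y
        + G (x.1, x.2 + 1) y + G (x.1, x.2 - 1) y) / 4
      + (Real.pi / 2) * (if x = y then 1 else 0)

def IsGFF (N : ℕ) (P : MeasureTheory.Measure FieldSp) : Prop :=
  MeasureTheory.IsProbabilityMeasure P ∧
  ∃ G : Vtx → Vtx → ℝ, IsGreenFn (VN N) G ∧
    ∀ c : Vtx → ℝ,
      P.map (fun ω => ∑ v ∈ VN N, c v * ω v) =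
        ProbabilityTheory.gaussianReal 0 (Real.toNNReal (∑ v ∈ VN N, ∑ w ∈ VN N, c v * c w * G v w))

open MeasureTheory in
def phiScale (N : ℕ) (P : MeasureTheory.Measure FieldSp) (v : Vtx) (lam : ℝ) : FieldSp → ℝ :=
  P[fun ω : FieldSp => ω v | scaleAlg N lam v]

def ScaleParams (M : ℕ) (sigv lamv : ℕ → ℝ) : Prop :=
  1 ≤ M ∧ (∀ i ∈ Finset.Icc 1 M, 0 < sigv i) ∧
  lamv 0 = 0 ∧ lamv M = 1 ∧ ∀ i, i < M → lamv i < lamv (i + 1)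

def psiFld (N M : ℕ) (sigv lamv : ℕ → ℝ) (P : MeasureTheory.Measure FieldSp) (v : Vtx) : FieldSp → ℝ :=
  fun ω => ∑ i ∈ Finset.Icc 1 M, sigv i * (phiScale N P v (lamv i) ω - phiScale N P v (lamv (i - 1)) ω)

open MeasureTheory in
def psiScale (N M : ℕ) (sigv lamv : ℕ → ℝ) (P : MeasureTheory.Measure FieldSp) (v : Vtx) (lam : ℝ) :
    FieldSp → ℝ :=
  P[psiFld N M sigv lamv P v | scaleAlg N lam v]

def psiInc (N M : ℕ) (sigv lamv : ℕ → ℝ) (P : MeasureTheory.Measure FieldSp) (v : Vtx) (lam lam' : ℝ) :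
    FieldSp → ℝ :=
  fun ω => psiScale N M sigv lamv P v lam' ω - psiScale N M sigv lamv P v lam ω

def stepFn (M : ℕ) (sigv lamv : ℕ → ℝ) (s : ℝ) : ℝ :=
  (if s = 0 then sigv 1 else 0) +
  ∑ i ∈ Finset.Icc 1 M, if lamv (i - 1) < s ∧ s ≤ lamv i then sigv i else 0

def Jint (f : ℝ → ℝ) (s : ℝ) : ℝ := ∫ r in (0:ℝ)..s, f r

def Jint2 (f : ℝ → ℝ) (s₁ s₂ : ℝ) : ℝ := ∫ r in s₁..s₂, f r

def Jsig2 (M : ℕ) (sigv lamv : ℕ → ℝ) (s : ℝ) : ℝ := Jint (fun r => (stepFn M sigv lamv r) ^ 2) s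

def JsigBar (M : ℕ) (sigv lamv : ℕ → ℝ) (s : ℝ) : ℝ := Jsig2 M sigv lamv s / Jsig2 M sigv lamv 1

def concaveHull (f : ℝ → ℝ) (s : ℝ) : ℝ :=
  sInf {y | ∃ g : ℝ → ℝ, ConcaveOn ℝ (Set.Icc (0:ℝ) 1) g ∧
    (∀ t ∈ Set.Icc (0:ℝ) 1, f t ≤ g t) ∧ y = g s}

def EffParams (M : ℕ) (sigv lamv : ℕ → ℝ) (m : ℕ) (sigb lamb : ℕ → ℝ) (sigbar : ℝ → ℝ) : Prop :=
  1 ≤ m ∧ m ≤ M ∧ lamb 0 = 0 ∧ lamb m = 1 ∧ (∀ j, j < m → lamb j < lamb (j + 1)) ∧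
  (∀ l, 1 ≤ l → l < m → sigb (l + 1) < sigb l) ∧ (∀ l ∈ Finset.Icc 1 m, 0 < sigb l) ∧
  sigbar 0 = sigb 1 ∧
  (∀ l ∈ Finset.Icc 1 m, ∀ s : ℝ, lamb (l - 1) < s → s ≤ lamb l → sigbar s = sigb l) ∧
  (∀ s : ℝ, 0 < s → s ≤ 1 →
    concaveHull (Jsig2 M sigv lamv) s = ∫ r in (0:ℝ)..s, (sigbar r) ^ 2)

def gammaStar (M : ℕ) (sigv lamv : ℕ → ℝ) (sigbar : ℝ → ℝ) : ℝ :=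
  ∫ s in (0:ℝ)..1, (stepFn M sigv lamv s) ^ 2 / sigbar s

def gammaL (M : ℕ) (sigv lamv : ℕ → ℝ) (lamb : ℕ → ℝ) (sigbar : ℝ → ℝ) (l : ℕ) : ℝ :=
  if l = 0 then 0 else ∫ s in (0:ℝ)..1, (stepFn M sigv lamv s) ^ 2 / sigbar (min s (lamb l))

def IsEntropy (M : ℕ) (sigv lamv : ℕ → ℝ) (m : ℕ) (lamb : ℕ → ℝ) (sigbar : ℝ → ℝ)
    (EntE : ℝ → ℝ) : Prop :=
  EntE 0 = 1 ∧
  ∀ l ∈ Finset.Icc 1 m, ∀ γ : ℝ,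
    gammaL M sigv lamv lamb sigbar (l - 1) < γ → γ ≤ gammaL M sigv lamv lamb sigbar l →
      EntE γ = (1 - lamb (l - 1)) -
        (γ - ∫ s in (0:ℝ)..(lamb (l - 1)), (stepFn M sigv lamv s) ^ 2 / sigbar s) ^ 2 /
          Jint2 (fun r => (stepFn M sigv lamv r) ^ 2) (lamb (l - 1)) 1

def fREM (σ β : ℝ) : ℝ :=
  if (2 / σ) < β then 2 * (β / (2 / σ)) else 1 + (β / (2 / σ)) ^ 2

def lbeta (m : ℕ) (sigb : ℕ → ℝ) (β : ℝ) : ℕ :=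
  if β ≤ 2 / sigb m then sInf {l : ℕ | 1 ≤ l ∧ β ≤ 2 / sigb l} else m + 1

def fpsiLim (m : ℕ) (sigb lamb : ℕ → ℝ) (β : ℝ) : ℝ :=
  (∑ j ∈ Finset.Icc 1 (lbeta m sigb β - 1), (2 * β / (2 / sigb j)) * (lamb j - lamb (j - 1))) +
  ∑ j ∈ Finset.Icc (lbeta m sigb β) m, (1 + β ^ 2 / (2 / sigb j) ^ 2) * (lamb j - lamb (j - 1))

def critSet (m : ℕ) (sigb : ℕ → ℝ) : Set ℝ :=
  {β | 0 < β ∧ ∀ j ∈ Finset.Icc 1 m, β ≠ 2 / sigb j}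

def ZN (N M : ℕ) (sigv lamv : ℕ → ℝ) (P : MeasureTheory.Measure FieldSp) (β : ℝ) (ω : FieldSp) : ℝ :=
  ∑ v ∈ VN N, Real.exp (β * psiFld N M sigv lamv P v ω)

def freeEnergy (N M : ℕ) (sigv lamv : ℕ → ℝ) (P : MeasureTheory.Measure FieldSp) (β : ℝ) (ω : FieldSp) : ℝ :=
  (Real.log ((N : ℝ) ^ 2))⁻¹ * Real.log (ZN N M sigv lamv P β ω)

def AN (N : ℕ) (ρ : ℝ) : Finset Vtx :=
  (VN N).filter fun v => ∀ z : Vtx, z ∉ VN N →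
    (N : ℝ) ^ ((1 : ℝ) - ρ) ≤ Real.sqrt (((v.1 : ℝ) - (z.1 : ℝ)) ^ 2 + ((v.2 : ℝ) - (z.2 : ℝ)) ^ 2)

def ZNres (N M : ℕ) (sigv lamv : ℕ → ℝ) (P : MeasureTheory.Measure FieldSp) (β ρ : ℝ) (ω : FieldSp) : ℝ :=
  ∑ v ∈ AN N ρ, Real.exp (β * psiFld N M sigv lamv P v ω)

def freeEnergyRes (N M : ℕ) (sigv lamv : ℕ → ℝ) (P : MeasureTheory.Measure FieldSp) (β ρ : ℝ)
    (ω : FieldSp) : ℝ :=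
  (Real.log ((N : ℝ) ^ 2))⁻¹ * Real.log (ZNres N M sigv lamv P β ρ ω)

def gibbsW (N M : ℕ) (sigv lamv : ℕ → ℝ) (P : MeasureTheory.Measure FieldSp) (β : ℝ) (v : Vtx)
    (ω : FieldSp) : ℝ :=
  Real.exp (β * psiFld N M sigv lamv P v ω) / ZN N M sigv lamv P β ω

def gibbsWres (N M : ℕ) (sigv lamv : ℕ → ℝ) (P : MeasureTheory.Measure FieldSp) (β ρ : ℝ) (v : Vtx)
    (ω : FieldSp) : ℝ :=
  Real.exp (β * psiFld N M sigv lamv P v ω) / ZNres N M sigv lamv P β ρ ω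

def gibbsExp (N M : ℕ) (sigv lamv : ℕ → ℝ) (P : MeasureTheory.Measure FieldSp) (β : ℝ) (s : ℕ)
    (F : (Fin s → Vtx) → ℝ) : ℝ :=
  ∫ ω, (∑ vv ∈ Fintype.piFinset (fun _ : Fin s => VN N),
    (∏ i, gibbsW N M sigv lamv P β (vv i) ω) * F vv) ∂P

def gibbsExpRes (N M : ℕ) (sigv lamv : ℕ → ℝ) (P : MeasureTheory.Measure FieldSp) (β ρ : ℝ) (s : ℕ)
    (F : (Fin s → Vtx) → FieldSp → ℝ) : ℝ :=
  ∫ ω, (∑ vv ∈ Fintype.piFinset (fun _ : Fin s => AN N ρ),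
    (∏ i, gibbsWres N M sigv lamv P β ρ (vv i) ω) * F vv ω) ∂P

def gibbsExpW (N M : ℕ) (sigv lamv : ℕ → ℝ) (P : MeasureTheory.Measure FieldSp) (β : ℝ) (s : ℕ)
    (F : (Fin s → Vtx) → FieldSp → ℝ) : ℝ :=
  ∫ ω, (∑ vv ∈ Fintype.piFinset (fun _ : Fin s => VN N),
    (∏ i, gibbsW N M sigv lamv P β (vv i) ω) * F vv ω) ∂P

def psiCov (N M : ℕ) (sigv lamv : ℕ → ℝ) (P : MeasureTheory.Measure FieldSp) (v v' : Vtx) : ℝ :=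
  ∫ ω, psiFld N M sigv lamv P v ω * psiFld N M sigv lamv P v' ω ∂P

def IsVarBound (M : ℕ) (sigv lamv : ℕ → ℝ) (P : ℕ → MeasureTheory.Measure FieldSp) (C₀ : ℝ) : Prop :=
  0 < C₀ ∧ ∃ N₀ : ℕ, ∀ N ≥ N₀, ∀ v ∈ VN N,
    psiCov N M sigv lamv (P N) v v ≤ Jsig2 M sigv lamv 1 * Real.log N + C₀

def overlapQ (N M : ℕ) (sigv lamv : ℕ → ℝ) (P : MeasureTheory.Measure FieldSp) (C₀ : ℝ) (v v' : Vtx) : ℝ :=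
  psiCov N M sigv lamv P v v' / (Jsig2 M sigv lamv 1 * Real.log N + C₀)

def TendstoInProb (P : ℕ → MeasureTheory.Measure FieldSp) (X : ℕ → FieldSp → ℝ) (c : ℝ) : Prop :=
  ∀ ε : ℝ, 0 < ε → Tendsto (fun N => P N {ω | ε < |X N ω - c|}) atTop (nhds 0)

def TendstoLp (P : ℕ → MeasureTheory.Measure FieldSp) (X : ℕ → FieldSp → ℝ) (p c : ℝ) : Prop :=
  Tendsto (fun N => ∫ ω, |X N ω - c| ^ p ∂(P N)) atTop (nhds 0)

def bScale (N : ℕ) (v v' : Vtx) : ℝ :=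
  sSup {lam : ℝ | lam ∈ Set.Icc (0:ℝ) 1 ∧ ((nbhd N lam v) ∩ (nbhd N lam v')).Nonempty}

end GFFCommon
section
local notation "𝝅" => Real.pi
open Finset (mem_filter mem_erase Icc sum_insert sum_congr sum_add_distrib mul_sum sum_sub_distrib abs_sum_le_sum_abs sum_le_sum sum_const sum_le_sum_of_subset_of_nonneg mem_product mem_Icc sum_eq_zero sum_div sum_eq_single single_le_sum sum_image mem_of_mem_erase mem_singleton sum_sdiff sum_ite_eq' sum_comm sum_mul sum_nonneg prod_mul_distrib prod_congr sum_coe_sort measurable_sum range sum_pos univ_nonempty mem_univ univ mem_insert_of_mem Ico mem_image sum_range card_le_card card_product card_image_of_injective sum_range_sub mem_range card_univ sum_map subset_univ add_sum_erase sum_filter sum_range_succ')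
open Real (pi_pos log log_nonneg log_div log_mul log_pow log_le_sub_one_of_pos arctan continuous_arctan log_le_iff_le_exp exp_one_gt_d9 exp log_le_log log_two_lt_d9 rpow_pos_of_pos log_rpow exp_nat_mul exp_log exp_pos exp_sub exp_le_exp add_one_le_exp tendsto_log_atTop log_exp exp_add log_pos toNNReal coe_toNNReal norm_eq_abs sqrt log_natCast_nonneg cos sin hasDerivAt_sin measurable_log rpow_one rpow_nonneg rpow_add zero_rpow rpow_add_le_add_rpow exp_mul mul_rpow sq_sqrt log_inv sqrt_le_iff sqrt_nonneg one_le_exp sqrt_sq log_le_log_iff exp_zero)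
open MeasureTheory (Measure)
local notation "ℙ" => (by positivity)
local notation "𝕆" => (by omega)
local notation "𝕃" => (by linarith)
local notation "𝕂" => (by norm_num)
local notation "𝟘" => (fun _ => 0)
local notation:max "𝕍" N:max => (VN N : Type)
local notation "𝟙" P:max => (if P then (1 : ℝ) else 0)
local notation "𝟏" => (1 : ℝ)
local notation "𝟎" => (0 : ℝ)
variable {M m : ℕ} {sigv lamv sigb lamb : ℕ → ℝ} {sigbar : ℝ → ℝ}


noncomputable def avg4 (u : Vtx → ℝ) (x : Vtx) : ℝ :=
  (u (x.1 + 1, x.2) + u (x.1 - 1, x.2) + u (x.1, x.2 + 1) + u (x.1, x.2 - 1)) / 4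

def adjTo (D : Finset Vtx) (y : Vtx) : Prop :=
  (y.1 + 1, y.2) ∈ D ∨ (y.1 - 1, y.2) ∈ D ∨ (y.1, y.2 + 1) ∈ D ∨ (y.1, y.2 - 1) ∈ D

theorem max_principle (D : Finset Vtx) (u : Vtx → ℝ) (h1 : ∀ x ∈ D, avg4 u x ≤ u x)
    (h2 : ∀ y, y ∉ D → adjTo D y → 0 ≤ u y) : ∀ x ∈ D, 0 ≤ u x := by
  intro x hx
  by_contra hneg
  push Not at hneg
  obtain ⟨x0, hx0, hmin⟩ := D.exists_min_image u ⟨x, hx⟩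
  have hm : u x0 < 0 := lt_of_le_of_lt (hmin x hx) hneg
  obtain ⟨x1, hx1, hmax⟩ := (D.filter fun z ↦ u z = u x0).exists_max_image (fun z ↦ z.1)
    ⟨x0, by simp [hx0]⟩
  simp only [mem_filter] at hx1 hmax
  have ge : ∀ y, adjTo D y → u x0 ≤ u y := by grind
  have a1 : u x0 < u (x1.1 + 1, x1.2) := by
    by_cases hyD : (x1.1 + 1, x1.2) ∈ D
    · grind
    · exact lt_of_lt_of_le hm (h2 _ hyD (by right; left; simpa using hx1.1))
  have a2 := ge (x1.1 - 1, x1.2) (by left; simpa using hx1.1)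
  have a3 := ge (x1.1, x1.2 + 1) (by right; right; right; simpa using hx1.1)
  have a4 := ge (x1.1, x1.2 - 1) (by right; right; left; simpa using hx1.1)
  have := h1 x1 hx1.1
  unfold avg4 at this
  linarith [hx1.2]

def GreenOn (D : Finset Vtx) (G : Vtx → Vtx → ℝ) : Prop :=
  (∀ x y : Vtx, x ∉ D ∨ y ∉ D → G x y = 0) ∧
  ∀ y ∈ D, ∀ x ∈ D, G x y = avg4 (fun z ↦ G z y) x + (𝝅 / 2) * (if x = y then 1 else 0)

theorem isGreenFn_iff (B : Finset Vtx) (G : Vtx → Vtx → ℝ) :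
    IsGreenFn B G ↔ GreenOn (intr B) G := Iff.rfl

theorem zero_of_harm (D : Finset Vtx) (u : Vtx → ℝ) (h1 : ∀ x ∈ D, u x = avg4 u x)
    (h2 : ∀ y, y ∉ D → u y = 0) : ∀ x, u x = 0 := by
  intro x
  by_cases hx : x ∈ D
  · apply le_antisymm
    · have := max_principle D (fun z ↦ - u z) (fun z hz ↦ by
        have := h1 z hz; unfold avg4 at *; linarith) (fun y hy _ ↦ by simp [h2 y hy]) x hx
      linarith
    · exact max_principle D u (fun z hz ↦ (h1 z hz).ge) (fun y hy _ ↦ (h2 y hy).ge) x hx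
  · exact h2 x hx

theorem green_exists (D : Finset Vtx) : ∃ G, GreenOn D G := by
  let ext : (D → ℝ) → Vtx → ℝ := fun u x ↦ if h : x ∈ D then u ⟨x, h⟩ else 0
  have ext_add : ∀ u w x, ext (u + w) x = ext u x + ext w x := by
    intro u w x; by_cases h : x ∈ D <;> simp [ext, h]
  have ext_smul : ∀ (c : ℝ) u x, ext (c • u) x = c * ext u x := by
    intro c u x; by_cases h : x ∈ D <;> simp [ext, h]
  let T : (D → ℝ) →ₗ[ℝ] (D → ℝ) :=
    { toFun := fun u x ↦ u x - avg4 (ext u) x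
      map_add' := by
        intro u w; funext x; simp only [avg4, ext_add, Pi.add_apply]; ring
      map_smul' := by
        intro c u; funext x
        simp only [avg4, ext_smul, Pi.smul_apply, smul_eq_mul, RingHom.id_apply]; ring }
  have hext : ∀ (u : D → ℝ) (x : D), ext u x = u x := by
    intro u x; simp [ext]
  have hinj : Function.Injective T := by
    rw [← LinearMap.ker_eq_bot, LinearMap.ker_eq_bot']
    intro u hu
    have := zero_of_harm D (ext u) (fun x hx ↦ by
      have := congrFun hu ⟨x, hx⟩
      simp only [T, LinearMap.coe_mk, AddHom.coe_mk, Pi.zero_apply] at this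
      have h2 := hext u ⟨x, hx⟩
      simp only at h2
      linarith) (fun y hy ↦ by simp [ext, hy])
    funext x
    rw [← hext u x, this]; rfl
  have hsurj := (LinearMap.injective_iff_surjective (f := T)).1 hinj
  choose S hS using hsurj
  refine ⟨fun x y ↦ if y ∈ D then
    ext (S fun z ↦ (𝝅 / 2) * (if (z : Vtx) = y then 1 else 0)) x else 0, ?_, ?_⟩
  · grind
  · intro y hy x hx
    have := congrFun (hS fun z ↦ (𝝅 / 2) * (if (z : Vtx) = y then 1 else 0)) ⟨x, hx⟩
    simp only [T, LinearMap.coe_mk, AddHom.coe_mk] at this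
    have h2 := hext (S fun z ↦ (𝝅 / 2) * (if (z : Vtx) = y then 1 else 0)) ⟨x, hx⟩
    simp only at h2
    simp only [hy, if_true]
    linarith

theorem green_unique {D : Finset Vtx} {G G' : Vtx → Vtx → ℝ} (h : GreenOn D G)
    (h' : GreenOn D G') (x y : Vtx) : G x y = G' x y := by
  by_cases hy : y ∈ D
  · have := zero_of_harm D (fun z ↦ G z y - G' z y) (fun z hz ↦ by
      have a := h.2 y hy z hz
      have b := h'.2 y hy z hz
      unfold avg4 at *; linarith) (fun z hz ↦ by simp [h.1 z y (Or.inl hz), h'.1 z y (Or.inl hz)]) x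
    linarith
  · rw [h.1 x y (Or.inr hy), h'.1 x y (Or.inr hy)]

theorem green_nonneg {D : Finset Vtx} {G : Vtx → Vtx → ℝ} (h : GreenOn D G) (x y : Vtx) :
    0 ≤ G x y := by
  by_cases hy : y ∈ D
  · by_cases hx : x ∈ D
    · refine max_principle D (fun z ↦ G z y) (fun z hz ↦ ?_)
        (fun z hz _ ↦ (h.1 z y (Or.inl hz)).ge) x hx
      have := h.2 y hy z hz
      have hp := pi_pos
      rw [this]
      split_ifs <;> linarith
    · rw [h.1 x y (Or.inl hx)]
  · rw [h.1 x y (Or.inr hy)]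

theorem green_le_diag {D : Finset Vtx} {G : Vtx → Vtx → ℝ} (h : GreenOn D G) (x y : Vtx) :
    G x y ≤ G y y := by
  by_cases hy : y ∈ D
  · by_cases hx : x ∈ D.erase y
    · have := max_principle (D.erase y) (fun z ↦ G y y - G z y) (fun z hz ↦ ?_)
        (fun z hz _ ↦ ?_) x hx
      · linarith
      · have hz' := mem_erase.1 hz
        have := h.2 y hy z hz'.2
        simp only [hz'.1, if_false] at this
        unfold avg4 at *; linarith
      · by_cases hzy : z = y
        · simp [hzy]
        · have : z ∉ D := fun hzD ↦ hz (mem_erase.2 ⟨hzy, hzD⟩)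
          rw [h.1 z y (Or.inl this)]
          linarith [green_nonneg h y y]
    · by_cases hxy : x = y
      · rw [hxy]
      · have : x ∉ D := fun hzD ↦ hx (mem_erase.2 ⟨hxy, hzD⟩)
        rw [h.1 x y (Or.inl this)]
        exact green_nonneg h y y
  · rw [h.1 x y (Or.inr hy), h.1 y y (Or.inr hy)]

theorem finsum_shift (F : Vtx → ℝ) (a : Vtx) : ∑ᶠ x : Vtx, F (x + a) = ∑ᶠ x : Vtx, F x :=
  finsum_comp_equiv (Equiv.addRight a)

theorem avg4_eq (u : Vtx → ℝ) (x : Vtx) : avg4 u x =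
    (u (x + (1, 0)) + u (x + (-1, 0)) + u (x + (0, 1)) + u (x + (0, -1))) / 4 := by
  obtain ⟨a, b⟩ := x
  simp [avg4, sub_eq_add_neg]

theorem avg4_symm (D : Finset Vtx) (u w : Vtx → ℝ) (hu : ∀ x, x ∉ D → u x = 0) :
    ∑ᶠ x : Vtx, u x * avg4 w x = ∑ᶠ x : Vtx, avg4 u x * w x := by
  have fin1 : ∀ (F : Vtx → ℝ), (Function.support fun x ↦ u x * F x).Finite := by
    intro F
    refine D.finite_toSet.subset fun x hx ↦ ?_
    by_contra h
    exact hx (by simp [hu x (by simpa using h)])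
  have key : ∀ a : Vtx, ∑ᶠ x : Vtx, u x * w (x + a) = ∑ᶠ x : Vtx, u (x + -a) * w x := by
    intro a
    rw [← finsum_shift (fun x ↦ u (x + -a) * w x) a]
    simp
  have fin2 : ∀ a : Vtx, (Function.support fun x ↦ u (x + a) * w x).Finite := by
    intro a
    have := (fin1 (fun x ↦ w (x + -a)))
    have h2 := this.preimage (f := fun x ↦ x + a) (by
      intro p _ q _ h; simpa using h)
    refine h2.subset fun x hx ↦ ?_
    simpa using hx
  have e1 : ∀ x, u x * avg4 w x = (1/4) * (((u x * w (x + (1, 0)) + u x * w (x + (-1, 0))) + u x * w (x + (0, 1)))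
      + u x * w (x + (0, -1))) := by intro x; rw [avg4_eq]; ring
  have e2 : ∀ x, avg4 u x * w x = (1/4) * (((u (x + (1, 0)) * w x + u (x + (-1, 0)) * w x) + u (x + (0, 1)) * w x)
      + u (x + (0, -1)) * w x) := by intro x; rw [avg4_eq]; ring
  simp_rw [e1, e2]
  rw [← mul_finsum, ← mul_finsum]
  · rw [finsum_add_distrib, finsum_add_distrib, finsum_add_distrib, finsum_add_distrib,
      finsum_add_distrib, finsum_add_distrib, key, key, key, key]
    · simp; ring
    all_goals first
      | exact fin2 _ | exact fin1 _
      | exact ((fin2 _).union (fin2 _)).subset (Function.support_add _ _)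
      | exact ((fin1 _).union (fin1 _)).subset (Function.support_add _ _)
      | exact ((((fin2 _).union (fin2 _)).subset (Function.support_add _ _)).union (fin2 _)).subset (Function.support_add _ _)
      | exact ((((fin1 _).union (fin1 _)).subset (Function.support_add _ _)).union (fin1 _)).subset (Function.support_add _ _)

theorem green_symm {D : Finset Vtx} {G : Vtx → Vtx → ℝ} (h : GreenOn D G) (x y : Vtx) :
    G x y = G y x := by
  by_cases hx : x ∈ D
  swap
  · rw [h.1 x y (Or.inl hx), h.1 y x (Or.inr hx)]
  by_cases hy : y ∈ D
  swap
  · rw [h.1 x y (Or.inr hy), h.1 y x (Or.inl hy)]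
  have key : ∀ a ∈ D, ∀ b ∈ D, ∑ᶠ z : Vtx, G z a * (G z b - avg4 (fun w ↦ G w b) z)
      = (𝝅 / 2) * G b a := by
    intro a ha b hb
    rw [finsum_eq_single _ b]
    · rw [h.2 b hb b hb]; simp; ring
    · intro z hz
      by_cases hzD : z ∈ D
      · rw [h.2 b hb z hzD]; simp [hz]
      · rw [h.1 z a (Or.inl hzD)]; simp
  have fin : ∀ (a : Vtx) (F : Vtx → ℝ), (Function.support fun z ↦ G z a * F z).Finite := by
    intro a F
    refine D.finite_toSet.subset fun z hz ↦ ?_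
    by_contra hh
    exact hz (by simp [h.1 z a (Or.inl (by simpa using hh))])
  have e1 := key x hx y hy
  have e2 := key y hy x hx
  simp_rw [mul_sub] at e1 e2
  rw [finsum_sub_distrib (fin _ _) (fin _ _), avg4_symm D (fun z ↦ G z x) _ (fun z hz ↦ h.1 z x (Or.inl hz))] at e1
  rw [finsum_sub_distrib (fin _ _) (fin _ _)] at e2
  have c1 : ∑ᶠ z, G z x * G z y = ∑ᶠ z, G z y * G z x := finsum_congr fun z ↦ mul_comm _ _
  have c2 : ∑ᶠ z, avg4 (fun w ↦ G w x) z * G z y = ∑ᶠ z, G z y * avg4 (fun w ↦ G w x) z :=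
    finsum_congr fun z ↦ mul_comm _ _
  rw [c1, c2] at e1
  have : (𝝅/2) * G y x = (𝝅/2) * G x y := by rw [← e1, ← e2]
  have hp := pi_pos
  exact (mul_left_cancel₀ ℙ this).symm

noncomputable def sq1 (x : Vtx) : ℝ := (x.1 : ℝ) ^ 2 + (x.2 : ℝ) ^ 2 + 1

noncomputable def fl (x : Vtx) : ℝ := (1/2) * log (sq1 x)

noncomputable def mu (x : Vtx) : ℝ := avg4 fl x - fl x

noncomputable def gl (x : Vtx) : ℝ := fl x - 12 / sq1 x

theorem sq1_ge (x : Vtx) : 1 ≤ sq1 x := by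
  unfold sq1; nlinarith [sq_nonneg (x.1:ℝ), sq_nonneg (x.2:ℝ)]
theorem sq1_pos (x : Vtx) : 0 < sq1 x := lt_of_lt_of_le one_pos (sq1_ge x)
theorem fl_nonneg (x : Vtx) : 0 ≤ fl x := by
  unfold fl; have := log_nonneg (sq1_ge x); linarith
theorem fl_zero : fl 0 = 0 := by simp [fl, sq1]
theorem gl_le (x : Vtx) : gl x ≤ fl x := by
  unfold gl; have := div_nonneg (by norm_num : 𝟎 ≤ 12) (sq1_pos x).le; linarith
theorem gl_ge (x : Vtx) : fl x - 12 ≤ gl x := by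
  unfold gl
  have : 12 / sq1 x ≤ 12 := div_le_self 𝕂 (sq1_ge x)
  linarith

theorem mu_eq (x : Vtx) : mu x = (1/8) * log (1 + (2 * sq1 x ^ 2 + 8 * sq1 x + 5
    + 16 * (x.1:ℝ)^2 * (x.2:ℝ)^2) / sq1 x ^ 4) := by
  have h0 := sq1_pos x
  have p : ∀ y, sq1 y ≠ 0 := fun y ↦ (sq1_pos y).ne'
  have : 1 + (2 * sq1 x ^ 2 + 8 * sq1 x + 5 + 16 * (x.1:ℝ)^2 * (x.2:ℝ)^2) / sq1 x ^ 4
    = (sq1 (x.1+1,x.2) * sq1 (x.1-1,x.2) * sq1 (x.1,x.2+1) * sq1 (x.1,x.2-1)) / sq1 x ^ 4 := by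
    field_simp
    simp only [sq1]; push_cast; ring
  rw [this, log_div (by simp [p]) (by simp [p]), log_mul (by simp [p]) (p _),
    log_mul (by simp [p]) (p _), log_mul (p _) (p _), log_pow]
  unfold mu avg4 fl; push_cast; ring

theorem mu_nonneg (x : Vtx) : 0 ≤ mu x := by
  rw [mu_eq]
  have := sq1_pos x
  have : 0 ≤ log (1 + (2 * sq1 x ^ 2 + 8 * sq1 x + 5
    + 16 * (x.1:ℝ)^2 * (x.2:ℝ)^2) / sq1 x ^ 4) := log_nonneg (by
      have : 0 ≤ (2 * sq1 x ^ 2 + 8 * sq1 x + 5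
    + 16 * (x.1:ℝ)^2 * (x.2:ℝ)^2) / sq1 x ^ 4 := by positivity
      linarith)
  linarith

theorem mu_le (x : Vtx) : mu x ≤ 3 / sq1 x ^ 2 := by
  rw [mu_eq]
  have h1 := sq1_ge x
  have h0 := sq1_pos x
  have h2 : (x.1:ℝ)^2 * (x.2:ℝ)^2 ≤ sq1 x ^ 2 / 4 := by
    have : sq1 x ≥ (x.1:ℝ)^2 + (x.2:ℝ)^2 := by unfold sq1; linarith
    nlinarith [sq_nonneg ((x.1:ℝ)^2 - (x.2:ℝ)^2), sq_nonneg (x.1:ℝ), sq_nonneg (x.2:ℝ)]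
  set A := (2 * sq1 x ^ 2 + 8 * sq1 x + 5 + 16 * (x.1:ℝ)^2 * (x.2:ℝ)^2) / sq1 x ^ 4 with hA
  have hA0 : 0 ≤ A := by positivity
  have h3 : log (1 + A) ≤ A := by
    have := log_le_sub_one_of_pos (by linarith : 0 < 1 + A); linarith
  have h4 : A ≤ 24 / sq1 x ^ 2 := by
    rw [hA, div_le_div_iff₀ ℙ ℙ]
    have e : (24:ℝ) * sq1 x ^ 4 = (24 * sq1 x ^ 2) * sq1 x ^ 2 := by ring
    rw [e]
    apply mul_le_mul_of_nonneg_right _ ℙ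
    nlinarith
  have : 3 / sq1 x ^ 2 = (1/8) * (24 / sq1 x ^ 2) := by ring
  rw [this]; linarith

theorem inv_sub (x : Vtx) (hx : 5 ≤ sq1 x) :
    1 / (4 * sq1 x ^ 2) ≤ avg4 (fun y ↦ 1 / sq1 y) x - 1 / sq1 x := by
  set s := sq1 x with hs
  set p := (x.1:ℝ) with hp
  set q := (x.2:ℝ) with hq
  have es : s = p^2+q^2+1 := rfl
  have e1 : sq1 (x.1+1,x.2) = s+1+2*p := by simp only [sq1]; push_cast; rw [es]; ring
  have e2 : sq1 (x.1-1,x.2) = s+1-2*p := by simp only [sq1]; push_cast; rw [es]; ring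
  have e3 : sq1 (x.1,x.2+1) = s+1+2*q := by simp only [sq1]; push_cast; rw [es]; ring
  have e4 : sq1 (x.1,x.2-1) = s+1-2*q := by simp only [sq1]; push_cast; rw [es]; ring
  have p1 : 0 < s+1+2*p := e1 ▸ sq1_pos _
  have p2 : 0 < s+1-2*p := e2 ▸ sq1_pos _
  have p3 : 0 < s+1+2*q := e3 ▸ sq1_pos _
  have p4 : 0 < s+1-2*q := e4 ▸ sq1_pos _
  have A : 𝟏/(s+1+2*p) + 1/(s+1-2*p) = 2*(s+1)/((s+1)^2-4*p^2) := by grind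
  have B : 𝟏/(s+1+2*q) + 1/(s+1-2*q) = 2*(s+1)/((s+1)^2-4*q^2) := by
    rw [div_add_div _ _ p3.ne' p4.ne']; congr 1 <;> ring
  have P : 0 < (s+1)^2-4*p^2 := by have := mul_pos p1 p2; nlinarith
  have Q : 0 < (s+1)^2-4*q^2 := by have := mul_pos p3 p4; nlinarith
  have C : ∀ a b : ℝ, 0 < a → 0 < b → 4/(a+b) ≤ 1/a+1/b := by
    intro a b ha hb
    rw [div_add_div _ _ ha.ne' hb.ne', div_le_div_iff₀ ℙ ℙ]
    nlinarith [sq_nonneg (a-b)]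
  have D := C _ _ P Q
  have E : (s+1)^2-4*p^2 + ((s+1)^2-4*q^2) = 2*(s^2+3) := by rw [es]; ring
  rw [E] at D
  have F : avg4 (fun y ↦ 1 / sq1 y) x = (s+1)/2 * (1/((s+1)^2-4*p^2) + 1/((s+1)^2-4*q^2)) := by
    have : avg4 (fun y ↦ 1 / sq1 y) x = (𝟏/(s+1+2*p) + 1/(s+1-2*p) + (𝟏/(s+1+2*q) + 1/(s+1-2*q)))/4 := by
      simp only [avg4, e1, e2, e3, e4]; ring
    rw [this, A, B]; ring
  rw [F]
  have G : (s+1)/2 * (4/(2*(s^2+3))) ≤ (s+1)/2 * (1/((s+1)^2-4*p^2) + 1/((s+1)^2-4*q^2)) :=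
    mul_le_mul_of_nonneg_left D 𝕃
  have H : 1 / (4 * s ^ 2) + 1/s ≤ (s+1)/2 * (4/(2*(s^2+3))) := by
    have : (s+1)/2 * (4/(2*(s^2+3))) = (s+1)/(s^2+3) := by field_simp; norm_num
    rw [this, div_add_div _ _ ℙ ℙ, div_le_div_iff₀ ℙ ℙ]
    have : 0 ≤ s * (3 * s^2 - 12 * s - 3) := by
      apply mul_nonneg 𝕃; nlinarith
    nlinarith
  linarith

theorem gl_super (x : Vtx) (hx : 5 ≤ sq1 x) : avg4 gl x ≤ gl x := by
  have h1 := inv_sub x hx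
  have h2 := mu_le x
  have e : avg4 gl x - gl x = mu x - 12 * (avg4 (fun y ↦ 1 / sq1 y) x - 1 / sq1 x) := by
    unfold mu avg4 gl; ring
  have : 12 * (1 / (4 * sq1 x ^ 2)) = 3 / sq1 x ^ 2 := by grind
  linarith

theorem fl_neg1 (a b : ℤ) : fl (-a, b) = fl (a, b) := by simp [fl, sq1]
theorem fl_swap (a b : ℤ) : fl (a, b) = fl (b, a) := by simp only [fl, sq1]; ring_nf

theorem mu_sum (n : ℕ) : ∑ x ∈ Icc (-n:ℤ) n ×ˢ Icc (-n:ℤ) n, mu x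
    = ∑ k ∈ Icc (-n:ℤ) n, (fl ((n:ℤ)+1, k) - fl ((n:ℤ), k)) := by
  have tel : ∀ (F : ℤ → ℝ) (n : ℕ), ∑ a ∈ Icc (-n:ℤ) n, (F (a+1) - F a) = F (n+1) - F (-n) := by
    intro F n
    induction n with
    | zero => simp
    | succ n ih =>
      have : Icc (-((n+1:ℕ):ℤ)) ((n+1:ℕ):ℤ) = insert (-((n:ℤ)+1)) (insert ((n:ℤ)+1) (Icc (-n:ℤ) n)) := by grind
      rw [this, sum_insert, sum_insert, ih]
      · simp
      · simp
      · grind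
  have hx : ∀ b : ℤ, ∑ a ∈ Icc (-n:ℤ) n, (fl (a+1,b) + fl (a-1,b) - 2 * fl (a,b))
      = 2 * (fl ((n:ℤ)+1, b) - fl ((n:ℤ), b)) := by
    intro b
    have := tel (fun a ↦ fl (a, b) - fl (a-1,b)) n
    simp only [add_sub_cancel_right] at this
    rw [sum_congr rfl (fun a _ ↦ (by ring : fl (a+1,b) + fl (a-1,b) - 2 * fl (a,b) = fl (a+1,b) - fl (a,b) - (fl (a,b) - fl (a-1,b)))), this]
    have : (-(n:ℤ) - 1) = -((n:ℤ)+1) := by ring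
    rw [this, fl_neg1, fl_neg1]; ring
  have e : ∀ x : Vtx, mu x = (1/4) * (fl (x.1+1,x.2) + fl (x.1-1,x.2) - 2 * fl (x.1,x.2))
    + (1/4) * (fl (x.2+1,x.1) + fl (x.2-1,x.1) - 2 * fl (x.2,x.1)) := by
    intro x
    rw [fl_swap (x.2+1), fl_swap (x.2-1), fl_swap x.2]
    obtain ⟨a, b⟩ := x
    simp only [mu, avg4]; ring
  rw [sum_congr rfl (fun x _ ↦ e x), sum_add_distrib, ← mul_sum, ← mul_sum]
  rw [Finset.sum_product_right, Finset.sum_product]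
  simp only [hx]
  rw [← mul_sum]; ring

theorem flux_term (n : ℕ) (hn : 1 ≤ n) (k : ℤ) :
    |(fl ((n:ℤ)+1, k) - fl ((n:ℤ), k)) - (arctan (((k+1:ℤ):ℝ)/n) - arctan ((k:ℝ)/n))| ≤ 8 / (n:ℝ)^2 := by
  have hn' : 𝟏 ≤ n := by exact_mod_cast hn
  have hn0 : 𝟎 < n := by linarith
  set a := (k:ℝ)/n with ha
  have hb : ((k+1:ℤ):ℝ)/n = a + 1/n := by rw [ha]; push_cast; ring
  rw [hb]
  have hi : 𝟎 < 1/n := by positivity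
  obtain ⟨c, hc, hc2⟩ := exists_deriv_eq_slope arctan (by linarith : a < a + 1/n)
    continuous_arctan.continuousOn (Real.differentiable_arctan.differentiableOn)
  have hc3 : arctan (a+1/n) - arctan a = (1/n) * (1/(1+c^2)) := by
    rw [Real.deriv_arctan] at hc2
    have : a + 1/(n:ℝ) - a = 1/n := by ring
    rw [this] at hc2; simp only at hc2; rw [hc2]; field_simp
  have b1 : |1/(1+c^2) - 1/(1+a^2)| ≤ 1/(n:ℝ) := by
    have e : 1/(1+c^2) - 1/(1+a^2) = (a-c)*((a+c)/((1+c^2)*(1+a^2))) := by field_simp; ring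
    rw [e, abs_mul]
    have h1 : |a - c| ≤ 1/n := by grind
    have h2 : |(a+c)/((1+c^2)*(1+a^2))| ≤ 1 := by
      rw [abs_div, div_le_one ℙ, abs_of_pos (a := (1+c^2)*(1+a^2)) ℙ, abs_le]
      constructor <;> nlinarith [sq_nonneg (a+1/2), sq_nonneg (c+1/2), sq_nonneg (a-1/2), sq_nonneg (c-1/2), sq_nonneg (a*c)]
    calc _ ≤ (1/(n:ℝ)) * 1 := mul_le_mul h1 h2 (abs_nonneg _) hi.le
      _ = _ := by ring
  set T := (n:ℝ)^2 + (k:ℝ)^2 with hT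
  have hT1 : (n:ℝ)^2 ≤ T := by nlinarith
  have hT0 : 0 < T := by positivity
  have b2 : (1/(n:ℝ)) * (1/(1+a^2)) = n / T := by rw [ha, hT]; field_simp
  set y := (2*(n:ℝ)+1)/(T+1) with hy
  have e1 : fl ((n:ℤ)+1, k) - fl ((n:ℤ), k) = (1/2) * log (1+y) := by
    have : 1 + y = sq1 ((n:ℤ)+1,k) / sq1 ((n:ℤ),k) := by
      simp only [sq1, hy]; push_cast; rw [← hT]; field_simp; rw [hT]; ring
    rw [this, log_div (sq1_pos _).ne' (sq1_pos _).ne']; unfold fl; ring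
  have y0 : 0 ≤ y := by positivity
  have y1 : y ≤ 3/n := by
    rw [hy, div_le_div_iff₀ ℙ hn0]; nlinarith
  have l1 : log (1+y) ≤ y := by
    have := log_le_sub_one_of_pos (by linarith : 0 < 1 + y); linarith
  have l2 : y - y^2 ≤ log (1+y) := by
    have := Real.one_sub_inv_le_log_of_pos (by linarith : 0 < 1 + y)
    have e : 1 - (1+y)⁻¹ = y - y^2/(1+y) := by field_simp; ring
    have : y^2/(1+y) ≤ y^2 := div_le_self ℙ 𝕃
    linarith
  have b3 : |y/2 - n/T| ≤ 2/(n:ℝ)^2 := by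
    have e : y/2 - n/T = (T/2 - n)/(T*(T+1)) := by rw [hy]; field_simp; ring
    rw [e, abs_div, abs_of_pos (a := T*(T+1)) ℙ, div_le_div_iff₀ ℙ ℙ]
    have : |T/2 - n| ≤ 2 * T := by rw [abs_le]; constructor <;> nlinarith
    calc _ ≤ (2*T) * (T) := mul_le_mul this hT1 ℙ ℙ
      _ ≤ _ := by nlinarith
  have b4 : y^2 ≤ 9/(n:ℝ)^2 := by
    have : y^2 ≤ (3/n)^2 := pow_le_pow_left₀ y0 y1 2
    calc _ ≤ _ := this
      _ = _ := by ring
  rw [e1, hc3]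
  have b5 : |(1/(n:ℝ)) * (1/(1+c^2)) - n/T| ≤ 1/(n:ℝ)^2 := by
    rw [← b2, ← mul_sub, abs_mul, abs_of_pos hi]
    calc _ ≤ (1/(n:ℝ)) * (1/n) := mul_le_mul_of_nonneg_left b1 hi.le
      _ = _ := by ring
  have g : (9:ℝ)/n^2 = 9*(1/n^2) := by ring
  have g2 : (2:ℝ)/n^2 = 2*(1/n^2) := by ring
  have g3 : (8:ℝ)/n^2 = 8*(1/n^2) := by ring
  rw [g] at b4; rw [g2] at b3; rw [g3]
  rw [abs_le] at *
  have : 0 ≤ 1/(n:ℝ)^2 := by positivity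
  constructor <;> linarith [b3.1, b3.2, b5.1, b5.2]

theorem mu_tendsto : Tendsto (fun n : ℕ ↦ ∑ x ∈ Icc (-n:ℤ) n ×ˢ Icc (-n:ℤ) n, mu x)
    atTop (nhds (𝝅 / 2)) := by
  have tel : ∀ (F : ℤ → ℝ) (n : ℕ), ∑ a ∈ Icc (-n:ℤ) n, (F (a+1) - F a) = F (n+1) - F (-n) := by
    intro F n
    induction n with
    | zero => simp
    | succ n ih =>
      have : Icc (-((n+1:ℕ):ℤ)) ((n+1:ℕ):ℤ) = insert (-((n:ℤ)+1)) (insert ((n:ℤ)+1) (Icc (-n:ℤ) n)) := by grind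
      rw [this, sum_insert, sum_insert, ih]
      · simp
      · simp
      · grind
  have hinv : Tendsto (fun n : ℕ ↦ 1/(n:ℝ)) atTop (nhds 0) := tendsto_one_div_atTop_nhds_zero_nat
  have lim : Tendsto (fun n : ℕ ↦ arctan (1 + 1/(n:ℝ)) + arctan 1) atTop (nhds (𝝅/2)) := by
    have := ((continuous_arctan.tendsto (1+0)).comp (hinv.const_add 1)).add_const (arctan 1)
    have e : arctan (1+0) + arctan 1 = 𝝅/2 := by
      rw [add_zero, Real.arctan_one]; ring
    rw [e] at this; exact this
  have z : Tendsto (fun n : ℕ ↦ 24 * (1/(n:ℝ))) atTop (nhds 0) := by simpa using hinv.const_mul 24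
  refine tendsto_of_tendsto_of_dist lim ?_
  refine squeeze_zero' (Eventually.of_forall fun _ ↦ dist_nonneg) ?_ z
  filter_upwards [eventually_ge_atTop 1] with n hn
  have hn' : 𝟏 ≤ n := by exact_mod_cast hn
  have hn0 : (n:ℝ) ≠ 0 := by positivity
  have t := tel (fun k ↦ arctan ((k:ℝ)/n)) n
  have e1 : (((n:ℤ)+1:ℤ):ℝ)/n = 1 + 1/n := by push_cast; field_simp
  have e2 : ((-(n:ℤ):ℤ):ℝ)/n = -1 := by push_cast; field_simp
  simp only [e1, e2, Real.arctan_neg, sub_neg_eq_add] at t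
  rw [dist_comm, Real.dist_eq, mu_sum, ← t, ← sum_sub_distrib]
  refine (abs_sum_le_sum_abs _ _).trans ?_
  refine (sum_le_sum fun k _ ↦ flux_term n hn k).trans ?_
  simp only [sum_const, Int.card_Icc, nsmul_eq_mul]
  have : (((n:ℤ) + 1 - -(n:ℤ)).toNat : ℝ) = 2*n+1 := by
    have : ((n:ℤ) + 1 - -(n:ℤ)).toNat = 2*n+1 := by omega
    rw [this]; push_cast; ring
  rw [this]
  have e : 24 * (1/(n:ℝ)) = (3*n) * (8/n^2) := by field_simp; norm_num
  rw [e]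
  exact mul_le_mul_of_nonneg_right 𝕃 ℙ

noncomputable def dropA : ℕ → ℝ
  | 0 => 0
  | k+1 => 4 * dropA k + 2 * 𝝅

theorem dropA_nonneg (k : ℕ) : 0 ≤ dropA k := by
  induction k with
  | zero => simp [dropA]
  | succ k ih => simp only [dropA]; have := pi_pos; linarith

theorem green_drop {D : Finset Vtx} {G : Vtx → Vtx → ℝ} (h : GreenOn D G) {v : Vtx} (hv : v ∈ D)
    (k : ℕ) : ∀ x : Vtx, (x.1 - v.1).natAbs + (x.2 - v.2).natAbs ≤ k → G v v - G x v ≤ dropA k := by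
  have hp := pi_pos
  have w0 : ∀ x, 0 ≤ G v v - G x v := fun x ↦ by linarith [green_le_diag h x v]
  have st : ∀ x, G v v - G (x.1+1,x.2) v ≤ 4 * (G v v - G x v) + 2 * 𝝅 ∧
      G v v - G (x.1-1,x.2) v ≤ 4 * (G v v - G x v) + 2 * 𝝅 ∧
      G v v - G (x.1,x.2+1) v ≤ 4 * (G v v - G x v) + 2 * 𝝅 ∧
      G v v - G (x.1,x.2-1) v ≤ 4 * (G v v - G x v) + 2 * 𝝅 := by
    intro x
    have a1 := w0 (x.1+1,x.2)
    have a2 := w0 (x.1-1,x.2)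
    have a3 := w0 (x.1,x.2+1)
    have a4 := w0 (x.1,x.2-1)
    by_cases hx : x ∈ D
    · have e := h.2 v hv x hx
      have : 𝟙(x = v) ≤ 1 := by split_ifs <;> norm_num
      have := mul_le_mul_of_nonneg_left this (by positivity : 0 ≤ 𝝅/2)
      unfold avg4 at e
      refine ⟨?_, ?_, ?_, ?_⟩ <;> linarith
    · have e := h.1 x v (Or.inl hx)
      have g0 := green_nonneg h v v
      have b1 := green_nonneg h (x.1+1,x.2) v
      have b2 := green_nonneg h (x.1-1,x.2) v
      have b3 := green_nonneg h (x.1,x.2+1) v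
      have b4 := green_nonneg h (x.1,x.2-1) v
      refine ⟨?_, ?_, ?_, ?_⟩ <;> linarith
  induction k with
  | zero =>
    intro x hx
    have : x = v := by ext <;> omega
    rw [this]; simp [dropA]
  | succ k ih =>
    intro x hx
    obtain ⟨a, b⟩ := x
    simp only at hx
    simp only [dropA]
    rcases lt_trichotomy a v.1 with h1 | h1 | h1
    · have i := ih (a+1, b) (by simp only; omega)
      have := (st (a+1,b)).2.1
      simp only [add_sub_cancel_right] at this; linarith
    · rcases lt_trichotomy b v.2 with h2 | h2 | h2
      · have i := ih (a, b+1) (by simp only; omega)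
        have := (st (a,b+1)).2.2.2
        simp only [add_sub_cancel_right] at this; linarith
      · grind
      · have i := ih (a, b-1) (by simp only; omega)
        have := (st (a,b-1)).2.2.1
        simp only [sub_add_cancel] at this; linarith
    · have i := ih (a-1, b) (by simp only; omega)
      have := (st (a-1,b)).1
      simp only [sub_add_cancel] at this; linarith

theorem avg4_shift (u : Vtx → ℝ) (a x : Vtx) : avg4 (fun y ↦ u (y - a)) x = avg4 u (x - a) := by
  rw [avg4_eq, avg4_eq]; simp [sub_add_eq_add_sub]

theorem mu_box_le (n : ℕ) (s : Finset Vtx) (hs : ∀ x ∈ s, x.1.natAbs ≤ n ∧ x.2.natAbs ≤ n) :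
    ∑ x ∈ s, mu x ≤ 𝝅 / 2 := by
  have mono : Monotone (fun n : ℕ ↦ ∑ x ∈ Icc (-n:ℤ) n ×ˢ Icc (-n:ℤ) n, mu x) := by
    intro a b hab
    refine sum_le_sum_of_subset_of_nonneg ?_ (fun x _ _ ↦ mu_nonneg x)
    intro x; simp only [mem_product, mem_Icc]; omega
  refine le_trans ?_ (mono.ge_of_tendsto mu_tendsto n)
  refine sum_le_sum_of_subset_of_nonneg ?_ (fun x _ _ ↦ mu_nonneg x)
  intro x hx
  have := hs x hx
  simp only [mem_product, mem_Icc]; omega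

theorem pot_exists {D : Finset Vtx} {G : Vtx → Vtx → ℝ} (h : GreenOn D G) (v : Vtx) :
    ∃ u : Vtx → ℝ, (∀ x, x ∉ D → u x = 0) ∧ (∀ x ∈ D, u x - avg4 u x = mu (x - v)) ∧
      u = fun x ↦ ∑ y ∈ D, (2/𝝅) * G x y * mu (y - v) := by
  have hp := pi_pos
  refine ⟨_, ?_, ?_, rfl⟩
  · intro x hx
    exact sum_eq_zero fun y _ ↦ by rw [h.1 x y (Or.inl hx)]; ring
  · intro x hx
    have : avg4 (fun x ↦ ∑ y ∈ D, (2/𝝅) * G x y * mu (y - v)) x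
      = ∑ y ∈ D, (2/𝝅) * avg4 (fun z ↦ G z y) x * mu (y - v) := by
      simp only [avg4, ← sum_add_distrib, sum_div]
      exact sum_congr rfl fun y _ ↦ by ring
    rw [this, ← sum_sub_distrib, sum_eq_single x]
    · rw [h.2 x hx x hx]; simp; field_simp; ring
    · intro y hy hyx
      rw [h.2 y hy x hx]; simp [hyx.symm]
    · exact fun hh ↦ absurd hx hh

theorem halfplane (e1 e2 p q n R : ℝ) (he : e1^2+e2^2 = 1) (hd : p*e1+q*e2 ≤ R) (hn : 2*R+3 ≤ n) (hR : 1 ≤ R) :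
    p^2+q^2+1 ≤ (p-n*e1)^2+(q-n*e2)^2+1 ∧ 5 ≤ (p-n*e1)^2+(q-n*e2)^2+1 := by
  have e : (p-n*e1)^2+(q-n*e2)^2 = p^2+q^2 - 2*n*(p*e1+q*e2) + n^2*(e1^2+e2^2) := by ring
  have f : p^2+q^2 = (p*e1+q*e2)^2 + (p*e2-q*e1)^2 := by grind
  rw [he] at e
  set d := p*e1+q*e2
  constructor
  · rw [e]; nlinarith
  · nlinarith

theorem small_nat (x v : Vtx) (h : sq1 (x - v) < 5) : (x.1 - v.1).natAbs + (x.2 - v.2).natAbs ≤ 4 := by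
  simp only [sq1, Prod.fst_sub, Prod.snd_sub] at h
  have t : ((x.1-v.1)^2 + (x.2-v.2)^2 : ℤ) < 4 := by
    have : (((x.1-v.1)^2 + (x.2-v.2)^2 : ℤ):ℝ) < 4 := by push_cast at h ⊢; linarith
    exact_mod_cast this
  generalize x.1 - v.1 = a at *
  generalize x.2 - v.2 = b at *
  have t1 : a < 2 := by nlinarith
  have t2 : -2 < a := by nlinarith
  have t3 : b < 2 := by nlinarith
  have t4 : -2 < b := by nlinarith
  omega

set_option maxHeartbeats 1000000 in
theorem green_est (ε : ℝ) (hε : 0 < ε) : ∃ C : ℝ, 0 ≤ C ∧ ∀ (D : Finset Vtx) (G : Vtx → Vtx → ℝ) (v : Vtx)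
    (R : ℝ) (e1 e2 : ℤ), GreenOn D G → 1 ≤ R →
    (∀ x : Vtx, |((x.1 - v.1 : ℤ):ℝ)| < R → |((x.2 - v.2:ℤ):ℝ)| < R → x ∈ D) → e1^2+e2^2 = 1 →
    (∀ x : Vtx, (x ∈ D ∨ adjTo D x) → (((x.1-v.1)*e1+(x.2-v.2)*e2 : ℤ) : ℝ) ≤ R) →
    ∀ x, |G x v - max 0 (log R - fl (x - v))| ≤ ε * log R + C := by
  have hp := pi_pos

  obtain ⟨n, hn⟩ : ∃ n : ℕ, (𝝅/2) / (1+ε) ≤ ∑ x ∈ Icc (-n:ℤ) n ×ˢ Icc (-n:ℤ) n, mu x := by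
    have : (𝝅/2) / (1+ε) < 𝝅/2 := div_lt_self ℙ 𝕃
    exact ((mu_tendsto.eventually (lt_mem_nhds this)).exists).imp fun _ h ↦ h.le
  have log37 : log 37 ≤ 4 := by
    rw [log_le_iff_le_exp 𝕂]
    have := exp_one_gt_d9
    have e : exp 4 = (exp 1)^4 := by simp
    rw [e]
    calc (37:ℝ) ≤ 2.7^4 := by norm_num
      _ ≤ _ := pow_le_pow_left₀ 𝕂 𝕃 4
  refine ⟨(1+ε)*30 + dropA (2*n) + dropA 4 + 20, by have := dropA_nonneg (2*n); have := dropA_nonneg 4; positivity, ?_⟩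
  intro D G v R e1 e2 hG hR hD he hhp
  have hR0 : 0 < R := by linarith
  have lR : 0 ≤ log R := log_nonneg hR
  have hv : v ∈ D := hD v (by simpa using hR0) (by simpa using hR0)
  set g0 := G v v with hg0
  have g00 : 0 ≤ g0 := green_nonneg hG v v

  have far : ∀ x, x ∉ D → log R ≤ fl (x - v) := by
    intro x hx
    have : R^2 ≤ sq1 (x - v) := by
      unfold sq1
      simp only [Prod.fst_sub, Prod.snd_sub]
      by_cases h1 : |((x.1 - v.1 : ℤ):ℝ)| < R
      · by_cases h2 : |((x.2 - v.2 : ℤ):ℝ)| < R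
        · grind
        · push Not at h2
          have := pow_le_pow_left₀ hR0.le h2 2
          rw [sq_abs] at this; nlinarith [sq_nonneg ((x.1-v.1:ℤ):ℝ)]
      · push Not at h1
        have := pow_le_pow_left₀ hR0.le h1 2
        rw [sq_abs] at this; nlinarith [sq_nonneg ((x.2-v.2:ℤ):ℝ)]
    have := log_le_log ℙ this
    rw [log_pow] at this
    unfold fl; push_cast at this; linarith

  set n' : ℕ := ⌈2*R⌉₊ + 3 with hn'
  have n1 : 2*R+3 ≤ (n':ℝ) := by rw [hn']; push_cast; have := Nat.le_ceil (2*R); linarith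
  have n2 : (n':ℝ) ≤ 2*R+4 := by
    rw [hn']; push_cast; have := (Nat.ceil_lt_add_one (by positivity : 0 ≤ 2*R)); linarith
  set vb : Vtx := (v.1 + n'*e1, v.2 + n'*e2) with hvb
  have sqb : ∀ x : Vtx, sq1 (x - vb) = (((x.1-v.1:ℤ):ℝ)-n'*e1)^2+(((x.2-v.2:ℤ):ℝ)-n'*e2)^2+1 := by
    intro x; simp only [sq1, hvb, Prod.fst_sub, Prod.snd_sub]; push_cast; ring
  have sqv : ∀ x : Vtx, sq1 (x - v) = (((x.1-v.1:ℤ):ℝ))^2+(((x.2-v.2:ℤ):ℝ))^2+1 := by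
    intro x; simp only [sq1, Prod.fst_sub, Prod.snd_sub]
  have heR : (e1:ℝ)^2+(e2:ℝ)^2 = 1 := by exact_mod_cast he
  have hpl : ∀ x : Vtx, (x ∈ D ∨ adjTo D x) → sq1 (x-v) ≤ sq1 (x-vb) ∧ 5 ≤ sq1 (x - vb) := by
    intro x hx
    rw [sqb, sqv]
    exact halfplane e1 e2 _ _ n' R heR (by have := hhp x hx; push_cast at this ⊢; linarith) n1 hR
  have flle : ∀ x : Vtx, (x ∈ D ∨ adjTo D x) → fl (x - v) ≤ gl (x - vb) + 12 := by
    intro x hx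
    have := log_le_log (sq1_pos _) (hpl x hx).1
    have h2 := gl_ge (x - vb)
    unfold fl at *; linarith
  have flup : ∀ x : Vtx, fl (x - vb) ≤ max (fl (x-v)) (log R) + 3 := by
    intro x
    have h1 : sq1 (x - vb) ≤ 2 * sq1 (x - v) + 72*R^2 := by
      rw [sqb, sqv]
      set p := ((x.1-v.1:ℤ):ℝ)
      set q := ((x.2-v.2:ℤ):ℝ)
      have : (n':ℝ)^2 ≤ 36*R^2 := by nlinarith
      have e : (p - n'*e1)^2+(q-n'*e2)^2 + ((p+n'*e1)^2+(q+n'*e2)^2) = 2*(p^2+q^2)+2*(n':ℝ)^2*((e1:ℝ)^2+(e2:ℝ)^2) := by ring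
      rw [heR] at e
      nlinarith [sq_nonneg (p+n'*e1), sq_nonneg (q+n'*e2)]
    set m := max (sq1 (x-v)) (R^2) with hm
    have m1 : 1 ≤ m := le_trans (sq1_ge _) (le_max_left _ _)
    have h2 : sq1 (x - vb) ≤ 2*37*m := by
      have := le_max_left (sq1 (x-v)) (R^2); have := le_max_right (sq1 (x-v)) (R^2); nlinarith
    have h3 := log_le_log (sq1_pos _) h2
    rw [log_mul 𝕂 ℙ, log_mul 𝕂 𝕂] at h3
    have h4 : (1/2) * log m ≤ max (fl (x-v)) (log R) := by
      rcases le_total (sq1 (x-v)) (R^2) with h | h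
      · rw [hm, max_eq_right h, log_pow]; push_cast
        exact le_trans 𝕃 (le_max_right _ _)
      · rw [hm, max_eq_left h]; exact le_max_left _ _
    have := log_two_lt_d9
    unfold fl at *; linarith

  have diagL : log R ≤ g0 ∧ g0 ≤ dropA (2*n) + (1+ε)*(log R + 15) := by
    obtain ⟨u, hu0, hu1, hu2⟩ := pot_exists hG v
    have uv : u v = ∑ y ∈ D, (2/𝝅) * G v y * mu (y - v) := by rw [hu2]
    constructor
    · have lo : log R ≤ u v := by
        have := max_principle D (fun x ↦ u x + fl (x - v) - log R) (fun x hx ↦ by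
          have a := hu1 x hx
          have b := avg4_shift fl v x
          unfold mu at a; rw [← b] at a; unfold avg4 at *; linarith)
          (fun y hy _ ↦ by rw [hu0 y hy]; have := far y hy; linarith) v hv
        simp only [sub_self, fl_zero] at this; linarith
      refine lo.trans ?_
      rw [uv]
      have s1 : ∑ y ∈ D, (2/𝝅) * G v y * mu (y - v) ≤ ∑ y ∈ D, (2/𝝅) * g0 * mu (y - v) := by
        refine sum_le_sum fun y _ ↦ ?_
        have := green_le_diag hG y v
        rw [green_symm hG v y]
        exact mul_le_mul_of_nonneg_right (mul_le_mul_of_nonneg_left this ℙ) (mu_nonneg _)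
      refine s1.trans ?_
      rw [← mul_sum]
      have s2 : ∑ y ∈ D, mu (y - v) ≤ 𝝅/2 := by
        have := mu_box_le (∑ x ∈ D.image (fun y ↦ y - v), (x.1.natAbs + x.2.natAbs)) (D.image (fun y ↦ y - v)) (by
          intro x hx
          have := single_le_sum (f := fun x : Vtx ↦ x.1.natAbs + x.2.natAbs) (fun i _ ↦ Nat.zero_le _) hx
          omega)
        rwa [sum_image (by intro a _ b _ h; simpa using h)] at this
      calc _ ≤ (2/𝝅) * g0 * (𝝅/2) := mul_le_mul_of_nonneg_left s2 ℙ
        _ = g0 := by field_simp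
    · have up : u v ≤ log R + 15 := by
        have := max_principle D (fun x ↦ gl (x - vb) + 12 - (u x + fl (x - v))) (fun x hx ↦ by
          have a := hu1 x hx
          have b := avg4_shift fl v x
          have c := avg4_shift gl vb x
          have d := gl_super (x - vb) (hpl x (Or.inl hx)).2
          rw [← c] at d
          unfold mu at a; rw [← b] at a; unfold avg4 at *; linarith)
          (fun y hy hya ↦ by rw [hu0 y hy]; have := flle y (Or.inr hya); linarith) v hv
        simp only [sub_self, fl_zero] at this
        have f1 := flup v
        simp only [sub_self, fl_zero, max_eq_right lR] at f1
        have := gl_le (v - vb); linarith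
      by_contra hcon
      push Not at hcon
      have dn := dropA_nonneg (2*n)
      have s1 : (2/𝝅) * (g0 - dropA (2*n)) * ∑ x ∈ Icc (-n:ℤ) n ×ˢ Icc (-n:ℤ) n, mu x ≤ u v := by
        rw [uv, mul_sum]
        have s3 : ∑ x ∈ Icc (-n:ℤ) n ×ˢ Icc (-n:ℤ) n, (2/𝝅) * (g0 - dropA (2*n)) * mu x
          ≤ ∑ x ∈ Icc (-n:ℤ) n ×ˢ Icc (-n:ℤ) n, (2/𝝅) * G (x+v) v * mu x := by
          refine sum_le_sum fun x hx ↦ ?_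
          simp only [mem_product, mem_Icc] at hx
          have := green_drop hG hv (2*n) (x+v) (by simp only [Prod.fst_add, Prod.snd_add, add_sub_cancel_right]; omega)
          exact mul_le_mul_of_nonneg_right (mul_le_mul_of_nonneg_left 𝕃 ℙ) (mu_nonneg _)
        refine s3.trans ?_
        have s4 : ∑ x ∈ Icc (-n:ℤ) n ×ˢ Icc (-n:ℤ) n, (2/𝝅) * G (x+v) v * mu x
           = ∑ x ∈ (Icc (-n:ℤ) n ×ˢ Icc (-n:ℤ) n).image (fun x ↦ x + v), (2/𝝅) * G v x * mu (x - v) := by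
          rw [sum_image (by intro a _ b _ h; simpa using h)]
          refine sum_congr rfl fun x _ ↦ ?_
          rw [green_symm hG v]; simp
        rw [s4]
        rw [← Finset.sum_filter_of_ne (p := fun x ↦ x ∈ D) (fun x _ hx ↦ by
          by_contra hxD
          exact hx (by rw [hG.1 v x (Or.inr hxD)]; ring))]
        refine sum_le_sum_of_subset_of_nonneg (fun x hx ↦ (mem_filter.1 hx).2) fun x _ _ ↦ ?_
        exact mul_nonneg (mul_nonneg ℙ (green_nonneg hG _ _)) (mu_nonneg _)
      have s2 : (2/𝝅) * (g0 - dropA (2*n)) * ((𝝅/2) / (1+ε)) ≤ u v :=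
        (mul_le_mul_of_nonneg_left hn (mul_nonneg ℙ (by nlinarith))).trans s1
      have e : (2/𝝅) * (g0 - dropA (2*n)) * ((𝝅/2) / (1+ε)) = (g0 - dropA (2*n)) / (1+ε) := by
        field_simp
      rw [e, div_le_iff₀ 𝕃] at s2
      nlinarith

  intro x
  have gx := green_nonneg hG x v
  have dn := dropA_nonneg (2*n)
  have dn4 := dropA_nonneg 4
  by_cases hx : x ∈ D
  swap
  · rw [hG.1 x v (Or.inl hx), max_eq_left (by have := far x hx; linarith)]
    simp only [sub_self, abs_zero]; positivity
  rw [abs_le]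
  constructor
  ·
    have low : log R - 12 - dropA 4 - gl (x - v) ≤ G x v + 12 := by
      by_cases hs : 5 ≤ sq1 (x - v)
      · have := max_principle (D.filter fun z ↦ 5 ≤ sq1 (z - v))
          (fun z ↦ G z v + gl (z - v) - (log R - 12 - dropA 4)) (fun z hz ↦ by
            simp only [mem_filter] at hz
            have a := hG.2 v hv z hz.1
            have b := gl_super (z - v) hz.2
            rw [← avg4_shift] at b
            have c : 0 ≤ (𝝅/2) * 𝟙(z = v) := by positivity
            unfold avg4 at *; linarith)
          (fun z hz _ ↦ by
            simp only [mem_filter, not_and_or] at hz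
            have b := gl_ge (z - v)
            rcases hz with hz | hz
            · rw [hG.1 z v (Or.inl hz)]; have := far z hz; linarith
            · have := green_drop hG hv 4 z (small_nat z v (by push Not at hz; exact hz))
              have f0 := fl_nonneg (z - v)
              linarith [diagL.1]) x (by simp [hx, hs])
        linarith
      · have := green_drop hG hv 4 x (small_nat x v (by push Not at hs; exact hs))
        have b := gl_ge (x - v)
        have f0 := fl_nonneg (x - v)
        linarith [diagL.1]
    have gle := gl_le (x - v)
    have : max 0 (log R - fl (x-v)) ≤ G x v + 24 + dropA 4 := max_le 𝕃 𝕃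
    have : 0 ≤ ε * log R := by positivity
    nlinarith
  · have S0 : ∀ z : Vtx, (z ∈ D ∨ adjTo D z) → 0 ≤ gl (z - vb) + 12 - fl (z - v) := fun z hz ↦ by
      linarith [flle z hz]
    have Sv : log R ≤ gl (v - vb) + 12 := by
      have h2 := gl_ge (v - vb)
      have : R^2 ≤ sq1 (v - vb) := by
        rw [sqb]; simp only [sub_self, Int.cast_zero]
        have : (0 - (n':ℝ)*e1)^2+(0-(n':ℝ)*e2)^2 = (n':ℝ)^2*((e1:ℝ)^2+(e2:ℝ)^2) := by ring
        rw [this, heR]; nlinarith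
      have := log_le_log ℙ this
      rw [log_pow] at this
      unfold fl at h2; push_cast at this; linarith
    have up : G x v ≤ (1+ε) * (gl (x - vb) + 12 - fl (x - v)) + (dropA (2*n) + (1+ε)*15) := by
      by_cases hxv : x = v
      · subst hxv
        rw [sub_self, fl_zero]
        have := diagL.2
        nlinarith
      · have := max_principle (D.erase v) (fun z ↦ (1+ε) * (gl (z - vb) + 12 - fl (z - v)) + (dropA (2*n) + (1+ε)*15) - G z v)
          (fun z hz ↦ by
            have hz' := mem_erase.1 hz
            have a := hG.2 v hv z hz'.2
            simp only [hz'.1, if_false, mul_zero, add_zero] at a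
            have b := gl_super (z - vb) (hpl z (Or.inl hz'.2)).2
            rw [← avg4_shift] at b
            have c := mu_nonneg (z - v)
            unfold mu at c; rw [← avg4_shift] at c
            have d := mul_le_mul_of_nonneg_left (by linarith : avg4 (fun y ↦ gl (y - vb)) z - avg4 (fun y ↦ fl (y - v)) z ≤ gl (z - vb) - fl (z - v)) (by linarith : 0 ≤ 1+ε)
            unfold avg4 at *; linarith)
          (fun z hz hza ↦ by
            have S := S0 z (Or.inr (by
              rcases hza with h | h | h | h
              · exact Or.inl (mem_of_mem_erase h)
              · exact Or.inr (Or.inl (mem_of_mem_erase h))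
              · exact Or.inr (Or.inr (Or.inl (mem_of_mem_erase h)))
              · exact Or.inr (Or.inr (Or.inr (mem_of_mem_erase h)))))
            by_cases hzv : z = v
            · subst hzv
              rw [sub_self, fl_zero]
              have := diagL.2
              nlinarith
            · have : z ∉ D := fun hh ↦ hz (mem_erase.2 ⟨hzv, hh⟩)
              rw [hG.1 z v (Or.inl this)]
              have := mul_nonneg (by linarith : 0 ≤ 1+ε) S
              nlinarith) x (mem_erase.2 ⟨hxv, hx⟩)
        linarith
    have f1 := flup x
    have f2 := gl_le (x - vb)
    have f3 : max (fl (x-v)) (log R) = fl (x - v) + max 0 (log R - fl (x-v)) := by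
      rw [← max_add_add_left]; simp
    have m0 : 0 ≤ max 0 (log R - fl (x-v)) := le_max_left _ _
    have m1 : max 0 (log R - fl (x-v)) ≤ log R := max_le lR (by linarith [fl_nonneg (x-v)])
    have : (1+ε) * (gl (x - vb) + 12 - fl (x - v)) ≤ (1+ε) * (max 0 (log R - fl (x-v)) + 15) :=
      mul_le_mul_of_nonneg_left 𝕃 𝕃
    nlinarith

def dN (N : ℕ) (v : Vtx) : ℤ := min (min v.1 v.2) (min (N - v.1) (N - v.2))

noncomputable def ld (N : ℕ) (v : Vtx) : ℝ := log (max 1 (dN N v : ℝ))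

noncomputable def rad (N : ℕ) (lam : ℝ) : ℝ := if lam = 0 then N else (N:ℝ) ^ (𝟏 - lam) / 2

theorem mem_VN {N : ℕ} {v : Vtx} : v ∈ VN N ↔ (0 ≤ v.1 ∧ v.1 ≤ N) ∧ (0 ≤ v.2 ∧ v.2 ≤ N) := by
  simp only [VN, mem_Icc, Prod.le_def]; tauto

theorem mem_intr {B : Finset Vtx} {x : Vtx} : x ∈ intr B ↔ x ∈ B ∧ (x.1+1,x.2) ∈ B ∧ (x.1-1,x.2) ∈ B
    ∧ (x.1,x.2+1) ∈ B ∧ (x.1,x.2-1) ∈ B := by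
  simp only [intr, bdry, Finset.mem_sdiff, mem_filter]; tauto

theorem mem_intr_VN {N : ℕ} {x : Vtx} : x ∈ intr (VN N) ↔ (0 < x.1 ∧ x.1 < N) ∧ (0 < x.2 ∧ x.2 < N) := by
  simp only [mem_intr, mem_VN]; constructor <;> intro h <;> omega

theorem abs_pm (a v r : ℝ) : (|a + 1 - v| ≤ r ∧ |a - 1 - v| ≤ r) ↔ |a - v| + 1 ≤ r := by grind

theorem mem_intr_nbhd {N : ℕ} {lam : ℝ} (_h0 : 0 ≤ lam) {v : Vtx} (hv : v ∈ VN N) {x : Vtx} :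
    x ∈ intr (nbhd N lam v) ↔ x ∈ intr (VN N) ∧
      |(x.1:ℝ) - v.1| + 1 ≤ rad N lam ∧ |(x.2:ℝ) - v.2| + 1 ≤ rad N lam := by
  rw [mem_VN] at hv
  by_cases h : lam = 0
  · subst h
    simp only [nbhd, rad, if_true]
    refine ⟨fun h ↦ ⟨h, ?_⟩, fun h ↦ h.1⟩
    rw [mem_intr_VN] at h
    constructor
    · have : |x.1 - v.1| + 1 ≤ (N:ℤ) := by grind
      exact_mod_cast this
    · have : |x.2 - v.2| + 1 ≤ (N:ℤ) := by grind
      exact_mod_cast this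
  by_cases h1 : lam = 1
  · subst h1
    simp only [nbhd, rad, one_ne_zero, if_false, if_true]
    constructor
    · intro h
      simp only [mem_intr, mem_singleton] at h
      have := h.1 ▸ h.2.1
      have := congrArg Prod.fst this
      simp at this
    · rintro ⟨_, h2, _⟩
      simp only [sub_self, Real.rpow_zero] at h2
      have := abs_nonneg ((x.1:ℝ) - v.1); linarith
  · have hB : ∀ w, w ∈ nbhd N lam v ↔ w ∈ VN N ∧ |(w.1:ℝ) - v.1| ≤ rad N lam ∧ |(w.2:ℝ) - v.2| ≤ rad N lam := by
      intro w; simp only [nbhd, rad, h, h1, if_false, mem_filter]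
    rw [mem_intr, mem_intr]
    simp only [hB]
    rw [← abs_pm, ← abs_pm]
    push_cast
    constructor
    · tauto
    · rintro ⟨⟨a, b, c, d, e⟩, ⟨f, g⟩, i, j⟩
      have f1 := (abs_pm _ _ _).1 ⟨f, g⟩
      have f2 := (abs_pm _ _ _).1 ⟨i, j⟩
      have k1 : |(x.1:ℝ) - v.1| ≤ rad N lam := by linarith
      have k2 : |(x.2:ℝ) - v.2| ≤ rad N lam := by linarith
      tauto

theorem dN_le {N : ℕ} (v : Vtx) : 2 * dN N v ≤ N := by unfold dN; omega
theorem dN_nonneg {N : ℕ} {v : Vtx} (hv : v ∈ VN N) : 0 ≤ dN N v := by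
  rw [mem_VN] at hv; unfold dN; omega

theorem ld_nonneg (N : ℕ) (v : Vtx) : 0 ≤ ld N v := log_nonneg (le_max_left _ _)

theorem ld_le {N : ℕ} (hN : 1 ≤ N) (v : Vtx) : ld N v ≤ log N := by
  unfold ld
  have hN' : 𝟏 ≤ N := by exact_mod_cast hN
  apply log_le_log (lt_of_lt_of_le one_pos (le_max_left _ _))
  refine max_le hN' ?_
  have := dN_le (N := N) v
  have : dN N v ≤ N := by omega
  exact_mod_cast this

theorem log2_le : log 2 ≤ 1 := by linarith [log_two_lt_d9]

theorem green_nbhd (ε : ℝ) (hε : 0 < ε) : ∃ C : ℝ, 0 ≤ C ∧ ∀ (N : ℕ) (_ : 1 ≤ N) (lam : ℝ) (_ : 0 ≤ lam) (_ : lam ≤ 1)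
    (v : Vtx) (_ : v ∈ VN N) (G : Vtx → Vtx → ℝ) (_ : GreenOn (intr (nbhd N lam v)) G) (x : Vtx),
    |G x v - max 0 (min (ld N v) ((1-lam) * log N) - fl (x - v))| ≤ ε * log N + C := by
  obtain ⟨C, hC0, hC⟩ := green_est ε hε
  refine ⟨C + 2, by linarith, ?_⟩
  intro N hN lam h0 h1 v hv G hG x
  have hN' : 𝟏 ≤ N := by exact_mod_cast hN
  have hN0 : 𝟎 < N := by linarith
  have L0 : 0 ≤ log N := log_nonneg hN'
  have hd0 := dN_nonneg hv
  have hdle := dN_le (N := N) v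
  set T := min (ld N v) ((1-lam) * log N) with hT
  have lip : ∀ a b c : ℝ, |max 0 (a - c) - max 0 (b - c)| ≤ |a - b| := by grind
  have half : ((N:ℝ) ^ (𝟏 - lam) / 2) ≤ rad N lam := by
    unfold rad; split_ifs with h
    · rw [h]; simp
    · exact le_rfl
  have rp : 𝟎 < (N:ℝ) ^ (𝟏 - lam) := rpow_pos_of_pos hN0 _
  have lrp : log ((N:ℝ) ^ (𝟏 - lam)) = (1-lam) * log N := log_rpow hN0 _
  have l1lam : 0 ≤ (1-lam) * log N := mul_nonneg 𝕃 L0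
  have r0 : 0 ≤ rad N lam := le_trans ℙ half
  set R : ℤ := min (dN N v) ⌊rad N lam⌋ with hRdef
  have fl0 := fl_nonneg (x - v)
  have hT0 : 0 ≤ T := le_min (ld_nonneg _ _) l1lam
  by_cases hR : 1 ≤ R
  · have hd1 : 1 ≤ dN N v := le_trans hR (min_le_left _ _)
    have hf1 : 1 ≤ ⌊rad N lam⌋ := le_trans hR (min_le_right _ _)
    have hr1 : 1 ≤ rad N lam := by
      have : ((1:ℤ):ℝ) ≤ rad N lam := le_trans (Int.cast_le.2 hf1) (Int.floor_le _)
      simpa using this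
    have hR' : 𝟏 ≤ R := by exact_mod_cast hR
    have hRd : R ≤ dN N v := min_le_left _ _
    have hRr : (R:ℝ) ≤ rad N lam := le_trans (Int.cast_le.2 (min_le_right _ _)) (Int.floor_le _)
    have ldv : ld N v = log (dN N v) := by
      unfold ld; rw [max_eq_right (by exact_mod_cast hd1)]

    have hlogR : |log R - T| ≤ 2 := by
      have up1 : log R ≤ ld N v := by
        rw [ldv]; exact log_le_log 𝕃 (by exact_mod_cast hRd)
      have up2 : log R ≤ (1-lam) * log N := by
        by_cases h : lam = 0
        · rw [h]; simpa using up1.trans (ld_le hN v)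
        · rw [← lrp]; refine log_le_log 𝕃 (hRr.trans ?_)
          unfold rad; rw [if_neg h]; linarith
      have dT : T - 2 ≤ log R := by
        rcases le_total (dN N v) ⌊rad N lam⌋ with hh | hh
        · grind
        · have hRe : R = ⌊rad N lam⌋ := min_eq_right hh
          have h2 : rad N lam < R + 1 := by rw [hRe]; exact Int.lt_floor_add_one _
          by_cases h : lam = 0
          · have : rad N lam = N := by unfold rad; rw [if_pos h]
            have hfl : ⌊rad N lam⌋ = N := by rw [this]; simp
            rw [hfl] at hh
            omega
          · have hr : rad N lam = (N:ℝ) ^ (𝟏 - lam) / 2 := by unfold rad; rw [if_neg h]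
            have h3 : (N:ℝ) ^ (𝟏 - lam) ≤ 4 * R := by linarith
            have h4 := log_le_log rp h3
            rw [lrp, log_mul 𝕂 𝕃] at h4
            have l4 : log 4 ≤ 2 := by
              rw [show (4:ℝ) = 2^2 by norm_num, log_pow]; push_cast; linarith [log2_le]
            have := min_le_right (ld N v) ((1-lam) * log N); linarith
      rw [abs_le]; constructor
      · linarith
      · grind
    have hlR : log R ≤ log N := by
      refine le_trans ?_ (ld_le hN v)
      rw [ldv]; exact log_le_log 𝕃 (by exact_mod_cast hRd)
    have box : ∀ y : Vtx, |((y.1 - v.1 : ℤ):ℝ)| < (R:ℝ) → |((y.2 - v.2:ℤ):ℝ)| < (R:ℝ) → y ∈ intr (nbhd N lam v) := by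
      intro y h1 h2
      have a1 : |y.1 - v.1| < R := by exact_mod_cast h1
      have a2 : |y.2 - v.2| < R := by exact_mod_cast h2
      rw [mem_intr_nbhd h0 hv, mem_intr_VN]
      have b1 : ((|y.1 - v.1| + 1 : ℤ):ℝ) ≤ R := by exact_mod_cast a1
      have b2 : ((|y.2 - v.2| + 1 : ℤ):ℝ) ≤ R := by exact_mod_cast a2
      push_cast at b1 b2
      rw [abs_lt] at a1 a2
      unfold dN at hRd
      refine ⟨by omega, by linarith, by linarith⟩
    have adjD : ∀ y : Vtx, (y ∈ intr (nbhd N lam v) ∨ adjTo (intr (nbhd N lam v)) y) →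
        (0 ≤ y.1 ∧ y.1 ≤ N ∧ 0 ≤ y.2 ∧ y.2 ≤ N) ∧ |(y.1:ℝ) - v.1| ≤ rad N lam := by
      intro y hy
      unfold adjTo at hy
      simp only [mem_intr_nbhd h0 hv, mem_intr_VN] at hy
      constructor
      · omega
      · rcases hy with h | h | h | h | h
        · linarith [h.2.1]
        · have := h.2.1; push_cast at this
          rcases abs_cases ((y.1:ℝ) - v.1) with h' | h' <;> rcases abs_cases ((y.1:ℝ) + 1 - v.1) with h'' | h'' <;> linarith
        · have := h.2.1; push_cast at this
          rcases abs_cases ((y.1:ℝ) - v.1) with h' | h' <;> rcases abs_cases ((y.1:ℝ) - 1 - v.1) with h'' | h'' <;> linarith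
        · linarith [h.2.1]
        · linarith [h.2.1]
    have fin : ∀ e1 e2 : ℤ, e1^2+e2^2=1 → (∀ y : Vtx, (y ∈ intr (nbhd N lam v) ∨ adjTo (intr (nbhd N lam v)) y) →
        (y.1-v.1)*e1+(y.2-v.2)*e2 ≤ R) → |G x v - max 0 (T - fl (x - v))| ≤ ε * log N + (C + 2) := by
      intro e1 e2 he hh
      have := hC _ G v R e1 e2 hG hR' box he (fun y hy ↦ by exact_mod_cast hh y hy) x
      have h2 := lip (log R) T (fl (x - v))
      have h3 := mul_le_mul_of_nonneg_left hlR hε.le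
      have h4 := abs_sub_le (G x v) (max 0 (log R - fl (x-v))) (max 0 (T - fl (x - v)))
      linarith
    rcases le_total (dN N v) ⌊rad N lam⌋ with hh | hh
    · have hRe : R = dN N v := min_eq_left hh
      unfold dN at hRe
      have : R = v.1 ∨ R = v.2 ∨ R = N - v.1 ∨ R = N - v.2 := by omega
      rcases this with h | h | h | h
      · exact fin (-1) 0 𝕂 fun y hy ↦ by have := (adjD y hy).1; omega
      · exact fin 0 (-1) 𝕂 fun y hy ↦ by have := (adjD y hy).1; omega
      · exact fin 1 0 𝕂 fun y hy ↦ by have := (adjD y hy).1; omega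
      · exact fin 0 1 𝕂 fun y hy ↦ by have := (adjD y hy).1; omega
    · have hRe : R = ⌊rad N lam⌋ := min_eq_right hh
      refine fin 1 0 𝕂 fun y hy ↦ ?_
      rw [hRe, Int.le_floor]
      have := (adjD y hy).2
      push_cast; have := le_abs_self ((y.1:ℝ) - v.1); linarith
  · have hvD : v ∉ intr (nbhd N lam v) := by
      rw [mem_intr_nbhd h0 hv, mem_intr_VN]
      rintro ⟨h1, h2, _⟩
      apply hR
      simp only [sub_self, abs_zero, zero_add] at h2
      have : 1 ≤ ⌊rad N lam⌋ := by rw [Int.le_floor]; simpa using h2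
      refine le_min ?_ this
      unfold dN; omega
    rw [hG.1 x v (Or.inr hvD)]
    have hT1 : T ≤ 1 := by
      rw [not_le] at hR
      rcases min_lt_iff.1 hR with h | h
      · have : dN N v = 0 := by omega
        have : ld N v = 0 := by unfold ld; rw [this]; simp
        have := min_le_left (ld N v) ((1-lam) * log N); linarith
      · have : rad N lam < 1 := by
          rw [← Int.cast_one, ← Int.floor_lt]; exact h
        have : (N:ℝ) ^ (𝟏 - lam) ≤ 2 := by linarith
        have := log_le_log rp this
        rw [lrp] at this
        have := min_le_right (ld N v) ((1-lam) * log N); linarith [log2_le]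
    have : max 0 (T - fl (x - v)) ≤ 1 := max_le 𝕂 𝕃
    rw [zero_sub, abs_neg, abs_of_nonneg (le_max_left _ _)]
    have : 0 ≤ ε * log N := by positivity
    linarith

noncomputable def grn (D : Finset Vtx) : Vtx → Vtx → ℝ := (green_exists D).choose

theorem grn_spec (D : Finset Vtx) : GreenOn D (grn D) := (green_exists D).choose_spec

noncomputable def hk (D : Finset Vtx) (v z : Vtx) : ℝ :=
  if v ∈ D then (if z ∈ D then 0 else (2 / 𝝅) * avg4 (fun y ↦ grn D v y) z)
  else (if z = v then 1 else 0)

theorem avg4_zero_of_not_adj {D : Finset Vtx} {u : Vtx → ℝ} (hu : ∀ x, x ∉ D → u x = 0) {z : Vtx}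
    (hz : ¬ adjTo D z) : avg4 u z = 0 := by
  unfold adjTo at hz; push Not at hz
  unfold avg4
  rw [hu _ hz.1, hu _ hz.2.1, hu _ hz.2.2.1, hu _ hz.2.2.2]; simp

theorem hk_nonneg (D : Finset Vtx) (v z : Vtx) : 0 ≤ hk D v z := by
  unfold hk
  split_ifs <;> try norm_num
  have := green_nonneg (grn_spec D) v
  unfold avg4
  have h1 := this (z.1+1,z.2); have h2 := this (z.1-1,z.2)
  have h3 := this (z.1,z.2+1); have h4 := this (z.1,z.2-1)
  have := pi_pos
  positivity

theorem hk_supp {D : Finset Vtx} {v z : Vtx} (h : hk D v z ≠ 0) : z ∉ D ∧ (z = v ∨ adjTo D z) := by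
  unfold hk at h
  split_ifs at h with h1 h2 h3
  · exact absurd rfl h
  · refine ⟨h2, Or.inr ?_⟩
    by_contra hz
    rw [avg4_zero_of_not_adj (fun x hx ↦ (grn_spec D).1 v x (Or.inr hx)) hz] at h
    simp at h
  · grind
  · exact absurd rfl h

theorem adj_VN {N : ℕ} {D : Finset Vtx} (hD : D ⊆ intr (VN N)) {z : Vtx} (h : adjTo D z) : z ∈ VN N := by
  unfold adjTo at h
  rcases h with h | h | h | h <;>
  · have := mem_intr_VN.1 (hD h)
    simp only at this
    rw [mem_VN]; omega

theorem hk_rep {N : ℕ} {D : Finset Vtx} (hD : D ⊆ intr (VN N)) {v : Vtx} (hv : v ∈ VN N) (u : Vtx → ℝ) :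
    ∑ z ∈ VN N, hk D v z * u z = u v - (2 / 𝝅) * ∑ y ∈ D, grn D v y * (u y - avg4 u y) := by
  by_cases hvD : v ∈ D
  · have hg0 : ∀ x, x ∉ D → grn D v x = 0 := fun x hx ↦ (grn_spec D).1 v x (Or.inr hx)
    have hsub : D ⊆ VN N := fun x hx ↦ by
      have := mem_intr_VN.1 (hD hx); rw [mem_VN]; omega
    have e := avg4_symm D (fun y ↦ grn D v y) u hg0
    rw [finsum_eq_sum_of_support_subset (s := D) _ (by
        intro x hx; by_contra h; exact hx (by simp [hg0 x h])),
      finsum_eq_sum_of_support_subset (s := VN N) _ (by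
        intro x hx; by_contra h
        refine hx ?_
        have : ¬ adjTo D x := fun h' ↦ h (adj_VN hD h')
        show avg4 _ x * _ = 0
        rw [avg4_zero_of_not_adj hg0 this]; simp),
      ← sum_sdiff hsub] at e
    rw [← sum_sdiff hsub]
    have e1 : ∑ z ∈ D, hk D v z * u z = 0 := sum_eq_zero fun z hz ↦ by simp [hk, hvD, hz]
    have e2 : ∑ z ∈ VN N \ D, hk D v z * u z
        = (2 / 𝝅) * ∑ z ∈ VN N \ D, avg4 (fun y ↦ grn D v y) z * u z := by
      rw [mul_sum]; refine sum_congr rfl fun z hz ↦ ?_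
      simp [hk, hvD, (Finset.mem_sdiff.1 hz).2]; ring
    have e3 : ∑ y ∈ D, avg4 (fun y ↦ grn D v y) y * u y
        = ∑ y ∈ D, grn D v y * u y - (𝝅 / 2) * u v := by
      have : ∀ y ∈ D, avg4 (fun y ↦ grn D v y) y * u y
          = grn D v y * u y - (if y = v then (𝝅 / 2) * u v else 0) := by
        intro y hy
        have h1 := (grn_spec D).2 v hvD y hy
        have h2 : (fun z ↦ grn D z v) = fun z ↦ grn D v z := by
          funext z; exact green_symm (grn_spec D) z v
        rw [h2, green_symm (grn_spec D) y v] at h1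
        by_cases hyv : y = v
        · grind
        · grind
      rw [sum_congr rfl this, sum_sub_distrib, sum_ite_eq' D v, if_pos hvD]
    have e4 : ∑ y ∈ D, grn D v y * (u y - avg4 u y) = ∑ y ∈ D, grn D v y * u y - ∑ y ∈ D, grn D v y * avg4 u y := by
      rw [← sum_sub_distrib]; exact sum_congr rfl fun _ _ ↦ by ring
    have hpi := pi_pos
    rw [e1, e2, e4, e]
    rw [e3]; field_simp; ring
  · have : ∑ y ∈ D, grn D v y * (u y - avg4 u y) = 0 := sum_eq_zero fun y _ ↦ by
      rw [(grn_spec D).1 v y (Or.inl hvD)]; simp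
    rw [this]
    simp [hk, hvD, hv]

theorem hk_sum_one {N : ℕ} {D : Finset Vtx} (hD : D ⊆ intr (VN N)) {v : Vtx} (hv : v ∈ VN N) :
    ∑ z ∈ VN N, hk D v z = 1 := by
  have := hk_rep hD hv (fun _ ↦ 1)
  have h2 : ∀ y, avg4 (fun _ : Vtx ↦ 𝟏) y = 1 := fun y ↦ by unfold avg4; norm_num
  simpa [h2] using this

theorem hk_green {N : ℕ} {D : Finset Vtx} (hD : D ⊆ intr (VN N)) {v : Vtx} (hv : v ∈ VN N) {G : Vtx → Vtx → ℝ}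
    (hG : GreenOn (intr (VN N)) G) (w : Vtx) :
    ∑ z ∈ VN N, hk D v z * G z w = G v w - grn D v w := by
  rw [hk_rep hD hv (fun z ↦ G z w)]
  congr 1
  by_cases hw : w ∈ intr (VN N)
  · have : ∀ y ∈ D, grn D v y * (G y w - avg4 (fun z ↦ G z w) y)
        = if y = w then (𝝅 / 2) * grn D v w else 0 := by
      intro y hy
      have := hG.2 w hw y (hD hy)
      have h2 : G y w - avg4 (fun z ↦ G z w) y = (𝝅 / 2) * (if y = w then 1 else 0) := by linarith
      rw [h2]; split_ifs with h
      · subst h; ring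
      · simp
    rw [sum_congr rfl this, sum_ite_eq']
    have hpi := pi_pos
    split_ifs with h
    · field_simp
    · rw [(grn_spec D).1 v w (Or.inr h)]; simp
  · have h0 : ∀ z, G z w = 0 := fun z ↦ hG.1 z w (Or.inr hw)
    rw [(grn_spec D).1 v w (Or.inr fun h ↦ hw (hD h))]
    simp [h0, avg4]

theorem hk_bil {N : ℕ} {D D' : Finset Vtx} (hD : D ⊆ intr (VN N)) (hD' : D' ⊆ intr (VN N)) {v w : Vtx}
    (hv : v ∈ VN N) (hw : w ∈ VN N) {G : Vtx → Vtx → ℝ} (hG : GreenOn (intr (VN N)) G) :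
    ∑ z ∈ VN N, ∑ z' ∈ VN N, hk D v z * hk D' w z' * G z z'
      = G v w - grn D v w - ∑ z ∈ VN N, hk D v z * grn D' z w := by
  rw [← hk_green hD hv hG w, ← sum_sub_distrib]
  refine sum_congr rfl fun z _ ↦ ?_
  have := hk_green hD' hw hG z
  rw [green_symm hG z w, green_symm (grn_spec D') z w, ← mul_sub, ← this, mul_sum]
  refine sum_congr rfl fun z' _ ↦ ?_
  rw [green_symm hG z z']; ring

theorem efl_abs1 (x : Vtx) : |(x.1:ℝ)| ≤ exp (fl x) ∧ |(x.2:ℝ)| ≤ exp (fl x) ∧ 1 ≤ exp (fl x)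
    ∧ exp (fl x) ≤ |(x.1:ℝ)| + |(x.2:ℝ)| + 1 := by
  have e : exp (fl x) ^ 2 = sq1 x := by
    rw [← exp_nat_mul, fl]; push_cast
    rw [show 2 * (1/2 * log (sq1 x)) = log (sq1 x) by ring, exp_log (sq1_pos x)]
  have p := exp_pos (fl x)
  unfold sq1 at e
  have a1 := sq_abs (x.1:ℝ); have a2 := sq_abs (x.2:ℝ)
  have b1 := abs_nonneg (x.1:ℝ); have b2 := abs_nonneg (x.2:ℝ)
  refine ⟨?_, ?_, ?_, ?_⟩
  · nlinarith
  · nlinarith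
  · nlinarith
  · nlinarith [mul_nonneg b1 b2]

theorem fl_neg (x : Vtx) : fl (-x) = fl x := by simp [fl, sq1]

theorem fl_sub_comm (v w : Vtx) : fl (v - w) = fl (w - v) := by rw [← fl_neg]; simp

theorem ld_le_max {N : ℕ} (v w : Vtx) : ld N w ≤ max (ld N v) (fl (v - w)) + 1 := by
  obtain ⟨h1, h2, h3, -⟩ := efl_abs1 (v - w)
  have hd : (dN N w : ℝ) ≤ dN N v + exp (fl (v-w)) := by
    have : dN N w ≤ dN N v + |v.1 - w.1| ∨ dN N w ≤ dN N v + |v.2 - w.2| := by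
      unfold dN
      have a1 := le_abs_self (v.1 - w.1); have a2 := neg_abs_le (v.1 - w.1)
      have a3 := le_abs_self (v.2 - w.2); have a4 := neg_abs_le (v.2 - w.2)
      omega
    rcases this with h | h
    · have : (dN N w : ℝ) ≤ dN N v + |(v.1:ℝ) - w.1| := by exact_mod_cast h
      simp at h1; linarith
    · have : (dN N w : ℝ) ≤ dN N v + |(v.2:ℝ) - w.2| := by exact_mod_cast h
      simp at h2; linarith
  have h4 : max 1 (dN N w : ℝ) ≤ 2 * max (max 1 (dN N v : ℝ)) (exp (fl (v - w))) := by grind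
  have p1 : 0 < max 1 (dN N v : ℝ) := by positivity
  have h5 := log_le_log ℙ h4
  rw [log_mul 𝕂 ℙ] at h5
  have h6 : log (max (max 1 (dN N v : ℝ)) (exp (fl (v - w)))) ≤ max (ld N v) (fl (v-w)) := by
    rcases max_cases (max 1 (dN N v : ℝ)) (exp (fl (v - w))) with ⟨h, _⟩ | ⟨h, _⟩ <;> rw [h]
    · exact le_max_left _ _
    · simp
  unfold ld at h6 ⊢
  linarith [log2_le]

noncomputable def Dn (N : ℕ) (lam : ℝ) (v : Vtx) : Finset Vtx := intr (nbhd N lam v)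

theorem Dn_sub {N : ℕ} {lam : ℝ} (h0 : 0 ≤ lam) {v : Vtx} (hv : v ∈ VN N) : Dn N lam v ⊆ intr (VN N) :=
  fun _ hx ↦ ((mem_intr_nbhd h0 hv).1 hx).1

noncomputable def cv (N : ℕ) (v : Vtx) (lam : ℝ) (w : Vtx) (lam' : ℝ) : ℝ :=
  ∑ z ∈ VN N, ∑ z' ∈ VN N, hk (Dn N lam v) v z * hk (Dn N lam' w) w z' * grn (intr (VN N)) z z'

theorem cv_symm (N : ℕ) (v : Vtx) (lam : ℝ) (w : Vtx) (lam' : ℝ) : cv N v lam w lam' = cv N w lam' v lam := by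
  unfold cv
  rw [sum_comm]
  refine sum_congr rfl fun z _ ↦ sum_congr rfl fun z' _ ↦ ?_
  rw [green_symm (grn_spec _) z z']; ring

theorem rad_bounds {N : ℕ} (hN : 1 ≤ N) {lam : ℝ} (h1 : lam ≤ 1) :
    exp ((1 - lam) * log N) / 2 ≤ rad N lam ∧ rad N lam ≤ exp ((1 - lam) * log N) := by
  have hN0 : 𝟎 < N := by exact_mod_cast hN
  have e : (N:ℝ) ^ (𝟏 - lam) = exp ((1 - lam) * log N) := by
    rw [Real.rpow_def_of_pos hN0]; ring_nf
  have p := exp_pos ((1 - lam) * log N)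
  unfold rad
  split_ifs with h
  · rw [h]; simp [exp_log hN0]
  · grind

theorem supp_near {N : ℕ} (hN : 1 ≤ N) {lam : ℝ} (h0 : 0 ≤ lam) (h1 : lam ≤ 1) {v : Vtx} (hv : v ∈ VN N) {z : Vtx}
    (hz : z = v ∨ adjTo (Dn N lam v) z) :
    |(z.1:ℝ) - v.1| ≤ exp ((1 - lam) * log N) ∧ |(z.2:ℝ) - v.2| ≤ exp ((1 - lam) * log N) := by
  have p := exp_pos ((1 - lam) * log N)
  have r := (rad_bounds hN h1).2
  rcases hz with rfl | hz
  · simp [p.le]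
  · unfold adjTo Dn at hz
    simp only [mem_intr_nbhd h0 hv] at hz
    rcases hz with ⟨_, a, b⟩ | ⟨_, a, b⟩ | ⟨_, a, b⟩ | ⟨_, a, b⟩ <;>
    · grind

theorem far_log {N : ℕ} (hN : 1 ≤ N) {lam : ℝ} (h0 : 0 ≤ lam) (h1 : lam ≤ 1) {v w : Vtx} (hv : v ∈ VN N) {z : Vtx}
    (hz : z = v ∨ adjTo (Dn N lam v) z) (hzD : z ∉ Dn N lam v) (hzi : z ∈ intr (VN N))
    (hF : 8 * exp (fl (v - w)) ≤ exp ((1 - lam) * log N) ∨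
      10 * exp ((1 - lam) * log N) ≤ exp (fl (v - w))) :
    (1 - lam) * log N - 3 ≤ fl (z - w) := by
  have p := exp_pos ((1 - lam) * log N)
  obtain ⟨r1, r2⟩ := rad_bounds hN h1
  obtain ⟨n1, n2⟩ := supp_near hN h0 h1 hv hz
  obtain ⟨a1, a2, a3, a4⟩ := efl_abs1 (v - w)
  obtain ⟨b1, b2, b3, b4⟩ := efl_abs1 (z - w)
  simp only [Prod.fst_sub, Prod.snd_sub, Int.cast_sub] at a1 a2 a4 b1 b2 b4
  set R := exp ((1 - lam) * log N)
  have key : R / 8 ≤ exp (fl (z - w)) := by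
    rcases hF with hF | hF
    · have : ¬ (|(z.1:ℝ) - v.1| + 1 ≤ rad N lam ∧ |(z.2:ℝ) - v.2| + 1 ≤ rad N lam) := fun h ↦
        hzD ((mem_intr_nbhd h0 hv).2 ⟨hzi, h⟩)
      rw [not_and_or, not_le, not_le] at this
      rcases this with h | h
      · have := abs_sub_le (z.1:ℝ) w.1 v.1
        rw [abs_sub_comm (w.1:ℝ)] at this
        linarith
      · have := abs_sub_le (z.2:ℝ) w.2 v.2
        rw [abs_sub_comm (w.2:ℝ)] at this
        linarith
    · have t1 := abs_sub_le (v.1:ℝ) z.1 w.1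
      have t2 := abs_sub_le (v.2:ℝ) z.2 w.2
      have u1 := abs_sub_comm (v.1:ℝ) z.1
      have u2 := abs_sub_comm (v.2:ℝ) z.2
      linarith
  have : R / 8 = exp ((1 - lam) * log N - log 8) := by
    rw [exp_sub, exp_log 𝕂]
  rw [this, exp_le_exp] at key
  have l8 : log 8 ≤ 3 := by
    rw [show (8:ℝ) = 2 ^ 3 by norm_num, log_pow]; push_cast; linarith [log2_le]
  linarith

noncomputable def pf (N : ℕ) (v w : Vtx) (t : ℝ) : ℝ :=
  max 0 (min (t * log N) (log N - fl (v - w)) - (log N - ld N v))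

theorem pf_swap (N : ℕ) (v w : Vtx) (t : ℝ) : |pf N v w t - pf N w v t| ≤ 1 := by
  have key : ∀ v w, pf N w v t ≤ pf N v w t + 1 := by
    intro v w
    unfold pf
    rw [fl_sub_comm w v]
    have := ld_le_max (N := N) v w
    have m1 := min_le_right (t * log N) (log N - fl (v - w))
    rcases le_total (ld N v) (fl (v - w)) with h | h
    · grind
    · grind
  rw [abs_le]; constructor <;> linarith [key v w, key w v]

theorem pf_alg (d F L a : ℝ) : max 0 (d - F) - max 0 (min d ((1 - a) * L) - F)
    = max 0 (min (a * L) (L - F) - (L - d)) := by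
  have : (1 - a) * L = L - a * L := by ring
  rw [this]
  rcases max_cases 0 (d - F) with ⟨h1,h2⟩|⟨h1,h2⟩ <;> rcases min_cases d (L - a*L) with ⟨h3,h4⟩|⟨h3,h4⟩ <;>
  rcases min_cases (a * L) (L - F) with ⟨h5,h6⟩|⟨h5,h6⟩ <;> rw [h1, h3, h5] <;>
  rcases max_cases 0 (d - F) with ⟨h7,h8⟩|⟨h7,h8⟩ <;>
  rcases max_cases 0 (L - a*L - F) with ⟨h9,h10⟩|⟨h9,h10⟩ <;>
  rcases max_cases 0 (a * L - (L - d)) with ⟨h11,h12⟩|⟨h11,h12⟩ <;>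
  rcases max_cases 0 (L - F - (L - d)) with ⟨h13,h14⟩|⟨h13,h14⟩ <;> linarith

theorem exp_mono_ge {ε L c : ℝ} (h : c ≤ ε * L) : 1 + c ≤ exp (ε * L) := by
  linarith [add_one_le_exp (ε * L)]

theorem T_small (ε : ℝ) (hε : 0 < ε) : ∃ N0 : ℕ, ∀ N ≥ N0, ∀ v ∈ VN N, ∀ w ∈ VN N, ∀ a b : ℝ, 0 ≤ a → a ≤ b → b ≤ 1 →
    ∑ z ∈ VN N, hk (Dn N a v) v z * grn (Dn N b w) z w ≤ 8 * ε * log N := by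
  obtain ⟨C, hC0, hC⟩ := green_nbhd ε hε
  obtain ⟨N0, hN0⟩ := eventually_atTop.1 (((tendsto_log_atTop.comp tendsto_natCast_atTop_atTop).eventually_ge_atTop
    (max (9 / ε) ((3 * C + 3) / ε))).and (eventually_ge_atTop 1))
  refine ⟨N0, fun N hN v hv w hw a b ha hab hb ↦ ?_⟩
  obtain ⟨hL, hN1⟩ := hN0 N hN
  simp only [Function.comp, max_le_iff, div_le_iff₀ hε] at hL
  obtain ⟨hL1, hL2⟩ := hL
  have ha1 := hab.trans hb
  have hb0 := ha.trans hab
  set L := log N with hLdef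
  have L0 : 0 ≤ L := by nlinarith
  have hexp : 10 ≤ exp (ε * L) := by
    have := exp_mono_ge (ε := ε) (L := L) (c := 9) 𝕃; linarith
  have gb : ∀ z, grn (Dn N b w) z w ≤ max 0 (min (ld N w) ((1-b) * L) - fl (z - w)) + (ε * L + C) := fun z ↦ by
    have := (abs_le.1 (hC N hN1 b hb0 hb w hw _ (grn_spec _) z)).2
    unfold Dn; linarith
  have avg : ∀ (u : Vtx → ℝ) (K : ℝ), (∀ z ∈ VN N, hk (Dn N a v) v z ≠ 0 → u z ≤ K) →
      ∑ z ∈ VN N, hk (Dn N a v) v z * u z ≤ K := by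
    intro u K h
    calc ∑ z ∈ VN N, hk (Dn N a v) v z * u z ≤ ∑ z ∈ VN N, hk (Dn N a v) v z * K := by
          refine sum_le_sum fun z hz ↦ ?_
          by_cases h0 : hk (Dn N a v) v z = 0
          · simp [h0]
          · exact mul_le_mul_of_nonneg_left (h z hz h0) (hk_nonneg _ _ _)
      _ = K := by rw [← sum_mul, hk_sum_one (Dn_sub ha hv) hv, one_mul]
  by_cases hfar : 8 * exp (fl (v - w)) ≤ exp ((1 - a) * L) ∨
      10 * exp ((1 - a) * L) ≤ exp (fl (v - w))
  · apply avg
    intro z hz h0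
    obtain ⟨hzD, hzs⟩ := hk_supp h0
    by_cases hzi : z ∈ intr (VN N)
    · have f := far_log hN1 ha ha1 hv hzs hzD hzi hfar
      have : max 0 (min (ld N w) ((1-b) * L) - fl (z - w)) ≤ 3 := by
        refine max_le 𝕂 ?_
        have := min_le_right (ld N w) ((1-b) * L)
        nlinarith
      have := gb z
      nlinarith
    · rw [(grn_spec (Dn N b w)).1 z w (Or.inl fun h ↦ hzi (Dn_sub hb0 hw h))]
      nlinarith
  · push Not at hfar
    obtain ⟨hf1, hf2⟩ := hfar

    have hF1 : (1 - a) * L - 3 ≤ fl (v - w) := by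
      have := log_le_log (exp_pos _) hf1.le
      rw [log_mul 𝕂 (exp_pos _).ne', log_exp, log_exp] at this
      have l8 : log 8 ≤ 3 := by
        rw [show (8:ℝ) = 2 ^ 3 by norm_num, log_pow]; push_cast; linarith [log2_le]
      linarith
    set c := max (a - 3 * ε) 0 with hc
    have hc0 : 0 ≤ c := le_max_right _ _
    have hca : c ≤ a := max_le 𝕃 ha
    have hsub : Dn N a v ⊆ Dn N c w := by
      intro x hx
      obtain ⟨x1, x2, x3⟩ := (mem_intr_nbhd ha hv).1 hx
      refine (mem_intr_nbhd hc0 hw).2 ⟨x1, ?_⟩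
      rcases le_total (a - 3 * ε) 0 with h | h
      · have c0 : c = 0 := max_eq_right h
        have hx := mem_intr_VN.1 x1
        have hw' := mem_VN.1 hw
        rw [c0]; simp only [rad, if_true]
        constructor
        · have : |x.1 - w.1| + 1 ≤ (N:ℤ) := by grind
          exact_mod_cast this
        · have : |x.2 - w.2| + 1 ≤ (N:ℤ) := by grind
          exact_mod_cast this
      · have c0 : c = a - 3 * ε := max_eq_left h
        obtain ⟨a1, a2, a3, a4⟩ := efl_abs1 (v - w)
        simp only [Prod.fst_sub, Prod.snd_sub, Int.cast_sub] at a1 a2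
        have r1 := (rad_bounds hN1 (hca.trans ha1)).1
        have r2 := (rad_bounds hN1 ha1).2
        have e3 : exp ((1 - c) * L) = exp ((1 - a) * L) * exp (ε * L) ^ 3 := by
          rw [← exp_nat_mul, ← exp_add, c0]; congr 1; push_cast; ring
        rw [← hLdef] at r1 r2
        have pR := exp_pos ((1-a) * L)
        have big : 11 * exp ((1 - a) * L) ≤ exp ((1 - c) * L) / 2 := by
          rw [e3]
          have : (22:ℝ) ≤ exp (ε * L) ^ 3 := by nlinarith [pow_le_pow_left₀ (by norm_num : 𝟎 ≤ 10) hexp 3]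
          nlinarith
        have t1 := abs_sub_le (x.1:ℝ) v.1 w.1
        have t2 := abs_sub_le (x.2:ℝ) v.2 w.2
        constructor <;> linarith
    have gc : ∀ z, |grn (Dn N c w) z w - max 0 (min (ld N w) ((1-c) * L) - fl (z - w))| ≤ (ε * L + C) := fun z ↦
      hC N hN1 c hc0 (hca.trans ha1) w hw _ (grn_spec _) z
    have s1 : ∑ z ∈ VN N, hk (Dn N a v) v z * (grn (Dn N b w) z w - grn (Dn N c w) z w) ≤ 2 * (ε * L + C) := by
      apply avg
      intro z _ _
      have h1 := gb z
      have h2 := (abs_le.1 (gc z)).1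
      have h3 : max 0 (min (ld N w) ((1-b) * L) - fl (z - w)) ≤ max 0 (min (ld N w) ((1-c) * L) - fl (z - w)) := by
        refine max_le_max le_rfl (sub_le_sub_right (min_le_min le_rfl ?_) _)
        nlinarith
      linarith
    have s2 : ∑ z ∈ VN N, hk (Dn N a v) v z * grn (Dn N c w) z w ≤ grn (Dn N c w) v w := by
      rw [hk_rep (Dn_sub ha hv) hv (fun z ↦ grn (Dn N c w) z w)]
      have : 0 ≤ ∑ y ∈ Dn N a v, grn (Dn N a v) v y * (grn (Dn N c w) y w - avg4 (fun z ↦ grn (Dn N c w) z w) y) := by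
        refine sum_nonneg fun y hy ↦ mul_nonneg (green_nonneg (grn_spec _) _ _) ?_
        by_cases hwD : w ∈ Dn N c w
        · have := (grn_spec (Dn N c w)).2 w hwD y (hsub hy)
          have h2 : 0 ≤ (𝝅 / 2) * 𝟙(y = w) := by positivity
          linarith
        · have : ∀ z, grn (Dn N c w) z w = 0 := fun z ↦ (grn_spec _).1 z w (Or.inr hwD)
          simp [this, avg4]
      have hp := pi_pos
      have : 0 ≤ 2 / 𝝅 * ∑ y ∈ Dn N a v, grn (Dn N a v) v y * (grn (Dn N c w) y w - avg4 (fun z ↦ grn (Dn N c w) z w) y) := by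
        positivity
      linarith
    have s3 : grn (Dn N c w) v w ≤ 3 * ε * L + 3 + (ε * L + C) := by
      have h2 := (abs_le.1 (gc v)).2
      have : max 0 (min (ld N w) ((1-c) * L) - fl (v - w)) ≤ 3 * ε * L + 3 := by
        refine max_le (by nlinarith) ?_
        have h1 := min_le_right (ld N w) ((1-c) * L)
        have h3 : a - 3 * ε ≤ c := le_max_left _ _
        nlinarith
      linarith
    have s4 : ∑ z ∈ VN N, hk (Dn N a v) v z * grn (Dn N b w) z w
        = ∑ z ∈ VN N, hk (Dn N a v) v z * (grn (Dn N b w) z w - grn (Dn N c w) z w)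
          + ∑ z ∈ VN N, hk (Dn N a v) v z * grn (Dn N c w) z w := by
      rw [← sum_add_distrib]; exact sum_congr rfl fun _ _ ↦ by ring
    rw [s4]
    nlinarith

theorem cv_est (δ : ℝ) (hδ : 0 < δ) : ∃ N0 : ℕ, ∀ N ≥ N0, ∀ v ∈ VN N, ∀ w ∈ VN N, ∀ a b : ℝ, 0 ≤ a → a ≤ 1 → 0 ≤ b → b ≤ 1 →
    |cv N v a w b - pf N v w (min a b)| ≤ δ * log N := by
  obtain ⟨N1, hN1⟩ := T_small (δ / 20) ℙ
  obtain ⟨C, hC0, hC⟩ := green_nbhd (δ / 20) ℙ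
  obtain ⟨N2, hN2⟩ := eventually_atTop.1 (((tendsto_log_atTop.comp tendsto_natCast_atTop_atTop).eventually_ge_atTop
    (20 * (2 * C + 1) / δ)).and (eventually_ge_atTop 1))
  refine ⟨max N1 N2, fun N hN ↦ ?_⟩
  obtain ⟨hL, h1N⟩ := hN2 N ((le_max_right _ _).trans hN)
  simp only [Function.comp, div_le_iff₀ hδ] at hL
  have main : ∀ v ∈ VN N, ∀ w ∈ VN N, ∀ a b : ℝ, 0 ≤ a → a ≤ b → b ≤ 1 →
      |cv N v a w b - pf N v w a| ≤ δ * log N - 1 := by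
    intro v hv w hw a b ha hab hb
    have T := hN1 N ((le_max_left _ _).trans hN) v hv w hw a b ha hab hb
    have T0 : 0 ≤ ∑ z ∈ VN N, hk (Dn N a v) v z * grn (Dn N b w) z w :=
      sum_nonneg fun z _ ↦ mul_nonneg (hk_nonneg _ _ _) (green_nonneg (grn_spec _) _ _)
    have e := hk_bil (Dn_sub ha hv) (Dn_sub (ha.trans hab) hw) hv hw (grn_spec (intr (VN N)))
    have g1 := hC N h1N 0 le_rfl zero_le_one v hv (grn (intr (VN N))) (by
      have : nbhd N 0 v = VN N := by simp [nbhd]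
      rw [this]; exact grn_spec _) w
    have g2 := hC N h1N a ha (hab.trans hb) v hv _ (grn_spec _) w
    rw [show min (ld N v) ((1-0) * log N) = ld N v by
      rw [min_eq_left]; simpa using ld_le h1N v] at g1
    have al := pf_alg (ld N v) (fl (w - v)) (log N) a
    unfold cv pf
    rw [e, fl_sub_comm v w, ← al, green_symm (grn_spec _) v w, green_symm (grn_spec (Dn N a v)) v w]
    unfold Dn at T T0 ⊢
    rw [abs_le] at g1 g2 ⊢
    constructor <;> linarith
  intro v hv w hw a b ha ha1 hb hb1
  rcases le_total a b with h | h
  · grind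
  · rw [min_eq_right h, cv_symm]
    have h1 := main w hw v hv b a hb h ha1
    have h2 := pf_swap N v w b
    rw [abs_le] at *
    constructor <;> linarith

noncomputable def cl (p q t : ℝ) : ℝ := max p (min t q)

theorem cl_mono {p q s t : ℝ} (h : s ≤ t) : cl p q s ≤ cl p q t :=
  max_le_max le_rfl (min_le_min h le_rfl)

theorem cl_mem {p q t : ℝ} (h : p ≤ q) : p ≤ cl p q t ∧ cl p q t ≤ q :=
  ⟨le_max_left _ _, max_le h (min_le_right _ _)⟩

theorem sp_mono (hp : ScaleParams M sigv lamv) {i k : ℕ} (h : i ≤ k) (hk : k ≤ M) :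
    lamv i ≤ lamv k := by
  induction k, h using Nat.le_induction with
  | base => exact le_rfl
  | succ n _ ih => exact (ih 𝕆).trans (hp.2.2.2.2 n 𝕆).le

theorem sp_mem (hp : ScaleParams M sigv lamv) {i : ℕ} (h : i ≤ M) :
    0 ≤ lamv i ∧ lamv i ≤ 1 := by
  constructor
  · rw [← hp.2.2.1]; exact sp_mono hp (Nat.zero_le _) h
  · rw [← hp.2.2.2.1]; exact sp_mono hp h le_rfl

theorem br_eq (f : ℝ → ℝ) {p q p' q' : ℝ} (hp : p' ≤ p) (hpq : p ≤ q) (hq : q ≤ q') {a a' b b' : ℝ} (ha : a ≤ a') (hb : b ≤ b')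
    (hab : (a = b ∧ a' = b') ∨ a' ≤ b ∨ b' ≤ a) :
    f (min (cl p q a') (cl p' q' b')) - f (min (cl p q a') (cl p' q' b)) - f (min (cl p q a) (cl p' q' b'))
      + f (min (cl p q a) (cl p' q' b)) = if a = b ∧ a' = b' then f (cl p q a') - f (cl p q a) else 0 := by
  by_cases h1 : a' ≤ p
  · have e1 : cl p q a' = p := by unfold cl; rw [max_eq_left]; exact (min_le_left _ _).trans h1
    have e2 : cl p q a = p := by unfold cl; rw [max_eq_left]; exact (min_le_left _ _).trans (ha.trans h1)
    rw [e1, e2]; simp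
  by_cases h2 : q ≤ a
  · have e1 : cl p q a' = q := by unfold cl; rw [min_eq_right (h2.trans ha), max_eq_right hpq]
    have e2 : cl p q a = q := by unfold cl; rw [min_eq_right h2, max_eq_right hpq]
    rw [e1, e2]; simp
  push Not at h1 h2
  have ub : cl p q a' ≤ cl p' q' a' := by
    unfold cl; apply max_le
    · grind
    · exact le_max_of_le_right (min_le_min le_rfl hq)
  have lb : cl p' q' a ≤ cl p q a := by
    unfold cl; apply max_le
    · exact le_max_of_le_left hp
    · grind
  have m := cl_mono (p := p) (q := q) ha
  have m' := cl_mono (p := p') (q := q') hb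
  by_cases he : a = b ∧ a' = b'
  · grind
  · rw [if_neg he]
    rcases hab with h | h | h
    · exact absurd h he
    · have u := ub.trans (cl_mono (p := p') (q := q') h)
      rw [min_eq_left (u.trans m'), min_eq_left u, min_eq_left (m.trans (u.trans m')), min_eq_left (m.trans u)]; ring
    · have u := (cl_mono (p := p') (q := q') h).trans lb
      rw [min_eq_right (u.trans m), min_eq_right (m'.trans (u.trans m)), min_eq_right u, min_eq_right (m'.trans u)]; ring

noncomputable def Qf (M : ℕ) (sigv lamv : ℕ → ℝ) (p q x : ℝ) : ℝ :=
  ∑ i ∈ Icc 1 M, sigv i ^ 2 * (min (cl p q (lamv i)) x - min (cl p q (lamv (i - 1))) x)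

noncomputable def cvY (N M : ℕ) (sigv lamv : ℕ → ℝ) (p q p' q' : ℝ) (v w : Vtx) : ℝ :=
  ∑ i ∈ Icc 1 M, ∑ k ∈ Icc 1 M, sigv i * sigv k *
    (cv N v (cl p q (lamv i)) w (cl p' q' (lamv k)) - cv N v (cl p q (lamv i)) w (cl p' q' (lamv (k-1)))
      - cv N v (cl p q (lamv (i-1))) w (cl p' q' (lamv k)) + cv N v (cl p q (lamv (i-1))) w (cl p' q' (lamv (k-1))))

noncomputable def bs (N : ℕ) (v w : Vtx) : ℝ := 1 - fl (v - w) / log N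
noncomputable def rs (N : ℕ) (v : Vtx) : ℝ := 1 - ld N v / log N

theorem pf_eq {N : ℕ} (hL : 0 < log N) (v w : Vtx) (t : ℝ) :
    pf N v w t = log N * (min t (max (bs N v w) (rs N v)) - min t (rs N v)) := by
  unfold pf
  have e1 : log N - fl (v - w) = bs N v w * log N := by unfold bs; field_simp
  have e2 : log N - ld N v = rs N v * log N := by unfold rs; field_simp
  rw [e1, e2, ← min_mul_of_nonneg _ _ hL.le, ← sub_mul, ← zero_mul (log N), ← max_mul_of_nonneg _ _ hL.le,
    mul_comm]
  congr 1
  generalize bs N v w = b; generalize rs N v = r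
  rcases min_cases t b with ⟨h1, h2⟩|⟨h1, h2⟩ <;> rcases min_cases t r with ⟨h3, h4⟩|⟨h3, h4⟩ <;>
  rcases max_cases b r with ⟨h5, h6⟩|⟨h5, h6⟩ <;> rw [h5] <;> (try rw [h1]) <;> rw [h3]
  all_goals first
    | (rw [max_eq_left 𝕃]; linarith)
    | (rw [max_eq_right 𝕃])

theorem cvY_est (hsp : ScaleParams M sigv lamv) (δ : ℝ) (hδ : 0 < δ) :
    ∃ N0 : ℕ, ∀ N ≥ N0, ∀ v ∈ VN N, ∀ w ∈ VN N, ∀ p q p' q' : ℝ, 0 ≤ p' → p' ≤ p → p ≤ q → q ≤ q' → q' ≤ 1 →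
    |cvY N M sigv lamv p q p' q' v w - log N * (Qf M sigv lamv p q (max (bs N v w) (rs N v))
      - Qf M sigv lamv p q (rs N v))| ≤ δ * log N := by
  set S := ∑ i ∈ Icc 1 M, ∑ k ∈ Icc 1 M, |sigv i * sigv k| with hS
  have S0 : 0 ≤ S := sum_nonneg fun _ _ ↦ sum_nonneg fun _ _ ↦ abs_nonneg _
  obtain ⟨N1, h1⟩ := cv_est (δ / (4 * (S + 1))) ℙ
  refine ⟨max N1 2, fun N hN v hv w hw p q p' q' h0 hp hpq hq hq1 ↦ ?_⟩
  have hN2 : 2 ≤ N := (le_max_right _ _).trans hN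
  have hL : 0 < log N := log_pos (by exact_mod_cast hN2)
  have main : log N * (Qf M sigv lamv p q (max (bs N v w) (rs N v)) - Qf M sigv lamv p q (rs N v))
      = ∑ i ∈ Icc 1 M, ∑ k ∈ Icc 1 M, sigv i * sigv k *
      (pf N v w (min (cl p q (lamv i)) (cl p' q' (lamv k))) - pf N v w (min (cl p q (lamv i)) (cl p' q' (lamv (k-1))))
      - pf N v w (min (cl p q (lamv (i-1))) (cl p' q' (lamv k)))
      + pf N v w (min (cl p q (lamv (i-1))) (cl p' q' (lamv (k-1))))) := by
    unfold Qf
    rw [← sum_sub_distrib, mul_sum]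
    refine sum_congr rfl fun i hi ↦ ?_
    have hi' := mem_Icc.1 hi
    have st : ∀ k ∈ Icc 1 M, lamv (k-1) < lamv k := fun k hk ↦ by
      have := mem_Icc.1 hk
      have := hsp.2.2.2.2 (k-1) 𝕆
      rwa [Nat.sub_add_cancel 𝕆] at this
    rw [sum_eq_single i]
    · rw [br_eq (pf N v w) hp hpq hq (st i hi).le (st i hi).le (Or.inl ⟨rfl, rfl⟩), if_pos ⟨rfl, rfl⟩, pf_eq hL, pf_eq hL]
      ring
    · intro k hk hki
      have hk' := mem_Icc.1 hk
      have hor : lamv i ≤ lamv (k-1) ∨ lamv k ≤ lamv (i-1) := by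
        rcases lt_or_gt_of_ne hki with h | h
        · right; exact sp_mono hsp 𝕆 𝕆
        · left; exact sp_mono hsp 𝕆 𝕆
      rw [br_eq (pf N v w) hp hpq hq (st i hi).le (st k hk).le (Or.inr hor), if_neg, mul_zero]
      rintro ⟨e1, e2⟩
      have := st k hk; have := st i hi
      rcases hor with h | h <;> linarith
    · exact fun h ↦ absurd hi h
  rw [main]
  unfold cvY
  rw [← sum_sub_distrib]
  refine (abs_sum_le_sum_abs _ _).trans ?_
  have b1 : ∀ t, 0 ≤ cl p q t ∧ cl p q t ≤ 1 := fun t ↦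
    ⟨(h0.trans hp).trans (cl_mem hpq).1, (cl_mem hpq).2.trans (hq.trans hq1)⟩
  have b2 : ∀ t, 0 ≤ cl p' q' t ∧ cl p' q' t ≤ 1 := fun t ↦
    ⟨h0.trans (cl_mem (hp.trans (hpq.trans hq))).1, (cl_mem (hp.trans (hpq.trans hq))).2.trans hq1⟩
  have e := fun s t ↦ abs_le.1 (h1 N ((le_max_left _ _).trans hN) v hv w hw (cl p q s) (cl p' q' t) (b1 s).1 (b1 s).2 (b2 t).1 (b2 t).2)
  have : ∀ i ∈ Icc 1 M, |∑ k ∈ Icc 1 M, sigv i * sigv k *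
    (cv N v (cl p q (lamv i)) w (cl p' q' (lamv k)) - cv N v (cl p q (lamv i)) w (cl p' q' (lamv (k-1)))
      - cv N v (cl p q (lamv (i-1))) w (cl p' q' (lamv k)) + cv N v (cl p q (lamv (i-1))) w (cl p' q' (lamv (k-1))))
      - ∑ k ∈ Icc 1 M, sigv i * sigv k *
      (pf N v w (min (cl p q (lamv i)) (cl p' q' (lamv k))) - pf N v w (min (cl p q (lamv i)) (cl p' q' (lamv (k-1))))
      - pf N v w (min (cl p q (lamv (i-1))) (cl p' q' (lamv k)))
      + pf N v w (min (cl p q (lamv (i-1))) (cl p' q' (lamv (k-1)))))|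
      ≤ ∑ k ∈ Icc 1 M, |sigv i * sigv k| * (4 * (δ / (4 * (S + 1)) * log N)) := by
    intro i _
    rw [← sum_sub_distrib]
    refine (abs_sum_le_sum_abs _ _).trans (sum_le_sum fun k _ ↦ ?_)
    rw [← mul_sub, abs_mul]
    refine mul_le_mul_of_nonneg_left ?_ (abs_nonneg _)
    have q1 := e (lamv i) (lamv k); have q2 := e (lamv i) (lamv (k-1))
    have q3 := e (lamv (i-1)) (lamv k); have q4 := e (lamv (i-1)) (lamv (k-1))
    rw [abs_le]; constructor <;> linarith
  refine (sum_le_sum this).trans ?_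
  simp_rw [← sum_mul]
  rw [← hS]
  have : S * (4 * (δ / (4 * (S + 1)) * log N)) = (S / (S+1)) * (δ * log N) := by field_simp
  rw [this]
  have : S / (S+1) ≤ 1 := by rw [div_le_one ℙ]; linarith
  nlinarith [mul_pos hδ hL]

theorem Qf_clamp {p q : ℝ} (hpq : p ≤ q) (hsp : ScaleParams M sigv lamv) (x : ℝ) :
    Qf M sigv lamv p q x = Qf M sigv lamv 0 1 (cl p q x) - Qf M sigv lamv 0 1 p := by
  unfold Qf
  rw [← sum_sub_distrib]
  refine sum_congr rfl fun i hi ↦ ?_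
  have hi' := mem_Icc.1 hi
  rw [← mul_sub]
  congr 1
  have key : ∀ y, 0 ≤ y → y ≤ 1 → min (cl p q y) x = min (cl 0 1 y) (cl p q x) - min (cl 0 1 y) p + min p x := by
    intro y h0 h1
    have : cl 0 1 y = y := by unfold cl; rw [min_eq_left h1, max_eq_right h0]
    rw [this]
    unfold cl
    rcases min_cases y q with ⟨a1,a2⟩|⟨a1,a2⟩ <;> rcases min_cases x q with ⟨a3,a4⟩|⟨a3,a4⟩ <;>
    rcases min_cases y p with ⟨a5,a6⟩|⟨a5,a6⟩ <;> rcases min_cases p x with ⟨a7,a8⟩|⟨a7,a8⟩ <;>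
    rw [a1,a3,a5,a7] <;>
    (try rw [max_eq_left (show y ≤ p by linarith)]) <;> (try rw [max_eq_right (show p ≤ y by linarith)]) <;>
    (try rw [max_eq_left (show x ≤ p by linarith)]) <;> (try rw [max_eq_right (show p ≤ x by linarith)]) <;>
    (try rw [max_eq_right hpq]) <;>
    grind
  have l1 := sp_mem hsp hi'.2
  have l2 := sp_mem hsp (show i - 1 ≤ M by omega)
  rw [key _ l1.1 l1.2, key _ l2.1 l2.2]; ring

theorem Qf_lip (hsp : ScaleParams M sigv lamv) (p q : ℝ) {x y : ℝ} (h : x ≤ y) :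
    0 ≤ Qf M sigv lamv p q y - Qf M sigv lamv p q x ∧
    Qf M sigv lamv p q y - Qf M sigv lamv p q x ≤ (∑ i ∈ Icc 1 M, sigv i ^ 2) * (y - x) := by
  unfold Qf
  rw [← sum_sub_distrib, sum_mul]
  have key : ∀ s t : ℝ, s ≤ t → 0 ≤ (min t y - min s y) - (min t x - min s x) ∧
      (min t y - min s y) - (min t x - min s x) ≤ y - x := by
    intro s t hst
    constructor <;> grind
  have hc : ∀ i ∈ Icc 1 M, cl p q (lamv (i-1)) ≤ cl p q (lamv i) := fun i hi ↦
    cl_mono (sp_mono hsp 𝕆 (mem_Icc.1 hi).2)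
  constructor
  · refine sum_nonneg fun i hi ↦ ?_
    have := (key _ _ (hc i hi)).1
    rw [← mul_sub]; positivity
  · refine sum_le_sum fun i hi ↦ ?_
    have := (key _ _ (hc i hi)).2
    rw [← mul_sub]
    exact mul_le_mul_of_nonneg_left this (sq_nonneg _)

theorem Qf_J (hsp : ScaleParams M sigv lamv) {x : ℝ} (h0 : 0 ≤ x) (h1 : x ≤ 1) :
    Jsig2 M sigv lamv x = Qf M sigv lamv 0 1 x := by
  unfold Jsig2 Jint
  have st : ∀ k ∈ Icc 1 M, lamv (k-1) < lamv k := fun k hk ↦ by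
    have := mem_Icc.1 hk
    have := hsp.2.2.2.2 (k-1) 𝕆
    rwa [Nat.sub_add_cancel 𝕆] at this
  have e : ∀ r ∈ Set.Ioc 0 x, stepFn M sigv lamv r ^ 2
      = ∑ i ∈ Icc 1 M, (Set.Ioc (lamv (i-1)) (lamv i)).indicator (fun _ ↦ sigv i ^ 2) r := by
    intro r hr
    unfold stepFn
    rw [if_neg hr.1.ne', zero_add]
    by_cases hex : ∃ i ∈ Icc 1 M, lamv (i-1) < r ∧ r ≤ lamv i
    · obtain ⟨i, hi, hir⟩ := hex
      have uniq : ∀ k ∈ Icc 1 M, k ≠ i → ¬ (lamv (k-1) < r ∧ r ≤ lamv k) := by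
        intro k hk hki ⟨a, b⟩
        rw [mem_Icc] at hi hk
        rcases lt_or_gt_of_ne hki with h | h
        · have := sp_mono hsp (show k ≤ i - 1 by omega) 𝕆; linarith
        · have := sp_mono hsp (show i ≤ k - 1 by omega) 𝕆; linarith
      rw [sum_eq_single i (fun k hk hki ↦ if_neg (uniq k hk hki)) (fun h ↦ absurd hi h), if_pos hir,
        sum_eq_single i (fun k hk hki ↦ Set.indicator_of_notMem (show r ∉ Set.Ioc _ _ from uniq k hk hki) _) (fun h ↦ absurd hi h),
        Set.indicator_of_mem (show r ∈ Set.Ioc _ _ from hir)]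
    · push Not at hex
      rw [sum_eq_zero (fun k hk ↦ if_neg (fun h ↦ by have := hex k hk h.1; linarith)),
        sum_eq_zero (fun k hk ↦ Set.indicator_of_notMem (fun h ↦ by
          have := hex k hk h.1; linarith [h.2]) _)]
      norm_num
  rw [intervalIntegral.integral_of_le h0, MeasureTheory.setIntegral_congr_fun measurableSet_Ioc e,
    MeasureTheory.integral_finsetSum]
  · unfold Qf
    refine sum_congr rfl fun i hi ↦ ?_
    have l1 := sp_mem hsp (mem_Icc.1 hi).2
    have l2 := sp_mem hsp (show i - 1 ≤ M by have := mem_Icc.1 hi; omega)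
    have := st i hi
    rw [MeasureTheory.integral_indicator measurableSet_Ioc, MeasureTheory.setIntegral_const,
      MeasureTheory.measureReal_def, Measure.restrict_apply measurableSet_Ioc, Set.Ioc_inter_Ioc,
      Real.volume_Ioc]
    unfold cl
    rw [min_eq_left l1.2, min_eq_left l2.2, max_eq_right l1.1, max_eq_right l2.1, max_eq_left l2.1, smul_eq_mul, mul_comm]
    congr 1
    rcases le_total (lamv (i-1)) x with h | h
    · rw [ENNReal.toReal_ofReal (sub_nonneg.2 (le_min this.le h)), min_eq_left h]
    · rw [min_eq_right h, min_eq_right (h.trans this.le), ENNReal.ofReal_of_nonpos 𝕃]; simp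
  · intro i _
    exact ((MeasureTheory.integrable_indicator_iff measurableSet_Ioc).2 (MeasureTheory.integrableOn_const (by
      rw [Measure.restrict_apply measurableSet_Ioc]; exact ((MeasureTheory.measure_mono Set.inter_subset_left).trans_lt measure_Ioc_lt_top).ne)))

section P8
open MeasureTheory ProbabilityTheory

noncomputable def gm (ι : Type) [Fintype ι] : Measure (ι → ℝ) := Measure.pi fun _ ↦ gaussianReal 0 1

instance (ι : Type) [Fintype ι] : IsProbabilityMeasure (gm ι) := by unfold gm; infer_instance

def dt {ι : Type} [Fintype ι] (a b : ι → ℝ) : ℝ := ∑ i, a i * b i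

variable {ι κ : Type} [Fintype ι] [Fintype κ]

theorem dt_comm (a b : ι → ℝ) : dt a b = dt b a := by simp [dt, mul_comm]
theorem dt_self_nonneg (a : ι → ℝ) : 0 ≤ dt a a := sum_nonneg fun _ _ ↦ mul_self_nonneg _
theorem dt_add_left (a b c : ι → ℝ) : dt (a + b) c = dt a c + dt b c := by
  simp [dt, add_mul, sum_add_distrib]
theorem dt_add_right (a b c : ι → ℝ) : dt a (b + c) = dt a b + dt a c := by
  simp [dt, mul_add, sum_add_distrib]
theorem dt_smul_left (r : ℝ) (a c : ι → ℝ) : dt (r • a) c = r * dt a c := by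
  simp [dt, mul_sum, mul_assoc]
theorem dt_smul_right (r : ℝ) (a c : ι → ℝ) : dt a (r • c) = r * dt a c := by
  rw [dt_comm, dt_smul_left, dt_comm]
theorem dt_sub_left (a b c : ι → ℝ) : dt (a - b) c = dt a c - dt b c := by
  simp [dt, sub_mul, sum_sub_distrib]
theorem dt_sub_right (a b c : ι → ℝ) : dt a (b - c) = dt a b - dt a c := by
  simp [dt, mul_sub, sum_sub_distrib]
theorem dt_zero_left (c : ι → ℝ) : dt 0 c = 0 := by simp [dt]
theorem dt_sum_left {V : Type} (s : Finset V) (f : V → ι → ℝ) (c : ι → ℝ) :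
    dt (∑ v ∈ s, f v) c = ∑ v ∈ s, dt (f v) c := by
  simp only [dt, Finset.sum_apply, sum_mul]; exact sum_comm
theorem dt_sum_right {V : Type} (s : Finset V) (f : V → ι → ℝ) (c : ι → ℝ) :
    dt c (∑ v ∈ s, f v) = ∑ v ∈ s, dt c (f v) := by
  rw [dt_comm, dt_sum_left]; simp [dt_comm]
theorem dt_single (i : ι) (ξ : ι → ℝ) : dt (Pi.single i 1) ξ = ξ i := by
  simp [dt, Pi.single_apply]

theorem dt_cont (a : ι → ℝ) : Continuous (dt a) := by unfold dt; fun_prop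
theorem dt_meas (a : ι → ℝ) : Measurable (dt a) := (dt_cont a).measurable

theorem gm_law (a : ι → ℝ) : (gm ι).map (dt a) = gaussianReal 0 (toNNReal (dt a a)) := by
  apply Measure.ext_of_charFun
  ext t
  rw [charFun_apply_real, integral_map (dt_meas a).aemeasurable (by fun_prop), charFun_gaussianReal]
  have : ∀ x : ι → ℝ, Complex.exp (t * (dt a x : ℝ) * Complex.I) = ∏ i, Complex.exp (((t * a i : ℝ) : ℂ) * (x i : ℂ) * Complex.I) := by
    intro x
    rw [← Complex.exp_sum]; congr 1
    simp only [dt, Complex.ofReal_sum, mul_sum, sum_mul]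
    refine sum_congr rfl fun i _ ↦ ?_
    push_cast; ring
  simp_rw [this]
  rw [gm, integral_fintype_prod_eq_prod (f := fun i (x : ℝ) ↦ Complex.exp (((t * a i : ℝ) : ℂ) * (x : ℂ) * Complex.I))]
  simp_rw [← charFun_apply_real, charFun_gaussianReal]
  rw [← Complex.exp_sum]
  congr 1
  rw [coe_toNNReal _ (dt_self_nonneg a)]
  simp only [dt]
  push_cast
  rw [sum_mul, sum_div, ]
  simp only [mul_zero, zero_mul, zero_sub, Finset.sum_neg_distrib]
  congr 1
  refine sum_congr rfl fun i _ ↦ ?_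
  ring

theorem law_eq {V : Type} [Fintype V] (A : V → ι → ℝ) (A' : V → κ → ℝ) (h : ∀ v w, dt (A v) (A w) = dt (A' v) (A' w)) :
    (gm ι).map (fun ξ v ↦ dt (A v) ξ) = (gm κ).map (fun ξ v ↦ dt (A' v) ξ) := by
  have m1 : Measurable (fun ξ v ↦ dt (A v) ξ) := measurable_pi_lambda _ fun v ↦ dt_meas _
  have m2 : Measurable (fun ξ v ↦ dt (A' v) ξ) := measurable_pi_lambda _ fun v ↦ dt_meas _
  have := Measure.isProbabilityMeasure_map (μ := gm ι) m1.aemeasurable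
  have := Measure.isProbabilityMeasure_map (μ := gm κ) m2.aemeasurable
  apply Measure.ext_of_charFunDual
  ext L
  have key : ∀ (μ : Measure (V → ℝ)), charFunDual μ L = ∫ x : ℝ, Complex.exp (x * Complex.I) ∂(μ.map L) := by
    intro μ
    rw [integral_map (by fun_prop) (by fun_prop), charFunDual_apply]
  rw [key, key, Measure.map_map (by fun_prop) m1, Measure.map_map (by fun_prop) m2]
  have hL : ∀ x : V → ℝ, L x = ∑ v, x v * L (Pi.single v 1) := by
    intro x
    conv_lhs => rw [pi_eq_sum_univ' x, map_sum]
    refine sum_congr rfl fun v _ ↦ ?_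
    rw [map_smul, smul_eq_mul]
  have e1 : (L ∘ fun ξ v ↦ dt (A v) ξ) = dt (∑ v, L (Pi.single v 1) • A v) := by
    ext ξ; simp only [Function.comp, hL (fun v ↦ dt (A v) ξ), dt_sum_left, dt_smul_left, mul_comm]
  have e2 : (L ∘ fun ξ v ↦ dt (A' v) ξ) = dt (∑ v, L (Pi.single v 1) • A' v) := by
    ext ξ; simp only [Function.comp, hL (fun v ↦ dt (A' v) ξ), dt_sum_left, dt_smul_left, mul_comm]
  rw [e1, e2, gm_law, gm_law]
  simp only [dt_sum_left, dt_sum_right, dt_smul_left, dt_smul_right, h]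

theorem dt_memLp (a : ι → ℝ) (p : ENNReal) (hp : p ≠ ⊤) : MemLp (dt a) p (gm ι) := by
  have : MemLp id p ((gm ι).map (dt a)) := by rw [gm_law]; exact memLp_id_gaussianReal' p hp
  exact (memLp_map_measure_iff aestronglyMeasurable_id (dt_meas a).aemeasurable).1 this

theorem dt_integrable (a : ι → ℝ) : Integrable (dt a) (gm ι) := (dt_memLp a 1 (by simp)).integrable le_rfl

theorem dt_mul_integrable (a b : ι → ℝ) : Integrable (fun ξ ↦ dt a ξ * dt b ξ) (gm ι) :=
  (dt_memLp a 2 (by simp)).integrable_mul (dt_memLp b 2 (by simp))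

theorem integral_dt (a : ι → ℝ) : ∫ ξ, dt a ξ ∂gm ι = 0 := by
  have := integral_map (μ := gm ι) (φ := dt a) (f := id) (dt_meas a).aemeasurable (by fun_prop)
  rw [gm_law] at this; simpa using this.symm

theorem integral_dt_sq (a : ι → ℝ) : ∫ ξ, dt a ξ ^ 2 ∂gm ι = dt a a := by
  have := integral_map (μ := gm ι) (φ := dt a) (f := fun x ↦ x ^ 2) (dt_meas a).aemeasurable (by fun_prop)
  rw [← this, gm_law]
  have h := variance_fun_id_gaussianReal (μ := 0) (v := toNNReal (dt a a))
  rw [variance_eq_integral (by fun_prop)] at h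
  simp at h
  rw [h, max_eq_left (dt_self_nonneg a)]

theorem integral_dt_mul (a b : ι → ℝ) : ∫ ξ, dt a ξ * dt b ξ ∂gm ι = dt a b := by
  have h : ∀ ξ, dt a ξ * dt b ξ = (1/2) * (dt (a + b) ξ ^ 2 - dt a ξ ^ 2 - dt b ξ ^ 2) := by
    intro ξ; rw [dt_add_left]; ring
  have i : ∀ a : ι → ℝ, Integrable (fun ξ ↦ dt a ξ ^ 2) (gm ι) := fun a ↦ by
    simpa [sq] using dt_mul_integrable a a
  simp_rw [h]
  rw [integral_const_mul, integral_sub (f := fun ξ ↦ dt (a + b) ξ ^ 2 - dt a ξ ^ 2) ((i _).sub (i _)) (i _), integral_sub (i _) (i _)]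
  rw [integral_dt_sq, integral_dt_sq, integral_dt_sq, dt_add_left, dt_add_right, dt_add_right, dt_comm b a]; ring

theorem exp_dt_integrable (a : ι → ℝ) : Integrable (fun ξ ↦ exp (dt a ξ)) (gm ι) := by
  have := integrable_exp_mul_gaussianReal (μ := 0) (v := toNNReal (dt a a)) 1
  rw [← gm_law, integrable_map_measure (by fun_prop) (dt_meas a).aemeasurable] at this
  simpa [Function.comp_def] using this

theorem integral_exp_dt (a : ι → ℝ) : ∫ ξ, exp (dt a ξ) ∂gm ι = exp (dt a a / 2) := by
  have := mgf_gaussianReal (gm_law a) 1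
  simpa [mgf, coe_toNNReal _ (dt_self_nonneg a), max_eq_left (dt_self_nonneg a)] using this

theorem exp_abs_dt_integrable (a : ι → ℝ) : Integrable (fun ξ ↦ exp |dt a ξ|) (gm ι) := by
  refine ((exp_dt_integrable a).add (exp_dt_integrable (-a))).mono' (by have := dt_cont a; fun_prop) (ae_of_all _ fun ξ ↦ ?_)
  have : dt (-a) ξ = - dt a ξ := by simp [dt]
  simp only [Pi.add_apply, this, norm_eq_abs, Real.abs_exp]
  rcases abs_cases (dt a ξ) with h | h <;> rw [h.1] <;> have := exp_pos (dt a ξ) <;> have := exp_pos (- dt a ξ) <;> linarith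

theorem merge_mp (A : Set ι) :
    MeasurePreserving (fun p : (ι → ℝ) × (ι → ℝ) ↦ A.piecewise p.2 p.1) ((gm ι).prod (gm ι)) (gm ι) := by
  have hm : Measurable (fun p : (ι → ℝ) × (ι → ℝ) ↦ A.piecewise p.2 p.1) := by
    refine measurable_pi_lambda _ fun i ↦ ?_
    by_cases h : i ∈ A <;> simp [Set.piecewise, h] <;> fun_prop
  refine ⟨hm, ?_⟩
  conv_rhs => rw [gm]
  symm
  refine Measure.pi_eq fun s hs ↦ ?_
  rw [Measure.map_apply hm (MeasurableSet.univ_pi hs)]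
  have : (fun p : (ι → ℝ) × (ι → ℝ) ↦ A.piecewise p.2 p.1) ⁻¹' (Set.univ.pi s)
      = (Set.univ.pi fun i ↦ if i ∈ A then Set.univ else s i) ×ˢ (Set.univ.pi fun i ↦ if i ∈ A then s i else Set.univ) := by
    ext p
    simp only [Set.mem_preimage, Set.mem_univ_pi, Set.mem_prod, Set.piecewise]
    rw [← forall_and]
    refine forall_congr' fun i ↦ ?_
    by_cases h : i ∈ A <;> simp [h]
  rw [this, Measure.prod_prod, gm, Measure.pi_pi, Measure.pi_pi, ← prod_mul_distrib]
  refine prod_congr rfl fun i _ ↦ ?_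
  by_cases h : i ∈ A <;> simp [h]

theorem indep_int (A : Set ι) (f H : (ι → ℝ) → ℝ)
    (hf : ∀ ξ η, A.EqOn ξ η → f ξ = f η) (hH : ∀ ξ η, Aᶜ.EqOn ξ η → H ξ = H η) (hfm : Measurable f) (hHm : Measurable H) :
    ∫ ξ, f ξ * H ξ ∂gm ι = (∫ ξ, f ξ ∂gm ι) * ∫ ξ, H ξ ∂gm ι := by
  have e := integral_map (μ := (gm ι).prod (gm ι)) (f := fun ξ ↦ f ξ * H ξ) (merge_mp A).measurable.aemeasurable (hfm.mul hHm).aestronglyMeasurable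
  rw [(merge_mp A).map_eq] at e
  rw [e, mul_comm, ← integral_prod_mul]
  refine integral_congr_ae (ae_of_all _ fun p ↦ ?_)
  dsimp only
  rw [hf _ p.2 (Set.piecewise_eqOn _ _ _), hH _ p.1 (Set.piecewise_eqOn_compl _ _ _), mul_comm]

theorem ibp1 (f f' : ℝ → ℝ) (hf : ∀ x, HasDerivAt f (f' x) x) (C C' : ℝ) (hC : ∀ x, |f x| ≤ C) (hC' : ∀ x, |f' x| ≤ C') (hm : Measurable f') :
    ∫ x, x * f x ∂(gaussianReal 0 1) = ∫ x, f' x ∂(gaussianReal 0 1) := by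
  have h1 : (1 : NNReal) ≠ 0 := one_ne_zero
  rw [integral_gaussianReal_eq_integral_smul h1, integral_gaussianReal_eq_integral_smul h1]
  set p := gaussianPDFReal 0 1 with hp
  have hpd : ∀ x, HasDerivAt p (-(x * p x)) x := by
    intro x
    have e : p = fun x ↦ (sqrt (2 * 𝝅 * (1:NNReal)))⁻¹ * exp (-(x - 0)^2 / (2 * (1:NNReal))) := rfl
    rw [e]
    have : HasDerivAt (fun x : ℝ ↦ -(x - 0)^2 / (2 * ((1:NNReal):ℝ))) (-x) x := by
      have := (((hasDerivAt_id x).sub_const 0).pow 2).neg.div_const (2 * ((1:NNReal):ℝ))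
      refine this.congr_deriv ?_
      simp; ring
    refine (this.exp.const_mul _).congr_deriv ?_
    ring
  have hpi : Integrable p := integrable_gaussianPDFReal 0 1
  have hfc : Continuous f := continuous_iff_continuousAt.2 fun x ↦ (hf x).continuousAt
  have hxp : Integrable (fun x ↦ x * p x) := by
    have : Integrable id (gaussianReal 0 1) := (memLp_id_gaussianReal' 1 (by simp)).integrable le_rfl
    rw [gaussianReal_of_var_ne_zero _ h1, integrable_withDensity_iff_integrable_smul' (measurable_gaussianPDF _ _) (ae_of_all _ fun x ↦ gaussianPDF_lt_top)] at this
    refine this.congr (ae_of_all _ fun x ↦ ?_)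
    simp [gaussianPDF, ENNReal.toReal_ofReal (gaussianPDFReal_nonneg _ _ _), hp, mul_comm]
  have i1 : Integrable (f * fun x ↦ -(x * p x)) := by
    refine hxp.neg.bdd_mul (c := C) hfc.aestronglyMeasurable (ae_of_all _ hC)
  have i2 : Integrable (f' * p) := hpi.bdd_mul (c := C') hm.aestronglyMeasurable (ae_of_all _ hC')
  have i3 : Integrable (f * p) := hpi.bdd_mul (c := C) hfc.aestronglyMeasurable (ae_of_all _ hC)
  have := integral_mul_deriv_eq_deriv_mul_of_integrable (fun x _ ↦ hf x) (fun x _ ↦ hpd x) i1 i2 i3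
  simp only [mul_neg, integral_neg, neg_inj] at this
  simp only [smul_eq_mul]
  rw [show (∫ x, p x * (x * f x)) = ∫ x, f x * (x * p x) from by congr 1; ext x; ring, this]
  congr 1; ext x; ring

theorem ibp (F : (ι → ℝ) → ℝ) (dF : (ι → ℝ) → (ι → ℝ) → ℝ) (hd : ∀ ξ a, HasDerivAt (fun t : ℝ ↦ F (ξ + t • a)) (dF ξ a) 0)
    (hlin : ∀ ξ a, dF ξ a = ∑ i, a i * dF ξ (Pi.single i 1)) (C C' : ℝ) (hC : ∀ ξ, |F ξ| ≤ C) (hC' : ∀ ξ i, |dF ξ (Pi.single i 1)| ≤ C')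
    (hm : Measurable F) (hm' : ∀ i, Measurable fun ξ ↦ dF ξ (Pi.single i 1)) (a : ι → ℝ) :
    ∫ ξ, dt a ξ * F ξ ∂gm ι = ∫ ξ, dF ξ a ∂gm ι := by
  have iF : ∀ i : ι, Integrable (fun ξ : ι → ℝ ↦ ξ i * F ξ) (gm ι) := by
    intro i
    have := dt_integrable (Pi.single i 𝟏 : ι → ℝ)
    have h2 : Integrable (fun ξ : ι → ℝ ↦ ξ i) (gm ι) := this.congr (ae_of_all _ fun ξ ↦ dt_single i ξ)
    exact (h2.bdd_mul (c := C) hm.aestronglyMeasurable (ae_of_all _ hC)).congr (ae_of_all _ fun ξ ↦ mul_comm _ _)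
  have iD : ∀ i : ι, Integrable (fun ξ : ι → ℝ ↦ dF ξ (Pi.single i 1)) (gm ι) := fun i ↦
    Integrable.of_bound (hm' i).aestronglyMeasurable C' (ae_of_all _ fun ξ ↦ hC' ξ i)
  have key : ∀ i : ι, ∫ ξ, ξ i * F ξ ∂gm ι = ∫ ξ, dF ξ (Pi.single i 1) ∂gm ι := by
    intro i
    have hmp : MeasurePreserving (fun p : (ι → ℝ) × (ι → ℝ) ↦ Function.update p.1 i (p.2 i)) ((gm ι).prod (gm ι)) (gm ι) := by
      convert merge_mp ({i} : Set ι) using 1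
      ext p k; by_cases h : k = i
      · subst h; simp [Set.piecewise]
      · simp [Set.piecewise, h]
    have tr : ∀ G : (ι → ℝ) → ℝ, Measurable G → Integrable G (gm ι) → ∫ ξ, G ξ ∂gm ι = ∫ ξ, ∫ t, G (Function.update ξ i t) ∂(gaussianReal 0 1) ∂gm ι := by
      intro G hGm hG
      have e := integral_map (μ := (gm ι).prod (gm ι)) (f := G) hmp.measurable.aemeasurable (by rw [hmp.map_eq]; exact hG.aestronglyMeasurable)
      rw [hmp.map_eq] at e
      have hI : Integrable (fun p : (ι → ℝ) × (ι → ℝ) ↦ G (Function.update p.1 i (p.2 i))) ((gm ι).prod (gm ι)) :=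
        (hmp.integrable_comp hG.aestronglyMeasurable).2 hG
      rw [e, integral_prod _ hI]
      refine integral_congr_ae ?_
      have hae := hI.prod_right_ae
      filter_upwards [hae] with ξ hξ
      have mp : MeasurePreserving (fun η : ι → ℝ ↦ η i) (gm ι) (gaussianReal 0 1) := by
        unfold gm; exact measurePreserving_eval _ i
      have e2 := mp.map_eq
      rw [← e2, integral_map (f := fun t : ℝ ↦ G (Function.update ξ i t)) mp.measurable.aemeasurable (hGm.comp (by fun_prop)).aestronglyMeasurable]
    rw [tr (fun ξ ↦ ξ i * F ξ) ((measurable_pi_apply i).mul hm) (iF i), tr _ (hm' i) (iD i)]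
    congr 1; ext ξ
    simp only [Function.update_self]
    refine ibp1 (fun t ↦ F (Function.update ξ i t)) (fun t ↦ dF (Function.update ξ i t) (Pi.single i 1)) ?_ C C' (fun _ ↦ hC _) (fun _ ↦ hC' _ _) ((hm' i).comp (by fun_prop))
    intro x
    have h0 := hd (Function.update ξ i x) (Pi.single i 1)
    have h1 : HasDerivAt (fun t : ℝ ↦ t - x) 1 x := (hasDerivAt_id x).sub_const x
    have h2 : HasDerivAt (fun t : ℝ ↦ F (Function.update ξ i x + t • Pi.single i 1)) (dF (Function.update ξ i x) (Pi.single i 1)) ((fun t : ℝ ↦ t - x) x) := by simpa using h0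
    have h3 := HasDerivAt.comp (h := fun t : ℝ ↦ t - x) x h2 h1
    rw [mul_one] at h3
    refine h3.congr_of_eventuallyEq (Eventually.of_forall fun t ↦ ?_)
    change _ = F (Function.update ξ i x + (t - x) • Pi.single i 1)
    dsimp only
    congr 1; funext k
    by_cases h : k = i
    · subst h; simp
    · simp [h]
  have e1 : ∀ ξ, dt a ξ * F ξ = ∑ i, a i * (ξ i * F ξ) := by
    intro ξ; rw [dt, sum_mul]; exact sum_congr rfl fun i _ ↦ by ring
  simp_rw [e1]
  rw [integral_finsetSum _ fun i _ ↦ (iF i).const_mul _]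
  rw [integral_congr_ae (ae_of_all _ fun ξ ↦ hlin ξ a), integral_finsetSum _ fun i _ ↦ (iD i).const_mul _]
  simp only [integral_const_mul, key]

end P8

section P9
open MeasureTheory ProbabilityTheory

theorem cramer_wold {V : Type} [Fintype V] (μ ν : Measure (V → ℝ)) [IsProbabilityMeasure μ] [IsProbabilityMeasure ν]
    (h : ∀ c : V → ℝ, μ.map (dt c) = ν.map (dt c)) : μ = ν := by
  apply Measure.ext_of_charFunDual
  ext L
  have key : ∀ (μ : Measure (V → ℝ)), charFunDual μ L = ∫ x : ℝ, Complex.exp (x * Complex.I) ∂(μ.map L) := by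
    intro μ
    rw [integral_map (by fun_prop) (by fun_prop), charFunDual_apply]
  have hL : (L : (V → ℝ) → ℝ) = dt (fun v ↦ L (Pi.single v 1)) := by
    ext x
    conv_lhs => rw [pi_eq_sum_univ' x, map_sum]
    refine sum_congr rfl fun v _ ↦ ?_
    rw [map_smul, smul_eq_mul, mul_comm]
  rw [key, key, hL, h]

theorem gff_lin {N : ℕ} {P : Measure FieldSp} (hP : IsGFF N P) (c : Vtx → ℝ) :
    P.map (fun ω ↦ ∑ v ∈ VN N, c v * ω v) = gaussianReal 0 (toNNReal (∑ v ∈ VN N, ∑ w ∈ VN N, c v * c w * grn (intr (VN N)) v w)) := by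
  obtain ⟨_, G, hG, h⟩ := hP
  have : G = grn (intr (VN N)) := by
    ext x y; exact green_unique ((isGreenFn_iff _ _).1 hG) (grn_spec _) x y
  rw [← this]; exact h c

theorem lin_meas (N : ℕ) (c : Vtx → ℝ) : Measurable (fun ω : FieldSp ↦ ∑ v ∈ VN N, c v * ω v) := by fun_prop

theorem gff_memLp {N : ℕ} {P : Measure FieldSp} (hP : IsGFF N P) (c : Vtx → ℝ) : MemLp (fun ω ↦ ∑ v ∈ VN N, c v * ω v) 2 P := by
  have : MemLp id 2 (P.map (fun ω ↦ ∑ v ∈ VN N, c v * ω v)) := by rw [gff_lin hP]; exact memLp_id_gaussianReal' 2 (by simp)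
  exact (memLp_map_measure_iff aestronglyMeasurable_id (lin_meas N c).aemeasurable).1 this

theorem gff_mean {N : ℕ} {P : Measure FieldSp} (hP : IsGFF N P) (c : Vtx → ℝ) : ∫ ω, ∑ v ∈ VN N, c v * ω v ∂P = 0 := by
  have := integral_map (μ := P) (f := id) (lin_meas N c).aemeasurable (by fun_prop)
  rw [gff_lin hP] at this; simpa using this.symm

theorem gff_var {N : ℕ} {P : Measure FieldSp} (hP : IsGFF N P) (c : Vtx → ℝ) :
    ∫ ω, (∑ v ∈ VN N, c v * ω v) ^ 2 ∂P = max (∑ v ∈ VN N, ∑ w ∈ VN N, c v * c w * grn (intr (VN N)) v w) 0 := by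
  have := integral_map (μ := P) (f := fun x ↦ x ^ 2) (lin_meas N c).aemeasurable (by fun_prop)
  rw [← this, gff_lin hP]
  have h := variance_fun_id_gaussianReal (μ := 0) (v := toNNReal (∑ v ∈ VN N, ∑ w ∈ VN N, c v * c w * grn (intr (VN N)) v w))
  rw [variance_eq_integral (by fun_prop)] at h
  simp at h
  rw [h]

theorem gff_coord {N : ℕ} {v : Vtx} (hv : v ∈ VN N) (ω : FieldSp) : ∑ z ∈ VN N, 𝟙(z = v) * ω z = ω v := by
  simp [hv]

theorem gff_cov2 {N : ℕ} {P : Measure FieldSp} (hP : IsGFF N P) {v w : Vtx} (hv : v ∈ VN N) (hw : w ∈ VN N) :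
    ∫ ω, ω v * ω w ∂P = grn (intr (VN N)) v w := by
  have g0 := grn_spec (intr (VN N))
  set G := grn (intr (VN N)) with hG
  have hs : ∀ v ∈ VN N, ∫ ω, ω v ^ 2 ∂P = G v v := by
    intro v hv
    have := gff_var hP (fun z ↦ 𝟙(z = v))
    simp only [gff_coord hv] at this
    rw [this]
    simp [hv, ← hG, green_nonneg g0 v v]
  have hi : ∀ v ∈ VN N, MemLp (fun ω : FieldSp ↦ ω v) 2 P := by
    intro v hv
    have := gff_memLp hP (fun z ↦ 𝟙(z = v))
    simpa only [gff_coord hv] using this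
  have h2 := gff_var hP (fun z ↦ 𝟙(z = v) + 𝟙(z = w))
  simp only [add_mul _ _ (_ : ℝ), sum_add_distrib, gff_coord hv, gff_coord hw] at h2
  have e : ∑ z ∈ VN N, ∑ z' ∈ VN N, (𝟙(z = v) + 𝟙(z = w)) * (𝟙(z' = v) + 𝟙(z' = w)) * G z z'
      = G v v + 2 * G v w + G w w := by
    simp only [add_mul, mul_add, sum_add_distrib]
    simp [hv, hw]
    rw [green_symm g0 w v]; ring
  have e3 : ∫ ω, (ω v + ω w) ^ 2 ∂P = G v v + 2 * G v w + G w w := by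
    have h3 := gff_var hP (fun z ↦ 𝟙(z = v) + 𝟙(z = w))
    rw [← hG, e, max_eq_left (by have := green_nonneg g0 v v; have := green_nonneg g0 v w; have := green_nonneg g0 w w; linarith)] at h3
    rw [← h3]
    congr 1; ext ω
    simp only [add_mul, sum_add_distrib, gff_coord hv, gff_coord hw]
  have i1 := (hi v hv).integrable_sq
  have i2 := (hi w hw).integrable_sq
  have i3 : Integrable (fun ω : FieldSp ↦ ω v * ω w) P := (hi v hv).integrable_mul (hi w hw)
  have : ∀ ω : FieldSp, (ω v + ω w) ^ 2 = ω v ^ 2 + 2 * (ω v * ω w) + ω w ^ 2 := fun ω ↦ by ring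
  simp_rw [this] at e3
  rw [integral_add (f := fun ω : FieldSp ↦ ω v ^ 2 + 2 * (ω v * ω w)) (i1.add (i3.const_mul 2)) i2, integral_add i1 (i3.const_mul 2), integral_const_mul, hs v hv, hs w hw] at e3
  linarith

theorem gff_memLp1 {N : ℕ} {P : Measure FieldSp} (hP : IsGFF N P) {v : Vtx} (hv : v ∈ VN N) : MemLp (fun ω : FieldSp ↦ ω v) 2 P := by
  have := gff_memLp hP (fun z ↦ 𝟙(z = v))
  simpa only [gff_coord hv] using this

theorem gff_cov {N : ℕ} {P : Measure FieldSp} (hP : IsGFF N P) (c d : Vtx → ℝ) :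
    ∫ ω, (∑ v ∈ VN N, c v * ω v) * (∑ w ∈ VN N, d w * ω w) ∂P = ∑ v ∈ VN N, ∑ w ∈ VN N, c v * d w * grn (intr (VN N)) v w := by
  have i : ∀ v ∈ VN N, ∀ w ∈ VN N, Integrable (fun ω : FieldSp ↦ c v * d w * (ω v * ω w)) P := fun v hv w hw ↦
    ((gff_memLp1 hP hv).integrable_mul (gff_memLp1 hP hw)).const_mul _
  have : ∀ ω : FieldSp, (∑ v ∈ VN N, c v * ω v) * (∑ w ∈ VN N, d w * ω w) = ∑ v ∈ VN N, ∑ w ∈ VN N, c v * d w * (ω v * ω w) := by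
    intro ω; rw [Finset.sum_mul_sum]
    exact sum_congr rfl fun v _ ↦ sum_congr rfl fun w _ ↦ by ring
  simp_rw [this]
  rw [integral_finsetSum _ fun v hv ↦ integrable_finsetSum _ fun w hw ↦ i v hv w hw]
  refine sum_congr rfl fun v hv ↦ ?_
  rw [integral_finsetSum _ fun w hw ↦ i v hv w hw]
  refine sum_congr rfl fun w hw ↦ ?_
  rw [integral_const_mul, gff_cov2 hP hv hw]

theorem gff_psd {N : ℕ} {P : Measure FieldSp} (hP : IsGFF N P) (c : Vtx → ℝ) :
    0 ≤ ∑ v ∈ VN N, ∑ w ∈ VN N, c v * c w * grn (intr (VN N)) v w := by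
  rw [← gff_cov hP]; exact integral_nonneg fun ω ↦ mul_self_nonneg _

open scoped MatrixOrder in
theorem gff_factor {N : ℕ} {P : Measure FieldSp} (hP : IsGFF N P) :
    ∃ B : Vtx → (𝕍 N → ℝ), (∀ v ∈ VN N, ∀ w ∈ VN N, dt (B v) (B w) = grn (intr (VN N)) v w) ∧
      P.map (fun ω (v : 𝕍 N) ↦ ω v) = (gm 𝕍 N).map (fun ξ (v : 𝕍 N) ↦ dt (B v) ξ) := by
  have := hP.1
  have g0 := grn_spec (intr (VN N))
  let Gm : Matrix 𝕍 N 𝕍 N ℝ := fun v w ↦ grn (intr (VN N)) v w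
  have hpsd : Gm.PosSemidef := by
    refine Matrix.PosSemidef.of_dotProduct_mulVec_nonneg ?_ ?_
    · ext v w
      change star (grn (intr (VN N)) w v) = grn (intr (VN N)) v w
      rw [star_trivial, green_symm g0]
    · intro x
      have := gff_psd hP (fun v ↦ if h : v ∈ VN N then x ⟨v, h⟩ else 0)
      refine this.trans_eq ?_
      rw [← sum_coe_sort]
      simp only [dotProduct, Matrix.mulVec, Pi.star_apply, star_trivial, mul_sum]
      refine sum_congr rfl fun v _ ↦ ?_
      conv_lhs => rw [← sum_coe_sort]
      refine sum_congr rfl fun w _ ↦ ?_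
      simp [Gm]; ring
  obtain ⟨B, hB⟩ := CStarAlgebra.nonneg_iff_eq_star_mul_self.mp hpsd.nonneg
  let Bv : Vtx → (𝕍 N → ℝ) := fun v i ↦ if h : v ∈ VN N then B i ⟨v, h⟩ else 0
  have hBv : ∀ v ∈ VN N, ∀ w ∈ VN N, dt (Bv v) (Bv w) = grn (intr (VN N)) v w := by
    intro v hv w hw
    have := congrFun (congrFun hB ⟨v, hv⟩) ⟨w, hw⟩
    simp only [Gm] at this
    rw [this]
    simp [Matrix.mul_apply, dt, Bv, hv, hw, Matrix.star_eq_conjTranspose]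
  refine ⟨Bv, hBv, ?_⟩
  have m1 : Measurable (fun (ω : FieldSp) (v : 𝕍 N) ↦ ω v) := by fun_prop
  have m2 : Measurable (fun (ξ : 𝕍 N → ℝ) (v : 𝕍 N) ↦ dt (Bv v) ξ) := measurable_pi_lambda _ fun v ↦ dt_meas _
  have := Measure.isProbabilityMeasure_map (μ := P) m1.aemeasurable
  have := Measure.isProbabilityMeasure_map (μ := gm 𝕍 N) m2.aemeasurable
  refine cramer_wold _ _ fun c ↦ ?_
  rw [Measure.map_map (dt_meas c) m1, Measure.map_map (dt_meas c) m2]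
  have e1 : (dt c ∘ fun (ω : FieldSp) (v : 𝕍 N) ↦ ω v) = fun ω ↦ ∑ v ∈ VN N, (if h : v ∈ VN N then c ⟨v, h⟩ else 0) * ω v := by
    ext ω; rw [← sum_coe_sort]; simp [dt]
  have e2 : (dt c ∘ fun (ξ : 𝕍 N → ℝ) (v : 𝕍 N) ↦ dt (Bv v) ξ) = dt (∑ v : 𝕍 N, c v • Bv v) := by
    ext ξ; rw [dt_sum_left]; simp only [dt_smul_left]; rfl
  rw [e1, e2, gff_lin hP, gm_law]
  congr 2
  rw [dt_sum_left, ← sum_coe_sort]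
  refine sum_congr rfl fun v _ ↦ ?_
  rw [dt_sum_right, ← sum_coe_sort]
  refine sum_congr rfl fun w _ ↦ ?_
  rw [dt_smul_left, dt_smul_right, hBv v v.2 w w.2]
  simp; ring

end P9

section P10
open MeasureTheory ProbabilityTheory

theorem gff_gauss {N : ℕ} {P : Measure FieldSp} (hP : IsGFF N P) : HasGaussianLaw (fun ω (v : 𝕍 N) ↦ (ω : FieldSp) v) P := by
  have := hP.1
  have m1 : Measurable (fun (ω : FieldSp) (v : 𝕍 N) ↦ ω v) := by fun_prop
  refine ⟨⟨fun L ↦ ?_⟩⟩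
  have e1 : (fun ω : FieldSp ↦ L (fun v : 𝕍 N ↦ ω v)) = fun ω ↦ ∑ v ∈ VN N, (if h : v ∈ VN N then L (Pi.single ⟨v, h⟩ 1) else 0) * ω v := by
    ext ω
    rw [← sum_coe_sort]
    conv_lhs => rw [pi_eq_sum_univ' (fun v : 𝕍 N ↦ ω v), map_sum]
    refine sum_congr rfl fun v _ ↦ ?_
    rw [map_smul, smul_eq_mul, mul_comm]; simp
  have e2 : (P.map (fun (ω : FieldSp) (v : 𝕍 N) ↦ ω v)).map L = P.map (fun ω : FieldSp ↦ L (fun v : 𝕍 N ↦ ω v)) :=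
    Measure.map_map (by fun_prop) m1
  have hmap := gff_lin hP (fun v ↦ if h : v ∈ VN N then L (Pi.single ⟨v, h⟩ 1) else 0)
  rw [← e1] at hmap
  rw [e2, hmap]
  have mL : AEMeasurable L ((P.map (fun (ω : FieldSp) (v : 𝕍 N) ↦ ω v))) := by fun_prop
  have f1 : (∫ x, L x ∂(P.map (fun (ω : FieldSp) (v : 𝕍 N) ↦ ω v))) = 0 := by
    have := integral_map (f := id) mL (by fun_prop)
    rw [e2, hmap] at this
    simpa using this.symm
  have f2 : Var[L; P.map (fun (ω : FieldSp) (v : 𝕍 N) ↦ ω v)] = Var[id; gaussianReal 0 (toNNReal (∑ v ∈ VN N, ∑ w ∈ VN N, (if h : v ∈ VN N then L (Pi.single ⟨v, h⟩ 1) else 0) * (if h : w ∈ VN N then L (Pi.single ⟨w, h⟩ 1) else 0) * grn (intr (VN N)) v w))] := by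
    rw [← hmap, ← e2, variance_map (by fun_prop) mL]; rfl
  rw [f1, f2, variance_id_gaussianReal, Real.toNNReal_coe]

theorem phiScale_eq {N : ℕ} {P : Measure FieldSp} (hP : IsGFF N P) {v : Vtx} (hv : v ∈ VN N) {lam : ℝ} (h0 : 0 ≤ lam) :
    phiScale N P v lam =ᵐ[P] fun ω ↦ ∑ z ∈ VN N, hk (Dn N lam v) v z * ω z := by
  have hpr := hP.1
  set D := Dn N lam v with hD
  have hDs : D ⊆ intr (VN N) := Dn_sub h0 hv
  let S := (VN N).filter (fun w ↦ w ∉ D)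
  let K : FieldSp → ℝ := fun ω ↦ ∑ z ∈ VN N, hk D v z * ω z
  let R : FieldSp → ℝ := fun ω ↦ ω v - K ω
  have hle : scaleAlg N lam v ≤ MeasurableSpace.pi := by
    refine iSup₂_le fun w _ ↦ ?_
    exact (measurable_pi_apply w).comap_le
  have hcoord : ∀ w ∈ S, Measurable[scaleAlg N lam v] (fun ω : FieldSp ↦ ω w) := by
    intro w hw
    rw [mem_filter] at hw
    rw [measurable_iff_comap_le]
    exact le_iSup₂_of_le (f := fun w (_ : w ∈ {w : Vtx | w ∈ VN N ∧ w ∉ intr (nbhd N lam v)}) =>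
      MeasurableSpace.comap (fun ω : FieldSp ↦ ω w) inferInstance) w hw le_rfl
  have hKm : Measurable[scaleAlg N lam v] K := by
    refine measurable_sum _ fun z hz ↦ ?_
    by_cases h : hk D v z = 0
    · simp_all
    · exact (hcoord z (mem_filter.2 ⟨hz, (hk_supp h).1⟩)).const_mul _
  have hcomap : scaleAlg N lam v ≤ MeasurableSpace.comap (fun (ω : FieldSp) (w : ↥S) ↦ ω w) inferInstance := by
    refine iSup₂_le fun w hw ↦ ?_
    have hw' : w ∈ S := mem_filter.2 hw
    have : (fun ω : FieldSp ↦ ω w) = (fun x : ↥S → ℝ ↦ x ⟨w, hw'⟩) ∘ (fun (ω : FieldSp) (w : ↥S) ↦ ω w) := rfl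
    rw [this, ← MeasurableSpace.comap_comp]
    exact MeasurableSpace.comap_mono (measurable_pi_apply _).comap_le
  have hRlin : ∀ ω, R ω = ∑ z ∈ VN N, (𝟙(z = v) - hk D v z) * ω z := by
    intro ω; simp only [R, K, sub_mul, sum_sub_distrib, gff_coord hv]
  have hind : IndepFun (fun ω (_ : Unit) ↦ R ω) (fun (ω : FieldSp) (w : ↥S) ↦ ω w) P := by
    refine HasGaussianLaw.indepFun_of_covariance_eval (X := fun (_ : Unit) ω ↦ R ω) (Y := fun (w : ↥S) (ω : FieldSp) ↦ ω w) ?_ ?_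
    · let L : (𝕍 N → ℝ) →ₗ[ℝ] (Unit → ℝ) × (↥S → ℝ) :=
        { toFun := fun x ↦ (fun _ ↦ ∑ z : 𝕍 N, (𝟙((z : Vtx) = v) - hk D v z) * x z,
            fun w ↦ x ⟨w, (mem_filter.1 w.2).1⟩)
          map_add' := by intro x y; ext <;> simp [mul_add, sum_add_distrib]
          map_smul' := by
            intro r x; ext
            · simp only [Pi.smul_apply, smul_eq_mul, RingHom.id_apply, Prod.smul_fst, mul_sum]
              exact sum_congr rfl fun _ _ ↦ by ring
            · simp }
      have := (gff_gauss hP).map_fun L.toContinuousLinearMap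
      refine this.congr (ae_of_all _ fun ω ↦ ?_)
      simp only [LinearMap.coe_toContinuousLinearMap', L, LinearMap.coe_mk, AddHom.coe_mk]
      ext
      · simp only [hRlin]
        rw [sum_coe_sort (VN N) (fun z ↦ (𝟙((z : Vtx) = v) - hk D v z) * ω z)]
      · rfl
    · intro _ w
      obtain ⟨w, hw⟩ := w
      rw [mem_filter] at hw
      have hRm : MemLp R 2 P := by
        have := gff_memLp hP (fun z ↦ 𝟙(z = v) - hk D v z)
        simpa only [← hRlin] using this
      rw [covariance_eq_sub hRm (gff_memLp1 hP hw.1)]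
      have m1 : P[R] = 0 := by
        have := gff_mean hP (fun z ↦ 𝟙(z = v) - hk D v z)
        simpa only [← hRlin] using this
      rw [m1, zero_mul, sub_zero]
      have c1 := gff_cov hP (fun z ↦ 𝟙(z = v) - hk D v z) (fun z ↦ 𝟙(z = w))
      simp only [← hRlin, gff_coord hw.1] at c1
      change ∫ ω, R ω * ω w ∂P = 0
      rw [c1]
      have : ∀ z ∈ VN N, ∑ z' ∈ VN N, (𝟙(z = v) - hk D v z) * 𝟙(z' = w) * grn (intr (VN N)) z z'
          = 𝟙(z = v) * grn (intr (VN N)) z w - hk D v z * grn (intr (VN N)) z w := by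
        intro z _
        simp [hw.1, sub_mul]
      rw [sum_congr rfl this, sum_sub_distrib, hk_green hDs hv (grn_spec _) w]
      simp [hv, (grn_spec D).1 v w (Or.inr hw.2)]
  have hind2 : Indep (MeasurableSpace.comap R inferInstance) (scaleAlg N lam v) P := by
    have := hind.comp (φ := fun x : Unit → ℝ ↦ x ()) (ψ := id) (by fun_prop : Measurable fun x : Unit → ℝ ↦ x ()) measurable_id
    exact indep_of_indep_of_le_right ((IndepFun_iff_Indep _ _ _).1 this) hcomap
  have hKi : Integrable K P := (gff_memLp hP _).integrable (by simp)
  have hvi : Integrable (fun ω : FieldSp ↦ ω v) P := (gff_memLp1 hP hv).integrable (by simp)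
  have hRi : Integrable R P := hvi.sub hKi
  have hRme : Measurable R := (measurable_pi_apply v).sub (lin_meas N _)
  have c1 : P[R | scaleAlg N lam v] =ᵐ[P] fun _ ↦ P[R] :=
    condExp_indep_eq hRme.comap_le hle (comap_measurable R).stronglyMeasurable hind2
  have m1 : P[R] = 0 := by
    have := gff_mean hP (fun z ↦ 𝟙(z = v) - hk D v z)
    simpa only [← hRlin] using this
  have c2 : P[K | scaleAlg N lam v] = K := condExp_of_stronglyMeasurable hle hKm.stronglyMeasurable hKi
  have e : (fun ω : FieldSp ↦ ω v) = R + K := by ext ω; simp [R]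
  unfold phiScale
  rw [e]
  filter_upwards [condExp_add hRi hKi (scaleAlg N lam v), c1] with ω h1 h2
  rw [h1, Pi.add_apply, h2, m1, c2, zero_add]

noncomputable def cw (N M : ℕ) (sigv lamv : ℕ → ℝ) (p q : ℝ) (v z : Vtx) : ℝ :=
  ∑ i ∈ Icc 1 M, sigv i * (hk (Dn N (cl p q (lamv i)) v) v z - hk (Dn N (cl p q (lamv (i - 1))) v) v z)

theorem cw_cov (N M : ℕ) (sigv lamv : ℕ → ℝ) (p q p' q' : ℝ) (v w : Vtx) :
    ∑ z ∈ VN N, ∑ z' ∈ VN N, cw N M sigv lamv p q v z * cw N M sigv lamv p' q' w z' * grn (intr (VN N)) z z'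
      = cvY N M sigv lamv p q p' q' v w := by
  have e : ∀ z ∈ VN N, ∀ z' ∈ VN N, cw N M sigv lamv p q v z * cw N M sigv lamv p' q' w z' * grn (intr (VN N)) z z'
      = ∑ i ∈ Icc 1 M, ∑ k ∈ Icc 1 M, (sigv i * (hk (Dn N (cl p q (lamv i)) v) v z - hk (Dn N (cl p q (lamv (i - 1))) v) v z))
        * (sigv k * (hk (Dn N (cl p' q' (lamv k)) w) w z' - hk (Dn N (cl p' q' (lamv (k - 1))) w) w z')) * grn (intr (VN N)) z z' := by
    intro z _ z' _
    simp only [cw, sum_mul, mul_sum]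
    exact sum_comm
  rw [sum_congr rfl fun z hz ↦ sum_congr rfl (e z hz)]
  have e2 : ∀ z ∈ VN N, ∀ f : Vtx → ℕ → ℕ → ℝ, ∑ z' ∈ VN N, ∑ i ∈ Icc 1 M, ∑ k ∈ Icc 1 M, f z' i k
      = ∑ i ∈ Icc 1 M, ∑ k ∈ Icc 1 M, ∑ z' ∈ VN N, f z' i k := by
    intro z _ f
    rw [sum_comm]; exact sum_congr rfl fun i _ ↦ sum_comm
  rw [sum_congr rfl fun z hz ↦ e2 z hz _, sum_comm]
  unfold cvY
  refine sum_congr rfl fun i _ ↦ ?_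
  rw [sum_comm]
  refine sum_congr rfl fun k _ ↦ ?_
  simp only [cv, ← sum_sub_distrib, ← sum_add_distrib, mul_sum]
  refine sum_congr rfl fun z _ ↦ sum_congr rfl fun z' _ ↦ ?_
  ring

theorem psi_eq {N M : ℕ} {sigv lamv : ℕ → ℝ} (hsp : ScaleParams M sigv lamv) {P : Measure FieldSp} (hP : IsGFF N P) {v : Vtx} (hv : v ∈ VN N) :
    psiFld N M sigv lamv P v =ᵐ[P] fun ω ↦ ∑ z ∈ VN N, cw N M sigv lamv 0 1 v z * ω z := by
  have h : ∀ i ∈ range (M + 1), phiScale N P v (lamv i) =ᵐ[P] fun ω ↦ ∑ z ∈ VN N, hk (Dn N (lamv i) v) v z * ω z :=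
    fun i hi ↦ phiScale_eq hP hv (sp_mem hsp (by simpa [Nat.lt_succ_iff] using hi)).1
  have h2 := (Finset.eventually_all (range (M+1))).2 h
  filter_upwards [h2] with ω hω
  simp only [psiFld, cw, sum_mul]
  rw [sum_comm]
  refine sum_congr rfl fun i hi ↦ ?_
  rw [mem_Icc] at hi
  have hc : ∀ i ≤ M, cl 0 1 (lamv i) = lamv i := fun i hi ↦ by
    have := sp_mem hsp hi; simp [cl, this.1, this.2]
  rw [hω i (by simp; omega), hω (i - 1) (by simp; omega), hc i hi.2, hc (i-1) 𝕆, ← sum_sub_distrib, mul_sum]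
  exact sum_congr rfl fun z _ ↦ by ring

end P10

section P11
open MeasureTheory ProbabilityTheory

variable {ι κ V : Type} [Fintype ι] [Fintype κ] [Fintype V]
variable (h : V → ℝ) (A : V → ι → ℝ)

noncomputable def gz (ξ : ι → ℝ) : ℝ := ∑ v, exp (h v + dt (A v) ξ)

noncomputable def gw (v : V) (ξ : ι → ℝ) : ℝ := exp (h v + dt (A v) ξ) / gz h A ξ

noncomputable def gW {s : ℕ} (vv : Fin s → V) (ξ : ι → ℝ) : ℝ := ∏ i, gw h A (vv i) ξ

theorem gz_pos [Nonempty V] (ξ : ι → ℝ) : 0 < gz h A ξ :=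
  sum_pos (fun _ _ ↦ exp_pos _) univ_nonempty
theorem gz_nonneg (ξ : ι → ℝ) : 0 ≤ gz h A ξ :=
  sum_nonneg (fun _ _ ↦ (exp_pos _).le)
theorem gz_meas : Measurable (gz h A) := by
  unfold gz
  exact measurable_sum _ fun v _ ↦ ((dt_meas (A v)).const_add _).exp
theorem gw_nonneg (v : V) (ξ : ι → ℝ) : 0 ≤ gw h A v ξ :=
  div_nonneg (exp_pos _).le (gz_nonneg h A ξ)
theorem gw_meas (v : V) : Measurable (gw h A v) :=
  ((dt_meas (A v)).const_add _).exp.div (gz_meas h A)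
theorem gw_sum [Nonempty V] (ξ : ι → ℝ) : ∑ v, gw h A v ξ = 1 := by
  simp only [gw, ← sum_div]; exact div_self (gz_pos h A ξ).ne'
theorem gw_le_one [Nonempty V] (v : V) (ξ : ι → ℝ) : gw h A v ξ ≤ 1 := by
  rw [← gw_sum h A ξ]; exact single_le_sum (fun v _ ↦ gw_nonneg h A v ξ) (mem_univ v)
theorem gW_nonneg {s : ℕ} (vv : Fin s → V) (ξ : ι → ℝ) : 0 ≤ gW h A vv ξ :=
  Finset.prod_nonneg fun _ _ ↦ gw_nonneg _ _ _ _
theorem gW_meas {s : ℕ} (vv : Fin s → V) : Measurable (gW h A vv) :=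
  Finset.measurable_prod _ fun _ _ ↦ gw_meas _ _ _
theorem gW_le_one [Nonempty V] {s : ℕ} (vv : Fin s → V) (ξ : ι → ℝ) : gW h A vv ξ ≤ 1 :=
  Finset.prod_le_one (fun _ _ ↦ gw_nonneg _ _ _ _) fun _ _ ↦ gw_le_one _ _ _ _
theorem gW_sum [Nonempty V] (s : ℕ) (ξ : ι → ℝ) : ∑ vv : Fin s → V, gW h A vv ξ = 1 := by
  unfold gW
  rw [← Fintype.sum_pow (fun v ↦ gw h A v ξ) s, gw_sum, one_pow]

theorem lz_deriv [Nonempty V] (ξ a : ι → ℝ) :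
    HasDerivAt (fun t : ℝ ↦ log (gz h A (ξ + t • a))) (∑ v, gw h A v ξ * dt (A v) a) 0 := by
  have h1 : HasDerivAt (fun t : ℝ ↦ gz h A (ξ + t • a)) (∑ v, exp (h v + dt (A v) ξ) * dt (A v) a) 0 := by
    unfold gz
    refine HasDerivAt.fun_sum fun v _ ↦ ?_
    have : HasDerivAt (fun t : ℝ ↦ h v + dt (A v) (ξ + t • a)) (dt (A v) a) 0 := by
      simp only [dt_add_right, dt_smul_right]
      simpa using (((hasDerivAt_id 𝟎).mul_const (dt (A v) a)).const_add (dt (A v) ξ)).const_add (h v)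
    simpa using this.exp
  have h2 := h1.log (by simpa using (gz_pos h A ξ).ne')
  convert h2 using 1
  simp only [gw, zero_smul, add_zero, sum_div]
  exact sum_congr rfl fun v _ ↦ by ring

theorem gW_exp [Nonempty V] {s : ℕ} (vv : Fin s → V) (ξ : ι → ℝ) :
    gW h A vv ξ = exp (∑ i, (h (vv i) + dt (A (vv i)) ξ) - s * log (gz h A ξ)) := by
  rw [exp_sub, Real.exp_sum, gW, ← log_pow, exp_log (pow_pos (gz_pos h A ξ) _)]
  simp [gw, Finset.prod_div_distrib]

theorem gW_deriv [Nonempty V] {s : ℕ} (vv : Fin s → V) (ξ a : ι → ℝ) :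
    HasDerivAt (fun t : ℝ ↦ gW h A vv (ξ + t • a))
      (gW h A vv ξ * (∑ i, dt (A (vv i)) a - s * ∑ v, gw h A v ξ * dt (A v) a)) 0 := by
  have h1 : HasDerivAt (fun t : ℝ ↦ ∑ i, (h (vv i) + dt (A (vv i)) (ξ + t • a))) (∑ i, dt (A (vv i)) a) 0 := by
    refine HasDerivAt.fun_sum fun i _ ↦ ?_
    simp only [dt_add_right, dt_smul_right]
    simpa using (((hasDerivAt_id 𝟎).mul_const (dt (A (vv i)) a)).const_add (dt (A (vv i)) ξ)).const_add (h (vv i))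
  have h2 := (h1.fun_sub ((lz_deriv h A ξ a).const_mul (s : ℝ))).exp
  simp only [gW_exp]
  convert h2 using 1
  simp

theorem gw_avg_abs [Nonempty V] (ξ : ι → ℝ) (f : V → ℝ) (C : ℝ) (hf : ∀ v, |f v| ≤ C) :
    |∑ v, gw h A v ξ * f v| ≤ C := by
  calc |∑ v, gw h A v ξ * f v| ≤ ∑ v, gw h A v ξ * C := by
        refine (abs_sum_le_sum_abs _ _).trans (sum_le_sum fun v _ ↦ ?_)
        rw [abs_mul, abs_of_nonneg (gw_nonneg _ _ _ _)]
        exact mul_le_mul_of_nonneg_left (hf v) (gw_nonneg _ _ _ _)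
    _ = C := by rw [← sum_mul, gw_sum, one_mul]

theorem gW_ibp [Nonempty V] {s : ℕ} (vv : Fin s → V) (a : ι → ℝ) :
    ∫ ξ, dt a ξ * gW h A vv ξ ∂gm ι
      = ∫ ξ, gW h A vv ξ * (∑ i, dt (A (vv i)) a - s * ∑ v, gw h A v ξ * dt (A v) a) ∂gm ι := by
  obtain ⟨C, hC⟩ : ∃ C : ℝ, ∀ v i, |A v i| ≤ C := by
    refine ⟨∑ v, ∑ i, |A v i|, fun v i ↦ ?_⟩
    exact (single_le_sum (fun i _ ↦ abs_nonneg (A v i)) (mem_univ i)).trans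
      (single_le_sum (f := fun v ↦ ∑ i, |A v i|) (fun v _ ↦ sum_nonneg fun i _ ↦ abs_nonneg _) (mem_univ v))
  refine ibp (gW h A vv) (fun ξ a ↦ gW h A vv ξ * (∑ i, dt (A (vv i)) a - s * ∑ v, gw h A v ξ * dt (A v) a))
    (fun ξ a ↦ gW_deriv h A vv ξ a) ?_ 1 (s * C + s * C) ?_ ?_ (gW_meas h A vv) ?_ a
  · intro ξ a
    have e : ∀ v, dt (A v) a = ∑ i, a i * dt (A v) (Pi.single i 1) := by
      intro v
      simp only [dt_comm (A v) (Pi.single _ 1), dt_single]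
      simp [dt, mul_comm]
    have e2 : ∑ i, a i * (gW h A vv ξ * (∑ j, dt (A (vv j)) (Pi.single i 1) - s * ∑ v, gw h A v ξ * dt (A v) (Pi.single i 1)))
        = gW h A vv ξ * (∑ j, ∑ i, a i * dt (A (vv j)) (Pi.single i 1) - s * ∑ v, gw h A v ξ * ∑ i, a i * dt (A v) (Pi.single i 1)) := by
      rw [sum_comm]
      simp only [mul_sum]
      rw [sum_comm (s := (univ : Finset V)), ← sum_sub_distrib, mul_sum]
      refine sum_congr rfl fun i _ ↦ ?_
      rw [mul_left_comm, mul_sub (a i), mul_sum, mul_sum]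
      congr 2
      refine sum_congr rfl fun v _ ↦ ?_
      ring
    rw [e2]
    simp only [← e]
  · intro ξ
    rw [abs_of_nonneg (gW_nonneg _ _ _ _)]; exact gW_le_one _ _ _ _
  · intro ξ i
    have hs : ∀ v, |dt (A v) (Pi.single i 1)| ≤ C := fun v ↦ by rw [dt_comm, dt_single]; exact hC v i
    rw [abs_mul, abs_of_nonneg (gW_nonneg _ _ _ _)]
    refine (mul_le_of_le_one_left (abs_nonneg _) (gW_le_one _ _ _ _)).trans ((abs_sub _ _).trans (add_le_add ?_ ?_))
    · refine (abs_sum_le_sum_abs _ _).trans ((sum_le_sum fun j _ ↦ hs (vv j)).trans ?_)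
      simp
    · rw [abs_mul, Nat.abs_cast]
      exact mul_le_mul_of_nonneg_left (gw_avg_abs h A ξ _ C hs) (Nat.cast_nonneg _)
  · intro i
    refine (gW_meas h A vv).mul (measurable_const.sub ((measurable_sum _ fun v _ ↦ ?_).const_mul _))
    exact (gw_meas h A v).mul_const _

theorem lz_bound [Nonempty V] (ξ : ι → ℝ) :
    |log (gz h A ξ)| ≤ log (Fintype.card V) + ∑ v, (|h v| + |dt (A v) ξ|) := by
  have hs : ∀ v, |h v + dt (A v) ξ| ≤ ∑ v, (|h v| + |dt (A v) ξ|) := fun v ↦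
    (abs_add_le _ _).trans (single_le_sum (f := fun v ↦ |h v| + |dt (A v) ξ|) (fun v _ ↦ by positivity) (mem_univ v))
  have hc : 𝟎 < Fintype.card V := by exact_mod_cast Fintype.card_pos
  have hlc : 0 ≤ log (Fintype.card V) := log_natCast_nonneg _
  rw [abs_le]
  constructor
  · obtain ⟨v⟩ := ‹Nonempty V›
    have : exp (h v + dt (A v) ξ) ≤ gz h A ξ := single_le_sum (f := fun v ↦ exp (h v + dt (A v) ξ)) (fun v _ ↦ (exp_pos _).le) (mem_univ v)
    have h2 := log_le_log (exp_pos _) this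
    rw [log_exp] at h2
    have := (abs_le.1 (hs v)).1
    linarith
  · rw [log_le_iff_le_exp (gz_pos h A ξ), exp_add, exp_log hc]
    refine (sum_le_sum fun v _ ↦ exp_le_exp.2 (abs_le.1 (hs v)).2).trans ?_
    simp

theorem lz_int [Nonempty V] : Integrable (fun ξ ↦ log (gz h A ξ)) (gm ι) := by
  refine Integrable.mono' (g := fun ξ ↦ log (Fintype.card V) + ∑ v, (|h v| + |dt (A v) ξ|)) ?_ (gz_meas h A).log.aestronglyMeasurable
    (ae_of_all _ fun ξ ↦ lz_bound h A ξ)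
  refine (integrable_const _).add (integrable_finsetSum _ fun v _ ↦ (integrable_const _).add (dt_integrable _).abs)

theorem lz_tderiv [Nonempty V] (h : V → ℝ) (X Y : V → ι → ℝ) (ξ : ι → ℝ) (t : ℝ) :
    HasDerivAt (fun t : ℝ ↦ log (gz h (fun v ↦ cos t • X v + sin t • Y v) ξ))
      (∑ v, gw h (fun v ↦ cos t • X v + sin t • Y v) v ξ * dt (-sin t • X v + cos t • Y v) ξ) t := by
  have h1 : HasDerivAt (fun t : ℝ ↦ gz h (fun v ↦ cos t • X v + sin t • Y v) ξ)
      (∑ v, exp (h v + dt (cos t • X v + sin t • Y v) ξ) * dt (-sin t • X v + cos t • Y v) ξ) t := by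
    unfold gz
    refine HasDerivAt.fun_sum fun v _ ↦ ?_
    have : HasDerivAt (fun t : ℝ ↦ h v + dt (cos t • X v + sin t • Y v) ξ) (dt (-sin t • X v + cos t • Y v) ξ) t := by
      simp only [dt_add_left, dt_smul_left]
      exact (((Real.hasDerivAt_cos t).mul_const _).add ((hasDerivAt_sin t).mul_const _)).const_add _
    exact this.exp
  have h2 := h1.log (gz_pos h _ ξ).ne'
  convert h2 using 1
  simp only [gw, sum_div]
  exact sum_congr rfl fun v _ ↦ by ring

theorem sf_orth [Nonempty V] (h : V → ℝ) (X Y : V → ι → ℝ) (ho : ∀ v w, dt (X v) (Y w) = 0) (δ : ℝ)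
    (hd : ∀ v w, dt (X v - X w) (X v - X w) - δ ≤ dt (Y v - Y w) (Y v - Y w)) :
    ∫ ξ, log (gz h X ξ) ∂gm ι ≤ ∫ ξ, log (gz h Y ξ) ∂gm ι + δ / 4 := by
  let At : ℝ → V → ι → ℝ := fun t v ↦ cos t • X v + sin t • Y v
  let at' : ℝ → V → ι → ℝ := fun t v ↦ -sin t • X v + cos t • Y v
  have hder : ∀ t, HasDerivAt (fun t ↦ ∫ ξ, log (gz h (At t) ξ) ∂gm ι) (∫ ξ, ∑ v, gw h (At t) v ξ * dt (at' t v) ξ ∂gm ι) t := by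
    intro t
    refine (hasDerivAt_integral_of_dominated_loc_of_deriv_le (F := fun t ξ ↦ log (gz h (At t) ξ)) (F' := fun t ξ ↦ ∑ v, gw h (At t) v ξ * dt (at' t v) ξ)
      (bound := fun ξ ↦ ∑ v, (|dt (X v) ξ| + |dt (Y v) ξ|)) (s := Set.univ) univ_mem ?_ (lz_int h _) ?_ ?_ ?_ ?_).2
    · exact Eventually.of_forall fun t ↦ (gz_meas h _).log.aestronglyMeasurable
    · exact (measurable_sum _ fun v _ ↦ (gw_meas h _ v).mul (dt_meas _)).aestronglyMeasurable
    · refine ae_of_all _ fun ξ t _ ↦ ?_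
      rw [norm_eq_abs]
      refine (abs_sum_le_sum_abs _ _).trans (sum_le_sum fun v _ ↦ ?_)
      rw [abs_mul, abs_of_nonneg (gw_nonneg _ _ _ _)]
      refine (mul_le_of_le_one_left (abs_nonneg _) (gw_le_one _ _ _ _)).trans ?_
      simp only [at', dt_add_left, dt_smul_left]
      refine (abs_add_le _ _).trans (add_le_add ?_ ?_)
      · rw [abs_mul, abs_neg]; exact mul_le_of_le_one_left (abs_nonneg _) (Real.abs_sin_le_one t)
      · rw [abs_mul]; exact mul_le_of_le_one_left (abs_nonneg _) (Real.abs_cos_le_one t)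
    · exact integrable_finsetSum _ fun v _ ↦ (dt_integrable _).abs.add (dt_integrable _).abs
    · exact ae_of_all _ fun ξ t _ ↦ lz_tderiv h X Y ξ t
  have hval : ∀ t, (∫ ξ, ∑ v, gw h (At t) v ξ * dt (at' t v) ξ ∂gm ι)
      = ∫ ξ, (sin t * cos t / 2) * ∑ v, ∑ w, gw h (At t) v ξ * gw h (At t) w ξ *
          (dt (Y v - Y w) (Y v - Y w) - dt (X v - X w) (X v - X w)) ∂gm ι := by
    intro t
    have hi : ∀ v, Integrable (fun ξ ↦ gw h (At t) v ξ * dt (at' t v) ξ) (gm ι) := fun v ↦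
      (dt_integrable (at' t v)).bdd_mul (c := 1) (gw_meas h _ v).aestronglyMeasurable (ae_of_all _ fun ξ ↦ by
        rw [norm_eq_abs, abs_of_nonneg (gw_nonneg _ _ _ _)]; exact gw_le_one _ _ _ _)
    have hgw : ∀ (v : V) ξ, gW h (At t) (fun _ : Fin 1 ↦ v) ξ = gw h (At t) v ξ := fun v ξ ↦ by simp [gW]
    have h1 : ∀ v, ∫ ξ, gw h (At t) v ξ * dt (at' t v) ξ ∂gm ι
        = ∫ ξ, gw h (At t) v ξ * (dt (At t v) (at' t v) - ∑ w, gw h (At t) w ξ * dt (At t w) (at' t v)) ∂gm ι := by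
      intro v
      have := gW_ibp h (At t) (fun _ : Fin 1 ↦ v) (at' t v)
      simp only [hgw] at this
      simpa [mul_comm] using this
    have hD : ∀ v w, dt (At t v) (at' t w) = sin t * cos t * (dt (Y v) (Y w) - dt (X v) (X w)) := by
      intro v w
      have ho' := ho w v
      rw [dt_comm] at ho'
      simp only [At, at', dt_add_left, dt_add_right, dt_smul_left, dt_smul_right, ho, ho']
      ring
    have hi2 : ∀ v, Integrable (fun ξ ↦ gw h (At t) v ξ * (dt (At t v) (at' t v) - ∑ w, gw h (At t) w ξ * dt (At t w) (at' t v))) (gm ι) := by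
      intro v
      refine ((integrable_const _).sub (integrable_finsetSum _ fun w _ ↦ Integrable.mul_const ?_ _)).bdd_mul (c := 1) (gw_meas h _ v).aestronglyMeasurable (ae_of_all _ fun ξ ↦ by
        rw [norm_eq_abs, abs_of_nonneg (gw_nonneg _ _ _ _)]; exact gw_le_one _ _ _ _)
      refine Integrable.of_bound (gw_meas h _ w).aestronglyMeasurable 1 (ae_of_all _ fun ξ ↦ by
        rw [norm_eq_abs, abs_of_nonneg (gw_nonneg _ _ _ _)]; exact gw_le_one _ _ _ _)
    rw [integral_finsetSum _ fun v _ ↦ hi v, sum_congr rfl fun v _ ↦ h1 v, ← integral_finsetSum _ fun v _ ↦ hi2 v]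
    congr 1
    ext ξ
    simp only [hD]
    have hs := gw_sum h (At t) ξ
    set g := fun v ↦ gw h (At t) v ξ with hg
    change ∑ v, g v * (_ - ∑ w, g w * _) = _ * ∑ v, ∑ w, g v * g w * _
    have hs' : ∑ v, g v = 1 := hs
    have q : ∀ v w, g v * g w * (dt (Y v - Y w) (Y v - Y w) - dt (X v - X w) (X v - X w))
        = g w * (g v * (dt (Y v) (Y v) - dt (X v) (X v))) + g v * (g w * (dt (Y w) (Y w) - dt (X w) (X w)))
          - 2 * (g v * (g w * (dt (Y w) (Y v) - dt (X w) (X v)))) := by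
      intro v w
      simp only [dt_sub_left, dt_sub_right, dt_comm (Y v) (Y w), dt_comm (X v) (X w)]; ring
    simp only [q, sum_add_distrib, sum_sub_distrib, ← mul_sum, ← sum_mul, hs', mul_sub, one_mul]
    have q2 : ∀ v : V, ∑ w, g w * (sin t * cos t * dt (Y w) (Y v) - sin t * cos t * dt (X w) (X v))
        = sin t * cos t * (∑ w, (g w * dt (Y w) (Y v)) - ∑ w, g w * dt (X w) (X v)) := by
      intro v
      rw [mul_sub, mul_sum, mul_sum, ← sum_sub_distrib]
      exact sum_congr rfl fun w _ ↦ by ring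
    have q3 : ∑ v, g v * (sin t * cos t * dt (Y v) (Y v)) = sin t * cos t * ∑ v, g v * dt (Y v) (Y v) := by
      rw [mul_sum]; exact sum_congr rfl fun w _ ↦ by ring
    have q4 : ∑ v, g v * (sin t * cos t * dt (X v) (X v)) = sin t * cos t * ∑ v, g v * dt (X v) (X v) := by
      rw [mul_sum]; exact sum_congr rfl fun w _ ↦ by ring
    have q5 : ∀ Z : V → ι → ℝ, ∑ v, g v * ∑ w, g w * (sin t * cos t * dt (Z w) (Z v)) = sin t * cos t * ∑ v, g v * ∑ w, g w * dt (Z w) (Z v) := by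
      intro Z
      simp only [mul_sum]; exact sum_congr rfl fun w _ ↦ sum_congr rfl fun v _ ↦ by ring
    rw [q3, q4, q5, q5]
    ring
  have hmono : MonotoneOn (fun t ↦ (∫ ξ, log (gz h (At t) ξ) ∂gm ι) + δ / 4 * sin t ^ 2) (Set.Icc 0 (𝝅 / 2)) := by
    have hd2 : ∀ t, HasDerivAt (fun t ↦ (∫ ξ, log (gz h (At t) ξ) ∂gm ι) + δ / 4 * sin t ^ 2)
        ((∫ ξ, ∑ v, gw h (At t) v ξ * dt (at' t v) ξ ∂gm ι) + δ / 4 * (2 * sin t * cos t)) t := by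
      intro t
      refine (hder t).add ?_
      have := ((hasDerivAt_sin t).pow 2).const_mul (δ / 4)
      simpa using this
    refine monotoneOn_of_deriv_nonneg (convex_Icc _ _) (fun t _ ↦ (hd2 t).continuousAt.continuousWithinAt) (fun t _ ↦ (hd2 t).differentiableAt.differentiableWithinAt) ?_
    intro t ht
    rw [interior_Icc] at ht
    rw [(hd2 t).deriv, hval]
    have hs : 0 ≤ sin t := Real.sin_nonneg_of_nonneg_of_le_pi ht.1.le (by linarith [ht.2, pi_pos])
    have hc : 0 ≤ cos t := Real.cos_nonneg_of_neg_pi_div_two_le_of_le (by linarith [ht.1, pi_pos]) ht.2.le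
    have hsc : 0 ≤ sin t * cos t := mul_nonneg hs hc
    have : ∫ ξ, (-(δ / 4 * (2 * sin t * cos t))) ∂gm ι ≤ ∫ ξ, (sin t * cos t / 2) * ∑ v, ∑ w, gw h (At t) v ξ * gw h (At t) w ξ *
          (dt (Y v - Y w) (Y v - Y w) - dt (X v - X w) (X v - X w)) ∂gm ι := by
      refine integral_mono (integrable_const _) ?_ ?_
      · refine Integrable.const_mul (integrable_finsetSum _ fun v _ ↦ integrable_finsetSum _ fun w _ ↦ Integrable.mul_const ?_ _) _
        refine Integrable.of_bound ((gw_meas h _ v).mul (gw_meas h _ w)).aestronglyMeasurable 1 (ae_of_all _ fun ξ ↦ ?_)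
        rw [norm_eq_abs, abs_of_nonneg (mul_nonneg (gw_nonneg _ _ _ _) (gw_nonneg _ _ _ _))]
        exact mul_le_one₀ (gw_le_one _ _ _ _) (gw_nonneg _ _ _ _) (gw_le_one _ _ _ _)
      · intro ξ
        have k : -δ ≤ ∑ v, ∑ w, gw h (At t) v ξ * gw h (At t) w ξ * (dt (Y v - Y w) (Y v - Y w) - dt (X v - X w) (X v - X w)) := by
          have e : -δ = ∑ v, ∑ w, gw h (At t) v ξ * gw h (At t) w ξ * (-δ) := by
            simp only [← sum_mul, ← mul_sum, gw_sum, mul_one, one_mul]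
          rw [e]
          refine sum_le_sum fun v _ ↦ sum_le_sum fun w _ ↦ ?_
          exact mul_le_mul_of_nonneg_left (by linarith [hd v w]) (mul_nonneg (gw_nonneg _ _ _ _) (gw_nonneg _ _ _ _))
        have := mul_le_mul_of_nonneg_left k (by positivity : 0 ≤ sin t * cos t / 2)
        simp only
        linarith
    rw [integral_const] at this
    simp at this
    linarith
  have := hmono (Set.left_mem_Icc.2 ℙ) (Set.right_mem_Icc.2 ℙ) (by positivity : 𝟎 ≤ 𝝅 / 2)
  simpa [At] using this

theorem gz_law {V : Type} [Fintype V] (h : V → ℝ) (A : V → ι → ℝ) (A' : V → κ → ℝ) (hA : ∀ v w, dt (A v) (A w) = dt (A' v) (A' w))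
    (φ : ℝ → ℝ) (hφ : Measurable φ) : ∫ ξ, φ (gz h A ξ) ∂gm ι = ∫ ξ, φ (gz h A' ξ) ∂(gm κ) := by
  have m1 : Measurable (fun ξ v ↦ dt (A v) ξ) := measurable_pi_lambda _ fun v ↦ dt_meas _
  have m2 : Measurable (fun ξ v ↦ dt (A' v) ξ) := measurable_pi_lambda _ fun v ↦ dt_meas _
  have mf : Measurable (fun x : V → ℝ ↦ φ (∑ v, exp (h v + x v))) := hφ.comp (by fun_prop)
  have e1 := integral_map (μ := gm ι) m1.aemeasurable mf.aestronglyMeasurable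
  have e2 := integral_map (μ := gm κ) m2.aemeasurable mf.aestronglyMeasurable
  rw [law_eq A A' hA] at e1
  exact e1.symm.trans e2

theorem dt_sum_type (a b : ι ⊕ κ → ℝ) : dt a b = dt (fun i ↦ a (Sum.inl i)) (fun i ↦ b (Sum.inl i)) + dt (fun i ↦ a (Sum.inr i)) (fun i ↦ b (Sum.inr i)) := by
  simp [dt, Fintype.sum_sum_type]

theorem sf [Nonempty V] (h : V → ℝ) (X : V → ι → ℝ) (Y : V → κ → ℝ) (δ : ℝ)
    (hd : ∀ v w, dt (X v - X w) (X v - X w) - δ ≤ dt (Y v - Y w) (Y v - Y w)) :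
    ∫ ξ, log (gz h X ξ) ∂gm ι ≤ ∫ ξ, log (gz h Y ξ) ∂(gm κ) + δ / 4 := by
  let X' : V → ι ⊕ κ → ℝ := fun v ↦ Sum.elim (X v) 0
  let Y' : V → ι ⊕ κ → ℝ := fun v ↦ Sum.elim 0 (Y v)
  have h1 := sf_orth h X' Y' (fun v w ↦ by simp [X', Y', dt]) δ (fun v w ↦ by
    simpa [dt_sum_type, X', Y', dt] using hd v w)
  rwa [gz_law h X' X (fun v w ↦ by simp [X', dt]) _ measurable_log,
    gz_law h Y' Y (fun v w ↦ by simp [Y', dt]) _ measurable_log] at h1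

end P11

section P12
open MeasureTheory ProbabilityTheory

noncomputable def ge {ι V : Type} [Fintype ι] [Fintype V] (A : V → ι → ℝ) (s : ℕ) (F : (Fin s → V) → ℝ) : ℝ :=
  ∫ ξ, ∑ vv : Fin s → V, gW 𝟘 A vv ξ * F vv ∂gm ι

theorem psi_cov {N M : ℕ} {sigv lamv : ℕ → ℝ} (hsp : ScaleParams M sigv lamv) {P : Measure FieldSp} (hP : IsGFF N P) {v w : Vtx}
    (hv : v ∈ VN N) (hw : w ∈ VN N) : psiCov N M sigv lamv P v w = cvY N M sigv lamv 0 1 0 1 v w := by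
  have e : psiCov N M sigv lamv P v w = ∫ ω : FieldSp, (∑ z ∈ VN N, cw N M sigv lamv 0 1 v z * ω z) * (∑ z ∈ VN N, cw N M sigv lamv 0 1 w z * ω z) ∂P := by
    refine integral_congr_ae ?_
    filter_upwards [psi_eq hsp hP hv, psi_eq hsp hP hw] with ω h1 h2
    rw [h1, h2]
  rw [e, gff_cov hP, cw_cov]

theorem sum_sub_pi (N s : ℕ) (f : (Fin s → Vtx) → ℝ) :
    ∑ vv ∈ Fintype.piFinset (fun _ : Fin s ↦ VN N), f vv = ∑ vv : Fin s → 𝕍 N, f (fun i ↦ vv i) := by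
  symm
  refine Finset.sum_bij (fun vv _ ↦ fun i ↦ (vv i : Vtx)) ?_ ?_ ?_ ?_
  · intro vv _; simp
  · intro a _ b _ h; ext i : 1; exact Subtype.ext (congrFun h i)
  · intro b hb
    rw [Fintype.mem_piFinset] at hb
    exact ⟨fun i ↦ ⟨b i, hb i⟩, mem_univ _, rfl⟩
  · intro _ _; rfl

theorem transfer {N M : ℕ} {sigv lamv : ℕ → ℝ} (hsp : ScaleParams M sigv lamv) {P : Measure FieldSp} (hP : IsGFF N P) :
    ∃ Aw : ℝ → ℝ → 𝕍 N → (𝕍 N → ℝ), (∀ p q p' q' v w, dt (Aw p q v) (Aw p' q' w) = cvY N M sigv lamv p q p' q' v w) ∧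
      ∀ (β : ℝ) (s : ℕ) (F : (Fin s → Vtx) → ℝ), gibbsExp N M sigv lamv P β s F = ge (fun v ↦ β • Aw 0 1 v) s (fun vv ↦ F (fun i ↦ vv i)) := by
  obtain ⟨B, hB, hmap⟩ := gff_factor hP
  refine ⟨fun p q v ↦ ∑ z ∈ VN N, cw N M sigv lamv p q v z • B z, ?_, ?_⟩
  · intro p q p' q' v w
    rw [← cw_cov, dt_sum_left]
    refine sum_congr rfl fun z hz ↦ ?_
    rw [dt_sum_right]
    refine sum_congr rfl fun z' hz' ↦ ?_
    rw [dt_smul_left, dt_smul_right, hB z hz z' hz']; ring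
  · intro β s F
    let ψ : 𝕍 N → (𝕍 N → ℝ) → ℝ := fun v x ↦ ∑ z : 𝕍 N, cw N M sigv lamv 0 1 v z * x z
    let Φ : (𝕍 N → ℝ) → ℝ := fun x ↦ ∑ vv : Fin s → 𝕍 N, (∏ i, (exp (β * ψ (vv i) x) / ∑ v, exp (β * ψ v x))) * F (fun i ↦ vv i)
    have mΦ : Measurable Φ := by fun_prop
    have m1 : Measurable (fun (ω : FieldSp) (v : 𝕍 N) ↦ ω v) := by fun_prop
    have m2 : Measurable (fun (ξ : 𝕍 N → ℝ) (v : 𝕍 N) ↦ dt (B v) ξ) := measurable_pi_lambda _ fun v ↦ dt_meas _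
    have e1 := integral_map (μ := P) m1.aemeasurable mΦ.aestronglyMeasurable
    have e2 := integral_map (μ := gm 𝕍 N) m2.aemeasurable mΦ.aestronglyMeasurable
    rw [hmap] at e1
    have hae : ∀ᵐ ω ∂P, ∀ v : 𝕍 N, psiFld N M sigv lamv P v ω = ψ v (fun z : 𝕍 N ↦ ω z) := by
      rw [ae_all_iff]
      intro v
      filter_upwards [psi_eq hsp hP v.2] with ω hω
      rw [hω]
      exact (sum_coe_sort (VN N) (fun z ↦ cw N M sigv lamv 0 1 v z * ω z)).symm
    have e3 : gibbsExp N M sigv lamv P β s F = ∫ ω, Φ (fun v : 𝕍 N ↦ ω v) ∂P := by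
      refine integral_congr_ae ?_
      filter_upwards [hae] with ω hω
      rw [sum_sub_pi]
      refine sum_congr rfl fun vv _ ↦ ?_
      simp only [gibbsW, ZN]
      rw [← sum_coe_sort]
      simp only [hω]
    rw [e3, ← e1, e2]
    unfold ge
    congr 1
    ext ξ
    refine sum_congr rfl fun vv _ ↦ ?_
    have hψ : ∀ v : 𝕍 N, β * ψ v (fun v ↦ dt (B v) ξ) = 0 + dt (β • ∑ z ∈ VN N, cw N M sigv lamv 0 1 v z • B z) ξ := by
      intro v
      rw [zero_add, dt_smul_left, dt_sum_left]
      congr 1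
      simp only [dt_smul_left]
      exact sum_coe_sort (VN N) (fun z ↦ cw N M sigv lamv 0 1 v z * dt (B z) ξ)
    simp only [gW, gw, gz, hψ]

end P12

section P13
open MeasureTheory ProbabilityTheory

noncomputable def tv {V C : Type} (K : ℕ) (π : ℕ → V → C) (s : ℕ → ℝ) (v : V) : Fin K × C → ℝ :=
  fun x ↦ if π x.1 v = x.2 then s x.1 else 0

noncomputable def tz {V C : Type} (K : ℕ) (π : ℕ → V → C) (s : ℕ → ℝ) (i : ℕ) (S : Finset V) (ξ : Fin K × C → ℝ) : ℝ :=
  ∑ v ∈ S, exp (∑ k : Fin K, if i ≤ (k : ℕ) then s k * ξ (k, π k v) else 0)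

variable {V C : Type} [Fintype V] [Fintype C]
set_option linter.unusedSectionVars false

theorem single_vec {ι : Type} [Fintype ι] (i : ι) : ∃ b : ι → ℝ, (∀ ξ, dt b ξ = ξ i) ∧ dt b b = 1 :=
  ⟨Pi.single i 1, fun ξ ↦ dt_single i ξ, by rw [dt_single]; simp⟩

theorem tv_dt (K : ℕ) (π : ℕ → V → C) (s : ℕ → ℝ) (v : V) (ξ : Fin K × C → ℝ) :
    dt (tv K π s v) ξ = ∑ k : Fin K, s k * ξ (k, π k v) := by
  simp only [dt, tv, Fintype.sum_prod_type]
  refine sum_congr rfl fun k _ ↦ ?_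
  simp

theorem tv_tv (K : ℕ) (π : ℕ → V → C) (s : ℕ → ℝ) (v w : V) :
    dt (tv K π s v) (tv K π s w) = ∑ k : Fin K, if π k v = π k w then s k ^ 2 else 0 := by
  rw [tv_dt]
  refine sum_congr rfl fun k _ ↦ ?_
  simp only [tv, eq_comm (a := π k v), sq]
  split_ifs <;> simp

theorem rpow_le_one_add {x t : ℝ} (hx : 0 ≤ x) (h0 : 0 ≤ t) (h1 : t ≤ 1) : x ^ t ≤ 1 + x := by
  rcases le_total x 1 with h | h
  · linarith [Real.rpow_le_one hx h h0]
  · have := Real.rpow_le_rpow_of_exponent_le h h1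
    rw [rpow_one] at this; linarith

theorem int_rpow {ι : Type} [Fintype ι] {f : (ι → ℝ) → ℝ} (hf : Integrable f (gm ι)) (hm : Measurable f) (h0 : ∀ ξ, 0 ≤ f ξ) {t : ℝ} (ht : 0 ≤ t) (h1 : t ≤ 1) :
    Integrable (fun ξ ↦ f ξ ^ t) (gm ι) := by
  refine Integrable.mono' ((integrable_const 1).add hf) (hm.pow_const t).aestronglyMeasurable (ae_of_all _ fun ξ ↦ ?_)
  rw [norm_eq_abs, abs_of_nonneg (rpow_nonneg (h0 ξ) t)]
  exact rpow_le_one_add (h0 ξ) ht h1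

theorem jensen_pow {ι : Type} [Fintype ι] {f : (ι → ℝ) → ℝ} (hf : Integrable f (gm ι)) (hm : Measurable f) (h0 : ∀ ξ, 0 ≤ f ξ) {t m : ℝ} (ht : 0 ≤ t) (h1 : t ≤ 1)
    (hpos : 0 < m) (hle : ∫ ξ, f ξ ∂gm ι ≤ m) : ∫ ξ, f ξ ^ t ∂gm ι ≤ m ^ t := by
  have key : ∀ ξ, f ξ ^ t ≤ m ^ (t - 1) * (t * f ξ + (1 - t) * m) := by
    intro ξ
    have := Real.geom_mean_le_arith_mean2_weighted ht (by linarith : 0 ≤ 1 - t) (h0 ξ) hpos.le (by ring)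
    calc f ξ ^ t = m ^ (t - 1) * (f ξ ^ t * m ^ (1 - t)) := by
          rw [mul_left_comm, ← rpow_add hpos]; simp
      _ ≤ _ := mul_le_mul_of_nonneg_left this (rpow_nonneg hpos.le _)
  calc ∫ ξ, f ξ ^ t ∂gm ι ≤ ∫ ξ, m ^ (t - 1) * (t * f ξ + (1 - t) * m) ∂gm ι :=
        integral_mono (int_rpow hf hm h0 ht h1) (((hf.const_mul _).add (integrable_const _)).const_mul _) key
    _ = m ^ (t - 1) * (t * ∫ ξ, f ξ ∂gm ι + (1 - t) * m) := by
        rw [integral_const_mul, integral_add (hf.const_mul _) (integrable_const _), integral_const_mul]; simp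
    _ ≤ m ^ (t - 1) * (t * m + (1 - t) * m) := by gcongr
    _ = m ^ t := by
        rw [show t * m + (1 - t) * m = m by ring]
        nth_rewrite 2 [← rpow_one m]
        rw [← rpow_add hpos]; simp

theorem sum_rpow_le {α : Type} (S : Finset α) (f : α → ℝ) (hf : ∀ a ∈ S, 0 ≤ f a) {t : ℝ} (ht : 0 < t) (h1 : t ≤ 1) :
    (∑ a ∈ S, f a) ^ t ≤ ∑ a ∈ S, f a ^ t := by
  induction S using Finset.induction_on with
  | empty => simp [zero_rpow ht.ne']
  | insert a S ha ih =>
    rw [sum_insert ha, sum_insert ha]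
    have h2 : 0 ≤ ∑ a ∈ S, f a := sum_nonneg fun b hb ↦ hf b (mem_insert_of_mem hb)
    exact (rpow_add_le_add_rpow (hf a (Finset.mem_insert_self _ _)) h2 ht.le h1).trans
      (add_le_add le_rfl (ih fun b hb ↦ hf b (mem_insert_of_mem hb)))

theorem tz_meas (K : ℕ) (π : ℕ → V → C) (s : ℕ → ℝ) (i : ℕ) (S : Finset V) : Measurable (tz K π s i S) := by
  unfold tz
  refine measurable_sum _ fun v _ ↦ Measurable.exp (measurable_sum _ fun k _ ↦ ?_)
  split_ifs <;> fun_prop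
theorem tz_nonneg (K : ℕ) (π : ℕ → V → C) (s : ℕ → ℝ) (i : ℕ) (S : Finset V) (ξ) : 0 ≤ tz K π s i S ξ :=
  sum_nonneg fun _ _ ↦ (exp_pos _).le
theorem tz_int (K : ℕ) (π : ℕ → V → C) (s : ℕ → ℝ) (i : ℕ) (S : Finset V) : Integrable (tz K π s i S) (gm (Fin K × C)) := by
  unfold tz
  refine integrable_finsetSum _ fun v _ ↦ ?_
  have := exp_dt_integrable (tv K π (fun k ↦ if i ≤ k then s k else 0) v)
  refine this.congr (ae_of_all _ fun ξ ↦ ?_)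
  simp only [tv_dt]
  congr 1
  refine sum_congr rfl fun k _ ↦ ?_
  split_ifs <;> simp

theorem tz_bound (K : ℕ) (π : ℕ → V → C) (s θ n : ℕ → ℝ) (hθ : ∀ k, 0 < θ k ∧ θ k ≤ 1 ∧ θ k ≤ θ (k+1)) (hn : ∀ k, 0 < n k)
    (hcard : ∀ i < K, ∀ u : V, (((univ.filter (fun v ↦ ∀ k < i, π k v = π k u)).image (π i)).card : ℝ) ≤ n i)
    (hinj : ∀ v w, (∀ k < K, π k v = π k w) → v = w) (d : ℕ) : ∀ i, i + d = K → ∀ u : V,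
    ∫ ξ, tz K π s i (univ.filter (fun v ↦ ∀ k < i, π k v = π k u)) ξ ^ θ i ∂(gm (Fin K × C))
      ≤ exp (θ i * ∑ k ∈ Ico i K, (log (n k) / θ k + θ k * s k ^ 2 / 2)) := by
  induction d with
  | zero =>
    intro i hi u
    rw [add_zero] at hi
    subst hi
    have e : univ.filter (fun v ↦ ∀ k < i, π k v = π k u) = {u} := by
      ext v; simp only [mem_filter, mem_univ, true_and, mem_singleton]
      exact ⟨fun h ↦ hinj v u h, fun h ↦ by simp [h]⟩
    have e2 : ∀ k : Fin i, ¬ (i ≤ (k : ℕ)) := fun k ↦ by have := k.2; omega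
    simp [e, tz, e2]
  | succ d ih =>
    intro i hi u
    have hiK : i < K := by omega
    set S := univ.filter (fun v ↦ ∀ k < i, π k v = π k u) with hS
    let Sc : C → Finset V := fun c ↦ S.filter (fun v ↦ π i v = c)
    have dec : ∀ ξ, tz K π s i S ξ = ∑ c ∈ S.image (π i), exp (s i * ξ (⟨i, hiK⟩, c)) * tz K π s (i+1) (Sc c) ξ := by
      intro ξ
      unfold tz
      rw [← Finset.sum_fiberwise_of_maps_to (g := π i) (t := S.image (π i)) (fun v hv ↦ Finset.mem_image_of_mem _ hv)]
      refine sum_congr rfl fun c _ ↦ ?_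
      rw [mul_sum]
      refine sum_congr rfl fun v hv ↦ ?_
      rw [← exp_add]
      congr 1
      have hv2 : π i v = c := (mem_filter.1 hv).2
      have : ∀ k : Fin K, (if i ≤ (k:ℕ) then s k * ξ (k, π k v) else 0) = (if k = ⟨i, hiK⟩ then s i * ξ (⟨i, hiK⟩, c) else 0) + (if i + 1 ≤ (k : ℕ) then s k * ξ (k, π k v) else 0) := by grind
      rw [sum_congr rfl fun k _ ↦ this k, sum_add_distrib]
      simp
    have hθi := hθ i
    have hθi' := hθ (i+1)
    set E := ∑ k ∈ Ico (i+1) K, (log (n k) / θ k + θ k * s k ^ 2 / 2) with hE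
    have hc : ∀ c ∈ S.image (π i), ∫ ξ, tz K π s (i+1) (Sc c) ξ ^ θ i ∂(gm (Fin K × C)) ≤ exp (θ i * E) := by
      intro c hc
      obtain ⟨u', hu', rfl⟩ := mem_image.1 hc
      have e : Sc (π i u') = univ.filter (fun v ↦ ∀ k < i + 1, π k v = π k u') := by grind
      have h1 := ih (i+1) 𝕆 u'
      rw [← e, ← hE] at h1
      have h2 := jensen_pow (t := θ i / θ (i+1)) (int_rpow (tz_int K π s (i+1) (Sc (π i u'))) (tz_meas _ _ _ _ _) (tz_nonneg _ _ _ _ _) hθi'.1.le hθi'.2.1)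
        ((tz_meas _ _ _ _ _).pow_const _) (fun ξ ↦ rpow_nonneg (tz_nonneg _ _ _ _ _ _) _) (div_nonneg hθi.1.le hθi'.1.le) ((div_le_one hθi'.1).2 hθi.2.2) (exp_pos _) h1
      simp only [← Real.rpow_mul (tz_nonneg _ _ _ _ _ _)] at h2
      rw [mul_div_cancel₀ _ hθi'.1.ne', ← exp_mul] at h2
      refine h2.trans (le_of_eq ?_)
      congr 1
      have := hθi'.1.ne'
      field_simp
    have hterm : ∀ c ∈ S.image (π i), ∫ ξ, (exp (s i * ξ (⟨i, hiK⟩, c)) * tz K π s (i+1) (Sc c) ξ) ^ θ i ∂(gm (Fin K × C))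
        ≤ exp (θ i ^ 2 * s i ^ 2 / 2) * exp (θ i * E) := by
      intro c hcc
      obtain ⟨b, hb, hbb⟩ := single_vec ((⟨i, hiK⟩, c) : Fin K × C)
      have e : ∀ ξ, (exp (s i * ξ (⟨i, hiK⟩, c)) * tz K π s (i+1) (Sc c) ξ) ^ θ i = exp (dt ((θ i * s i) • b) ξ) * tz K π s (i+1) (Sc c) ξ ^ θ i := by
        intro ξ
        rw [mul_rpow (exp_pos _).le (tz_nonneg _ _ _ _ _ _), ← exp_mul, dt_smul_left, hb]
        congr 2; ring
      simp_rw [e]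
      rw [indep_int {((⟨i, hiK⟩, c) : Fin K × C)} (fun ξ ↦ exp (dt ((θ i * s i) • b) ξ)) (fun ξ ↦ tz K π s (i+1) (Sc c) ξ ^ θ i)]
      · rw [integral_exp_dt, dt_smul_left, dt_smul_right, hbb]
        rw [show θ i * s i * (θ i * s i * 1) / 2 = θ i ^ 2 * s i ^ 2 / 2 by ring]
        exact mul_le_mul_of_nonneg_left (hc c hcc) (exp_pos _).le
      · intro ξ η h
        have := h (Set.mem_singleton _)
        simp only [dt_smul_left, hb, this]
      · intro ξ η h
        simp only [tz]
        congr 1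
        refine sum_congr rfl fun v _ ↦ ?_
        congr 1
        refine sum_congr rfl fun k _ ↦ ?_
        split_ifs with hk
        · rw [h (show ((k, π k v) : Fin K × C) ∈ ({((⟨i, hiK⟩, c) : Fin K × C)} : Set _)ᶜ from ?_)]
          simp only [Set.mem_compl_iff, Set.mem_singleton_iff, Prod.mk.injEq, not_and]
          intro h; rw [h] at hk; simp at hk
        · rfl
      · exact (dt_meas _).exp
      · exact (tz_meas _ _ _ _ _).pow_const _
    have hint : ∀ c, Integrable (fun ξ ↦ (exp (s i * ξ (⟨i, hiK⟩, c)) * tz K π s (i+1) (Sc c) ξ) ^ θ i) (gm (Fin K × C)) := by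
      intro c
      have hm : Measurable (fun ξ : Fin K × C → ℝ ↦ exp (s i * ξ (⟨i, hiK⟩, c)) * tz K π s (i+1) (Sc c) ξ) :=
        Measurable.mul (by fun_prop) (tz_meas _ _ _ _ _)
      by_cases hcc : c ∈ S.image (π i)
      · refine int_rpow ?_ hm (fun ξ ↦ mul_nonneg (exp_pos _).le (tz_nonneg _ _ _ _ _ _)) hθi.1.le hθi.2.1
        refine (tz_int K π s i S).mono' hm.aestronglyMeasurable (ae_of_all _ fun ξ ↦ ?_)
        rw [norm_eq_abs, abs_of_nonneg (mul_nonneg (exp_pos _).le (tz_nonneg _ _ _ _ _ _)), dec]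
        exact single_le_sum (f := fun c ↦ exp (s i * ξ (⟨i, hiK⟩, c)) * tz K π s (i+1) (Sc c) ξ)
          (fun c _ ↦ mul_nonneg (exp_pos _).le (tz_nonneg _ _ _ _ _ _)) hcc
      · have : Sc c = ∅ := by grind
        simp [this, tz, zero_rpow hθi.1.ne']
    calc ∫ ξ, tz K π s i S ξ ^ θ i ∂(gm (Fin K × C))
        ≤ ∫ ξ, ∑ c ∈ S.image (π i), (exp (s i * ξ (⟨i, hiK⟩, c)) * tz K π s (i+1) (Sc c) ξ) ^ θ i ∂(gm (Fin K × C)) := by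
          refine integral_mono (int_rpow (tz_int _ _ _ _ _) (tz_meas _ _ _ _ _) (tz_nonneg _ _ _ _ _) hθi.1.le hθi.2.1) (integrable_finsetSum _ fun c _ ↦ hint c) fun ξ ↦ ?_
          simp only [dec]
          exact sum_rpow_le _ _ (fun c _ ↦ mul_nonneg (exp_pos _).le (tz_nonneg _ _ _ _ _ _)) hθi.1 hθi.2.1
      _ ≤ ∑ c ∈ S.image (π i), exp (θ i ^ 2 * s i ^ 2 / 2) * exp (θ i * E) := by
          rw [integral_finsetSum _ fun c _ ↦ hint c]; exact sum_le_sum hterm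
      _ ≤ n i * (exp (θ i ^ 2 * s i ^ 2 / 2) * exp (θ i * E)) := by
          rw [sum_const, nsmul_eq_mul]
          exact mul_le_mul_of_nonneg_right (hcard i hiK u) ℙ
      _ = _ := by
          rw [Finset.sum_eq_sum_Ico_succ_bot hiK, ← hE]
          nth_rewrite 1 [← exp_log (hn i)]
          rw [← exp_add, ← exp_add]
          congr 1
          have := hθi.1.ne'
          field_simp
          ring

theorem log_one_add_le {x t : ℝ} (hx : 0 ≤ x) (ht : 0 < t) (h1 : t ≤ 1) : log (1 + x) ≤ x ^ t / t := by
  have h2 : (1 + x) ^ t ≤ 1 + x ^ t := by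
    have := rpow_add_le_add_rpow zero_le_one hx ht.le h1
    simpa using this
  rw [le_div_iff₀ ht, mul_comm, ← log_rpow 𝕃]
  have := log_le_sub_one_of_pos (rpow_pos_of_pos (by linarith : 0 < 1 + x) t)
  linarith

theorem tree_upper {ι : Type} [Fintype ι] [Nonempty V] (K : ℕ) (π : ℕ → V → C) (a θ n : ℕ → ℝ) (ha : ∀ k, 0 ≤ a k) (hθ : ∀ k, 0 < θ k ∧ θ k ≤ 1 ∧ θ k ≤ θ (k+1)) (hn : ∀ k, 0 < n k)
    (hcard : ∀ i < K, ∀ u : V, (((univ.filter (fun v ↦ ∀ k < i, π k v = π k u)).image (π i)).card : ℝ) ≤ n i)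
    (hinj : ∀ v w, (∀ k < K, π k v = π k w) → v = w) (X : V → ι → ℝ) (δ : ℝ)
    (hX1 : ∀ v, dt (X v) (X v) ≤ ∑ k ∈ range K, a k + δ)
    (hX2 : ∀ v w, dt (X v - X w) (X v - X w) ≤ 2 * ∑ k ∈ range K, (if π k v = π k w then 0 else a k) + δ) (lA : ℝ) :
    ∫ ξ, log (1 + ∑ v, exp (-lA + dt (X v) ξ)) ∂gm ι ≤
      (1 / θ 0) * exp (θ 0 * (∑ k ∈ range K, (log (n k) / θ k + θ k * a k / 2) - lA)) + δ / 4 := by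
  let s : ℕ → ℝ := fun k ↦ sqrt (a k)
  have hs : ∀ k, s k ^ 2 = a k := fun k ↦ sq_sqrt (ha k)
  let h : Option V → ℝ := fun o ↦ o.elim 0 (fun _ ↦ -lA)
  let X' : Option V → ι → ℝ := fun o ↦ o.elim 0 X
  let Y' : Option V → (Fin K × C) → ℝ := fun o ↦ o.elim 0 (tv K π s)
  have gX : ∀ ξ, gz h X' ξ = 1 + ∑ v, exp (-lA + dt (X v) ξ) := by
    intro ξ; simp [gz, Fintype.sum_option, h, X', dt_zero_left]
  have gY : ∀ ξ, gz h Y' ξ = 1 + exp (-lA) * tz K π s 0 univ ξ := by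
    intro ξ; simp [gz, Fintype.sum_option, h, Y', dt_zero_left, tz, tv_dt, exp_add, mul_sum]
  have tvv : ∀ v, dt (tv K π s v) (tv K π s v) = ∑ k ∈ range K, a k := by
    intro v; rw [tv_tv]; simp [hs, sum_range]
  have tvw : ∀ v w, dt (tv K π s v - tv K π s w) (tv K π s v - tv K π s w) = 2 * ∑ k ∈ range K, (if π k v = π k w then 0 else a k) := by
    intro v w
    rw [dt_sub_left, dt_sub_right, dt_sub_right, tvv, tvv, dt_comm (tv K π s w), tv_tv]
    have : ∑ k ∈ range K, (if π k v = π k w then 0 else a k) = ∑ k ∈ range K, a k - ∑ k : Fin K, (if π k v = π k w then s k ^ 2 else 0) := by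
      simp only [hs]
      rw [← sum_range (fun k ↦ if π k v = π k w then a k else 0), ← sum_sub_distrib]
      refine sum_congr rfl fun k _ ↦ ?_
      split_ifs <;> simp
    rw [this]; ring
  have key := sf h X' Y' δ (by
    intro v w
    rcases v with _ | v <;> rcases w with _ | w
    · have : 𝟎 ≤ δ := by
        obtain ⟨v⟩ := ‹Nonempty V›
        have := hX2 v v
        simpa [dt_zero_left] using this
      simpa [X', Y', dt_zero_left] using this
    · have e : ∀ {ι : Type} [Fintype ι] (a : ι → ℝ), dt (0 - a) (0 - a) = dt a a := by intro ι _ a; simp [dt]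
      simp only [X', Y', Option.elim, e, tvv]
      linarith [hX1 w]
    · simp only [X', Y', Option.elim, sub_zero, tvv]
      linarith [hX1 v]
    · simp only [X', Y', Option.elim, tvw]
      linarith [hX2 v w])
  simp only [gX] at key
  refine key.trans (add_le_add ?_ le_rfl)
  have e1 : ∀ ξ, (exp (-lA) * tz K π s 0 univ ξ) ^ θ 0 / θ 0 = (1 / θ 0 * exp (- θ 0 * lA)) * tz K π s 0 univ ξ ^ θ 0 := by
    intro ξ
    rw [mul_rpow (exp_pos _).le (tz_nonneg _ _ _ _ _ _), ← exp_mul]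
    rw [show -lA * θ 0 = -θ 0 * lA by ring]; ring
  have hmain := tz_bound K π s θ n hθ hn hcard hinj K 0 𝕆 (Classical.arbitrary V)
  simp only [Nat.not_lt_zero, false_imp_iff, implies_true, Finset.filter_true, hs, Nat.Ico_zero_eq_range] at hmain
  calc ∫ ξ, log (gz h Y' ξ) ∂(gm (Fin K × C)) ≤ ∫ ξ, (1 / θ 0 * exp (- θ 0 * lA)) * tz K π s 0 univ ξ ^ θ 0 ∂(gm (Fin K × C)) := by
        refine integral_mono (lz_int h Y') ((int_rpow (tz_int _ _ _ _ _) (tz_meas _ _ _ _ _) (tz_nonneg _ _ _ _ _) (hθ 0).1.le (hθ 0).2.1).const_mul _) fun ξ ↦ ?_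
        rw [← e1]
        simp only [gY]
        exact log_one_add_le (mul_nonneg (exp_pos _).le (tz_nonneg _ _ _ _ _ _)) (hθ 0).1 (hθ 0).2.1
    _ = (1 / θ 0 * exp (- θ 0 * lA)) * ∫ ξ, tz K π s 0 univ ξ ^ θ 0 ∂(gm (Fin K × C)) := integral_const_mul _ _
    _ ≤ (1 / θ 0 * exp (- θ 0 * lA)) * exp (θ 0 * ∑ k ∈ range K, (log (n k) / θ k + θ k * a k / 2)) :=
        mul_le_mul_of_nonneg_left hmain (mul_nonneg (one_div_nonneg.2 (hθ 0).1.le) (exp_pos _).le)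
    _ = _ := by
        rw [mul_assoc, ← exp_add]; congr 2; ring

end P13

section P14
open MeasureTheory ProbabilityTheory

def FE {ι : Type} [Fintype ι] (N : ℕ) (Q : ℝ → ℝ) (δ : ℝ) (X : 𝕍 N → ι → ℝ) : Prop :=
  (∀ v, |dt (X v) (X v) - log N * (Q 1 - Q (rs N v))| ≤ δ * log N) ∧
  ∀ v w, |dt (X v - X w) (X v - X w) - log N * (2 * Q 1 - Q (max (bs N v w) (rs N v)) - Q (max (bs N v w) (rs N w)))| ≤ δ * log N

theorem rs_mem {N : ℕ} (hN : 2 ≤ N) (v : Vtx) : 0 ≤ rs N v ∧ rs N v ≤ 1 := by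
  have hL : 0 < log N := log_pos (by exact_mod_cast hN)
  have h1 := ld_le (N := N) 𝕆 v
  have h2 := ld_nonneg N v
  unfold rs
  constructor
  · have := (div_le_one hL).2 h1; linarith
  · have := div_nonneg h2 hL.le; linarith

theorem bs_self (N : ℕ) (v : Vtx) : bs N v v = 1 := by
  simp [bs, fl_zero]

theorem bs_comm (N : ℕ) (v w : Vtx) : bs N v w = bs N w v := by
  unfold bs; rw [fl_sub_comm]

theorem fe_of (hsp : ScaleParams M sigv lamv) {α α' : ℝ} (h0 : 0 ≤ α) (h1 : α ≤ α') (h2 : α' ≤ 1) (β u δ : ℝ) (hδ : 0 < δ) :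
    ∃ N0 : ℕ, ∀ N ≥ N0, ∀ Aw : ℝ → ℝ → 𝕍 N → (𝕍 N → ℝ), (∀ p q p' q' v w, dt (Aw p q v) (Aw p' q' w) = cvY N M sigv lamv p q p' q' v w) →
      FE N (fun x ↦ β ^ 2 * Qf M sigv lamv 0 1 x + (2 * β * u + u ^ 2) * Qf M sigv lamv α α' x) δ (fun v ↦ β • Aw 0 1 v + u • Aw α α' v) := by
  set B := (|β| + |u|) ^ 2 with hB
  have hB0 : 0 ≤ B := by positivity
  obtain ⟨N0, hN0⟩ := cvY_est hsp (δ / (4 * (B + 1))) ℙ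
  refine ⟨max N0 2, fun N hN Aw hA ↦ ?_⟩
  have hN2 : 2 ≤ N := (le_max_right _ _).trans hN
  have hL : 0 < log N := log_pos (by exact_mod_cast hN2)
  set L := log N with hLdef
  set η := δ / (4 * (B + 1)) * L with hη
  have hη0 : 0 ≤ η := by positivity
  have est := hN0 N ((le_max_left _ _).trans hN)
  set Q := fun x ↦ β ^ 2 * Qf M sigv lamv 0 1 x + (2 * β * u + u ^ 2) * Qf M sigv lamv α α' x with hQ
  set X := fun v ↦ β • Aw 0 1 v + u • Aw α α' v with hX
  have key : ∀ v w, |dt (X v) (X w) + dt (X w) (X v) - L * ((Q (max (bs N v w) (rs N v)) - Q (rs N v)) + (Q (max (bs N v w) (rs N w)) - Q (rs N w)))| ≤ 2 * B * η := by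
    intro v w
    have e1 := est v v.2 w w.2 0 1 0 1 le_rfl le_rfl zero_le_one le_rfl le_rfl
    have e2 := est v v.2 w w.2 α α' 0 1 le_rfl h0 h1 h2 le_rfl
    have e3 := est v v.2 w w.2 α α' α α' h0 le_rfl h1 le_rfl h2
    have f1 := est w w.2 v v.2 0 1 0 1 le_rfl le_rfl zero_le_one le_rfl le_rfl
    have f2 := est w w.2 v v.2 α α' 0 1 le_rfl h0 h1 h2 le_rfl
    have f3 := est w w.2 v v.2 α α' α α' h0 le_rfl h1 le_rfl h2
    rw [bs_comm N w v] at f1 f2 f3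
    rw [← hA] at e1 e2 e3 f1 f2 f3
    have c := dt_comm (Aw 0 1 v) (Aw α α' w)
    have c' := dt_comm (Aw 0 1 w) (Aw α α' v)
    simp only [hX, hQ, dt_add_left, dt_add_right, dt_smul_left, dt_smul_right]
    rw [c, c']
    have m2 : ∀ {x y : ℝ}, |x| ≤ y → ∀ c : ℝ, |c * x| ≤ |c| * y := fun h c ↦ by
      rw [abs_mul]; exact mul_le_mul_of_nonneg_left h (abs_nonneg c)
    have E1 := m2 e1 (β ^ 2)
    have E2 := m2 e2 (2 * β * u)
    have E3 := m2 e3 (u ^ 2)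
    have F1 := m2 f1 (β ^ 2)
    have F2 := m2 f2 (2 * β * u)
    have F3 := m2 f3 (u ^ 2)
    have a1 : |β ^ 2| + |2 * β * u| + |u ^ 2| = B := by
      rw [hB, abs_mul, abs_mul, abs_pow, abs_pow, abs_two]; ring
    have a2 : 2 * B * η = 2 * (|β ^ 2| * η + |2 * β * u| * η + |u ^ 2| * η) := by rw [← a1]; ring
    rw [a2]
    rw [abs_le] at *
    constructor <;> linarith [E1.1, E1.2, E2.1, E2.2, E3.1, E3.2, F1.1, F1.2, F2.1, F2.2, F3.1, F3.2]
  have hb : 4 * B * η ≤ δ * L := by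
    have : 4 * B * η = (B / (B + 1)) * (δ * L) := by rw [hη]; field_simp
    rw [this]
    exact mul_le_of_le_one_left ℙ ((div_le_one ℙ).2 𝕃)
  have hBη : 0 ≤ B * η := by positivity
  have k1 : ∀ v, |dt (X v) (X v) - L * (Q 1 - Q (rs N v))| ≤ B * η := by
    intro v
    have := key v v
    rw [bs_self, max_eq_left (rs_mem hN2 v).2] at this
    rw [abs_le] at *
    constructor <;> linarith [this.1, this.2]
  refine ⟨fun v ↦ (k1 v).trans 𝕃, fun v w ↦ ?_⟩
  have K1 := k1 v
  have K2 := k1 w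
  have K3 := key v w
  rw [dt_sub_left, dt_sub_right, dt_sub_right]
  refine le_trans ?_ hb
  rw [abs_le] at *
  constructor <;> linarith [K1.1, K1.2, K2.1, K2.2, K3.1, K3.2]

theorem qmono (hsp : ScaleParams M sigv lamv) {α α' : ℝ} (h1 : α ≤ α') (h0 : 0 ≤ α) (h2 : α' ≤ 1) (β u : ℝ) :
    ∃ Λ, 0 ≤ Λ ∧ ∀ x y : ℝ, x ≤ y →
      0 ≤ (β ^ 2 * Qf M sigv lamv 0 1 y + (2 * β * u + u ^ 2) * Qf M sigv lamv α α' y) - (β ^ 2 * Qf M sigv lamv 0 1 x + (2 * β * u + u ^ 2) * Qf M sigv lamv α α' x) ∧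
      (β ^ 2 * Qf M sigv lamv 0 1 y + (2 * β * u + u ^ 2) * Qf M sigv lamv α α' y) - (β ^ 2 * Qf M sigv lamv 0 1 x + (2 * β * u + u ^ 2) * Qf M sigv lamv α α' x) ≤ Λ * (y - x) := by
  set S := ∑ i ∈ Icc 1 M, sigv i ^ 2
  have hS : 0 ≤ S := sum_nonneg fun i _ ↦ sq_nonneg _
  refine ⟨(β ^ 2 + |2 * β * u + u ^ 2|) * S, by positivity, fun x y hxy ↦ ?_⟩
  have A := Qf_lip hsp 0 1 hxy
  have B := Qf_lip hsp α α' hxy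
  have D : Qf M sigv lamv α α' y - Qf M sigv lamv α α' x ≤ Qf M sigv lamv 0 1 y - Qf M sigv lamv 0 1 x := by
    rw [Qf_clamp h1 hsp y, Qf_clamp h1 hsp x, Qf_clamp zero_le_one hsp y, Qf_clamp zero_le_one hsp x]
    have m : cl α α' x ≤ cl α α' y := cl_mono hxy
    rcases m.eq_or_lt with h | h
    · rw [h]; have := (Qf_lip hsp 0 1 (cl_mono hxy : cl 0 1 x ≤ cl 0 1 y)).1; linarith
    · have i1 : cl 0 1 x ≤ cl α α' x := by unfold cl at *; grind
      have i2 : cl α α' y ≤ cl 0 1 y := by unfold cl at *; grind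
      have := (Qf_lip hsp 0 1 i1).1
      have := (Qf_lip hsp 0 1 i2).1
      linarith
  set a := Qf M sigv lamv 0 1 y - Qf M sigv lamv 0 1 x with ha
  set b := Qf M sigv lamv α α' y - Qf M sigv lamv α α' x with hb
  have e : (β ^ 2 * Qf M sigv lamv 0 1 y + (2 * β * u + u ^ 2) * Qf M sigv lamv α α' y) - (β ^ 2 * Qf M sigv lamv 0 1 x + (2 * β * u + u ^ 2) * Qf M sigv lamv α α' x) = β ^ 2 * a + (2 * β * u + u ^ 2) * b := by
    rw [ha, hb]; ring
  rw [e]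
  constructor
  · nlinarith [mul_nonneg (sq_nonneg (β + u)) B.1, mul_nonneg (sq_nonneg β) (sub_nonneg.2 D)]
  · have := mul_le_mul_of_nonneg_left A.2 (sq_nonneg β)
    have := mul_le_mul (le_abs_self (2 * β * u + u ^ 2)) B.2 B.1 (abs_nonneg _)
    nlinarith

def cel (l : ℤ) (v : Vtx) : Vtx := (v.1 / l, v.2 / l)

theorem cel_mem {N : ℕ} {l : ℤ} (hl : 1 ≤ l) {v : Vtx} (hv : v ∈ VN N) : cel l v ∈ VN N := by
  rw [mem_VN] at *
  have h := fun x : ℤ ↦ fun hx : 0 ≤ x ↦ (⟨Int.ediv_nonneg hx 𝕆, Int.ediv_le_self l hx⟩ : 0 ≤ x / l ∧ x / l ≤ x)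
  simp only [cel]
  have := h _ hv.1.1
  have := h _ hv.2.1
  omega

theorem icc_count {l A : ℤ} {H : ℝ} (hl : 1 ≤ l) (hH : 0 ≤ H) : ((Icc (A / l) ((A + ⌊H⌋) / l)).card : ℝ) ≤ H / l + 2 := by
  have hl0 : 𝟎 < l := by positivity
  rw [Int.card_Icc]
  have hf : 0 ≤ ⌊H⌋ := Int.floor_nonneg.2 hH
  have h1 : A / l ≤ (A + ⌊H⌋) / l := Int.ediv_le_ediv 𝕆 𝕆
  have h2 : (((((A + ⌊H⌋) / l + 1 - A / l).toNat : ℤ)) : ℝ) = (((A + ⌊H⌋) / l : ℤ) : ℝ) + 1 - ((A / l : ℤ) : ℝ) := by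
    rw [Int.toNat_of_nonneg 𝕆]; push_cast; ring
  rw [← Int.cast_natCast, h2]
  have h3 : (((A + ⌊H⌋) / l : ℤ) : ℝ) * l ≤ A + H := by
    have : ((A + ⌊H⌋) / l) * l ≤ A + ⌊H⌋ := Int.ediv_mul_le _ 𝕆
    have : (((A + ⌊H⌋) / l : ℤ) : ℝ) * l ≤ A + (⌊H⌋ : ℝ) := by exact_mod_cast this
    linarith [Int.floor_le H]
  have h4 : (A : ℝ) < (((A / l : ℤ) : ℝ) + 1) * l := by
    have := Int.lt_ediv_add_one_mul_self A (by omega : 0 < l)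
    exact_mod_cast this
  have : ((((A + ⌊H⌋) / l : ℤ) : ℝ) - ((A / l : ℤ) : ℝ) - 1) * l ≤ H := by nlinarith
  rw [← le_div_iff₀ hl0] at this
  linarith

theorem cell_count {W : Type} (S : Finset W) (f : W → Vtx) {l A B : ℤ} {H H' : ℝ} (hl : 1 ≤ l) (hH : 0 ≤ H) (hH' : 0 ≤ H')
    (h : ∀ v ∈ S, A ≤ (f v).1 ∧ ((f v).1 : ℝ) ≤ A + H ∧ B ≤ (f v).2 ∧ ((f v).2 : ℝ) ≤ B + H') :
    ((S.image (fun v ↦ cel l (f v))).card : ℝ) ≤ (H / l + 2) * (H' / l + 2) := by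
  have sub : S.image (fun v ↦ cel l (f v)) ⊆ Icc (A / l) ((A + ⌊H⌋) / l) ×ˢ Icc (B / l) ((B + ⌊H'⌋) / l) := by
    intro c hc
    obtain ⟨v, hv, rfl⟩ := mem_image.1 hc
    obtain ⟨a, b, c, d⟩ := h v hv
    have b' : (f v).1 ≤ A + ⌊H⌋ := by
      have := Int.le_floor.2 (by push_cast; linarith : (((f v).1 - A : ℤ) : ℝ) ≤ H); omega
    have d' : (f v).2 ≤ B + ⌊H'⌋ := by
      have := Int.le_floor.2 (by push_cast; linarith : (((f v).2 - B : ℤ) : ℝ) ≤ H'); omega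
    simp only [cel, mem_product, mem_Icc]
    exact ⟨⟨Int.ediv_le_ediv 𝕆 a, Int.ediv_le_ediv 𝕆 b'⟩, Int.ediv_le_ediv 𝕆 c, Int.ediv_le_ediv 𝕆 d'⟩
  have h1 := card_le_card sub
  rw [card_product] at h1
  have h2 : ((S.image (fun v ↦ cel l (f v))).card : ℝ) ≤ (Icc (A / l) ((A + ⌊H⌋) / l)).card * (Icc (B / l) ((B + ⌊H'⌋) / l)).card := by
    exact_mod_cast h1
  exact h2.trans (mul_le_mul (icc_count hl hH) (icc_count hl hH') ℙ (by
        have : 𝟎 < l := by positivity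
        positivity))

noncomputable def ell (N : ℕ) (t : ℝ) : ℤ := ⌈(N : ℝ) ^ (1 - t)⌉

theorem ell_pos {N : ℕ} (hN : 1 ≤ N) (t : ℝ) : 1 ≤ ell N t := by
  have : 𝟎 < (N : ℝ) ^ (1 - t) := rpow_pos_of_pos (by exact_mod_cast hN) _
  have := Int.ceil_pos.2 this
  unfold ell; omega

theorem npow_ge {N : ℕ} (hN : 1 ≤ N) {t : ℝ} (ht : 0 ≤ t) : 𝟏 ≤ (N : ℝ) ^ t :=
  Real.one_le_rpow (by exact_mod_cast hN) ht

theorem cel_diff {l x y : ℤ} (hl : 1 ≤ l) (h : x / l = y / l) : |x - y| ≤ l - 1 := by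
  have h1 := Int.emod_add_mul_ediv x l
  have h2 := Int.emod_add_mul_ediv y l
  have := Int.emod_nonneg x (by omega : l ≠ 0)
  have := Int.emod_nonneg y (by omega : l ≠ 0)
  have := Int.emod_lt_of_pos x (by omega : 0 < l)
  have := Int.emod_lt_of_pos y (by omega : 0 < l)
  rw [h] at h1
  rw [abs_le]
  constructor <;> omega

theorem cel_close {N : ℕ} (hN : 2 ≤ N) {t : ℝ} (ht : t ≤ 1) {v w : Vtx} (h : cel (ell N t) v = cel (ell N t) w) :
    t - log 3 / log N ≤ bs N v w := by
  have hL : 0 < log N := log_pos (by exact_mod_cast hN)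
  have hl := ell_pos (by omega : 1 ≤ N) t
  simp only [cel, Prod.mk.injEq] at h
  have a1 := cel_diff hl h.1
  have a2 := cel_diff hl h.2
  have P1 := npow_ge (by omega : 1 ≤ N) (by linarith : 0 ≤ 1 - t)
  have c : ((ell N t : ℤ) : ℝ) < (N : ℝ) ^ (1 - t) + 1 := Int.ceil_lt_add_one _
  have b1 : |(((v - w).1 : ℤ) : ℝ)| ≤ (N : ℝ) ^ (1 - t) := by
    have : |(((v - w).1 : ℤ) : ℝ)| ≤ ell N t - 1 := by exact_mod_cast a1
    linarith
  have b2 : |(((v - w).2 : ℤ) : ℝ)| ≤ (N : ℝ) ^ (1 - t) := by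
    have : |(((v - w).2 : ℤ) : ℝ)| ≤ ell N t - 1 := by exact_mod_cast a2
    linarith
  have e := (efl_abs1 (v - w)).2.2.2
  have e2 : exp (fl (v - w)) ≤ 3 * (N : ℝ) ^ (1 - t) := by linarith
  have e3 := log_le_log (exp_pos _) e2
  rw [log_exp, log_mul 𝕂 𝕃, log_rpow ℙ] at e3
  unfold bs
  have : fl (v - w) / log N ≤ (log 3 + (1 - t) * log N) / log N := by gcongr
  rw [add_div, mul_div_cancel_right₀ _ hL.ne'] at this
  linarith

theorem bs_ge {N : ℕ} (hN : 2 ≤ N) {v w : Vtx} (hv : v ∈ VN N) (hw : w ∈ VN N) : - (log 3 / log N) ≤ bs N v w := by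
  have hL : 0 < log N := log_pos (by exact_mod_cast hN)
  rw [mem_VN] at hv hw
  have e := (efl_abs1 (v - w)).2.2.2
  have b1 : |(((v - w).1 : ℤ) : ℝ)| ≤ N := by
    have : |(v - w).1| ≤ (N:ℤ) := by simp only [Prod.fst_sub]; rw [abs_le]; omega
    exact_mod_cast this
  have b2 : |(((v - w).2 : ℤ) : ℝ)| ≤ N := by
    have : |(v - w).2| ≤ (N:ℤ) := by simp only [Prod.snd_sub]; rw [abs_le]; omega
    exact_mod_cast this
  have h2 : (2:ℝ) ≤ N := by exact_mod_cast hN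
  have e3 := log_le_log (exp_pos _) (by linarith : exp (fl (v - w)) ≤ 3 * N)
  rw [log_exp, log_mul 𝕂 𝕃] at e3
  unfold bs
  have : fl (v - w) / log N ≤ (log 3 + log N) / log N := by gcongr
  rw [add_div, div_self hL.ne'] at this
  linarith

end P14

section P15
open MeasureTheory ProbabilityTheory

theorem logN_large (C : ℝ) : ∃ N0 : ℕ, ∀ N ≥ N0, 2 ≤ N ∧ C ≤ log N := by
  have := (tendsto_log_atTop.comp tendsto_natCast_atTop_atTop).eventually_ge_atTop C
  obtain ⟨N0, h⟩ := eventually_atTop.1 this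
  exact ⟨max N0 2, fun N hN ↦ ⟨(le_max_right _ _).trans hN, h N ((le_max_left _ _).trans hN)⟩⟩

theorem upper (Q : ℝ → ℝ) (Λ : ℝ) (hΛ : 0 ≤ Λ) (hQ : ∀ x y, x ≤ y → 0 ≤ Q y - Q x ∧ Q y - Q x ≤ Λ * (y - x))
    (K : ℕ) (hK : 1 ≤ K) (t θ c : ℕ → ℝ) (t0 : t 0 = 0) (tK : t K = 1) (tm : ∀ k, t k ≤ t (k+1))
    (hθ : ∀ k, 0 < θ k ∧ θ k ≤ 1 ∧ θ k ≤ θ (k+1)) (hc : ∀ k, 1 ≤ k → c k = 2 * (t (k+1) - t k)) (ε : ℝ) (hε : 0 < ε) :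
    ∃ N0 : ℕ, ∀ N ≥ N0, ∀ (ι : Type) [Fintype ι] (X : 𝕍 N → ι → ℝ), FE N Q ε X →
      ∀ S : Finset 𝕍 N, S.Nonempty → ((S.image (fun v : 𝕍 N ↦ cel (ell N (t 1)) v.1)).card : ℝ) ≤ 100 * (N:ℝ) ^ c 0 → ∀ lA : ℝ,
      ∫ ξ, log (1 + ∑ v ∈ S, exp (-lA + dt (X v) ξ)) ∂gm ι ≤ (1 / θ 0) *
        exp (θ 0 * (((∑ k ∈ range K, (c k / θ k + θ k * (Q (t (k+1)) - Q (t k)) / 2)) + ε) * log N - lA)) + ε * log N := by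
  obtain ⟨N0, hN0⟩ := logN_large (max ((∑ k ∈ range K, log 100 / θ k) / ε) (2 * Λ * log 3 / (ε / 2)))
  refine ⟨N0, fun N hN ι _ X hX S hS hcard lA ↦ ?_⟩
  obtain ⟨hN2, hLL⟩ := hN0 N hN
  have hN1 : 1 ≤ N := by omega
  have hNpos : 𝟎 < N := by exact_mod_cast hN1
  have hL : 0 < log N := log_pos (by exact_mod_cast hN2)
  set L := log N with hLdef
  have tmono : Monotone t := monotone_nat_of_le_succ tm
  have L1 : ∑ k ∈ range K, log 100 / θ k ≤ ε * L := by
    have := (le_max_left _ _).trans hLL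
    rwa [div_le_iff₀ hε, mul_comm] at this
  have L2 : 2 * Λ * log 3 ≤ ε / 2 * L := by
    have := (le_max_right _ _).trans hLL
    rw [div_le_iff₀ 𝕃] at this; linarith
  let π : ℕ → ↥S → 𝕍 N := fun k v ↦ ⟨cel (ell N (t (k+1))) v.1, cel_mem (ell_pos hN1 _) v.1.2⟩
  have πeq : ∀ k (v w : ↥S), π k v = π k w ↔ cel (ell N (t (k+1))) v.1 = cel (ell N (t (k+1))) w.1 := fun k v w ↦ by
    simp only [π, Subtype.mk.injEq]
  have : Nonempty ↥S := hS.to_subtype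
  have T := tree_upper (V := ↥S) (C := 𝕍 N) K π (fun k ↦ (Q (t (k+1)) - Q (t k)) * L) θ (fun k ↦ 100 * (N:ℝ) ^ c k)
    (fun k ↦ mul_nonneg (hQ _ _ (tm k)).1 hL.le) hθ (fun k ↦ by positivity) ?_ ?_ (fun v ↦ X v.1) (2 * ε * L) ?_ ?_ lA
  · have cs : ∀ ξ, ∑ v : ↥S, exp (-lA + dt (X v.1) ξ) = ∑ v ∈ S, exp (-lA + dt (X v) ξ) := fun ξ ↦ sum_coe_sort S (fun v ↦ exp (-lA + dt (X v) ξ))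
    simp only [cs] at T
    refine T.trans ?_
    have th := (hθ 0).1
    have : ∑ k ∈ range K, (log (100 * (N:ℝ) ^ c k) / θ k + θ k * ((Q (t (k + 1)) - Q (t k)) * L) / 2) ≤ ((∑ k ∈ range K, (c k / θ k + θ k * (Q (t (k+1)) - Q (t k)) / 2)) + ε) * L := by
      have e : ∀ k ∈ range K, log (100 * (N:ℝ) ^ c k) / θ k + θ k * ((Q (t (k + 1)) - Q (t k)) * L) / 2 = log 100 / θ k + (c k / θ k + θ k * (Q (t (k+1)) - Q (t k)) / 2) * L := fun k _ ↦ by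
        rw [log_mul 𝕂 ℙ, log_rpow hNpos]; ring
      rw [sum_congr rfl e, sum_add_distrib, ← sum_mul]
      linarith
    have h2 : 2 * ε * L / 4 ≤ ε * L := by nlinarith
    gcongr
  · intro i hi u
    have e : ∀ A : Finset ↥S, (A.image (π i)).card = (A.image (fun v ↦ cel (ell N (t (i+1))) v.1)).card := fun A ↦ by
      rw [← card_image_of_injective (A.image (π i)) Subtype.val_injective, Finset.image_image]; rfl
    suffices H : (((univ.filter fun v : ↥S ↦ ∀ k < i, π k v = π k u).image (π i)).card : ℝ) ≤ 100 * (N:ℝ) ^ c i by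
      convert H
    rw [e]
    rcases Nat.eq_zero_or_pos i with rfl | hi0
    · refine le_trans ?_ hcard
      exact_mod_cast card_le_card (fun x hx ↦ by
        obtain ⟨v, hv, rfl⟩ := mem_image.1 hx
        exact mem_image.2 ⟨v.1, v.2, rfl⟩)
    · obtain ⟨i', rfl⟩ : ∃ i', i = i' + 1 := ⟨i - 1, by omega⟩
      have hl := ell_pos hN1 (t (i'+1))
      have hl2 := ell_pos hN1 (t (i'+1+1))
      have c1 : ((ell N (t (i'+1)) : ℤ) : ℝ) < (N : ℝ) ^ (1 - t (i'+1)) + 1 := Int.ceil_lt_add_one _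
      have c2 : (N : ℝ) ^ (1 - t (i'+1+1)) ≤ ((ell N (t (i'+1+1)) : ℤ) : ℝ) := Int.le_ceil _
      have cc := cell_count (univ.filter fun v : ↥S ↦ ∀ k < i' + 1, π k v = π k u) (fun v ↦ (v.1 : Vtx)) (l := ell N (t (i'+1+1)))
        (A := (u.1.1.1 / ell N (t (i'+1))) * ell N (t (i'+1))) (B := (u.1.1.2 / ell N (t (i'+1))) * ell N (t (i'+1)))
        (H := (N : ℝ) ^ (1 - t (i'+1))) (H' := (N : ℝ) ^ (1 - t (i'+1))) hl2 ℙ ℙ ?_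
      · refine cc.trans ?_
        have d : (N : ℝ) ^ (1 - t (i'+1)) / (ell N (t (i'+1+1)) : ℝ) ≤ (N:ℝ) ^ (t (i'+1+1) - t (i'+1)) := by
          have p2 : 𝟎 < (N : ℝ) ^ (1 - t (i'+1+1)) := by positivity
          calc _ ≤ (N : ℝ) ^ (1 - t (i'+1)) / (N : ℝ) ^ (1 - t (i'+1+1)) := by gcongr
            _ = _ := by rw [← Real.rpow_sub hNpos]; congr 1; ring
        have g := npow_ge hN1 (by linarith [tm (i'+1)] : 0 ≤ t (i'+1+1) - t (i'+1))
        rw [hc _ 𝕆, two_mul, rpow_add hNpos]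
        have d0 : 0 ≤ (N : ℝ) ^ (1 - t (i'+1)) / (ell N (t (i'+1+1)) : ℝ) := div_nonneg ℙ (by exact_mod_cast 𝕆)
        nlinarith
      · intro v hv
        have hv := (mem_filter.1 hv).2 i' 𝕆
        rw [πeq] at hv
        simp only [cel, Prod.mk.injEq] at hv
        rw [← hv.1, ← hv.2]
        have q : ∀ x l : ℤ, 1 ≤ l → (l:ℝ) < (N : ℝ) ^ (1 - t (i'+1)) + 1 → x / l * l ≤ x ∧ (x : ℝ) ≤ ((x / l * l : ℤ) : ℝ) + (N : ℝ) ^ (1 - t (i'+1)) := by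
          intro x l hl hlt
          refine ⟨Int.ediv_mul_le _ 𝕆, ?_⟩
          have : x ≤ x / l * l + (l - 1) := by
            have := Int.lt_ediv_add_one_mul_self x (by omega : 0 < l)
            linarith
          have : (x:ℝ) ≤ ((x / l * l : ℤ) : ℝ) + (l - 1) := by exact_mod_cast this
          linarith
        exact ⟨(q _ _ hl c1).1, (q _ _ hl c1).2, (q _ _ hl c1).1, (q _ _ hl c1).2⟩
  · intro v w h
    have := (πeq _ _ _).1 (h (K-1) 𝕆)
    rw [show K - 1 + 1 = K by omega, tK] at this
    simpa [ell, cel] using this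
  · intro v
    rw [← sum_mul, sum_range_sub (fun k ↦ Q (t k)), tK, t0]
    have := (abs_le.1 (hX.1 v)).2
    have := mul_nonneg hL.le (hQ _ _ (rs_mem hN2 v).1).1
    nlinarith
  · intro v w
    have a1 := (abs_le.1 (hX.2 v w)).2
    set b := bs N v w with hb
    have m1 := mul_nonneg hL.le (hQ _ _ (le_max_left b (rs N v))).1
    have m2 := mul_nonneg hL.le (hQ _ _ (le_max_left b (rs N w))).1
    set b' := b + log 3 / L with hb'
    have b0 : 0 ≤ b' := by have := bs_ge hN2 v.1.2 w.1.2; linarith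
    have per : ∀ k ∈ range K, Q (max (t (k+1)) b') - Q (max (t k) b') ≤ if π k v = π k w then 0 else Q (t (k+1)) - Q (t k) := by
      intro k hk
      split_ifs with h
      · have := cel_close hN2 (by rw [← tK]; exact tmono (mem_range.1 hk)) ((πeq _ _ _).1 h)
        have h1 : t (k+1) ≤ b' := by linarith
        rw [max_eq_right h1, max_eq_right ((tm k).trans h1)]; linarith
      · rcases le_total (t (k+1)) b' with h1 | h1
        · rw [max_eq_right h1, max_eq_right ((tm k).trans h1)]; linarith [(hQ _ _ (tm k)).1]
        · rw [max_eq_left h1]; linarith [(hQ _ _ (le_max_left (t k) b')).1]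
    have su := sum_le_sum per
    rw [sum_range_sub (fun k ↦ Q (max (t k) b')), tK, t0, max_eq_right b0] at su
    have s1 := (hQ _ _ (le_max_left 1 b')).1
    have s2 := (hQ b b' (by linarith [div_nonneg (log_nonneg (by norm_num : 𝟏 ≤ 3)) hL.le])).2
    rw [hb', add_sub_cancel_left, ← hb'] at s2
    have s3 : Λ * (log 3 / L) * L = Λ * log 3 := by field_simp
    have s4 : (∑ k ∈ range K, (if π k v = π k w then 0 else (Q (t (k+1)) - Q (t k)) * L)) = (∑ k ∈ range K, if π k v = π k w then 0 else Q (t (k+1)) - Q (t k)) * L := by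
      rw [sum_mul]; exact sum_congr rfl fun k _ ↦ by split_ifs <;> simp
    suffices H : dt (X v.1 - X w.1) (X v.1 - X w.1) ≤ 2 * (∑ k ∈ range K, (if π k v = π k w then 0 else (Q (t (k+1)) - Q (t k)) * L)) + 2 * ε * L by
      convert H
    rw [s4]
    set Ss := ∑ k ∈ range K, (if π k v = π k w then 0 else Q (t (k+1)) - Q (t k))
    have s5 : (Q 1 - Q b) * L ≤ (Ss + Λ * (log 3 / L)) * L := mul_le_mul_of_nonneg_right 𝕃 hL.le
    nlinarith

end P15

section P16
open MeasureTheory ProbabilityTheory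

theorem log_jensen {α : Type} (S : Finset α) (w A : α → ℝ) (hw : ∀ a ∈ S, 0 ≤ w a) (h1 : ∑ a ∈ S, w a = 1) (hA : ∀ a ∈ S, 0 < A a) :
    ∑ a ∈ S, w a * log (A a) ≤ log (∑ a ∈ S, w a * A a) := by
  have := strictConcaveOn_log_Ioi.concaveOn.le_map_sum (t := S) (w := w) (p := A) hw h1 hA
  simpa using this

theorem gtail {t : ℝ} (ht : 0 ≤ t) : (gaussianReal 0 1).real (Set.Iio t) ≤ exp (- exp (-(t+1)^2/2 - 1)) := by
  have h1 : exp (-(t+1)^2/2 - 1) ≤ (gaussianReal 0 1).real (Set.Ici t) := by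
    have h2 : (gaussianReal 0 1).real (Set.Icc t (t+1)) ≤ (gaussianReal 0 1).real (Set.Ici t) := measureReal_mono Set.Icc_subset_Ici_self
    refine le_trans ?_ h2
    rw [measureReal_def, gaussianReal_apply_eq_integral 0 one_ne_zero, ENNReal.toReal_ofReal (setIntegral_nonneg measurableSet_Icc fun x _ ↦ gaussianPDFReal_nonneg _ _ _)]
    have : ∫ x in Set.Icc t (t+1), exp (-(t+1)^2/2 - 1) ≤ ∫ x in Set.Icc t (t+1), gaussianPDFReal 0 1 x := by
      refine setIntegral_mono_on (by simp) (integrable_gaussianPDFReal 0 1).integrableOn measurableSet_Icc fun x hx ↦ ?_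
      unfold gaussianPDFReal
      rw [exp_sub, div_eq_mul_inv, mul_comm]
      have e : √(2 * 𝝅 * ((1:NNReal):ℝ)) ≤ exp 1 := by
        rw [Real.sqrt_le_left (exp_pos 1).le]
        have := exp_one_gt_d9
        have := Real.pi_lt_d2
        push_cast; nlinarith
      have e0 : 0 < √(2 * 𝝅 * ((1:NNReal):ℝ)) := Real.sqrt_pos.2 (by push_cast; positivity)
      refine mul_le_mul (inv_anti₀ e0 e) (exp_le_exp.2 ?_) (exp_pos _).le (inv_nonneg.2 e0.le)
      push_cast
      have := hx.1; have := hx.2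
      nlinarith
    simpa using this
  have h3 : (gaussianReal 0 1).real (Set.Iio t) = 1 - (gaussianReal 0 1).real (Set.Ici t) := by
    rw [← Set.compl_Ici, probReal_compl_eq_one_sub measurableSet_Ici]
  rw [h3]
  have := add_one_le_exp (- (gaussianReal 0 1).real (Set.Ici t))
  have := exp_le_exp.2 (neg_le_neg h1)
  linarith

theorem max_prob {ι : Type} [Fintype ι] (B : Finset ι) {t : ℝ} (ht : 0 ≤ t) :
    (gm ι).real {ξ | ∀ b ∈ B, ξ b < t} ≤ exp (- (B.card * exp (-(t+1)^2/2 - 1))) := by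
  have e : {ξ : ι → ℝ | ∀ b ∈ B, ξ b < t} = Set.univ.pi (fun i ↦ if i ∈ B then Set.Iio t else Set.univ) := by grind
  rw [e, measureReal_def, gm, Measure.pi_pi, ENNReal.toReal_prod]
  have : ∀ i ∈ (univ : Finset ι), ((gaussianReal 0 1) (if i ∈ B then Set.Iio t else Set.univ)).toReal = if i ∈ B then (gaussianReal 0 1).real (Set.Iio t) else 1 := by
    intro i _; split_ifs <;> simp [measureReal_def]
  rw [prod_congr rfl this, Finset.prod_ite_mem, Finset.univ_inter, Finset.prod_const, ← mul_neg, exp_nat_mul]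
  exact pow_le_pow_left₀ measureReal_nonneg (gtail ht) _

theorem xi_int {ι : Type} [Fintype ι] (i : ι) : Integrable (fun ξ : ι → ℝ ↦ ξ i) (gm ι) ∧ ∫ ξ : ι → ℝ, |ξ i| ∂gm ι ≤ 1 := by
  obtain ⟨b, hb, hbb⟩ := single_vec i
  have h1 := dt_integrable b
  have h2 := dt_mul_integrable b b
  have h3 := integral_dt_mul b b
  rw [hbb] at h3
  simp only [hb, show (dt b) = (fun ξ ↦ ξ i) from funext hb] at h1 h2 h3
  refine ⟨h1, ?_⟩
  calc ∫ ξ : ι → ℝ, |ξ i| ∂gm ι ≤ ∫ ξ : ι → ℝ, (1/2 + (1/2) * (ξ i * ξ i)) ∂gm ι :=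
        integral_mono h1.abs ((integrable_const _).add (h2.const_mul _)) fun ξ ↦ by
          have := abs_mul_abs_self (ξ i); dsimp only; nlinarith [sq_nonneg (|ξ i| - 1)]
    _ = 1 := by rw [integral_add (integrable_const _) (h2.const_mul _), integral_const_mul, h3]; simp; norm_num

theorem lsum_int {ι D : Type} [Fintype ι] [Fintype D] [Nonempty D] (f : D → ι) (s : ℝ) : Integrable (fun ξ : ι → ℝ ↦ log (∑ c, exp (s * ξ (f c)))) (gm ι) := by
  choose b hb _ using (single_vec (ι := ι))
  have := lz_int (fun _ : D ↦ 𝟎) (fun c ↦ s • b (f c))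
  simpa only [gz, dt_smul_left, hb, zero_add] using this

theorem rem {ι D : Type} [Fintype ι] [Fintype D] [Nonempty D] (f : D → ι) (hf : Function.Injective f) {s t : ℝ} (hs : 0 ≤ s) (ht : 0 ≤ t) {n1 n2 : ℕ}
    (h1 : 1 ≤ n1) (h2 : 1 ≤ n2) (h12 : n1 * n2 ≤ Fintype.card D) :
    log n1 + s * (t * (1 - exp (-(n2 * exp (-(t+1)^2/2 - 1)))) - 1) ≤ ∫ ξ, log (∑ c, exp (s * ξ (f c))) ∂gm ι := by
  have n1p : 𝟎 < n1 := by exact_mod_cast h1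
  obtain ⟨e⟩ : Nonempty (Fin n1 × Fin n2 ↪ D) := Function.Embedding.nonempty_of_card_le (by simpa using h12)
  let g : Fin n1 → Fin n2 → ι := fun a b ↦ f (e (a, b))
  have gi : ∀ a, Function.Injective (g a) := fun a b b' h ↦ by
    have := e.injective (hf h); simpa using this
  let b0 : Fin n2 := ⟨0, h2⟩
  let E : Fin n1 → Set (ι → ℝ) := fun a ↦ {ξ | ∀ b ∈ univ.image (g a), ξ b < t}
  have Em : ∀ a, MeasurableSet (E a) := fun a ↦ by
    have : E a = ⋂ b ∈ univ.image (g a), {ξ : ι → ℝ | ξ b < t} := by ext; simp [E]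
    rw [this]
    exact Finset.measurableSet_biInter _ fun b _ ↦ measurableSet_lt (measurable_pi_apply b) measurable_const
  let m : Fin n1 → (ι → ℝ) → ℝ := fun a ξ ↦ t * (1 - (E a).indicator 1 ξ) - |ξ (g a b0)|
  have mint : ∀ a, Integrable (m a) (gm ι) := fun a ↦
    (((integrable_const _).sub ((integrable_const 𝟏).indicator (Em a))).const_mul t).sub (xi_int _).1.abs
  have mE : ∀ a, t * (1 - exp (-(n2 * exp (-(t+1)^2/2 - 1)))) - 1 ≤ ∫ ξ, m a ξ ∂gm ι := by
    intro a
    have i1 : Integrable ((E a).indicator (1 : (ι → ℝ) → ℝ)) (gm ι) := (integrable_const 𝟏).indicator (Em a)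
    have : ∫ ξ, m a ξ ∂gm ι = t * (1 - (gm ι).real (E a)) - ∫ ξ : ι → ℝ, |ξ (g a b0)| ∂gm ι := by
      have i2 : Integrable (fun ξ ↦ 1 - (E a).indicator (1 : (ι → ℝ) → ℝ) ξ) (gm ι) := (integrable_const _).sub i1
      have i3 : Integrable (fun ξ ↦ t * (1 - (E a).indicator (1 : (ι → ℝ) → ℝ) ξ)) (gm ι) := i2.const_mul t
      simp only [m]
      rw [integral_sub i3 (xi_int _).1.abs, integral_const_mul, integral_sub (integrable_const _) i1, integral_indicator_one (Em a)]
      simp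
    rw [this]
    have p := max_prob (univ.image (g a)) ht
    rw [card_image_of_injective _ (gi a), card_univ, Fintype.card_fin] at p
    have := (xi_int (g a b0)).2
    have : t * (gm ι).real (E a) ≤ t * exp (-(n2 * exp (-(t+1)^2/2 - 1))) := mul_le_mul_of_nonneg_left p ht
    linarith
  have pt : ∀ ξ : ι → ℝ, log n1 + ∑ a, (n1:ℝ)⁻¹ * (s * m a ξ) ≤ log (∑ c, exp (s * ξ (f c))) := by
    intro ξ
    have a1 : ∑ a, exp (s * m a ξ) ≤ ∑ c, exp (s * ξ (f c)) := by
      have sub : ∑ x : Fin n1 × Fin n2, exp (s * ξ (f (e x))) ≤ ∑ c, exp (s * ξ (f c)) := by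
        rw [← sum_map univ e (fun c ↦ exp (s * ξ (f c)))]
        exact sum_le_sum_of_subset_of_nonneg (subset_univ _) fun _ _ _ ↦ (exp_pos _).le
      refine le_trans ?_ sub
      rw [Fintype.sum_prod_type]
      refine sum_le_sum fun a _ ↦ ?_
      have : ∃ b, m a ξ ≤ ξ (g a b) := by
        by_cases h : ξ ∈ E a
        · exact ⟨b0, by simp only [m, Set.indicator_of_mem h]; simp; exact neg_abs_le _⟩
        · have h' := h
          simp only [E, Set.mem_setOf_eq, not_forall, not_lt] at h'
          obtain ⟨b, hb, hbt⟩ := h'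
          obtain ⟨b, _, rfl⟩ := mem_image.1 hb
          exact ⟨b, by simp only [m, Set.indicator_of_notMem h]; linarith [abs_nonneg (ξ (g a b0))]⟩
      obtain ⟨b, hb⟩ := this
      exact (exp_le_exp.2 (mul_le_mul_of_nonneg_left hb hs)).trans
        (single_le_sum (f := fun b ↦ exp (s * ξ (f (e (a, b))))) (fun _ _ ↦ (exp_pos _).le) (mem_univ b))
    have : Nonempty (Fin n1) := ⟨⟨0, h1⟩⟩
    have a0 : 0 < ∑ a, exp (s * m a ξ) := sum_pos (fun _ _ ↦ exp_pos _) univ_nonempty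
    refine le_trans ?_ (log_le_log a0 a1)
    have J := log_jensen univ (fun _ : Fin n1 ↦ (n1:ℝ)⁻¹) (fun a ↦ exp (s * m a ξ)) (fun _ _ ↦ by positivity) (by simp [n1p.ne']) (fun _ _ ↦ exp_pos _)
    simp only [log_exp] at J
    rw [← mul_sum _ (fun a ↦ exp (s * m a ξ)), log_mul (inv_pos.2 n1p).ne' a0.ne', log_inv] at J
    linarith
  have I : Integrable (fun ξ ↦ ∑ a, (n1:ℝ)⁻¹ * (s * m a ξ)) (gm ι) := integrable_finsetSum _ fun a _ ↦ ((mint a).const_mul _).const_mul _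
  refine le_trans ?_ (integral_mono ((integrable_const _).add I) (lsum_int f s) pt)
  have e2 : ∫ ξ, (log n1 + ∑ a, (n1:ℝ)⁻¹ * (s * m a ξ)) ∂gm ι = log n1 + ∑ a, (n1:ℝ)⁻¹ * (s * ∫ ξ, m a ξ ∂gm ι) := by
    rw [integral_add (integrable_const _) I, integral_finsetSum _ fun a _ ↦ ((mint a).const_mul _).const_mul _]
    simp only [integral_const_mul]; simp
  refine le_of_le_of_eq ?_ e2.symm
  have : ∑ a : Fin n1, (n1:ℝ)⁻¹ * (s * (t * (1 - exp (-(n2 * exp (-(t+1)^2/2 - 1)))) - 1)) ≤ ∑ a, (n1:ℝ)⁻¹ * (s * ∫ ξ, m a ξ ∂gm ι) :=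
    sum_le_sum fun a _ ↦ by gcongr; exact mE a
  rw [sum_const, card_univ, Fintype.card_fin, nsmul_eq_mul, ← mul_assoc, mul_inv_cancel₀ n1p.ne', one_mul] at this
  linarith

end P16

section P17
open MeasureTheory ProbabilityTheory

def tpi {K : ℕ} {D : Type} (d0 : D) (k : ℕ) (v : Fin K → D) : Fin K → D := fun i ↦ if (i:ℕ) ≤ k then v i else d0

theorem upd_sum {K : ℕ} {D : Type} [Fintype D] (i : Fin K) (F : (Fin K → D) → ℝ) :
    ∑ v, ∑ c, F (Function.update v i c) = Fintype.card D * ∑ v, F v := by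
  let e : ((Fin K → D) × D) ≃ ((Fin K → D) × D) := Function.Involutive.toPerm (fun p ↦ (Function.update p.1 i p.2, p.1 i)) (fun p ↦ by simp)
  rw [← Fintype.sum_prod_type (f := fun p : (Fin K → D) × D ↦ F (Function.update p.1 i p.2))]
  rw [show ∑ p : (Fin K → D) × D, F (Function.update p.1 i p.2) = ∑ p, F (e p).1 from rfl, Equiv.sum_comp e (fun p ↦ F p.1), Fintype.sum_prod_type]
  simp [mul_sum]

theorem tree_lower {K : ℕ} {D : Type} [Fintype D] [Nonempty D] (d0 : D) (s R : ℕ → ℝ)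
    (hR : ∀ k < K, ∀ f : D → Fin K × (Fin K → D), Function.Injective f → R k ≤ ∫ ξ, log (∑ c, exp (s k * ξ (f c))) ∂(gm (Fin K × (Fin K → D)))) :
    ∑ k ∈ range K, R k ≤ ∫ ξ, log (gz 𝟘 (tv K (tpi d0) s) ξ) ∂(gm (Fin K × (Fin K → D))) := by
  set μ := gm (Fin K × (Fin K → D))
  let ss : ℕ → ℕ → ℝ := fun i k ↦ if k < i then s k else 0
  let Z : ℕ → (Fin K × (Fin K → D) → ℝ) → ℝ := fun i ↦ gz 𝟘 (tv K (tpi d0) (ss i))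
  have cp : 𝟎 < Fintype.card D := by exact_mod_cast Fintype.card_pos
  have key : ∀ i, i ≤ K → ∑ k ∈ range i, R k + ((K:ℝ) - i) * log (Fintype.card D) ≤ ∫ ξ, log (Z i ξ) ∂μ := by
    intro i
    induction i with
    | zero =>
      intro _
      have : ∀ ξ, Z 0 ξ = (Fintype.card D : ℝ) ^ K := fun ξ ↦ by simp [Z, gz, tv_dt, ss]
      simp [this, log_pow]
    | succ i ih =>
      intro hi
      have IH := ih 𝕆
      let i' : Fin K := ⟨i, hi⟩
      let w : (Fin K → D) → (Fin K × (Fin K → D) → ℝ) → ℝ := fun v ξ ↦ gw 𝟘 (tv K (tpi d0) (ss i)) v ξ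
      let f : (Fin K → D) → D → Fin K × (Fin K → D) := fun v c ↦ (i', tpi d0 i (Function.update v i' c))
      have fi : ∀ v, Function.Injective (f v) := fun v c c' h ↦ by
        have := congrFun (Prod.ext_iff.1 h).2 i'
        simpa [f, tpi, i'] using this
      let S : (Fin K → D) → (Fin K × (Fin K → D) → ℝ) → ℝ := fun v ξ ↦ ∑ c, exp (s i * ξ (f v c))
      have Sp : ∀ v ξ, 0 < S v ξ := fun v ξ ↦ sum_pos (fun _ _ ↦ exp_pos _) univ_nonempty
      have dts : ∀ (v : Fin K → D) ξ, dt (tv K (tpi d0) (ss (i+1)) v) ξ = dt (tv K (tpi d0) (ss i) v) ξ + s i * ξ (i', tpi d0 i v) := by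
        intro v ξ
        rw [tv_dt, tv_dt, ← add_sum_erase _ _ (mem_univ i'), ← add_sum_erase (univ) (fun k : Fin K ↦ ss i k * _) (mem_univ i')]
        have : ∑ x ∈ univ.erase i', ss (i+1) x * ξ (x, tpi d0 x v) = ∑ x ∈ univ.erase i', ss i x * ξ (x, tpi d0 x v) := by
          refine sum_congr rfl fun x hx ↦ ?_
          have : (x:ℕ) ≠ i := fun h ↦ (mem_erase.1 hx).1 (Fin.ext h)
          simp only [ss]
          congr 2
          exact propext ⟨fun h ↦ by omega, fun h ↦ by omega⟩
        rw [this]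
        simp [ss, i']; ring
      have wu : ∀ v c ξ, w (Function.update v i' c) ξ = w v ξ := by
        intro v c ξ
        simp only [w, gw, tv_dt]
        congr 2
        refine congrArg _ (sum_congr rfl fun x _ ↦ ?_)
        simp only [ss]
        split_ifs with h
        · have : tpi d0 x (Function.update v i' c) = tpi d0 x v := by
            funext y; simp only [tpi]; split_ifs with hy
            · grind
            · rfl
          rw [this]
        · simp
      have zs : ∀ ξ, Z (i+1) ξ = Z i ξ * ∑ v, w v ξ * ((Fintype.card D : ℝ)⁻¹ * S v ξ) := by
        intro ξ
        have e1 : Z (i+1) ξ = Z i ξ * ∑ v, w v ξ * exp (s i * ξ (i', tpi d0 i v)) := by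
          have := (gz_pos 𝟘 (tv K (tpi d0) (ss i)) ξ).ne'
          simp only [Z, w, gw]
          rw [mul_sum, gz]
          refine sum_congr rfl fun v _ ↦ ?_
          rw [dts, ← add_assoc, exp_add]; field_simp
        rw [e1]; congr 1
        have := upd_sum i' (fun v ↦ w v ξ * exp (s i * ξ (i', tpi d0 i v)))
        simp only [wu, ← mul_sum] at this
        have e3 : ∑ v, w v ξ * ((Fintype.card D : ℝ)⁻¹ * S v ξ) = (Fintype.card D : ℝ)⁻¹ * ∑ v, w v ξ * S v ξ := by
          rw [mul_sum]; exact sum_congr rfl fun _ _ ↦ by ring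
        rw [e3]
        simp only [S, f]
        rw [this, ← mul_assoc, inv_mul_cancel₀ cp.ne', one_mul]
      have ws : ∀ ξ, ∑ v, w v ξ = 1 := fun ξ ↦ gw_sum _ _ ξ
      have pt : ∀ ξ, log (Z i ξ) + (-log (Fintype.card D) + ∑ v, w v ξ * log (S v ξ)) ≤ log (Z (i+1) ξ) := by
        intro ξ
        have ap : ∀ v, 0 < (Fintype.card D : ℝ)⁻¹ * S v ξ := fun v ↦ mul_pos (inv_pos.2 cp) (Sp v ξ)
        have J := log_jensen univ (fun v ↦ w v ξ) (fun v ↦ (Fintype.card D : ℝ)⁻¹ * S v ξ) (fun v _ ↦ gw_nonneg _ _ v ξ) (ws ξ) (fun v _ ↦ ap v)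
        have pp : 0 < ∑ v, w v ξ * ((Fintype.card D : ℝ)⁻¹ * S v ξ) := by
          have h1 := gz_pos 𝟘 (tv K (tpi d0) (ss (i+1))) ξ
          have h2 := gz_pos 𝟘 (tv K (tpi d0) (ss i)) ξ
          have := zs ξ
          change 0 < Z (i+1) ξ at h1
          rw [this] at h1
          exact pos_of_mul_pos_right h1 h2.le
        rw [zs ξ, log_mul (gz_pos _ _ ξ).ne' pp.ne']
        have : ∑ v, w v ξ * log ((Fintype.card D : ℝ)⁻¹ * S v ξ) = -log (Fintype.card D) + ∑ v, w v ξ * log (S v ξ) := by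
          have : ∀ v, w v ξ * log ((Fintype.card D : ℝ)⁻¹ * S v ξ) = w v ξ * (-log (Fintype.card D)) + w v ξ * log (S v ξ) := fun v ↦ by
            rw [log_mul (inv_pos.2 cp).ne' (Sp v ξ).ne', log_inv]; ring
          rw [sum_congr rfl fun v _ ↦ this v, sum_add_distrib, ← sum_mul, ws, one_mul]
        linarith
      have wI : ∀ v, Integrable (w v) μ := fun v ↦
        Integrable.of_bound (gw_meas _ _ v).aestronglyMeasurable 1 (ae_of_all _ fun ξ ↦ by
          rw [norm_eq_abs, abs_of_nonneg (gw_nonneg _ _ v ξ)]; exact gw_le_one _ _ v ξ)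
      have wS : ∀ v, Integrable (fun ξ ↦ w v ξ * log (S v ξ)) μ := fun v ↦
        (lsum_int (f v) (s i)).bdd_mul (c := 1) (gw_meas _ _ v).aestronglyMeasurable (ae_of_all _ fun ξ ↦ by
          rw [norm_eq_abs, abs_of_nonneg (gw_nonneg _ _ v ξ)]; exact gw_le_one _ _ v ξ)
      have ind : ∀ v, ∫ ξ, w v ξ * log (S v ξ) ∂μ = (∫ ξ, w v ξ ∂μ) * ∫ ξ, log (S v ξ) ∂μ := by
        intro v
        refine indep_int {x | x.1 ≠ i'} _ _ ?_ ?_ (gw_meas _ _ v) (Measurable.log (Finset.measurable_fun_sum _ fun c _ ↦ ((measurable_pi_apply _).const_mul _).exp))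
        · intro ξ η h
          have : ∀ v : Fin K → D, dt (tv K (tpi d0) (ss i) v) ξ = dt (tv K (tpi d0) (ss i) v) η := by
            intro v
            rw [tv_dt, tv_dt]
            refine sum_congr rfl fun x _ ↦ ?_
            by_cases hx : x = i'
            · grind
            · rw [h (show (x, tpi d0 x v) ∈ {x : Fin K × (Fin K → D) | x.1 ≠ i'} from hx)]
          simp only [w, gw, gz, this]
        · intro ξ η h
          simp only [S]
          congr 1
          refine sum_congr rfl fun c _ ↦ ?_
          rw [h (show f v c ∈ {x : Fin K × (Fin K → D) | x.1 ≠ i'}ᶜ by simp [f])]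
      have I0 : Integrable (fun ξ ↦ log (Z i ξ)) μ := lz_int _ _
      have I1 : Integrable (fun ξ ↦ ∑ v, w v ξ * log (S v ξ)) μ := integrable_finsetSum univ fun v _ ↦ wS v
      have I2 : Integrable (fun ξ ↦ -log (Fintype.card D) + ∑ v, w v ξ * log (S v ξ)) μ := (integrable_const _).add I1
      have fin := integral_mono (I0.add I2) (lz_int 𝟘 (tv K (tpi d0) (ss (i+1)))) pt
      have e : ∫ ξ, (log (Z i ξ) + (-log (Fintype.card D) + ∑ v, w v ξ * log (S v ξ))) ∂μ = ∫ ξ, log (Z i ξ) ∂μ + (-log (Fintype.card D) + ∑ v, (∫ ξ, w v ξ ∂μ) * ∫ ξ, log (S v ξ) ∂μ) := by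
        have ip : IsProbabilityMeasure μ := by simp only [μ]; infer_instance
        rw [integral_add I0 I2, integral_add (integrable_const _) I1, integral_finsetSum _ fun v _ ↦ wS v]
        simp [ind]
      have s1 : ∑ v, (∫ ξ, w v ξ ∂μ) = 1 := by
        rw [← integral_finsetSum _ fun v _ ↦ wI v]; simp [ws]
      have s2 : R i ≤ ∑ v, (∫ ξ, w v ξ ∂μ) * ∫ ξ, log (S v ξ) ∂μ := by
        calc R i = ∑ v, (∫ ξ, w v ξ ∂μ) * R i := by rw [← sum_mul, s1, one_mul]
          _ ≤ _ := sum_le_sum fun v _ ↦ mul_le_mul_of_nonneg_left (hR i hi (f v) (fi v)) (integral_nonneg fun ξ ↦ gw_nonneg _ _ v ξ)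
      rw [Finset.sum_range_succ]
      push_cast
      have : ∫ ξ, log (Z i ξ) ∂μ + (-log (Fintype.card D) + ∑ v, (∫ ξ, w v ξ ∂μ) * ∫ ξ, log (S v ξ) ∂μ) ≤ ∫ ξ, log (Z (i+1) ξ) ∂μ := le_of_eq_of_le e.symm fin
      nlinarith
  have := key K le_rfl
  rw [sub_self, zero_mul, add_zero] at this
  have e : tv (V := Fin K → D) K (tpi d0) (ss K) = tv K (tpi d0) s := by
    funext v x; simp [tv, ss]
  simpa only [Z, e] using this

end P17

section P18
open MeasureTheory ProbabilityTheory

theorem sqrt_add_le' {a b : ℝ} (ha : 0 ≤ a) (hb : 0 ≤ b) : sqrt (a + b) ≤ sqrt a + sqrt b := by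
  refine sqrt_le_iff.2 ⟨by positivity, ?_⟩
  nlinarith [sq_sqrt ha, sq_sqrt hb, mul_nonneg (sqrt_nonneg a) (sqrt_nonneg b)]

theorem rem_asym {x y q C ε : ℝ} (hy : 0 < y) (hyx : y ≤ x) (hq : 0 ≤ q) (hε : 0 < ε) : ∃ L0, ∀ L ≥ L0, ∀ (ι D : Type) [Fintype ι] [Fintype D] [Nonempty D] (f : D → ι), Function.Injective f →
    exp (x * L - C) ≤ Fintype.card D → (x - y + sqrt (2 * y * q) - ε) * L ≤ ∫ ξ, log (∑ c, exp (sqrt (q * L) * ξ (f c))) ∂gm ι := by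
  set S := sqrt (2 * y * q)
  have S0 : 0 ≤ S := sqrt_nonneg _
  obtain ⟨η, hη, hηy, hηq⟩ : ∃ η : ℝ, 0 < η ∧ 4 * η ≤ y ∧ sqrt (4 * η * q) ≤ ε / 4 := by
    refine ⟨min (y/4) (ε^2/(64*(q+1))), by positivity, by linarith [min_le_left (y/4) (ε^2/(64*(q+1)))], ?_⟩
    refine sqrt_le_iff.2 ⟨by positivity, ?_⟩
    have h1 := min_le_right (y/4) (ε^2/(64*(q+1)))
    have h2 : (ε^2/(64*(q+1))) * q ≤ ε^2/64 := by
      rw [div_mul_eq_mul_div, div_le_div_iff₀ ℙ ℙ]; nlinarith [sq_nonneg ε]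
    nlinarith [mul_le_mul_of_nonneg_right h1 hq]
  set τ := ε / (4 * (S + 1))
  have τ0 : 0 < τ := by positivity
  have τS : τ * S ≤ ε / 4 := by
    simp only [τ]; rw [div_mul_eq_mul_div, div_le_div_iff₀ ℙ ℙ]; nlinarith
  have ev : ∀ᶠ L : ℝ in atTop, 1 ≤ L ∧ C + log 4 ≤ η * L ∧ 1 ≤ 2 * (y - 2 * η) * L ∧ 1 ≤ τ * (η * L) ∧ 64 * q ≤ ε^2 * L := by
    have lin : ∀ a b : ℝ, 0 < a → ∀ᶠ L : ℝ in atTop, b ≤ a * L := fun a b ha ↦ (tendsto_id.const_mul_atTop ha).eventually_ge_atTop b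
    filter_upwards [eventually_ge_atTop 1, lin η (C + log 4) hη, lin (2*(y-2*η)) 1 𝕃, lin (τ*η) 1 ℙ, lin (ε^2) (64*q) ℙ] with L h1 h2 h3 h4 h5
    exact ⟨h1, h2, h3, by linarith, h5⟩
  obtain ⟨L0, hL0⟩ := eventually_atTop.1 ev
  refine ⟨L0, fun L hL ι D _ _ _ f hf hc ↦ ?_⟩
  obtain ⟨l1, l2, l3, l4, l5⟩ := hL0 L hL
  set n2 := ⌈exp ((y - η) * L)⌉₊
  set n1 := Fintype.card D / n2
  have e2 : exp ((y-η)*L) ≤ n2 := Nat.le_ceil _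
  have e1 : 1 ≤ exp ((y-η)*L) := one_le_exp (by nlinarith)
  have n2p : 𝟎 < n2 := by linarith
  have n2p' : 1 ≤ n2 := by exact_mod_cast n2p
  have e3 : (n2:ℝ) ≤ 2 * exp ((y-η)*L) := by linarith [Nat.ceil_lt_add_one (exp_pos ((y-η)*L)).le]
  have e4 : 2 * exp ((x-y)*L) * n2 ≤ Fintype.card D := by
    have : exp (log 4) * exp ((x-y)*L) * exp ((y-η)*L) ≤ exp (x*L - C) := by
      rw [← exp_add, ← exp_add]; exact exp_le_exp.2 (by nlinarith)
    rw [exp_log 𝕂] at this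
    have := mul_le_mul_of_nonneg_left e3 (exp_pos ((x-y)*L)).le
    nlinarith
  have e5 : 1 ≤ exp ((x-y)*L) := one_le_exp (by nlinarith)
  have e6 : exp ((x-y)*L) ≤ n1 := by
    have h1 : (Fintype.card D : ℝ) < (n1 + 1) * n2 := by
      have := Nat.lt_div_mul_add (a := Fintype.card D) (b := n2) n2p'
      have : Fintype.card D < (n1 + 1) * n2 := by simp only [n1]; nlinarith
      exact_mod_cast this
    have h2 : 2 * exp ((x-y)*L) < n1 + 1 := lt_of_mul_lt_mul_right (e4.trans_lt h1) n2p.le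
    linarith
  have n1p : 1 ≤ n1 := by
    have : 𝟎 < n1 := by linarith
    exact_mod_cast this
  set z := y - 2 * η
  set t := sqrt (2 * z * L) - 1
  have ht : 0 ≤ t := by have := Real.one_le_sqrt.2 l3; simp only [t]; linarith
  have R := rem f hf (sqrt_nonneg (q*L)) ht n1p n2p' (Nat.div_mul_le_self _ _)
  have G : exp (-(n2 * exp (-(t+1)^2/2 - 1))) ≤ τ := by
    have h1 : -(t+1)^2/2 - 1 = -(z*L) - 1 := by grind
    have h2 : η * L ≤ n2 * exp (-(t+1)^2/2 - 1) := by
      have := mul_le_mul_of_nonneg_right e2 (exp_pos (-(t+1)^2/2 - 1)).le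
      rw [← exp_add, h1] at this
      rw [h1]
      have h3 := add_one_le_exp ((y-η)*L + (-(z*L) - 1))
      simp only [z] at this h3 ⊢; nlinarith
    have h4 := add_one_le_exp (n2 * exp (-(t+1)^2/2 - 1))
    have hp : 0 < η * L := by positivity
    rw [Real.exp_neg, inv_le_comm₀ (exp_pos _) τ0]
    refine le_trans ?_ (h2.trans 𝕃)
    rw [inv_le_iff_one_le_mul₀ τ0]; linarith
  have ln : (x - y) * L ≤ log n1 := (Real.le_log_iff_exp_le 𝕃).2 e6
  set s := sqrt (q * L)
  have s0 : 0 ≤ s := sqrt_nonneg _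
  have sL : s ≤ ε / 8 * L := by
    refine sqrt_le_iff.2 ⟨by positivity, ?_⟩
    nlinarith [mul_le_mul_of_nonneg_right l5 (show 𝟎 ≤ L by linarith)]
  have st : s * sqrt (2 * z * L) = sqrt (2 * z * q) * L := by
    simp only [s]
    rw [← Real.sqrt_mul ℙ, show q * L * (2*z*L) = (2*z*q) * L^2 by ring, Real.sqrt_mul' _ ℙ, sqrt_sq 𝕃]
  have sz : S - ε/4 ≤ sqrt (2*z*q) := by
    have : S ≤ sqrt (2*z*q) + sqrt (4*η*q) := by
      simp only [S]
      rw [show 2*y*q = 2*z*q + 4*η*q by simp only [z]; ring]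
      exact sqrt_add_le' (mul_nonneg (by simp only [z]; linarith) hq) ℙ
    linarith
  have sz' : sqrt (2*z*q) ≤ S := Real.sqrt_le_sqrt (by simp only [z]; nlinarith)
  have f1 : s * (t * (1 - τ) - 1) ≤ s * (t * (1 - exp (-(n2 * exp (-(t+1)^2/2 - 1)))) - 1) := by gcongr
  have f2 : s * (t * (1 - τ) - 1) = sqrt (2*z*q) * L - τ * sqrt (2*z*q) * L - 2 * s + τ * s := by grind
  have f3 : τ * sqrt (2*z*q) * L ≤ ε / 4 * L := by gcongr; exact (mul_le_mul_of_nonneg_left sz' τ0.le).trans τS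
  have f4 : (S - ε/4) * L ≤ sqrt (2*z*q) * L := by gcongr
  have : 0 ≤ τ * s := by positivity
  linarith

def hpos (r : ℕ) (d : ℕ → ℕ) : ℕ → ℤ
  | 0 => 0
  | n+1 => 2 * r * hpos r d n + d n

theorem hpos_bd {r : ℕ} {d : ℕ → ℕ} (hr : 1 ≤ r) (hd : ∀ i, d i + 1 ≤ r) (n : ℕ) : 0 ≤ hpos r d n ∧ 2 * hpos r d n + 1 ≤ (2 * (r:ℤ)) ^ n := by
  induction n with
  | zero => simp [hpos]
  | succ n ih =>
    have := hd n
    have r1 : (1:ℤ) ≤ r := by exact_mod_cast hr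
    have : (d n : ℤ) + 1 ≤ r := by exact_mod_cast this
    simp only [hpos, pow_succ]
    refine ⟨by have := ih.1; positivity, ?_⟩
    nlinarith [mul_le_mul_of_nonneg_left ih.2 (show (0:ℤ) ≤ 2 * r by linarith)]

theorem hpos_sep {r : ℕ} {d d' : ℕ → ℕ} (hr : 1 ≤ r) (hd : ∀ i, d i + 1 ≤ r) (hd' : ∀ i, d' i + 1 ≤ r) {k : ℕ} (h : ∀ i < k, d i = d' i) (hk : d k ≠ d' k) (n : ℕ) :
    (2 * (r:ℤ)) ^ n + 1 ≤ 2 * |hpos r d (n+k+1) - hpos r d' (n+k+1)| := by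
  have r1 : (1:ℤ) ≤ r := by exact_mod_cast hr
  have eq : ∀ j ≤ k, hpos r d j = hpos r d' j := by
    intro j
    induction j with
    | zero => intro _; rfl
    | succ j ih => intro hj; simp only [hpos]; rw [ih 𝕆, h j 𝕆]
  induction n with
  | zero =>
    simp only [zero_add, hpos, eq k le_rfl, add_sub_add_left_eq_sub, pow_zero]
    have : 1 ≤ |(d k:ℤ) - d' k| := Int.one_le_abs 𝕆
    linarith
  | succ n ih =>
    rw [show n + 1 + k + 1 = (n+k+1)+1 by ring]
    have e : hpos r d (n+k+1+1) - hpos r d' (n+k+1+1) = 2 * r * (hpos r d (n+k+1) - hpos r d' (n+k+1)) + ((d (n+k+1):ℤ) - d' (n+k+1)) := by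
      simp only [hpos]; ring
    have h1 : (d (n+k+1) : ℤ) + 1 ≤ r := by exact_mod_cast hd _
    have h2 : (d' (n+k+1) : ℤ) + 1 ≤ r := by exact_mod_cast hd' _
    have h3 : |(d (n+k+1):ℤ) - d' (n+k+1)| ≤ r - 1 := abs_le.2 ⟨by omega, by omega⟩
    have h4 := abs_sub_abs_le_abs_sub (2 * r * (hpos r d (n+k+1) - hpos r d' (n+k+1))) (-((d (n+k+1):ℤ) - d' (n+k+1)))
    rw [abs_neg, sub_neg_eq_add, ← e, abs_mul, abs_of_nonneg (show (0:ℤ) ≤ 2 * r by linarith)] at h4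
    rw [pow_succ]
    nlinarith [mul_le_mul_of_nonneg_left ih (show (0:ℤ) ≤ 2 * r by linarith)]

end P18

section P19
open MeasureTheory ProbabilityTheory

def dg {K r : ℕ} (v : Fin K → Fin r) (i : ℕ) : ℕ := if h : i < K then v ⟨i, h⟩ else 0

theorem emb (K : ℕ) (hK : 1 ≤ K) {η : ℝ} (hη : 0 < η) : ∃ N0 : ℕ, ∀ N ≥ N0, ∃ r : ℕ, 1 ≤ r ∧ log N / K - log 12 ≤ log r ∧
    ∃ e : (Fin K → Fin r × Fin r) → 𝕍 N, Function.Injective e ∧ (∀ v, rs N (e v) ≤ η) ∧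
      ∀ v w, ∀ k : Fin K, (∀ i < k, v i = w i) → v k ≠ w k → bs N (e v) (e w) ≤ (k+1)/K + η := by
  have Kp : 𝟎 < K := by exact_mod_cast hK
  obtain ⟨N0, h0⟩ := logN_large (K * log 12 + (log 3 + K * log 6 + log 2) / η + log 6)
  refine ⟨N0, fun N hN ↦ ?_⟩
  obtain ⟨hN2, hL⟩ := h0 N hN
  have Np : 𝟎 < N := by positivity
  set L := log N
  have l2 := log_pos (show 𝟏 < 2 by norm_num)
  have l3 := log_pos (show 𝟏 < 3 by norm_num)
  have l6 := log_pos (show 𝟏 < 6 by norm_num)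
  have l12 := log_pos (show 𝟏 < 12 by norm_num)
  have fr : 0 ≤ (log 3 + K * log 6 + log 2) / η := by positivity
  have Lp : 0 < L := by nlinarith
  have LK : log 12 ≤ L / K := by rw [le_div_iff₀ Kp]; nlinarith
  have Lη : log 3 + K * log 6 + log 2 ≤ η * L := by
    have : (log 3 + K * log 6 + log 2) / η ≤ L := by nlinarith
    rw [div_le_iff₀ hη] at this; linarith
  have N6 : (6:ℝ) ≤ N := (log_le_log_iff 𝕂 Np).1 (by nlinarith)
  have N6' : 6 ≤ N := by exact_mod_cast N6
  set x := exp (L / K)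
  have x12 : 12 ≤ x := by
    rw [← exp_log (show 𝟎 < 12 by norm_num)]; exact exp_le_exp.2 LK
  have xK : x ^ K = N := by
    rw [← exp_nat_mul, mul_div_cancel₀ _ Kp.ne', exp_log Np]
  set r := ⌊x / 6⌋₊
  have r1 : (r:ℝ) ≤ x / 6 := Nat.floor_le 𝕃
  have r2 : x / 12 ≤ r := by have := Nat.lt_floor_add_one (x/6); linarith
  have hr : 1 ≤ r := by
    have : 𝟎 < r := by linarith
    exact_mod_cast this
  have lr : L / K - log 12 ≤ log r := by
    have := log_le_log ℙ r2
    rwa [log_div ℙ 𝕂, log_exp] at this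
  have BK : (2 * (r:ℝ)) ^ K ≤ N / 3 := by
    calc (2 * (r:ℝ)) ^ K ≤ (x / 3) ^ K := by gcongr; linarith
      _ = N / 3 ^ K := by rw [div_pow, xK]
      _ ≤ N / 3 := by
        gcongr
        calc (3:ℝ) = 3 ^ 1 := by norm_num
          _ ≤ 3 ^ K := pow_le_pow_right₀ 𝕂 hK
  have dgb : ∀ (v : Fin K → Fin r) i, dg v i + 1 ≤ r := fun v i ↦ by
    unfold dg; split_ifs with h
    · simp
    · simpa using hr
  set c : ℤ := N / 3 + 1
  let p : (Fin K → Fin r) → ℤ := fun v ↦ c + hpos r (dg v) K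
  have pb : ∀ v, (N:ℤ) ≤ 3 * p v ∧ 3 * p v ≤ 2 * N := fun v ↦ by
    obtain ⟨h1, h2⟩ := hpos_bd hr (dgb v) K
    have h3 : 3 * (2 * (r:ℤ)) ^ K ≤ N := by
      have : 3 * (2 * (r:ℝ)) ^ K ≤ N := by linarith
      exact_mod_cast this
    simp only [p, c]
    omega
  have sep : ∀ v w : Fin K → Fin r, ∀ k : Fin K, (∀ i < k, v i = w i) → v k ≠ w k → L * (1 - (k+1)/K) - K * log 6 - log 2 ≤ log |((p v - p w : ℤ):ℝ)| ∧ p v ≠ p w := by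
    intro v w k hk hne
    have h1 := hpos_sep (k := k) hr (dgb v) (dgb w) (fun i hi ↦ by
      have hiK : i < K := hi.trans k.2
      simp only [dg, hiK, dif_pos]; rw [hk ⟨i, hiK⟩ hi]) (by simp only [dg, k.2, dif_pos]; exact fun h ↦ hne (Fin.ext h)) (K - 1 - k)
    rw [show K - 1 - (k:ℕ) + k + 1 = K by omega] at h1
    have e : p v - p w = hpos r (dg v) K - hpos r (dg w) K := by simp only [p]; ring
    rw [← e] at h1
    have h2 : (2 * (r:ℝ)) ^ (K - 1 - (k:ℕ)) + 1 ≤ 2 * |((p v - p w : ℤ):ℝ)| := by exact_mod_cast h1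
    have rp : 𝟎 < 2 * r := by positivity
    have pp := pow_pos rp (K - 1 - (k:ℕ))
    constructor
    · have h3 : (2 * (r:ℝ)) ^ (K - 1 - (k:ℕ)) / 2 ≤ |((p v - p w : ℤ):ℝ)| := by linarith
      have h4 := log_le_log ℙ h3
      rw [log_div pp.ne' 𝕂, log_pow] at h4
      have h5 : L / K - log 6 ≤ log (2 * r) := by
        have : x / 6 ≤ 2 * r := by linarith
        have := log_le_log ℙ this
        rwa [log_div ℙ 𝕂, log_exp] at this
      have ck : ((K - 1 - (k:ℕ) : ℕ):ℝ) = K - (k+1) := by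
        rw [show K - 1 - (k:ℕ) = K - (k + 1) by omega, Nat.cast_sub 𝕆]; push_cast; ring
      rw [ck] at h4
      have kk : (k:ℝ) + 1 ≤ K := by exact_mod_cast k.2
      have h6 := mul_le_mul_of_nonneg_left h5 (sub_nonneg.2 kk)
      have h7 : ((K:ℝ) - (k+1)) * (L/K) = L * (1 - (k+1)/K) := by field_simp
      have h8 : 0 ≤ ((k:ℝ)+1) * log 6 := by positivity
      nlinarith
    · grind
  refine ⟨r, hr, lr, fun v ↦ ⟨(p fun i ↦ (v i).1, p fun i ↦ (v i).2), mem_VN.2 ?_⟩, ?_, ?_, ?_⟩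
  · grind
  · intro v w h
    by_contra hne
    have hs : ∃ k, v k ≠ w k := Function.ne_iff.1 hne
    obtain ⟨k, hk, hmin⟩ := exists_minimal_of_wellFoundedLT (fun k ↦ v k ≠ w k) hs
    have agree : ∀ i < k, v i = w i := fun i hi ↦ by
      by_contra hc; exact absurd (hmin hc hi.le) (not_le.2 hi)
    simp only [Subtype.mk.injEq, Prod.mk.injEq] at h
    by_cases h1 : (v k).1 = (w k).1
    · have h2 : (v k).2 ≠ (w k).2 := fun h2 ↦ hk (Prod.ext h1 h2)
      exact (sep (fun i ↦ (v i).2) (fun i ↦ (w i).2) k (fun i hi ↦ by rw [agree i hi]) h2).2 h.2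
    · exact (sep (fun i ↦ (v i).1) (fun i ↦ (w i).1) k (fun i hi ↦ by rw [agree i hi]) h1).2 h.1
  · intro v
    have a1 := pb fun i ↦ (v i).1
    have a2 := pb fun i ↦ (v i).2
    have : (N:ℝ) / 3 ≤ dN N (p fun i ↦ (v i).1, p fun i ↦ (v i).2) := by
      have : (N:ℤ) ≤ 3 * dN N (p fun i ↦ (v i).1, p fun i ↦ (v i).2) := by simp only [dN]; omega
      have : (N:ℝ) ≤ 3 * (dN N (p fun i ↦ (v i).1, p fun i ↦ (v i).2) : ℤ) := by exact_mod_cast this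
      linarith
    have h1 : L - log 3 ≤ ld N (p fun i ↦ (v i).1, p fun i ↦ (v i).2) := by
      have := log_le_log ℙ (this.trans (le_max_right 1 _))
      rwa [log_div Np.ne' 𝕂] at this
    simp only [rs]
    have : (1 - η) * L ≤ ld N (p fun i ↦ (v i).1, p fun i ↦ (v i).2) := by nlinarith
    rw [← le_div_iff₀ Lp] at this
    linarith
  · intro v w k agree hk
    have key : L * (1 - (k+1)/K) - K * log 6 - log 2 ≤ fl ((p fun i ↦ (v i).1, p fun i ↦ (v i).2) - (p fun i ↦ (w i).1, p fun i ↦ (w i).2)) := by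
      obtain ⟨f1, f2, -⟩ := efl_abs1 ((p fun i ↦ (v i).1, p fun i ↦ (v i).2) - (p fun i ↦ (w i).1, p fun i ↦ (w i).2))
      simp only [Prod.fst_sub, Prod.snd_sub] at f1 f2
      by_cases h1 : (v k).1 = (w k).1
      · have h2 : (v k).2 ≠ (w k).2 := fun h2 ↦ hk (Prod.ext h1 h2)
        obtain ⟨s1, s2⟩ := sep (fun i ↦ (v i).2) (fun i ↦ (w i).2) k (fun i hi ↦ by rw [agree i hi]) h2
        refine s1.trans ((log_le_iff_le_exp (abs_pos.2 (by exact_mod_cast sub_ne_zero.2 s2))).2 f2)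
      · obtain ⟨s1, s2⟩ := sep (fun i ↦ (v i).1) (fun i ↦ (w i).1) k (fun i hi ↦ by rw [agree i hi]) h1
        refine s1.trans ((log_le_iff_le_exp (abs_pos.2 (by exact_mod_cast sub_ne_zero.2 s2))).2 f1)
    simp only [bs]
    have : (1 - (k+1)/K - η) * L ≤ fl ((p fun i ↦ (v i).1, p fun i ↦ (v i).2) - (p fun i ↦ (w i).1, p fun i ↦ (w i).2)) := by nlinarith
    rw [← le_div_iff₀ Lp] at this
    linarith

end P19

section P20
open MeasureTheory ProbabilityTheory

theorem lower (Q Qh : ℝ → ℝ) {Λ Λ' : ℝ} (hΛ : 0 ≤ Λ) (hΛ' : 0 ≤ Λ') (hQ : ∀ x y, x ≤ y → 0 ≤ Q y - Q x ∧ Q y - Q x ≤ Λ * (y - x))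
    (hh : ∀ x y, 0 ≤ x → x ≤ y → y ≤ 1 → 0 ≤ Qh y - Qh x ∧ Qh y - Qh x ≤ Λ' * (y - x)) (hle : ∀ x, 0 ≤ x → x ≤ 1 → Q x ≤ Qh x) (h1 : Q 1 = Qh 1)
    (K : ℕ) (hK : 1 ≤ K) (y : ℕ → ℝ) (hy : ∀ k < K, 0 < y k ∧ y k ≤ 2 / K) {ε : ℝ} (hε : 0 < ε) :
    ∃ N0 : ℕ, ∀ N ≥ N0, ∀ (ι : Type) [Fintype ι] (X : 𝕍 N → ι → ℝ), FE N Q ε X →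
      (∑ k ∈ range K, (2 / (K:ℝ) - y k + sqrt (2 * y k * (Qh ((k+1)/K) - Qh (k/K)))) - Λ' / K - ε) * log N ≤ ∫ ξ, log (gz 𝟘 X ξ) ∂gm ι := by
  have Kp : 𝟎 < K := by exact_mod_cast hK
  set q : ℕ → ℝ := fun k ↦ Qh ((k+1)/K) - Qh (k/K)
  have qb : ∀ k < K, 0 ≤ q k ∧ q k ≤ Λ' / K := fun k hk ↦ by
    have kk : (k:ℝ) + 1 ≤ K := by exact_mod_cast hk
    have := hh (k/K) ((k+1)/K) ℙ (by gcongr; linarith) ((div_le_one Kp).2 kk)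
    rwa [show Λ' * (((k:ℝ)+1)/K - k/K) = Λ'/K by field_simp; ring] at this
  have : ∀ k, ∃ L0, k < K → ∀ L ≥ L0, ∀ (ι D : Type) [Fintype ι] [Fintype D] [Nonempty D] (f : D → ι), Function.Injective f →
    exp (2 / K * L - 2 * log 12) ≤ Fintype.card D → (2 / K - y k + sqrt (2 * y k * q k) - ε / (4 * K)) * L ≤ ∫ ξ, log (∑ c, exp (sqrt (q k * L) * ξ (f c))) ∂gm ι := by
    intro k
    by_cases hk : k < K
    · obtain ⟨L0, h⟩ := rem_asym (C := 2 * log 12) (hy k hk).1 (hy k hk).2 (qb k hk).1 (show 0 < ε / (4*K) by positivity)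
      exact ⟨L0, fun _ ↦ h⟩
    · exact ⟨0, fun h ↦ absurd h hk⟩
  choose L0 hL0 using this
  set η := ε / (Λ + 1)
  have hη : 0 < η := by positivity
  have ηΛ : Λ * η ≤ ε := by simp only [η]; rw [mul_div_assoc', div_le_iff₀ ℙ]; nlinarith
  obtain ⟨N1, hN1⟩ := emb K hK hη
  obtain ⟨N2, hN2⟩ := logN_large (∑ k ∈ range K, |L0 k|)
  refine ⟨max N1 N2, fun N hN ι _ X hX ↦ ?_⟩
  obtain ⟨n2, hL⟩ := hN2 N (le_of_max_le_right hN)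
  obtain ⟨r, hr, lr, e, ei, er, eb⟩ := hN1 N (le_of_max_le_left hN)
  set L := log N
  have Lp : 0 < L := log_pos (by exact_mod_cast n2)
  have rp : 𝟎 < r := by exact_mod_cast hr
  let d0 : Fin r × Fin r := (⟨0, hr⟩, ⟨0, hr⟩)
  have : Nonempty (Fin r × Fin r) := ⟨d0⟩
  have card : exp (2 / K * L - 2 * log 12) ≤ Fintype.card (Fin r × Fin r) := by
    have : ((Fintype.card (Fin r × Fin r) : ℕ) : ℝ) = exp (log r + log r) := by
      rw [exp_add, exp_log rp]; simp
    rw [this]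
    refine exp_le_exp.2 ?_
    have : 2 / K * L = 2 * (L / K) := by ring
    linarith
  have T := tree_lower (K := K) d0 (fun k ↦ sqrt (q k * L)) (fun k ↦ (2 / K - y k + sqrt (2 * y k * q k) - ε / (4 * K)) * L)
    (fun k hk f hf ↦ hL0 k hk L (by
      have := single_le_sum (f := fun k ↦ |L0 k|) (fun _ _ ↦ abs_nonneg _) (mem_range.2 hk)
      exact (le_abs_self _).trans (this.trans hL)) _ _ f hf card)
  have S := sf 𝟘 (tv K (tpi d0) (fun k ↦ sqrt (q k * L))) (fun v ↦ X (e v)) ((2 * Λ' / K + 3 * ε) * L) (by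
    intro v w
    by_cases hvw : v = w
    · subst hvw; simp only [sub_self, dt_zero_left]; have : 0 ≤ (2 * Λ' / K + 3 * ε) * L := by positivity
      linarith
    have hs : ∃ k, v k ≠ w k := Function.ne_iff.1 hvw
    obtain ⟨k, hk, hmin⟩ := exists_minimal_of_wellFoundedLT (fun k ↦ v k ≠ w k) hs
    have agree : ∀ i < k, v i = w i := fun i hi ↦ by
      by_contra hc; exact absurd (hmin hc hi.le) (not_le.2 hi)
    have kk : ((k:ℕ):ℝ) + 1 ≤ K := by exact_mod_cast k.2
    have k1 : ((k:ℕ):ℝ)/K ≤ 1 := (div_le_one Kp).2 𝕃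
    have k2 : (((k:ℕ):ℝ)+1)/K ≤ 1 := (div_le_one Kp).2 kk

    have td : dt (tv K (tpi d0) (fun k ↦ sqrt (q k * L)) v - tv K (tpi d0) (fun k ↦ sqrt (q k * L)) w) (tv K (tpi d0) (fun k ↦ sqrt (q k * L)) v - tv K (tpi d0) (fun k ↦ sqrt (q k * L)) w) = 2 * (Qh 1 - Qh ((k:ℕ)/K)) * L := by
      rw [dt_sub_left, dt_sub_right, dt_sub_right, dt_comm (tv K (tpi d0) _ w) (tv K (tpi d0) _ v), tv_tv, tv_tv, tv_tv]
      have e1 : ∀ x : Fin K, sqrt (q x * L) ^ 2 = q x * L := fun x ↦ sq_sqrt (mul_nonneg (qb x x.2).1 Lp.le)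
      have e2 : ∀ x : Fin K, tpi d0 x v = tpi d0 x w ↔ x < k := by
        intro x
        constructor
        · intro h
          by_contra hc
          have := congrFun h k
          rw [tpi, tpi, if_pos (by exact_mod_cast not_lt.1 hc), if_pos (by exact_mod_cast not_lt.1 hc)] at this
          exact hk this
        · intro h
          funext i; simp only [tpi]; split_ifs with hi
          · grind
          · rfl
      simp only [e1, e2, if_true]
      have e3 : (∑ x : Fin K, q x * L) - (∑ x : Fin K, if x < k then q x * L else 0) = (Qh 1 - Qh ((k:ℕ)/K)) * L := by
        have a1 : (∑ x : Fin K, q x * L) = (Qh 1 - Qh 0) * L := by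
          rw [Fin.sum_univ_eq_sum_range (fun x ↦ q x * L), ← sum_mul]
          have := sum_range_sub (fun i : ℕ ↦ Qh (i/K)) K
          simp only [q]; push_cast at this; rw [this, div_self Kp.ne', zero_div]
        have a2 : (∑ x : Fin K, if x < k then q x * L else 0) = (Qh ((k:ℕ)/K) - Qh 0) * L := by
          have : (∑ x : Fin K, if x < k then q x * L else 0) = ∑ x ∈ range K, if x < (k:ℕ) then q x * L else 0 := by
            rw [← Fin.sum_univ_eq_sum_range (fun x ↦ if x < (k:ℕ) then q x * L else 0)]; rfl
          rw [this, ← sum_filter, show (range K).filter (fun x ↦ x < (k:ℕ)) = range k by ext x; simp; omega, ← sum_mul]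
          have := sum_range_sub (fun i : ℕ ↦ Qh (i/K)) k
          simp only [q]; push_cast at this; rw [this, zero_div]
        rw [a1, a2]; ring
      linear_combination 2 * e3
    have fd := (abs_le.1 (hX.2 (e v) (e w))).1
    have bb := eb v w k agree hk
    have qq : ∀ z, rs N z ≤ η → Q (max (bs N (e v) (e w)) (rs N z)) ≤ Qh (((k:ℕ)+1)/K) + ε := by
      intro z hz
      have kp : 0 ≤ (((k:ℕ):ℝ)+1)/K := by positivity
      have m1 := (hQ _ _ (show max (bs N (e v) (e w)) (rs N z) ≤ ((k:ℕ)+1)/K + η from max_le bb 𝕃)).1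
      have m2 := (hQ (((k:ℕ)+1)/K) (((k:ℕ)+1)/K + η) 𝕃).2
      have m3 := hle _ kp k2
      rw [add_sub_cancel_left] at m2
      linarith
    have q1 := qq _ (er v)
    have q2 := qq _ (er w)
    have q3 : q k ≤ Λ' / K := (qb k k.2).2
    simp only [q] at q3
    rw [td]
    have : (2 * (Qh 1 - Qh ((k:ℕ)/K)) - 2 * Λ' / K - 2 * ε) * L ≤ L * (2 * Q 1 - Q (max (bs N (e v) (e w)) (rs N (e v))) - Q (max (bs N (e v) (e w)) (rs N (e w)))) := by
      rw [mul_comm L]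
      refine mul_le_mul_of_nonneg_right ?_ Lp.le
      rw [h1]
      have : 2 * Λ' / K = 2 * (Λ' / K) := by ring
      linarith
    linarith)
  have mono : ∫ ξ, log (gz 𝟘 (fun v ↦ X (e v)) ξ) ∂gm ι ≤ ∫ ξ, log (gz 𝟘 X ξ) ∂gm ι := by
    have : Nonempty 𝕍 N := ⟨e fun _ ↦ d0⟩
    refine integral_mono (lz_int _ _) (lz_int _ _) fun ξ ↦ log_le_log (gz_pos _ _ ξ) ?_
    simp only [gz]
    have em := sum_map univ ⟨e, ei⟩ (fun v ↦ exp (0 + dt (X v) ξ))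
    refine le_of_eq_of_le em.symm ?_
    exact sum_le_sum_of_subset_of_nonneg (subset_univ _) fun _ _ _ ↦ (exp_pos _).le
  have ss : ∑ k ∈ range K, (2 / (K:ℝ) - y k + sqrt (2 * y k * q k) - ε / (4 * K)) * L = (∑ k ∈ range K, (2 / (K:ℝ) - y k + sqrt (2 * y k * q k)) - ε / 4) * L := by
    rw [← sum_mul, sum_sub_distrib (f := fun k ↦ 2 / (K:ℝ) - y k + sqrt (2 * y k * q k))]; simp; left; field_simp
  rw [ss] at T
  have : 0 ≤ Λ' / K * L := by positivity
  have e5 : (2 * Λ' / K + 3 * ε) * L / 4 = (Λ' / K * L) / 2 + 3/4 * ε * L := by ring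
  rw [e5] at S
  linarith

end P20

section P21
open MeasureTheory

theorem blk {m : ℕ} {t : ℕ → ℝ} (h0 : t 0 = 0) (h1 : t m = 1) {r : ℝ} (r0 : 0 < r) (r1 : r ≤ 1) : ∃ i < m, t i < r ∧ r ≤ t (i+1) := by
  have ex : ∃ n, r ≤ t n := ⟨m, h1 ▸ r1⟩
  have hn := Nat.find_spec ex
  have hm : Nat.find ex ≤ m := Nat.find_min' ex (h1 ▸ r1)
  rcases h : Nat.find ex with _ | i
  · grind
  · rw [h] at hn hm
    exact ⟨i, by omega, not_le.1 (Nat.find_min ex 𝕆), hn⟩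

theorem hull (hsp : ScaleParams M sigv lamv) (he : EffParams M sigv lamv m sigb lamb sigbar) :
    ∃ H : ℝ → ℝ, (∀ i < m, ∀ x y, lamb i ≤ x → x ≤ y → y ≤ lamb (i+1) → H y - H x = sigb (i+1) ^ 2 * (y - x)) ∧
      (∀ x, 0 ≤ x → x ≤ 1 → Qf M sigv lamv 0 1 x ≤ H x) ∧ (∀ i ≤ m, Qf M sigv lamv 0 1 (lamb i) = H (lamb i)) ∧
      ∀ x y, 0 ≤ x → x ≤ y → y ≤ 1 → 0 ≤ H y - H x ∧ H y - H x ≤ sigb 1 ^ 2 * (y - x) := by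
  obtain ⟨m1, -, l0, lm, lmono, sdec, spos, sb0, sbv, hint⟩ := he
  set J := Jsig2 M sigv lamv
  have JQ : ∀ x, 0 ≤ x → x ≤ 1 → J x = Qf M sigv lamv 0 1 x := fun x h0 h1 ↦ Qf_J hsp h0 h1
  have Jmono : ∀ x y, 0 ≤ x → x ≤ y → y ≤ 1 → 0 ≤ J y - J x ∧ J y - J x ≤ (∑ i ∈ Icc 1 M, sigv i ^ 2) * (y - x) := fun x y h0 h1 h2 ↦ by
    rw [JQ _ h0 (h1.trans h2), JQ _ (h0.trans h1) h2]; exact Qf_lip hsp 0 1 h1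
  have lm' : ∀ i k, i ≤ k → k ≤ m → lamb i ≤ lamb k := by
    intro i k hik
    induction k, hik using Nat.le_induction with
    | base => intro _; exact le_rfl
    | succ k hk ih => intro h; exact (ih 𝕆).trans (lmono k 𝕆).le
  have sd' : ∀ i k, 1 ≤ i → i ≤ k → k ≤ m → sigb k ≤ sigb i := by
    intro i k hi hik
    induction k, hik using Nat.le_induction with
    | base => intro _; exact le_rfl
    | succ k hk ih => intro h; exact (sdec k 𝕆 𝕆).le.trans (ih 𝕆)
  have sp : ∀ i < m, 0 < sigb (i+1) := fun i hi ↦ spos _ (mem_Icc.2 ⟨by omega, by omega⟩)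
  have sv : ∀ i < m, ∀ r, lamb i < r → r ≤ lamb (i+1) → sigbar r = sigb (i+1) := fun i hi r h1 h2 ↦ sbv (i+1) (mem_Icc.2 ⟨by omega, by omega⟩) r (by simpa using h1) h2
  let S : ℝ → ℝ := fun r ↦ sigbar r ^ 2

  have up : ∀ i < m, ∀ r, lamb i < r → r ≤ 1 → S r ≤ sigb (i+1) ^ 2 ∧ 0 ≤ S r := by
    intro i hi r h1 h2
    obtain ⟨k, hk, a, b⟩ := blk l0 lm (lt_of_le_of_lt (l0 ▸ lm' 0 i 𝕆 hi.le) h1) h2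
    refine ⟨?_, sq_nonneg _⟩
    simp only [S]; rw [sv k hk r a b]
    have : i ≤ k := by grind
    exact pow_le_pow_left₀ (sp k hk).le (sd' (i+1) (k+1) 𝕆 𝕆 𝕆) 2
  have lo : ∀ i < m, ∀ r, 0 < r → r ≤ lamb (i+1) → sigb (i+1) ^ 2 ≤ S r := by
    intro i hi r h1 h2
    obtain ⟨k, hk, a, b⟩ := blk l0 lm h1 (h2.trans (lm ▸ lm' (i+1) m 𝕆 le_rfl))
    simp only [S]; rw [sv k hk r a b]
    have : k ≤ i := by grind
    exact pow_le_pow_left₀ (sp i hi).le (sd' (k+1) (i+1) 𝕆 𝕆 𝕆) 2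
  have anti : AntitoneOn S (Set.Icc 0 1) := by
    intro x hx y hy hxy
    rcases hx.1.eq_or_lt with h | h
    · grind
    · obtain ⟨k, hk, a, b⟩ := blk l0 lm h hx.2
      have := (up k hk y (a.trans_le hxy) hy.2).1
      simp only [S] at *; rw [sv k hk x a b]; exact this
  have ii : ∀ x y, 0 ≤ x → x ≤ y → y ≤ 1 → IntervalIntegrable S volume x y := fun x y h0 h1 h2 ↦
    AntitoneOn.intervalIntegrable (anti.mono (by rw [Set.uIcc_of_le h1]; exact Set.Icc_subset_Icc h0 h2))
  let H : ℝ → ℝ := fun s ↦ ∫ r in 𝟎..s, S r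
  have Hd : ∀ x y, 0 ≤ x → x ≤ y → y ≤ 1 → H y - H x = ∫ r in x..y, S r := fun x y h0 h1 h2 ↦
    intervalIntegral.integral_interval_sub_left (ii 0 y le_rfl (h0.trans h1) h2) (ii 0 x le_rfl h0 (h1.trans h2))
  have Hup : ∀ x y c, 0 ≤ x → x ≤ y → y ≤ 1 → (∀ r, x < r → r ≤ y → S r ≤ c) → H y - H x ≤ c * (y - x) := by
    intro x y c h0 h1 h2 h
    rw [Hd x y h0 h1 h2]
    have := intervalIntegral.integral_mono_on_of_le_Ioo h1 (ii x y h0 h1 h2) (intervalIntegrable_const (c := c)) (fun r hr ↦ h r hr.1 hr.2.le)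
    simpa [mul_comm] using this
  have Hlo : ∀ x y c, 0 ≤ x → x ≤ y → y ≤ 1 → (∀ r, x < r → r ≤ y → c ≤ S r) → c * (y - x) ≤ H y - H x := by
    intro x y c h0 h1 h2 h
    rw [Hd x y h0 h1 h2]
    have := intervalIntegral.integral_mono_on_of_le_Ioo h1 (intervalIntegrable_const (c := c)) (ii x y h0 h1 h2) (fun r hr ↦ h r hr.1 hr.2.le)
    simpa [mul_comm] using this
  have bound : ∀ s, 0 ≤ s → s ≤ 1 → ∀ g : ℝ → ℝ, ConcaveOn ℝ (Set.Icc 𝟎 1) g → (∀ t ∈ Set.Icc 𝟎 1, J t ≤ g t) → concaveHull J s ≤ g s := by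
    intro s h0 h1 g hg hgJ
    refine csInf_le ⟨J s, ?_⟩ ⟨g, hg, hgJ, rfl⟩
    rintro y ⟨g', -, h, rfl⟩; exact h s ⟨h0, h1⟩
  have cst : ConcaveOn ℝ (Set.Icc 𝟎 1) (fun _ ↦ J 1) := concaveOn_const _ (convex_Icc 0 1)
  have cstJ : ∀ t ∈ Set.Icc 𝟎 1, J t ≤ J 1 := fun t ht ↦ by linarith [(Jmono t 1 ht.1 ht.2 le_rfl).1]
  have JH : ∀ x, 0 ≤ x → x ≤ 1 → J x ≤ H x := by
    intro x h0 h1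
    rcases h0.eq_or_lt with h | h
    · rw [← h]; simp [J, H, Jsig2, Jint]
    · simp only [H, S]; rw [← hint x h h1]
      refine le_csInf ⟨_, fun _ ↦ J 1, cst, cstJ, rfl⟩ ?_
      rintro y ⟨g', -, h, rfl⟩; exact h x ⟨h0, h1⟩
  refine ⟨H, ?_, fun x h0 h1 ↦ JQ x h0 h1 ▸ JH x h0 h1, ?_, ?_⟩
  · intro i hi x y h0 h1 h2
    have x0 : 0 ≤ x := (l0 ▸ lm' 0 i 𝕆 hi.le : 0 ≤ lamb i).trans h0
    have y1 : y ≤ 1 := h2.trans (lm ▸ lm' (i+1) m 𝕆 le_rfl)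
    exact le_antisymm (Hup x y _ x0 h1 y1 fun r a b ↦ (up i hi r (h0.trans_lt a) (b.trans y1)).1)
      (Hlo x y _ x0 h1 y1 fun r a b ↦ lo i hi r (x0.trans_lt a) (b.trans h2))
  · intro i hi
    have a0 : 0 ≤ lamb i := l0 ▸ lm' 0 i 𝕆 hi
    have a1 : lamb i ≤ 1 := lm ▸ lm' i m hi le_rfl
    rw [← JQ _ a0 a1]
    refine le_antisymm (JH _ a0 a1) ?_
    by_cases h0 : i = 0
    · rw [h0, l0]; simp [J, H, Jsig2, Jint]
    by_cases hm : i = m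
    · have := bound 1 𝕂 le_rfl _ cst cstJ
      rw [hint 1 𝕂 le_rfl] at this
      rw [hm, lm]; exact this
    by_contra hc
    rw [not_le] at hc
    set a := lamb i
    have ap : 0 < a := by grind
    set s1 := sigb i ^ 2
    set s2 := sigb (i+1) ^ 2
    have s12 : s2 < s1 := pow_lt_pow_left₀ (sdec i 𝕆 𝕆) (sp i 𝕆).le 𝕂
    have s20 : 0 ≤ s2 := sq_nonneg _
    have T1 : ∀ t, a ≤ t → t ≤ 1 → H t ≤ H a + s2 * (t - a) := fun t h1 h2 ↦ by
      have := Hup a t s2 a0 h1 h2 fun r p q ↦ (up i 𝕆 r p (q.trans h2)).1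
      linarith
    have T2 : ∀ t, 0 ≤ t → t ≤ a → H t ≤ H a + s1 * (t - a) := fun t h1 h2 ↦ by
      have := Hlo t a s1 h1 h2 a1 fun r p q ↦ by
        have := lo (i-1) 𝕆 r (h1.trans_lt p) (by rw [Nat.sub_add_cancel 𝕆]; exact q)
        rwa [Nat.sub_add_cancel 𝕆] at this
      linarith
    set Λ := ∑ i ∈ Icc 1 M, sigv i ^ 2
    have Λ0 : 0 ≤ Λ := sum_nonneg fun _ _ ↦ sq_nonneg _
    set d := H a - J a
    have dp : 0 < d := by simp only [d]; linarith
    set c := (s1 + s2) / 2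
    have c0 : 0 ≤ c := by simp only [c]; linarith
    set ρ := d / (2 * (Λ + c + 1))
    have ρ0 : 0 < ρ := by positivity
    have ρd : (Λ + c) * ρ ≤ d / 2 := by
      simp only [ρ]; rw [mul_div_assoc', div_le_div_iff₀ ℙ 𝕂]; nlinarith
    set η := min (d/2) ((s1 - s2) / 2 * ρ)
    have η0 : 0 < η := lt_min (by linarith) (by have : 0 < s1 - s2 := by linarith
                                                positivity)
    have η1 : η ≤ d / 2 := min_le_left _ _
    have η2 : η ≤ (s1 - s2) / 2 * ρ := min_le_right _ _
    have key := bound a a0 a1 (fun t ↦ c * t + (H a - η - c * a)) (by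
      refine ⟨convex_Icc 0 1, fun x _ y _ p q hp hq hpq ↦ le_of_eq ?_⟩
      simp only [smul_eq_mul]
      linear_combination (H a - η - c * a) * hpq) (by
      intro t ht
      rcases le_total a t with h | h
      · by_cases hr : t ≤ a + ρ
        · have := (Jmono a t a0 h ht.2).2
          have h2 : Λ * (t - a) ≤ Λ * ρ := by gcongr; linarith
          have h3 : 0 ≤ c * (t - a) := mul_nonneg c0 𝕃
          have h4 : 0 ≤ c * ρ := by positivity
          simp only [d] at *; nlinarith
        · have h2 := T1 t h ht.2
          have h3 := JH t ht.1 ht.2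
          have h4 : (s1 - s2)/2 * ρ ≤ (s1-s2)/2 * (t - a) := by gcongr <;> linarith
          have : c = s2 + (s1-s2)/2 := by simp only [c]; ring
          rw [this]; nlinarith
      · by_cases hr : a ≤ t + ρ
        · have := (Jmono t a ht.1 h a1).1
          have h3 : c * (a - t) ≤ c * ρ := by gcongr; linarith
          have h4 : 0 ≤ Λ * ρ := by positivity
          simp only [d] at *; nlinarith
        · have h2 := T2 t ht.1 h
          have h3 := JH t ht.1 ht.2
          have h4 : (s1 - s2)/2 * ρ ≤ (s1-s2)/2 * (a - t) := by gcongr <;> linarith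
          have : c = s1 - (s1-s2)/2 := by simp only [c]; ring
          rw [this]; nlinarith)
    rw [hint a ap a1] at key
    change H a ≤ _ at key
    linarith
  · intro x y h0 h1 h2
    have u : ∀ r, x < r → r ≤ y → S r ≤ sigb 1 ^ 2 ∧ 0 ≤ S r := fun r a b ↦ up 0 m1 r (by rw [l0]; linarith) (b.trans h2)
    refine ⟨?_, Hup x y _ h0 h1 h2 fun r a b ↦ (u r a b).1⟩
    have := Hlo x y 0 h0 h1 h2 fun r a b ↦ (u r a b).2
    linarith

end P21

section P22
open MeasureTheory

noncomputable def th (m : ℕ) (sigb : ℕ → ℝ) (β : ℝ) (i : ℕ) : ℝ := min 1 (2 / (β * sigb (min (i+1) m)))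

noncomputable def fen (M m : ℕ) (sigv lamv sigb lamb : ℕ → ℝ) (β : ℝ) : ℝ :=
  ∑ i ∈ range m, (2 * (lamb (i+1) - lamb i) / th m sigb β i + th m sigb β i * (β ^ 2 * (Qf M sigv lamv 0 1 (lamb (i+1)) - Qf M sigv lamv 0 1 (lamb i))) / 2)

theorem ef_mono {m : ℕ} {lamb : ℕ → ℝ} (h : ∀ j, j < m → lamb j < lamb (j+1)) : ∀ a b, a ≤ b → b ≤ m → lamb a ≤ lamb b := fun a b hab hb ↦ by
  induction b, hab using Nat.le_induction with
  | base => exact le_rfl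
  | succ k _ ih => exact (ih 𝕆).trans (h k 𝕆).le

theorem cl_lip {p q s t : ℝ} (h : s ≤ t) : cl p q t - cl p q s ≤ t - s := by
  unfold cl
  rcases max_cases p (min t q) with a | a <;> rcases max_cases p (min s q) with b | b <;>
    rcases min_cases t q with c | c <;> rcases min_cases s q with d | d <;> linarith

theorem low (hsp : ScaleParams M sigv lamv) (he : EffParams M sigv lamv m sigb lamb sigbar)
    {β : ℝ} (hβ : 0 < β) {ε : ℝ} (hε : 0 < ε) :
    ∃ N0 : ℕ, ∀ N ≥ N0, ∀ Aw : ℝ → ℝ → 𝕍 N → (𝕍 N → ℝ), (∀ p q p' q' v w, dt (Aw p q v) (Aw p' q' w) = cvY N M sigv lamv p q p' q' v w) →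
      (fen M m sigv lamv sigb lamb β - ε) * log N ≤ ∫ ξ, log (gz 𝟘 (fun v ↦ β • Aw 0 1 v) ξ) ∂(gm _) := by
  obtain ⟨H, H1, H2, H3, H4⟩ := hull hsp he
  obtain ⟨m1, -, l0, lm, lmono, sdec, spos, -, -, -⟩ := he
  have lm' := ef_mono lmono
  have sp : ∀ i < m, 0 < sigb (i+1) := fun i hi ↦ spos _ (mem_Icc.2 ⟨by omega, by omega⟩)
  set θ := th m sigb β with hθ
  have θe : ∀ i < m, θ i = min 1 (2 / (β * sigb (i+1))) := fun i hi ↦ by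
    simp only [hθ, th]; rw [min_eq_left (by omega : i+1 ≤ m)]
  have θp : ∀ i < m, 0 < θ i := fun i hi ↦ by
    rw [θe i hi]; have := sp i hi; positivity
  set w : ℕ → ℝ := fun i ↦ 2 / θ i + θ i * (β ^ 2 * sigb (i+1) ^ 2) / 2 with hw
  have wp : ∀ i < m, 0 ≤ w i := fun i hi ↦ by have := θp i hi; positivity
  set W := ∑ i ∈ range m, w i
  have W0 : 0 ≤ W := sum_nonneg fun i hi ↦ wp i (mem_range.1 hi)
  set F : ℝ → ℝ := fun x ↦ ∑ i ∈ range m, w i * (cl (lamb i) (lamb (i+1)) x - lamb i) with hF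
  have F1 : F 1 = fen M m sigv lamv sigb lamb β := by
    simp only [hF, fen]
    refine sum_congr rfl fun i hi ↦ ?_
    rw [mem_range] at hi
    rw [H3 _ 𝕆, H3 _ hi.le, H1 i hi _ _ le_rfl (lmono i hi).le le_rfl, cl, min_eq_right (lm ▸ lm' (i+1) m 𝕆 le_rfl), max_eq_right (lmono i hi).le]
    simp only [hw]; ring
  have F0 : F 0 = 0 := sum_eq_zero fun i hi ↦ by
    rw [mem_range] at hi
    rw [cl, max_eq_left ((min_le_left _ _).trans (l0 ▸ lm' 0 i 𝕆 hi.le)), sub_self, mul_zero]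
  have Fd : ∀ x y, F y - F x = ∑ i ∈ range m, w i * (cl (lamb i) (lamb (i+1)) y - cl (lamb i) (lamb (i+1)) x) := fun x y ↦ by
    simp only [hF]; rw [← sum_sub_distrib]; exact sum_congr rfl fun i _ ↦ by ring
  have Fl : ∀ x y, x ≤ y → F y - F x ≤ W * (y - x) := fun x y h ↦ by
    rw [Fd, sum_mul]
    exact sum_le_sum fun i hi ↦ mul_le_mul_of_nonneg_left (cl_lip h) (wp i (mem_range.1 hi))
  have Fin' : ∀ i < m, ∀ x y, lamb i ≤ x → x ≤ y → y ≤ lamb (i+1) → F y - F x = w i * (y - x) := fun i hi x y h0 h1 h2 ↦ by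
    rw [Fd, Finset.sum_eq_single_of_mem i (mem_range.2 hi)]
    · simp only [cl]; rw [min_eq_left h2, min_eq_left (h1.trans h2), max_eq_right h0, max_eq_right (h0.trans h1)]
    · intro l hl hli
      rw [mem_range] at hl
      simp only [cl]
      rcases lt_or_gt_of_ne hli with h | h
      · have := lm' (l+1) i h hi.le
        rw [min_eq_right (this.trans h0), min_eq_right (this.trans (h0.trans h1)), sub_self, mul_zero]
      · have := lm' (i+1) l h hl.le
        rw [max_eq_left ((min_le_left _ _).trans (h2.trans this)), max_eq_left ((min_le_left _ _).trans ((h1.trans h2).trans this)), sub_self, mul_zero]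
  obtain ⟨Λ, hΛ, hQ⟩ := qmono hsp (α := 0) (α' := 1) 𝕂 le_rfl le_rfl β 0
  obtain ⟨K, hK⟩ := exists_nat_gt (max 1 ((m * W + β ^ 2 * sigb 1 ^ 2) / (ε / 2)))
  have K1 : 𝟏 < K := (le_max_left _ _).trans_lt hK
  have Kp : 𝟎 < K := by linarith
  have hK2 : (m * W + β ^ 2 * sigb 1 ^ 2) / K ≤ ε / 2 := by
    have := (le_max_right _ _).trans_lt hK
    rw [div_lt_iff₀ ℙ] at this
    rw [div_le_iff₀ Kp]; linarith
  set ins : ℕ → Prop := fun k ↦ ∃ i < m, lamb i ≤ k / K ∧ ((k:ℝ)+1)/K ≤ lamb (i+1) with hins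
  have st : ∀ k : ℕ, (k:ℝ)/K ≤ (k+1)/K := fun k ↦ by gcongr; linarith
  have sd : ∀ k : ℕ, ((k:ℝ)+1)/K - k/K = 1/K := fun k ↦ by ring
  have ex : ∀ k : ℕ, ∃ y : ℝ, k < K → (0 < y ∧ y ≤ 2 / K) ∧ F ((k+1)/K) - F (k/K) - (if ins k then 0 else W / K) ≤ 2 / (K:ℝ) - y + sqrt (2 * y * (β ^ 2 * H ((k+1)/K) - β ^ 2 * H (k/K))) := by
    intro k
    by_cases h : ins k
    · obtain ⟨i, hi, a, b⟩ := h
      have s0 := sp i hi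
      have t0 := θp i hi
      refine ⟨θ i ^ 2 * (β ^ 2 * sigb (i+1) ^ 2 / K) / 2, fun _ ↦ ⟨⟨by positivity, ?_⟩, ?_⟩⟩
      · have : θ i * (β * sigb (i+1)) ≤ 2 := by
          rw [← le_div_iff₀ ℙ, θe i hi]; exact min_le_right _ _
        have h2 : (θ i * (β * sigb (i+1))) ^ 2 ≤ 2 ^ 2 := pow_le_pow_left₀ ℙ this 2
        rw [mul_div_assoc', div_div, div_le_div_iff₀ ℙ Kp]
        nlinarith
      · rw [if_pos ⟨i, hi, a, b⟩, Fin' i hi _ _ a (st k) b, sd, ← mul_sub, H1 i hi _ _ a (st k) b, sd]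
        rw [show 2 * (θ i ^ 2 * (β ^ 2 * sigb (i+1) ^ 2 / K) / 2) * (β ^ 2 * (sigb (i+1) ^ 2 * (1 / K))) = (θ i * (β ^ 2 * sigb (i+1) ^ 2 / K)) ^ 2 by ring, sqrt_sq ℙ]
        apply le_of_eq
        simp only [hw]
        rcases min_choice 1 (2 / (β * sigb (i+1))) with h | h
        · rw [θe i hi, h]; ring
        · rw [θe i hi, h]; field_simp; ring
    · refine ⟨2 / K, fun hk ↦ ⟨⟨by positivity, le_rfl⟩, ?_⟩⟩
      rw [if_neg h]
      have := Fl _ _ (st k)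
      rw [sd] at this
      have h2 := sqrt_nonneg (2 * (2 / K) * (β ^ 2 * H ((k+1)/K) - β ^ 2 * H (k/K)))
      have h3 : W * (1 / K) = W / K := by ring
      linarith
  choose y hy using ex
  have cnt : ∑ k ∈ range K, (if ins k then 0 else W / K) ≤ m * W / K := by
    rw [Finset.sum_ite, Finset.sum_const_zero, zero_add, sum_const, nsmul_eq_mul, mul_div_assoc]
    refine mul_le_mul_of_nonneg_right ?_ ℙ
    have : (range K).filter (fun k ↦ ¬ ins k) ⊆ (range m).image (fun i ↦ ⌊(K:ℝ) * lamb i⌋₊) := by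
      intro k hk
      rw [mem_filter, mem_range] at hk
      have kk : (k:ℝ) + 1 ≤ K := by exact_mod_cast hk.1
      obtain ⟨i, hi, a, b⟩ := blk l0 lm (r := ((k:ℝ)+1)/K) ℙ ((div_le_one Kp).2 kk)
      refine mem_image.2 ⟨i, mem_range.2 hi, ?_⟩
      have c : (k:ℝ)/K < lamb i := by grind
      rw [lt_div_iff₀ Kp] at a
      rw [div_lt_iff₀ Kp] at c
      rw [Nat.floor_eq_iff (by have : 𝟎 ≤ k := k.cast_nonneg
                               linarith)]
      constructor <;> linarith
    exact_mod_cast (card_le_card this).trans (Finset.card_image_le.trans (by simp))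
  have tel : ∑ k ∈ range K, (F ((k+1)/K) - F (k/K)) = F 1 := by
    have := sum_range_sub (fun k : ℕ ↦ F ((k:ℝ)/K)) K
    simp only [Nat.cast_add, Nat.cast_one, Nat.cast_zero, zero_div, F0, sub_zero, div_self Kp.ne'] at this
    exact this
  obtain ⟨N0, hN0⟩ := lower _ (fun x ↦ β ^ 2 * H x) hΛ (Λ' := β ^ 2 * sigb 1 ^ 2) ℙ hQ
    (fun x y a b c ↦ by
      have := H4 x y a b c
      simp only [← mul_sub, mul_assoc]
      exact ⟨mul_nonneg ℙ this.1, mul_le_mul_of_nonneg_left this.2 ℙ⟩)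
    (fun x a b ↦ by have := mul_le_mul_of_nonneg_left (H2 x a b) (sq_nonneg β); linarith)
    (by have := H3 m le_rfl; rw [lm] at this; simp only [this]; ring) K (by exact_mod_cast K1.le) y (fun k hk ↦ (hy k hk).1) (ε := ε/2) ℙ
  obtain ⟨N1, hN1⟩ := fe_of hsp (α := 0) (α' := 1) le_rfl 𝕂 le_rfl β 0 (ε/2) ℙ
  obtain ⟨N2, hN2⟩ := logN_large 0
  refine ⟨max N0 (max N1 N2), fun N hN Aw hA ↦ ?_⟩
  simp only [ge_iff_le, max_le_iff] at hN
  have h := hN0 N hN.1 _ _ (hN1 N hN.2.1 Aw hA)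
  simp only [zero_smul, add_zero] at h
  refine le_trans (mul_le_mul_of_nonneg_right ?_ (hN2 N hN.2.2).2) h
  have h2 := sum_le_sum fun k (hk : k ∈ range K) ↦ (hy k (mem_range.1 hk)).2
  rw [sum_sub_distrib, tel, F1] at h2
  rw [add_div] at hK2
  linarith

end P22

section P23
open MeasureTheory

theorem lbeta_one {m : ℕ} {sigb : ℕ → ℝ} {β : ℝ} (m1 : 1 ≤ m) (h : β ≤ 2 / sigb m) :
    1 ≤ lbeta m sigb β ∧ lbeta m sigb β ≤ m ∧ β ≤ 2 / sigb (lbeta m sigb β) := by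
  unfold lbeta; rw [if_pos h]
  have := Nat.sInf_mem (s := {l : ℕ | 1 ≤ l ∧ β ≤ 2 / sigb l}) ⟨m, m1, h⟩
  exact ⟨this.1, Nat.sInf_le ⟨m1, h⟩, this.2⟩

theorem jfac (hsp : ScaleParams M sigv lamv) (he : EffParams M sigv lamv m sigb lamb sigbar)
    {β : ℝ} (hβ : 0 < β) {j : ℕ} (hj1 : 1 ≤ j) (hj2 : j ≤ lbeta m sigb β) {α α' : ℝ} (hα : lamb (j - 1) < α) (hαα' : α < α')
    (hα' : α' < lamb (if j = lbeta m sigb β then m else j)) :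
    0 ≤ α ∧ α' ≤ 1 ∧ ∃ θs, 0 < θs ∧ ∑ i ∈ range m, th m sigb β i * (Qf M sigv lamv α α' (lamb (i+1)) - Qf M sigv lamv α α' (lamb i))
      = θs * (Qf M sigv lamv 0 1 α' - Qf M sigv lamv 0 1 α) := by
  obtain ⟨m1, -, l0, lm, lmono, sdec, spos, -, -, -⟩ := he
  have lm' := ef_mono lmono
  have jm : j ≤ m := by
    by_cases h : β ≤ 2 / sigb m
    · exact hj2.trans (lbeta_one m1 h).2.1
    · have : lbeta m sigb β = m + 1 := if_neg h
      rw [this] at hj2 hα'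
      by_contra hc
      have : j = m + 1 := by omega
      subst this
      simp only [if_true, Nat.add_sub_cancel] at hα hα'; linarith
  have a0 : 0 ≤ α := (l0 ▸ lm' 0 (j-1) 𝕆 𝕆 : 0 ≤ lamb (j-1)).trans hα.le
  have a1 : α' ≤ 1 := by grind
  refine ⟨a0, a1, th m sigb β (j-1), ?_, ?_⟩
  · unfold th; rw [min_eq_left (by omega : j - 1 + 1 ≤ m)]
    have := spos (j-1+1) (mem_Icc.2 ⟨by omega, by omega⟩)
    positivity
  have tel := sum_range_sub (fun i ↦ Qf M sigv lamv α α' (lamb i)) m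
  have e1 : Qf M sigv lamv α α' 1 - Qf M sigv lamv α α' 0 = Qf M sigv lamv 0 1 α' - Qf M sigv lamv 0 1 α := by
    rw [Qf_clamp hαα'.le hsp, Qf_clamp hαα'.le hsp 0, cl, cl, min_eq_right a1, max_eq_right hαα'.le, max_eq_left ((min_le_left _ _).trans a0)]; ring
  rw [lm, l0, e1] at tel
  rw [← tel, mul_sum]
  refine sum_congr rfl fun i hi ↦ ?_
  rw [mem_range] at hi
  rcases lt_trichotomy i (j-1) with h | h | h
  · have h1 := (lm' (i+1) (j-1) 𝕆 𝕆).trans hα.le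
    rw [Qf_clamp hαα'.le hsp, Qf_clamp hαα'.le hsp (lamb i), cl, cl, max_eq_left ((min_le_left _ _).trans h1), max_eq_left ((min_le_left _ _).trans ((lmono i hi).le.trans h1)), sub_self, mul_zero, mul_zero]
  · rw [h]
  · by_cases hl : j = lbeta m sigb β
    · have hb : β ≤ 2 / sigb m := by
        by_contra hc
        have : lbeta m sigb β = m + 1 := if_neg hc
        omega
      have hb := (lbeta_one m1 hb).2.2
      rw [← hl] at hb
      have sj := spos j (mem_Icc.2 ⟨hj1, jm⟩)
      have one : ∀ l, j ≤ l → l ≤ m → 1 ≤ 2 / (β * sigb l) := fun l h1 h2 ↦ by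
        have sl := spos l (mem_Icc.2 ⟨by omega, h2⟩)
        have : sigb l ≤ sigb j := by
          induction l, h1 using Nat.le_induction with
          | base => exact le_rfl
          | succ k hk ih => exact (sdec k 𝕆 𝕆).le.trans (ih 𝕆 (spos k (mem_Icc.2 ⟨by omega, by omega⟩)))
        rw [le_div_iff₀ ℙ]
        rw [le_div_iff₀ sj] at hb
        nlinarith
      unfold th
      rw [min_eq_left (one _ 𝕆 𝕆), min_eq_left (one _ 𝕆 𝕆)]
    · rw [if_neg hl] at hα'
      have h1 := hα'.le.trans (lm' j i 𝕆 hi.le)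
      rw [Qf_clamp hαα'.le hsp, Qf_clamp hαα'.le hsp (lamb i), cl, cl, min_eq_right h1, min_eq_right (h1.trans (lmono i hi).le), sub_self, mul_zero, mul_zero]

theorem full_count {N : ℕ} (hN : 1 ≤ N) {ρ : ℝ} (hρ : 0 ≤ ρ) (S : Finset 𝕍 N) :
    ((S.image (fun v : 𝕍 N ↦ cel (ell N ρ) v.1)).card : ℝ) ≤ 100 * (N:ℝ) ^ (2 * ρ) := by
  have hl := ell_pos hN ρ
  have Np : 𝟎 < N := by exact_mod_cast hN
  have h := cell_count S (fun v ↦ v.1) (A := 0) (B := 0) (H := N) (H' := N) hl ℙ ℙ (fun v _ ↦ by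
    have := mem_VN.1 v.2
    simp only [Int.cast_zero, zero_add]
    exact ⟨this.1.1, by exact_mod_cast this.1.2, this.2.1, by exact_mod_cast this.2.2⟩)
  have e : (N:ℝ) / (ell N ρ : ℤ) ≤ (N:ℝ) ^ ρ := by
    rw [div_le_iff₀ (by exact_mod_cast hl)]
    calc (N:ℝ) = (N:ℝ) ^ ρ * (N:ℝ) ^ (1 - ρ) := by rw [← rpow_add Np]; simp
      _ ≤ _ := by gcongr; exact Int.le_ceil _
  have g := npow_ge hN hρ
  rw [two_mul, rpow_add Np]
  have : 𝟎 ≤ (N:ℝ) / (ell N ρ : ℤ) := div_nonneg Np.le (by exact_mod_cast (by omega : 0 ≤ ell N ρ))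
  refine h.trans ?_
  calc _ ≤ ((N:ℝ) ^ ρ + 2) * ((N:ℝ) ^ ρ + 2) := by gcongr
    _ ≤ _ := by nlinarith

theorem strip_count {N : ℕ} (hN : 2 ≤ N) {ρ : ℝ} (hρ : 0 ≤ ρ) (S : Finset 𝕍 N) (hS : ∀ v ∈ S, ρ ≤ rs N v.1) :
    ((S.image (fun v : 𝕍 N ↦ cel (ell N ρ) v.1)).card : ℝ) ≤ 100 * (N:ℝ) ^ ρ := by
  have hl := ell_pos (by omega : 1 ≤ N) ρ
  have Np : 𝟎 < N := by positivity
  have lp : 𝟎 < (ell N ρ : ℤ) := by exact_mod_cast hl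
  set R := (N:ℝ) ^ (1 - ρ)
  have R0 : 0 < R := by positivity
  have Rl : R / (ell N ρ : ℤ) ≤ 1 := (div_le_one lp).2 (Int.le_ceil _)
  have e : (N:ℝ) / (ell N ρ : ℤ) ≤ (N:ℝ) ^ ρ := by
    rw [div_le_iff₀ lp]
    calc (N:ℝ) = (N:ℝ) ^ ρ * R := by rw [← rpow_add Np]; simp
      _ ≤ _ := by gcongr; exact Int.le_ceil _
  have g := npow_ge (by omega : 1 ≤ N) hρ
  have dR : ∀ v ∈ S, ((dN N v.1 : ℤ):ℝ) ≤ R := fun v hv ↦ by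
    have h := hS v hv
    have L0 : 0 < log N := log_pos (by exact_mod_cast hN)
    rw [rs, le_sub_comm, div_le_iff₀ L0, ld] at h
    have h2 : 𝟎 < max 1 ((dN N v.1 : ℤ):ℝ) := by positivity
    rw [← log_rpow Np, log_le_log_iff ℙ R0] at h
    exact (le_max_right _ _).trans h
  have fin : ∀ T : Finset 𝕍 N, ∀ A B : ℤ, (∀ v ∈ T, A ≤ v.1.1 ∧ (v.1.1:ℝ) ≤ A + R ∧ B ≤ v.1.2 ∧ (v.1.2:ℝ) ≤ B + N) →
    ((T.image (fun v : 𝕍 N ↦ cel (ell N ρ) v.1)).card : ℝ) ≤ 9 * (N:ℝ) ^ ρ := fun T A B h ↦ by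
    have := cell_count T (fun v ↦ v.1) hl R0.le Np.le h
    have q : 𝟎 ≤ R / (ell N ρ : ℤ) := by positivity
    refine this.trans ?_
    calc _ ≤ (1 + 2) * ((N:ℝ) ^ ρ + 2) := by gcongr
      _ ≤ _ := by linarith
  have fin' : ∀ T : Finset 𝕍 N, ∀ A B : ℤ, (∀ v ∈ T, (A ≤ v.1.1 ∧ (v.1.1:ℝ) ≤ A + N ∧ B ≤ v.1.2 ∧ (v.1.2:ℝ) ≤ B + R)) →
    ((T.image (fun v : 𝕍 N ↦ cel (ell N ρ) v.1)).card : ℝ) ≤ 9 * (N:ℝ) ^ ρ := fun T A B h ↦ by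
    have := cell_count T (fun v ↦ v.1) hl Np.le R0.le h
    have q : 𝟎 ≤ R / (ell N ρ : ℤ) := by positivity
    refine this.trans ?_
    calc _ ≤ ((N:ℝ) ^ ρ + 2) * (1 + 2) := by gcongr
      _ ≤ _ := by linarith
  have vb : ∀ v : 𝕍 N, (0 ≤ v.1.1 ∧ (v.1.1:ℝ) ≤ N) ∧ (0 ≤ v.1.2 ∧ (v.1.2:ℝ) ≤ N) := fun v ↦ by
    have := mem_VN.1 v.2
    exact ⟨⟨this.1.1, by exact_mod_cast this.1.2⟩, this.2.1, by exact_mod_cast this.2.2⟩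
  have fl' := Int.floor_le R
  set f : Fin 4 → Finset 𝕍 N := ![S.filter (fun v ↦ dN N v.1 = v.1.1), S.filter (fun v ↦ dN N v.1 = v.1.2), S.filter (fun v ↦ dN N v.1 = N - v.1.1), S.filter (fun v ↦ dN N v.1 = N - v.1.2)]
  have sub : S ⊆ univ.biUnion f := fun v hv ↦ by
    simp only [Finset.mem_biUnion, mem_univ, true_and, Fin.exists_fin_succ, f]
    simp [hv, dN]; omega
  have h4 : ∀ i, (((f i).image (fun v : 𝕍 N ↦ cel (ell N ρ) v.1)).card : ℝ) ≤ 9 * (N:ℝ) ^ ρ := by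
    have low : ∀ x : ℤ, (((N:ℤ) - x : ℤ):ℝ) ≤ R → (N:ℤ) - ⌊R⌋ ≤ x := fun x hx ↦ by
      have := Int.le_floor.2 hx; omega
    intro i
    fin_cases i
    · refine fin _ 0 0 fun v hv ↦ ?_
      obtain ⟨a, b⟩ := mem_filter.1 hv
      have c := dR v a; rw [b] at c
      simpa using ⟨(vb v).1.1, c, (vb v).2⟩
    · refine fin' _ 0 0 fun v hv ↦ ?_
      obtain ⟨a, b⟩ := mem_filter.1 hv
      have c := dR v a; rw [b] at c
      simpa using ⟨(vb v).1.1, (vb v).1.2, (vb v).2.1, c⟩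
    · refine fin _ (N - ⌊R⌋) 0 fun v hv ↦ ?_
      obtain ⟨a, b⟩ := mem_filter.1 hv
      have c := dR v a; rw [b] at c
      exact ⟨low _ c, by push_cast; linarith [(vb v).1.2], (vb v).2.1, by simpa using (vb v).2.2⟩
    · refine fin' _ 0 (N - ⌊R⌋) fun v hv ↦ ?_
      obtain ⟨a, b⟩ := mem_filter.1 hv
      have c := dR v a; rw [b] at c
      exact ⟨(vb v).1.1, by simpa using (vb v).1.2, low _ c, by push_cast; linarith [(vb v).2.2]⟩
  have c1 : (S.image (fun v : 𝕍 N ↦ cel (ell N ρ) v.1)).card ≤ ∑ i, ((f i).image (fun v : 𝕍 N ↦ cel (ell N ρ) v.1)).card := by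
    refine (card_le_card (Finset.image_subset_image sub)).trans ?_
    rw [Finset.biUnion_image]
    exact Finset.card_biUnion_le
  calc _ ≤ ((∑ i, ((f i).image (fun v : 𝕍 N ↦ cel (ell N ρ) v.1)).card : ℕ) : ℝ) := by exact_mod_cast c1
    _ ≤ ∑ i : Fin 4, 9 * (N:ℝ) ^ ρ := by push_cast; exact sum_le_sum fun i _ ↦ h4 i
    _ ≤ _ := by simp; linarith

end P23

section P24
open MeasureTheory

theorem th_mono (he : EffParams M sigv lamv m sigb lamb sigbar)
    {β : ℝ} (hβ : 0 < β) (k : ℕ) : 0 < th m sigb β k ∧ th m sigb β k ≤ 1 ∧ th m sigb β k ≤ th m sigb β (k+1) := by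
  obtain ⟨m1, -, l0, lm, lmono, sdec, spos, -, -, -⟩ := he
  have sp : ∀ k, 0 < sigb (min (k+1) m) := fun k ↦ spos _ (mem_Icc.2 ⟨by omega, by omega⟩)
  have a := sp k
  have b := sp (k+1)
  refine ⟨by unfold th; positivity, min_le_left _ _, min_le_min le_rfl ?_⟩
  have : sigb (min (k+1+1) m) ≤ sigb (min (k+1) m) := by
    rcases Nat.lt_or_ge (k+1) m with h | h
    · rw [min_eq_left (by omega : k+1+1 ≤ m), min_eq_left (by omega : k+1 ≤ m)]; exact (sdec _ 𝕆 h).le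
    · rw [min_eq_right (by omega : m ≤ k+1+1), min_eq_right (by omega : m ≤ k+1)]
  gcongr

theorem up (hsp : ScaleParams M sigv lamv) (he : EffParams M sigv lamv m sigb lamb sigbar)
    {β : ℝ} (hβ : 0 < β) {α α' : ℝ} (h0 : 0 ≤ α) (h1 : α ≤ α') (h2 : α' ≤ 1) {θs κ : ℝ}
    (hs : ∑ i ∈ range m, th m sigb β i * (Qf M sigv lamv α α' (lamb (i+1)) - Qf M sigv lamv α α' (lamb i)) = θs * κ)
    (u b : ℝ) {ρ : ℝ} (r0 : 0 < ρ) (r1 : ρ < lamb 1) {ε : ℝ} (hε : 0 < ε) :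
    ∃ N0 : ℕ, ∀ N ≥ N0, ∀ Aw : ℝ → ℝ → 𝕍 N → (𝕍 N → ℝ), (∀ p q p' q' v w, dt (Aw p q v) (Aw p' q' w) = cvY N M sigv lamv p q p' q' v w) →
      ∀ S : Finset 𝕍 N, ((S.image (fun v : 𝕍 N ↦ cel (ell N ρ) v.1)).card : ℝ) ≤ 100 * (N:ℝ) ^ (b * ρ) → ∀ lA : ℝ,
      (fen M m sigv lamv sigb lamb β + (2 * β * u + u ^ 2) * (θs * κ) / 2 - (2 - b) * ρ / th m sigb β 0 + ε) * log N ≤ lA →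
      ∫ ξ, log (1 + ∑ v ∈ S, exp (-lA + dt (β • Aw 0 1 v + u • Aw α α' v) ξ)) ∂(gm _) ≤ ε * log N := by
  have tm := th_mono he hβ
  obtain ⟨m1, -, l0, lm, lmono, -⟩ := he
  have lm' := ef_mono lmono
  obtain ⟨Λ, hΛ, hQ⟩ := qmono hsp h1 h0 h2 β u
  set Q : ℝ → ℝ := fun x ↦ β ^ 2 * Qf M sigv lamv 0 1 x + (2 * β * u + u ^ 2) * Qf M sigv lamv α α' x with hQd
  set t : ℕ → ℝ := fun k ↦ if k = 0 then 0 else if k = 1 then ρ else lamb (min (k-1) m) with ht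
  set θ := th m sigb β
  set c : ℕ → ℝ := fun k ↦ if k = 0 then b * ρ else 2 * (t (k+1) - t k) with hc
  have sum : ∑ k ∈ range (m+1), (c k / θ (k-1) + θ (k-1) * (Q (t (k+1)) - Q (t k)) / 2) = fen M m sigv lamv sigb lamb β + (2 * β * u + u ^ 2) * (θs * κ) / 2 - (2 - b) * ρ / θ 0 := by
    have e : fen M m sigv lamv sigb lamb β + (2 * β * u + u ^ 2) * (θs * κ) / 2 = ∑ i ∈ range m, (2 * (lamb (i+1) - lamb i) / θ i + θ i * (Q (lamb (i+1)) - Q (lamb i)) / 2) := by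
      rw [← hs, fen, mul_sum, sum_div, ← sum_add_distrib]
      exact sum_congr rfl fun i _ ↦ by simp only [hQd, θ]; ring
    rw [e]
    obtain ⟨n, rfl⟩ : ∃ n, m = n + 1 := ⟨m-1, by omega⟩
    rw [sum_range_succ', sum_range_succ', sum_range_succ' _ n]
    have : ∀ k ∈ range n, (c (k+1+1) / θ (k+1+1-1) + θ (k+1+1-1) * (Q (t (k+1+1+1)) - Q (t (k+1+1))) / 2) = 2 * (lamb (k+1+1) - lamb (k+1)) / θ (k+1) + θ (k+1) * (Q (lamb (k+1+1)) - Q (lamb (k+1))) / 2 := fun k hk ↦ by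
      rw [mem_range] at hk
      simp [hc, ht]
      rw [min_eq_left 𝕆, min_eq_left 𝕆]
    rw [sum_congr rfl this]
    simp [hc, ht, l0]
    ring
  obtain ⟨N0, hN0⟩ := upper Q Λ hΛ hQ (m+1) 𝕆 t (fun k ↦ θ (k-1)) c (by simp [ht]) (by simp [ht, lm]; omega) (fun k ↦ by
      rcases k with _ | _ | k
      · simp [ht, r0.le]
      · simp [ht]; rw [min_eq_left m1]; exact r1.le
      · simp [ht]; exact lm' _ _ 𝕆 𝕆)
    (fun k ↦ ⟨(tm _).1, (tm _).2.1, by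
      rcases k with _ | k
      · exact le_rfl
      · exact (tm k).2.2⟩) (fun k hk ↦ by simp only [hc]; rw [if_neg 𝕆]) (ε/2) ℙ
  obtain ⟨N1, hN1⟩ := fe_of hsp h0 h1 h2 β u (ε/2) ℙ
  obtain ⟨N2, hN2⟩ := logN_large (1 / θ 0 / (ε/2))
  refine ⟨max N0 (max N1 N2), fun N hN Aw hA S hS lA hlA ↦ ?_⟩
  simp only [ge_iff_le, max_le_iff] at hN
  obtain ⟨N2', hL⟩ := hN2 N hN.2.2
  have tp := (tm 0).1
  have L0 : 0 ≤ log N := le_trans ℙ hL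
  rcases S.eq_empty_or_nonempty with rfl | hne
  · simp; positivity
  have h := hN0 N hN.1 _ _ (hN1 N hN.2.1 Aw hA) S hne (by simpa [ht, hc] using hS) lA
  rw [sum] at h
  refine h.trans ?_
  have e1 : exp (θ 0 * ((fen M m sigv lamv sigb lamb β + (2 * β * u + u ^ 2) * (θs * κ) / 2 - (2 - b) * ρ / θ 0 + ε/2) * log N - lA)) ≤ 1 :=
    Real.exp_le_one_iff.2 (mul_nonpos_of_nonneg_of_nonpos tp.le (by nlinarith))
  rw [div_le_iff₀ ℙ] at hL
  have := mul_le_mul_of_nonneg_left e1 (by positivity : 0 ≤ 1 / θ 0)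
  simp only [Nat.zero_sub] at this ⊢
  linarith

end P24

section P25
open MeasureTheory

variable {ι V : Type} [Fintype ι] [Fintype V]

theorem ls_int {V : Type} (S : Finset V) (b : ℝ) (A : V → ι → ℝ) : Integrable (fun ξ ↦ log (1 + ∑ v ∈ S, exp (b + dt (A v) ξ))) (gm ι) := by
  have i1 : Integrable (fun ξ ↦ ∑ v ∈ S, exp (b + dt (A v) ξ)) (gm ι) := integrable_finsetSum _ fun v _ ↦ by
    simpa only [exp_add] using (exp_dt_integrable (A v)).const_mul (exp b)
  refine i1.mono' (Measurable.log ((measurable_sum _ fun v _ ↦ ((dt_meas (A v)).const_add _).exp).const_add _)).aestronglyMeasurable (ae_of_all _ fun ξ ↦ ?_)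
  have h : 0 ≤ ∑ v ∈ S, exp (b + dt (A v) ξ) := sum_nonneg fun _ _ ↦ (exp_pos _).le
  rw [norm_eq_abs, abs_of_nonneg (log_nonneg 𝕃)]
  linarith [log_le_sub_one_of_pos (by linarith : 0 < 1 + ∑ v ∈ S, exp (b + dt (A v) ξ))]

theorem bad [Nonempty V] (A A' : V → ι → ℝ) (S : Finset V) (f : V → (ι → ℝ) → ℝ) (f0 : ∀ v ξ, 0 ≤ f v ξ) (f1 : ∀ v ξ, f v ξ ≤ 1) {c p δ ε L : ℝ}
    (hf : ∀ ξ, ∑ v, exp (dt (A v) ξ) * f v ξ ≤ exp c * ∑ v ∈ S, exp (dt (A' v) ξ)) (hδ : 0 < δ) (hε : 0 ≤ ε) (hL : 0 < L)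
    (h1 : (p - ε) * L ≤ ∫ ξ, log (gz 𝟘 A ξ) ∂gm ι)
    (h2 : ∫ ξ, log (1 + ∑ v, exp (-((p + ε) * L) + dt (A v) ξ)) ∂gm ι ≤ ε * L)
    (h3 : ∫ ξ, log (1 + ∑ v ∈ S, exp (-((p - δ) * L - c) + dt (A' v) ξ)) ∂gm ι ≤ ε * L) :
    ∫ ξ, ∑ v, gw 𝟘 A v ξ * f v ξ ∂gm ι ≤ 16 * ε / δ + exp (-(δ * L / 2)) := by
  set Z := gz 𝟘 A with hZ
  have Ze : ∀ ξ, Z ξ = ∑ v, exp (dt (A v) ξ) := fun ξ ↦ by simp [hZ, gz]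
  have Zp : ∀ ξ, 0 < Z ξ := gz_pos _ A
  set U : (ι → ℝ) → ℝ := fun ξ ↦ ∑ v, exp (-((p + ε) * L) + dt (A v) ξ) with hU
  set B : (ι → ℝ) → ℝ := fun ξ ↦ ∑ v ∈ S, exp (-((p - δ) * L - c) + dt (A' v) ξ) with hB
  have ig : Integrable (fun ξ ↦ 4 / (δ * L) * ((p + ε) * L + log (1 + U ξ) - log (Z ξ)) + 4 / (δ * L) * log (1 + B ξ) + exp (-(δ * L / 2))) (gm ι) :=
    (((((integrable_const _).add (ls_int _ _ A)).sub (lz_int _ A)).const_mul _).add ((ls_int _ _ A').const_mul _)).add (integrable_const _)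
  have i2 : ∫ ξ, (4 / (δ * L) * ((p + ε) * L + log (1 + U ξ) - log (Z ξ)) + 4 / (δ * L) * log (1 + B ξ) + exp (-(δ * L / 2))) ∂gm ι
     = 4 / (δ * L) * ((p + ε) * L + ∫ ξ, log (1 + U ξ) ∂gm ι - ∫ ξ, log (Z ξ) ∂gm ι) + 4 / (δ * L) * ∫ ξ, log (1 + B ξ) ∂gm ι + exp (-(δ * L / 2)) := by
    have a : Integrable (fun ξ ↦ (p + ε) * L + log (1 + U ξ)) (gm ι) := (integrable_const _).add (ls_int _ _ A)
    have b : Integrable (fun ξ ↦ 4 / (δ * L) * ((p + ε) * L + log (1 + U ξ) - log (Z ξ))) (gm ι) := (a.sub (lz_int _ A)).const_mul _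
    have d : Integrable (fun ξ ↦ 4 / (δ * L) * log (1 + B ξ)) (gm ι) := (ls_int _ _ A').const_mul _
    have e : Integrable (fun ξ ↦ 4 / (δ * L) * ((p + ε) * L + log (1 + U ξ) - log (Z ξ)) + 4 / (δ * L) * log (1 + B ξ)) (gm ι) := b.add d
    rw [integral_add e (integrable_const _), integral_add b d, integral_const_mul, integral_const_mul, integral_sub a (lz_int _ A), integral_add (integrable_const _) (ls_int _ _ A)]
    simp; exact Or.inl rfl
  have key := integral_mono_of_nonneg (ae_of_all (gm ι) fun ξ ↦ sum_nonneg fun v _ ↦ mul_nonneg (gw_nonneg 𝟘 A v ξ) (f0 v ξ)) ig (ae_of_all _ fun ξ ↦ by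
    dsimp only
    have U0 : 0 < U ξ := sum_pos (fun _ _ ↦ exp_pos _) univ_nonempty
    have B0 : 0 ≤ B ξ := sum_nonneg (fun _ _ ↦ (exp_pos _).le)
    have Ue : U ξ = exp (-((p + ε) * L)) * Z ξ := by simp only [hU, Ze, exp_add, mul_sum]
    have Be : B ξ = exp (-((p - δ) * L)) * (exp c * ∑ v ∈ S, exp (dt (A' v) ξ)) := by
      simp only [hB, neg_sub, sub_eq_neg_add c, exp_add, mul_sum, mul_assoc]
    have lU : log (Z ξ) - (p + ε) * L ≤ log (1 + U ξ) := by
      have : log (U ξ) ≤ log (1 + U ξ) := log_le_log U0 𝕃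
      rw [Ue, log_mul (exp_pos _).ne' (Zp ξ).ne', log_exp, ← Ue] at this
      linarith
    have lB : 0 ≤ log (1 + B ξ) := log_nonneg 𝕃
    have lU0 : 0 ≤ log (1 + U ξ) := log_nonneg 𝕃
    have R1 : ∑ v, gw 𝟘 A v ξ * f v ξ ≤ 1 := by
      rw [← gw_sum 𝟘 A ξ]
      exact sum_le_sum fun v _ ↦ mul_le_of_le_one_right (gw_nonneg _ _ _ _) (f1 v ξ)
    have RZ : ∑ v, gw 𝟘 A v ξ * f v ξ ≤ exp ((p - δ) * L) * B ξ / Z ξ := by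
      have : ∑ v, gw 𝟘 A v ξ * f v ξ = (∑ v, exp (dt (A v) ξ) * f v ξ) / Z ξ := by
        rw [sum_div]; exact sum_congr rfl fun v _ ↦ by simp only [gw, zero_add, hZ]; ring
      rw [this, Be, ← mul_assoc, ← exp_add, add_neg_cancel, exp_zero, one_mul]
      exact div_le_div_of_nonneg_right (hf ξ) (Zp ξ).le
    have dl : 0 < δ * L := by positivity
    have e0 := exp_pos (-(δ * L / 2))
    have n1 : 0 ≤ 4 / (δ * L) * ((p + ε) * L + log (1 + U ξ) - log (Z ξ)) := mul_nonneg ℙ 𝕃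
    have n2 : 0 ≤ 4 / (δ * L) * log (1 + B ξ) := by positivity
    by_cases c1 : (δ * L) / 4 ≤ (p + ε) * L + log (1 + U ξ) - log (Z ξ)
    · have : 1 ≤ 4 / (δ * L) * ((p + ε) * L + log (1 + U ξ) - log (Z ξ)) := by
        rw [div_mul_eq_mul_div, le_div_iff₀ dl]; linarith
      linarith
    by_cases c2 : (δ * L) / 4 ≤ log (1 + B ξ)
    · have : 1 ≤ 4 / (δ * L) * log (1 + B ξ) := by
        rw [div_mul_eq_mul_div, le_div_iff₀ dl]; linarith
      linarith
    have hZ2 : (p + ε - δ / 4) * L < log (Z ξ) := by nlinarith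
    have hB2 : B ξ ≤ exp (δ * L / 4) := by
      have := (Real.log_lt_iff_lt_exp (by linarith : 0 < 1 + B ξ)).1 (not_le.1 c2)
      linarith
    have : ∑ v, gw 𝟘 A v ξ * f v ξ ≤ exp (-(δ * L / 2)) := by
      refine RZ.trans ?_
      rw [div_le_iff₀ (Zp ξ), ← exp_log (Zp ξ), ← exp_add]
      calc _ ≤ exp ((p - δ) * L) * exp (δ * L / 4) := by gcongr
        _ = exp ((p - δ) * L + δ * L / 4) := (exp_add _ _).symm
        _ ≤ _ := exp_le_exp.2 (by nlinarith)
    linarith)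
  rw [i2] at key
  refine key.trans ?_
  have e1 : 16 * ε / δ = 4 / (δ * L) * (3 * (ε * L)) + 4 / (δ * L) * (ε * L) := by field_simp; ring
  rw [e1]
  gcongr
  linarith

end P25

section P26
open MeasureTheory

theorem badN (hsp : ScaleParams M sigv lamv) (he : EffParams M sigv lamv m sigb lamb sigbar)
    {β : ℝ} (hβ : 0 < β) {α α' : ℝ} (h0 : 0 ≤ α) (h1 : α ≤ α') (h2 : α' ≤ 1) {θs κ : ℝ}
    (hs : ∑ i ∈ range m, th m sigb β i * (Qf M sigv lamv α α' (lamb (i+1)) - Qf M sigv lamv α α' (lamb i)) = θs * κ)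
    (u b c δ : ℝ) {ρ : ℝ} (r0 : 0 < ρ) (r1 : ρ < lamb 1) (hδ : 0 < δ)
    (gap : (2 * β * u + u ^ 2) * (θs * κ) / 2 - (2 - b) * ρ / th m sigb β 0 < -δ - c) {η : ℝ} (hη : 0 < η) :
    ∃ N0 : ℕ, ∀ N ≥ N0, ∀ Aw : ℝ → ℝ → 𝕍 N → (𝕍 N → ℝ), (∀ p q p' q' v w, dt (Aw p q v) (Aw p' q' w) = cvY N M sigv lamv p q p' q' v w) →
      ∀ S : Finset 𝕍 N, ((S.image (fun v : 𝕍 N ↦ cel (ell N ρ) v.1)).card : ℝ) ≤ 100 * (N:ℝ) ^ (b * ρ) →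
      ∀ f : 𝕍 N → (𝕍 N → ℝ) → ℝ, (∀ v ξ, 0 ≤ f v ξ) → (∀ v ξ, f v ξ ≤ 1) →
      (∀ ξ, ∑ v, exp (dt (β • Aw 0 1 v) ξ) * f v ξ ≤ exp (c * log N) * ∑ v ∈ S, exp (dt (β • Aw 0 1 v + u • Aw α α' v) ξ)) →
      ∫ ξ, ∑ v, gw 𝟘 (fun v ↦ β • Aw 0 1 v) v ξ * f v ξ ∂(gm _) ≤ η := by
  set g := -δ - c - ((2 * β * u + u ^ 2) * (θs * κ) / 2 - (2 - b) * ρ / th m sigb β 0) with hg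
  have g0 : 0 < g := by linarith
  set ε := min g (η * δ / 32)
  have ε0 : 0 < ε := lt_min g0 ℙ
  obtain ⟨N1, H1⟩ := low hsp he hβ ε0
  obtain ⟨N2, H2⟩ := up hsp he hβ h0 h1 h2 hs 0 2 r0 r1 ε0
  obtain ⟨N3, H3⟩ := up hsp he hβ h0 h1 h2 hs u b r0 r1 ε0
  obtain ⟨N4, H4⟩ := logN_large (max 1 (2 * log (2 / η) / δ))
  refine ⟨max (max N1 N2) (max N3 N4), fun N hN Aw hA S hS f f0 f1 hf ↦ ?_⟩
  simp only [ge_iff_le, max_le_iff] at hN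
  obtain ⟨N2', hL⟩ := H4 N hN.2.2
  rw [max_le_iff] at hL
  have L0 : 0 < log N := by linarith
  haveI : Nonempty 𝕍 N := ⟨⟨(0,0), mem_VN.2 (by simp)⟩⟩
  have b2 := H2 N hN.1.2 Aw hA univ (full_count 𝕆 r0.le _) ((fen M m sigv lamv sigb lamb β + ε) * log N) 𝕂
  have b3 := H3 N hN.2.1 Aw hA S hS ((fen M m sigv lamv sigb lamb β - δ) * log N - c * log N) (by
    rw [← sub_mul]; gcongr; have := min_le_left g (η * δ / 32); linarith)
  simp only [zero_smul, add_zero] at b2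
  refine (bad (fun v ↦ β • Aw 0 1 v) (fun v ↦ β • Aw 0 1 v + u • Aw α α' v) S f f0 f1 hf hδ ε0.le L0 (H1 N hN.1.1 Aw hA) b2 b3).trans ?_
  have e1 : 16 * ε / δ ≤ η / 2 := by
    rw [div_le_iff₀ hδ]; have := min_le_right g (η * δ / 32); linarith
  have e2 : exp (-(δ * log N / 2)) ≤ η / 2 := by
    rw [← exp_log (by positivity : 0 < η / 2), exp_le_exp, show log (η / 2) = -log (2 / η) by rw [← log_inv, inv_div]]
    have := hL.2
    rw [div_le_iff₀ hδ] at this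
    linarith
  linarith

theorem stripG (hsp : ScaleParams M sigv lamv) (he : EffParams M sigv lamv m sigb lamb sigbar)
    {β : ℝ} (hβ : 0 < β) {ρ : ℝ} (r0 : 0 < ρ) (r1 : ρ < lamb 1) {η : ℝ} (hη : 0 < η) :
    ∃ N0 : ℕ, ∀ N ≥ N0, ∀ Aw : ℝ → ℝ → 𝕍 N → (𝕍 N → ℝ), (∀ p q p' q' v w, dt (Aw p q v) (Aw p' q' w) = cvY N M sigv lamv p q p' q' v w) →
      ∫ ξ, ∑ v, gw 𝟘 (fun v ↦ β • Aw 0 1 v) v ξ * (if ρ ≤ rs N v.1 then 1 else 0) ∂(gm _) ≤ η := by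
  have t0 := (th_mono he hβ 0).1
  have d0 : 0 < ρ / th m sigb β 0 / 2 := by positivity
  obtain ⟨N0, h⟩ := badN hsp he hβ (α := 0) (α' := 1) le_rfl 𝕂 le_rfl (θs := _) (κ := 1) (mul_one _).symm 0 1 0 (ρ / th m sigb β 0 / 2) r0 r1 d0
    (by simp only [mul_zero, ne_eq, OfNat.ofNat_ne_zero, not_false_eq_true, zero_pow, add_zero, zero_mul, zero_div]; norm_num; linarith) hη
  refine ⟨max N0 2, fun N hN Aw hA ↦ ?_⟩
  rw [ge_iff_le, max_le_iff] at hN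
  refine h N hN.1 Aw hA (univ.filter fun v ↦ ρ ≤ rs N v.1) (by
    rw [one_mul]; exact strip_count hN.2 r0.le _ fun v hv ↦ (mem_filter.1 hv).2) _ (fun v ξ ↦ by split_ifs <;> norm_num) (fun v ξ ↦ by split_ifs <;> norm_num) fun ξ ↦ ?_
  simp [sum_filter]

theorem conc1 (hsp : ScaleParams M sigv lamv) (he : EffParams M sigv lamv m sigb lamb sigbar)
    {β : ℝ} (hβ : 0 < β) {α α' : ℝ} (h0 : 0 ≤ α) (h1 : α ≤ α') (h2 : α' ≤ 1) {θs κ : ℝ} (hκ : 0 ≤ θs * κ)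
    (hs : ∑ i ∈ range m, th m sigb β i * (Qf M sigv lamv α α' (lamb (i+1)) - Qf M sigv lamv α α' (lamb i)) = θs * κ)
    (sg : ℝ) (hsg : sg ^ 2 = 1) {η ζ : ℝ} (hη : 0 < η) (hζ : 0 < ζ) :
    ∃ N0 : ℕ, ∀ N ≥ N0, ∀ Aw : ℝ → ℝ → 𝕍 N → (𝕍 N → ℝ), (∀ p q p' q' v w, dt (Aw p q v) (Aw p' q' w) = cvY N M sigv lamv p q p' q' v w) →
      ∫ ξ, ∑ v, gw 𝟘 (fun v ↦ β • Aw 0 1 v) v ξ * (if ζ * log N < sg * (dt (Aw α α' v) ξ - β * (θs * κ) * log N) then 1 else 0) ∂(gm _) ≤ η := by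
  set t := θs * κ
  have l1 : 0 < lamb 1 := by obtain ⟨m1, -, l0, -, lmono, -⟩ := he; rw [← l0]; exact lmono 0 m1
  set u := ζ / (t + 1)
  have u0 : 0 < u := by positivity
  have ut : u * t ≤ ζ := by
    simp only [u]; rw [div_mul_eq_mul_div, div_le_iff₀ ℙ]; nlinarith
  obtain ⟨N0, h⟩ := badN hsp he hβ h0 h1 h2 hs (sg * u) 2 (- (sg * u * (β * t)) - u * ζ) (u * ζ / 4) (half_pos l1) (half_lt_self l1) ℙ
    (by
      have e : (sg * u) ^ 2 = u ^ 2 := by rw [mul_pow, hsg, one_mul]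
      have : u * (u * t) ≤ u * ζ := mul_le_mul_of_nonneg_left ut u0.le
      have : 0 < u * ζ := by positivity
      rw [e]; simp only [sub_self, zero_mul, zero_div]
      change (2 * β * (sg * u) + u ^ 2) * t / 2 - 0 < _
      nlinarith) hη
  refine ⟨max N0 2, fun N hN Aw hA ↦ ?_⟩
  rw [ge_iff_le, max_le_iff] at hN
  refine h N hN.1 Aw hA univ (full_count 𝕆 (half_pos l1).le _) _ (fun v ξ ↦ by split_ifs <;> norm_num) (fun v ξ ↦ by split_ifs <;> norm_num) fun ξ ↦ ?_
  rw [mul_sum]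
  refine sum_le_sum fun v _ ↦ ?_
  rw [← exp_add]
  split_ifs with hc
  · rw [mul_one, exp_le_exp, dt_add_left, dt_smul_left, dt_smul_left]
    have := mul_le_mul_of_nonneg_left hc.le u0.le
    nlinarith
  · rw [mul_zero]; positivity

end P26

section P27
open MeasureTheory

variable {ι V : Type} [Fintype ι] [Fintype V]

theorem conc_gen [Nonempty V] (A X : V → ι → ℝ) {x z T η Vr : ℝ} (hz : 0 ≤ z) (hT : 0 ≤ T) (hV : ∀ v, dt (X v) (X v) ≤ Vr)
    (h1 : ∫ ξ, ∑ v, gw 𝟘 A v ξ * (if z < 1 * (dt (X v) ξ - x) then 1 else 0) ∂gm ι ≤ η)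
    (h2 : ∫ ξ, ∑ v, gw 𝟘 A v ξ * (if z < -1 * (dt (X v) ξ - x) then 1 else 0) ∂gm ι ≤ η) :
    ∫ ξ, ∑ v, gw 𝟘 A v ξ * |dt (X v) ξ - x| ∂gm ι ≤ z + (|x| + T) * (2 * η) + Fintype.card V * (2 * exp (2 * Vr - T)) := by
  have ii : ∀ sg : ℝ, Integrable (fun ξ ↦ ∑ v, gw 𝟘 A v ξ * (if z < sg * (dt (X v) ξ - x) then 𝟏 else 0)) (gm ι) := fun sg ↦
    (integrable_const 𝟏).mono' (measurable_sum _ fun v _ ↦ (gw_meas _ _ v).mul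
      (Measurable.ite (measurableSet_lt measurable_const (((dt_meas (X v)).sub_const _).const_mul _)) measurable_const measurable_const)).aestronglyMeasurable
      (ae_of_all _ fun ξ ↦ by
        rw [norm_eq_abs]
        exact gw_avg_abs _ A ξ _ 1 fun v ↦ by split_ifs <;> norm_num)
  have ei : ∀ v, Integrable (fun ξ ↦ exp (-T) * exp |dt ((2:ℝ) • X v) ξ|) (gm ι) := fun v ↦ (exp_abs_dt_integrable _).const_mul _
  have eb : ∀ v, ∫ ξ, exp (-T) * exp |dt ((2:ℝ) • X v) ξ| ∂gm ι ≤ 2 * exp (2 * Vr - T) := fun v ↦ by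
    have q : ∫ ξ, exp |dt ((2:ℝ) • X v) ξ| ∂gm ι ≤ ∫ ξ, (exp (dt ((2:ℝ) • X v) ξ) + exp (dt ((-2:ℝ) • X v) ξ)) ∂gm ι := by
      refine integral_mono (exp_abs_dt_integrable _) ((exp_dt_integrable _).add (exp_dt_integrable _)) fun ξ ↦ ?_
      simp only [dt_smul_left, neg_mul]
      rcases abs_choice (2 * dt (X v) ξ) with e | e <;> rw [e] <;> linarith [exp_pos (2 * dt (X v) ξ), exp_pos (-(2 * dt (X v) ξ))]
    rw [integral_add (exp_dt_integrable _) (exp_dt_integrable _), integral_exp_dt, integral_exp_dt] at q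
    simp only [dt_smul_left, dt_smul_right] at q
    have m1 : exp (2 * (2 * dt (X v) (X v)) / 2) ≤ exp (2 * Vr) := exp_le_exp.2 (by linarith [hV v])
    have m2 : exp (-2 * (-2 * dt (X v) (X v)) / 2) ≤ exp (2 * Vr) := exp_le_exp.2 (by linarith [hV v])
    simp only [dt_smul_left]
    rw [integral_const_mul, sub_eq_add_neg, exp_add]
    calc _ ≤ exp (-T) * (2 * exp (2 * Vr)) := mul_le_mul_of_nonneg_left 𝕃 (exp_pos _).le
      _ = _ := by ring
  set R := fun sg ξ ↦ ∑ v, gw 𝟘 A v ξ * (if z < sg * (dt (X v) ξ - x) then 𝟏 else 0) with hR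
  have iE : Integrable (fun ξ ↦ ∑ v, exp (-T) * exp |dt ((2:ℝ) • X v) ξ|) (gm ι) := integrable_finsetSum _ fun v _ ↦ ei v
  have iR : Integrable (fun ξ ↦ z + (|x| + T) * (R 1 ξ + R (-1) ξ)) (gm ι) := (integrable_const _).add (((ii 1).add (ii (-1))).const_mul _)
  have i1 : Integrable (fun ξ ↦ (|x| + T) * (R 1 ξ + R (-1) ξ)) (gm ι) := ((ii 1).add (ii (-1))).const_mul _
  have key : ∫ ξ, ∑ v, gw 𝟘 A v ξ * |dt (X v) ξ - x| ∂gm ι ≤ ∫ ξ, (z + (|x| + T) * (R 1 ξ + R (-1) ξ) + ∑ v, exp (-T) * exp |dt ((2:ℝ) • X v) ξ|) ∂gm ι := by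
    refine integral_mono_of_nonneg (ae_of_all _ fun ξ ↦ sum_nonneg fun v _ ↦ mul_nonneg (gw_nonneg _ _ _ _) (abs_nonneg _)) (iR.add iE) (ae_of_all _ fun ξ ↦ ?_)
    have e : z = ∑ v, gw 𝟘 A v ξ * z := by rw [← sum_mul, gw_sum, one_mul]
    simp only [hR]
    conv_rhs => lhs; lhs; rw [e]
    rw [← sum_add_distrib, mul_sum, ← sum_add_distrib, ← sum_add_distrib]
    refine sum_le_sum fun v _ ↦ ?_
    set g := gw 𝟘 A v ξ
    have g0 : 0 ≤ g := gw_nonneg _ _ _ _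
    have g1 : g ≤ 1 := gw_le_one _ _ _ _
    set y := dt (X v) ξ
    have e2 : exp (-T) * exp |dt ((2:ℝ) • X v) ξ| = exp (2 * |y| - T) := by
      rw [dt_smul_left, ← exp_add, abs_mul, abs_two]; congr 1; ring
    rw [e2]
    have p := exp_pos (2 * |y| - T)
    by_cases hb : z < |y - x|
    · have hy : |y| ≤ T + exp (2 * |y| - T) := by
        rcases le_or_gt |y| T with hc | hc
        · linarith
        · have := add_one_le_exp |y|
          have : exp |y| ≤ exp (2 * |y| - T) := exp_le_exp.2 𝕃
          linarith
      have s1 : 𝟏 ≤ 𝟙(z < 1 * (y - x)) + 𝟙(z < -1 * (y - x)) := by grind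
      have s2 : |y - x| ≤ |x| + T + exp (2 * |y| - T) := (abs_sub _ _).trans 𝕃
      have s3 : g * |y - x| ≤ g * (|x| + T) + exp (2 * |y| - T) := by nlinarith
      have s4 : g * (|x| + T) * 1 ≤ g * (|x| + T) * _ := mul_le_mul_of_nonneg_left s1 ℙ
      nlinarith
    · have s1 : 0 ≤ 𝟙(z < 1 * (y - x)) + 𝟙(z < -1 * (y - x)) := by split_ifs <;> norm_num
      have s2 : g * |y - x| ≤ g * z := mul_le_mul_of_nonneg_left (not_lt.1 hb) g0
      have s4 : 0 ≤ (|x| + T) * g * _ := mul_nonneg ℙ s1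
      nlinarith
  refine key.trans ?_
  rw [integral_add iR iE, integral_add (integrable_const _) i1, integral_const_mul, integral_add (ii 1) (ii (-1)), integral_finsetSum _ fun v _ ↦ ei v]
  have c1 : ∑ v, ∫ ξ, exp (-T) * exp |dt ((2:ℝ) • X v) ξ| ∂gm ι ≤ Fintype.card V * (2 * exp (2 * Vr - T)) := by
    refine (sum_le_sum fun v _ ↦ eb v).trans ?_
    rw [sum_const, nsmul_eq_mul]; rfl
  have c2 : (|x| + T) * (∫ ξ, R 1 ξ ∂gm ι + ∫ ξ, R (-1) ξ ∂gm ι) ≤ (|x| + T) * (2 * η) := mul_le_mul_of_nonneg_left (by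
    have h1' : ∫ ξ, R 1 ξ ∂gm ι ≤ η := h1
    have h2' : ∫ ξ, R (-1) ξ ∂gm ι ≤ η := h2
    linarith) ℙ
  rw [show ∫ _ : ι → ℝ, z ∂gm ι = z by simp]
  exact add_le_add (add_le_add le_rfl c2) c1

theorem var_le (hsp : ScaleParams M sigv lamv) :
    ∃ N0 : ℕ, ∀ N ≥ N0, ∀ v ∈ VN N, ∀ w ∈ VN N, ∀ p q, 0 ≤ p → p ≤ q → q ≤ 1 →
      |cvY N M sigv lamv p q 0 1 v w| ≤ (2 * (∑ i ∈ Icc 1 M, sigv i ^ 2) + 1) * log N ∧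
      cvY N M sigv lamv p q p q v v ≤ (2 * (∑ i ∈ Icc 1 M, sigv i ^ 2) + 1) * log N := by
  obtain ⟨N0, h⟩ := cvY_est hsp 1 one_pos
  refine ⟨max N0 2, fun N hN v hv w hw p q hp hpq hq ↦ ?_⟩
  rw [ge_iff_le, max_le_iff] at hN
  have L0 : 0 ≤ log N := log_natCast_nonneg N
  have S0 : 0 ≤ ∑ i ∈ Icc 1 M, sigv i ^ 2 := sum_nonneg fun _ _ ↦ sq_nonneg _
  have key : ∀ w, 0 ≤ Qf M sigv lamv p q (max (bs N v w) (rs N v)) - Qf M sigv lamv p q (rs N v) ∧ Qf M sigv lamv p q (max (bs N v w) (rs N v)) - Qf M sigv lamv p q (rs N v) ≤ 2 * (∑ i ∈ Icc 1 M, sigv i ^ 2) := fun w ↦ by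
    have a := Qf_lip hsp p q (le_max_right (bs N v w) (rs N v))
    refine ⟨a.1, a.2.trans ?_⟩
    have r := rs_mem hN.2 v
    have : bs N v w ≤ 1 := by
      unfold bs; have : 0 ≤ fl (v - w) / log N := div_nonneg (fl_nonneg _) L0
      linarith
    have : max (bs N v w) (rs N v) - rs N v ≤ 2 := by linarith [max_le this r.2]
    nlinarith
  have e := fun w hw p' q' a b c d ↦ abs_le.1 (h N hN.1 v hv w hw p q p' q' a b hpq c d)
  have k := key w
  have k2 := key v
  have f1 := e w hw 0 1 le_rfl hp hq le_rfl
  have f2 := e v hv p q hp le_rfl le_rfl hq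
  refine ⟨abs_le.2 ⟨?_, ?_⟩, ?_⟩ <;> nlinarith

theorem conc (hsp : ScaleParams M sigv lamv) (he : EffParams M sigv lamv m sigb lamb sigbar)
    {β : ℝ} (hβ : 0 < β) {α α' : ℝ} (h0 : 0 ≤ α) (h1 : α ≤ α') (h2 : α' ≤ 1) {θs κ : ℝ} (hκ : 0 ≤ θs * κ)
    (hs : ∑ i ∈ range m, th m sigb β i * (Qf M sigv lamv α α' (lamb (i+1)) - Qf M sigv lamv α α' (lamb i)) = θs * κ)
    {η : ℝ} (hη : 0 < η) :
    ∃ N0 : ℕ, ∀ N ≥ N0, ∀ Aw : ℝ → ℝ → 𝕍 N → (𝕍 N → ℝ), (∀ p q p' q' v w, dt (Aw p q v) (Aw p' q' w) = cvY N M sigv lamv p q p' q' v w) →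
      ∫ ξ, ∑ v, gw 𝟘 (fun v ↦ β • Aw 0 1 v) v ξ * |dt (Aw α α' v) ξ - β * (θs * κ) * log N| ∂(gm _) ≤ η * log N := by
  set S := 2 * (∑ i ∈ Icc 1 M, sigv i ^ 2) + 1
  have S0 : 0 < S := by have : 0 ≤ ∑ i ∈ Icc 1 M, sigv i ^ 2 := sum_nonneg fun _ _ ↦ sq_nonneg _
                        positivity
  set x := β * (θs * κ)
  have x0 : 0 ≤ x := by positivity
  set T := 4 + 2 * S
  set e := η / (6 * (x + T))
  have e0 : 0 < e := by positivity
  have ee : (x + T) * (2 * e) = η / 3 := by grind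
  obtain ⟨N1, c1⟩ := conc1 hsp he hβ h0 h1 h2 hκ hs 1 𝕂 e0 (by positivity : 0 < η / 3)
  obtain ⟨N2, c2⟩ := conc1 hsp he hβ h0 h1 h2 hκ hs (-1) 𝕂 e0 (by positivity : 0 < η / 3)
  obtain ⟨N3, c3⟩ := var_le hsp
  obtain ⟨N4, c4⟩ := logN_large (6 / η)
  refine ⟨max (max N1 N2) (max N3 N4), fun N hN Aw hA ↦ ?_⟩
  simp only [ge_iff_le, max_le_iff] at hN
  obtain ⟨hN2, hL⟩ := c4 N hN.2.2
  have L0 : 0 ≤ log N := log_natCast_nonneg N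
  have Np : 𝟎 < N := by positivity
  have : Nonempty 𝕍 N := ⟨⟨(0, 0), by rw [mem_VN]; simp⟩⟩
  refine (conc_gen (fun v ↦ β • Aw 0 1 v) (fun v ↦ Aw α α' v) (z := η / 3 * log N) (T := T * log N) (Vr := S * log N) ℙ ℙ
    (fun v ↦ by rw [hA]; exact (c3 N hN.2.1 v v.2 v v.2 α α' h0 h1 h2).2) (c1 N hN.1.1 Aw hA) (c2 N hN.1.2 Aw hA)).trans ?_
  have card : (Fintype.card 𝕍 N : ℝ) ≤ exp (4 * log N) := by
    rw [show 4 * log N = log N * ((4:ℕ):ℝ) by norm_num; ring, exp_mul, exp_log Np, Real.rpow_natCast, Fintype.card_coe]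
    have : (VN N).card = (N + 1) * (N + 1) := by
      have : VN N = Icc (0:ℤ) N ×ˢ Icc (0:ℤ) N := by
        ext v; rw [mem_VN, mem_product, mem_Icc, mem_Icc]
      rw [this, card_product, Int.card_Icc]; simp
    rw [this]; push_cast
    have n2 : (2:ℝ) ≤ N := by exact_mod_cast hN2
    have : (N:ℝ) + 1 ≤ N ^ 2 := by nlinarith
    calc ((N:ℝ) + 1) * (N + 1) ≤ N ^ 2 * N ^ 2 := by gcongr
      _ = _ := by ring
  have t : (Fintype.card 𝕍 N : ℝ) * (2 * exp (2 * (S * log N) - T * log N)) ≤ 2 := by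
    calc _ ≤ exp (4 * log N) * (2 * exp (2 * (S * log N) - T * log N)) := by gcongr
      _ = 2 * (exp (4 * log N) * exp (2 * (S * log N) - T * log N)) := by ring
      _ = 2 := by rw [← exp_add, show 4 * log N + (2 * (S * log N) - T * log N) = 0 by simp only [T]; ring, exp_zero, mul_one]
  rw [div_le_iff₀ hη] at hL
  rw [abs_of_nonneg ℙ, ← add_mul, mul_right_comm, ee]
  linarith

end P27

section P28
open MeasureTheory

variable {ι V : Type} [Fintype ι] [Fintype V] [Nonempty V]

theorem gW_marg (A : V → ι → ℝ) {s : ℕ} (k : Fin s) (ξ : ι → ℝ) (f : V → ℝ) :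
    ∑ vv : Fin s → V, gW 𝟘 A vv ξ * f (vv k) = ∑ v, gw 𝟘 A v ξ * f v := by
  have e : ∀ vv : Fin s → V, gW 𝟘 A vv ξ * f (vv k) = ∏ i, (gw 𝟘 A (vv i) ξ * (if i = k then f (vv i) else 1)) := fun vv ↦ by
    rw [prod_mul_distrib, Finset.prod_ite_eq' univ k fun i ↦ f (vv i), if_pos (mem_univ _)]; rfl
  simp_rw [e]
  have p := Finset.prod_univ_sum (fun _ : Fin s ↦ (univ : Finset V)) (fun i v ↦ gw 𝟘 A v ξ * (if i = k then f v else 1))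
  rw [Fintype.piFinset_univ] at p
  rw [← p, Finset.prod_eq_single k (fun i _ hi ↦ by simp [hi, gw_sum]) (by simp)]
  simp

theorem ge_int (A : V → ι → ℝ) {s : ℕ} (F : (Fin s → V) → ℝ) : Integrable (fun ξ ↦ ∑ vv : Fin s → V, gW 𝟘 A vv ξ * F vv) (gm ι) :=
  integrable_finsetSum _ fun vv _ ↦ ((integrable_const 𝟏).mono' (gW_meas _ _ _).aestronglyMeasurable (ae_of_all _ fun ξ ↦ by
    rw [norm_eq_abs, abs_of_nonneg (gW_nonneg _ _ _ _)]; exact gW_le_one _ _ _ _)).mul_const _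

theorem ge_const_mul (A : V → ι → ℝ) {s : ℕ} (c : ℝ) (F : (Fin s → V) → ℝ) : ge A s (fun vv ↦ c * F vv) = c * ge A s F := by
  unfold ge; rw [← integral_const_mul]
  congr 1; ext ξ; rw [mul_sum]; exact sum_congr rfl fun _ _ ↦ by ring

theorem ge_const (A : V → ι → ℝ) (s : ℕ) (c : ℝ) : ge A s (fun _ ↦ c) = c := by
  unfold ge; simp [← sum_mul, gW_sum]

theorem ge_close (A : V → ι → ℝ) {s : ℕ} (k : Fin s) (F G : (Fin s → V) → ℝ) (B : V → ℝ) {C e : ℝ} (hC : 0 ≤ C)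
    (h : ∀ vv, |F vv - G vv| ≤ C * B (vv k)) (hB : ∫ ξ, ∑ v, gw 𝟘 A v ξ * B v ∂gm ι ≤ e) : |ge A s F - ge A s G| ≤ C * e := by
  unfold ge
  rw [← integral_sub (ge_int A F) (ge_int A G)]
  refine abs_integral_le_integral_abs.trans (le_trans ?_ (mul_le_mul_of_nonneg_left hB hC))
  rw [← integral_const_mul]
  have e : ∀ ξ, C * ∑ v, gw 𝟘 A v ξ * B v = ∑ vv : Fin s → V, gW 𝟘 A vv ξ * (C * B (vv k)) := fun ξ ↦ by
    rw [← gW_marg A k ξ B, mul_sum]; exact sum_congr rfl fun _ _ ↦ by ring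
  simp_rw [e]
  refine integral_mono ((ge_int A F).sub (ge_int A G)).abs (ge_int A _) fun ξ ↦ ?_
  simp only [← sum_sub_distrib]
  refine (abs_sum_le_sum_abs _ _).trans (sum_le_sum fun vv _ ↦ ?_)
  rw [← mul_sub, abs_mul, abs_of_nonneg (gW_nonneg _ _ _ _)]
  exact mul_le_mul_of_nonneg_left (h vv) (gW_nonneg _ _ _ _)

theorem ge_abs (A : V → ι → ℝ) {s : ℕ} (F : (Fin s → V) → ℝ) {C : ℝ} (h : ∀ vv, |F vv| ≤ C) : |ge A s F| ≤ C := by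
  unfold ge
  refine abs_integral_le_integral_abs.trans ?_
  have e : ∫ _ : ι → ℝ, C ∂gm ι = C := by simp
  rw [← e]
  refine integral_mono (ge_int A F).abs (integrable_const _) fun ξ ↦ ?_
  refine (abs_sum_le_sum_abs _ _).trans ?_
  rw [← one_mul C, ← gW_sum 𝟘 A s ξ, sum_mul]
  refine sum_le_sum fun vv _ ↦ ?_
  rw [abs_mul, abs_of_nonneg (gW_nonneg _ _ _ _)]
  exact mul_le_mul_of_nonneg_left (h vv) (gW_nonneg _ _ _ _)

theorem ge_succ (A : V → ι → ℝ) {s : ℕ} (F : (Fin s → V) → V → ℝ) :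
    ge A (s + 1) (fun vv ↦ F (fun i ↦ vv i.castSucc) (vv (Fin.last s))) = ∫ ξ, ∑ vv : Fin s → V, gW 𝟘 A vv ξ * ∑ v, gw 𝟘 A v ξ * F vv v ∂gm ι := by
  unfold ge
  congr 1; ext ξ
  rw [← (Fin.snocEquiv fun _ : Fin (s + 1) ↦ V).sum_comp, Fintype.sum_prod_type, sum_comm]
  refine sum_congr rfl fun vv _ ↦ ?_
  rw [mul_sum]
  refine sum_congr rfl fun v _ ↦ ?_
  simp [Fin.snocEquiv, gW, Fin.prod_univ_castSucc, mul_assoc]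

theorem ge_ibp (A X : V → ι → ℝ) {s : ℕ} (k : Fin s) (h : (Fin s → V) → ℝ) :
    ∫ ξ, ∑ vv : Fin s → V, gW 𝟘 A vv ξ * (h vv * dt (X (vv k)) ξ) ∂gm ι
      = ∑ l, ge A s (fun vv ↦ h vv * dt (A (vv l)) (X (vv k)))
        - s * ge A (s + 1) (fun vv ↦ h (fun i ↦ vv i.castSucc) * dt (A (vv (Fin.last s))) (X (vv k.castSucc))) := by
  have wi : ∀ vv : Fin s → V, Integrable (fun ξ ↦ dt (X (vv k)) ξ * gW 𝟘 A vv ξ) (gm ι) := fun vv ↦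
    (dt_integrable (X (vv k))).mono ((dt_meas _).mul (gW_meas _ _ _)).aestronglyMeasurable (ae_of_all _ fun ξ ↦ by
      rw [norm_mul]; refine mul_le_of_le_one_right (norm_nonneg _) ?_
      rw [norm_eq_abs, abs_of_nonneg (gW_nonneg _ _ _ _)]; exact gW_le_one _ _ _ _)
  have e1 : ∀ ξ (vv : Fin s → V), gW 𝟘 A vv ξ * (h vv * dt (X (vv k)) ξ) = h vv * (dt (X (vv k)) ξ * gW 𝟘 A vv ξ) := fun ξ vv ↦ by ring
  simp_rw [e1]
  rw [integral_finsetSum _ fun vv _ ↦ (wi vv).const_mul _]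
  simp_rw [integral_const_mul, gW_ibp]
  rw [ge_succ A (fun vv v ↦ h vv * dt (A v) (X (vv k)))]
  unfold ge
  have gi : ∀ vv : Fin s → V, Integrable (gW 𝟘 A vv) (gm ι) := fun vv ↦ (integrable_const 𝟏).mono' (gW_meas _ _ _).aestronglyMeasurable (ae_of_all _ fun ξ ↦ by
    rw [norm_eq_abs, abs_of_nonneg (gW_nonneg _ _ _ _)]; exact gW_le_one _ _ _ _)
  have q : ∀ (vv : Fin s → V) (D : V → ℝ), Integrable (fun ξ ↦ gW 𝟘 A vv ξ * ∑ v, gw 𝟘 A v ξ * D v) (gm ι) := fun vv D ↦ by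
    simp_rw [mul_sum, ← mul_assoc]
    refine integrable_finsetSum _ fun v _ ↦ ((gi vv).mono ((gW_meas _ _ _).mul (gw_meas _ _ _)).aestronglyMeasurable (ae_of_all _ fun ξ ↦ ?_)).mul_const _
    rw [Pi.mul_apply, norm_mul]; refine mul_le_of_le_one_right (norm_nonneg _) ?_
    rw [norm_eq_abs, abs_of_nonneg (gw_nonneg _ _ _ _)]; exact gw_le_one _ _ _ _
  have q1 : ∀ vv : Fin s → V, Integrable (fun ξ ↦ gW 𝟘 A vv ξ * (∑ i, dt (A (vv i)) (X (vv k)) - s * ∑ v, gw 𝟘 A v ξ * dt (A v) (X (vv k)))) (gm ι) := fun vv ↦ by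
    have := ((gi vv).mul_const (∑ i, dt (A (vv i)) (X (vv k)))).sub ((q vv fun v ↦ dt (A v) (X (vv k))).const_mul (s:ℝ))
    refine this.congr (ae_of_all _ fun ξ ↦ ?_)
    simp only [Pi.sub_apply]; ring
  have q2 : Integrable (fun ξ ↦ (s:ℝ) * ∑ vv : Fin s → V, gW 𝟘 A vv ξ * ∑ v, gw 𝟘 A v ξ * (h vv * dt (A v) (X (vv k)))) (gm ι) :=
    (integrable_finsetSum _ fun vv _ ↦ q vv _).const_mul _
  have q3 : Integrable (fun ξ ↦ ∑ l, ∑ vv : Fin s → V, gW 𝟘 A vv ξ * (h vv * dt (A (vv l)) (X (vv k)))) (gm ι) :=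
    integrable_finsetSum _ fun l _ ↦ ge_int A _
  rw [← integral_finsetSum _ fun l _ ↦ ge_int A _, ← integral_const_mul, ← integral_sub q3 q2]
  simp_rw [← integral_const_mul]
  rw [← integral_finsetSum _ fun vv _ ↦ (q1 vv).const_mul _]
  congr 1; ext ξ
  rw [sum_comm, mul_sum, ← sum_sub_distrib]
  refine sum_congr rfl fun vv _ ↦ ?_
  simp only [mul_sub, mul_sum]
  congr 1 <;> exact sum_congr rfl fun _ _ ↦ by ring

theorem gg_abs (Y X : V → ι → ℝ) {β : ℝ} (hβ : 0 < β) (I : V → V → ℝ) (B : V → ℝ) {κ c x e η C : ℝ} (hc : 0 < c) (hC : 0 ≤ C)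
    (h1 : ∫ ξ, ∑ v, gw 𝟘 (fun v ↦ β • Y v) v ξ * |dt (X v) ξ - x| ∂gm ι ≤ η)
    (hB1 : ∀ v w, |dt (X v) (Y w) - c * I v w| ≤ B v) (hB2 : ∀ v, |dt (X v) (Y v) - κ| ≤ B v)
    (hB : ∫ ξ, ∑ v, gw 𝟘 (fun v ↦ β • Y v) v ξ * B v ∂gm ι ≤ e)
    {s : ℕ} (k : Fin s) (h : (Fin s → V) → ℝ) (hh : ∀ vv, |h vv| ≤ C) :
    |ge (fun v ↦ β • Y v) (s + 1) (fun vv ↦ I (vv k.castSucc) (vv (Fin.last s)) * h (fun i ↦ vv i.castSucc))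
      - ((1 / (s:ℝ)) * ge (fun v ↦ β • Y v) 2 (fun vv ↦ I (vv 0) (vv 1)) * ge (fun v ↦ β • Y v) s h
        + (1 / (s:ℝ)) * ∑ l ∈ univ.erase k, ge (fun v ↦ β • Y v) s (fun vv ↦ I (vv k) (vv l) * h vv))|
      ≤ (2 * C * η + β * C * e * (2 * s + 2)) / (s * β * c) := by
  set A := fun v ↦ β • Y v with hA
  have iX : Integrable (fun ξ ↦ ∑ v, gw 𝟘 A v ξ * |dt (X v) ξ - x|) (gm ι) := integrable_finsetSum _ fun v _ ↦
    (((dt_integrable (X v)).sub (integrable_const x)).abs).mono ((gw_meas _ _ _).mul ((dt_meas _).sub_const _).abs).aestronglyMeasurable (ae_of_all _ fun ξ ↦ by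
      rw [norm_mul, norm_eq_abs, abs_of_nonneg (gw_nonneg _ _ _ _)]
      exact mul_le_of_le_one_left (norm_nonneg _) (gw_le_one _ _ _ _))
  have main : ∀ {r : ℕ} (k : Fin r) (g : (Fin r → V) → ℝ) (D : ℝ), 0 ≤ D → (∀ vv, |g vv| ≤ D) →
      |x * ge A r g - β * (κ * ge A r g + c * ∑ l ∈ univ.erase k, ge A r (fun vv ↦ I (vv k) (vv l) * g vv)
        - r * (c * ge A (r + 1) (fun vv ↦ I (vv k.castSucc) (vv (Fin.last r)) * g (fun i ↦ vv i.castSucc))))| ≤ D * η + β * (D * e) * (2 * r) := by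
    intro r k g D hD hg
    have ib := ge_ibp A X k g
    set W := ∫ ξ, ∑ vv : Fin r → V, gW 𝟘 A vv ξ * (g vv * dt (X (vv k)) ξ) ∂gm ι with hW
    have a1 : |W - x * ge A r g| ≤ D * η := by
      have wi : Integrable (fun ξ ↦ ∑ vv : Fin r → V, gW 𝟘 A vv ξ * (g vv * dt (X (vv k)) ξ)) (gm ι) := integrable_finsetSum _ fun vv _ ↦
        ((dt_integrable (X (vv k))).const_mul (g vv)).mono ((gW_meas _ _ _).mul ((dt_meas _).const_mul _)).aestronglyMeasurable (ae_of_all _ fun ξ ↦ by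
          rw [norm_mul, norm_eq_abs, abs_of_nonneg (gW_nonneg _ _ _ _)]
          exact mul_le_of_le_one_left (norm_nonneg _) (gW_le_one _ _ _ _))
      rw [← ge_const_mul, hW, ge, ← integral_sub wi (ge_int A _)]
      refine abs_integral_le_integral_abs.trans (le_trans ?_ (mul_le_mul_of_nonneg_left h1 hD))
      rw [← integral_const_mul]
      refine integral_mono (wi.sub (ge_int A _)).abs (iX.const_mul _) fun ξ ↦ ?_
      simp only [← sum_sub_distrib, ← gW_marg A k ξ fun v ↦ |dt (X v) ξ - x|, mul_sum]
      refine (abs_sum_le_sum_abs _ _).trans (sum_le_sum fun vv _ ↦ ?_)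
      rw [← mul_sub, abs_mul, abs_of_nonneg (gW_nonneg _ _ _ _), mul_left_comm, mul_comm x, ← mul_sub, abs_mul]
      exact mul_le_mul_of_nonneg_left (mul_le_mul_of_nonneg_right (hg vv) (abs_nonneg _)) (gW_nonneg _ _ _ _)
    have b1 : ∀ l, ge A r (fun vv ↦ g vv * dt (A (vv l)) (X (vv k))) = β * ge A r (fun vv ↦ g vv * dt (X (vv k)) (Y (vv l))) := fun l ↦ by
      rw [← ge_const_mul]; congr 1; ext vv; rw [hA, dt_smul_left, dt_comm]; ring
    have b2 : ge A (r + 1) (fun vv ↦ g (fun i ↦ vv i.castSucc) * dt (A (vv (Fin.last r))) (X (vv k.castSucc)))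
        = β * ge A (r + 1) (fun vv ↦ g (fun i ↦ vv i.castSucc) * dt (X (vv k.castSucc)) (Y (vv (Fin.last r)))) := by
      rw [← ge_const_mul]; congr 1; ext vv; rw [hA, dt_smul_left, dt_comm]; ring
    have gm' : ∀ {a b z : ℝ}, |z| ≤ D → |z * a - z * b| ≤ D * |a - b| := fun h ↦ by
      rw [← mul_sub, abs_mul]; exact mul_le_mul_of_nonneg_right h (abs_nonneg _)
    have c1 : |ge A r (fun vv ↦ g vv * dt (X (vv k)) (Y (vv k))) - κ * ge A r g| ≤ D * e := by
      rw [← ge_const_mul]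
      refine ge_close A k _ _ B hD (fun vv ↦ ?_) hB
      rw [mul_comm κ]
      exact (gm' (hg vv)).trans (mul_le_mul_of_nonneg_left (hB2 _) hD)
    have c2 : ∀ l, |ge A r (fun vv ↦ g vv * dt (X (vv k)) (Y (vv l))) - c * ge A r (fun vv ↦ I (vv k) (vv l) * g vv)| ≤ D * e := fun l ↦ by
      rw [← ge_const_mul]
      refine ge_close A k _ _ B hD (fun vv ↦ ?_) hB
      rw [show c * (I (vv k) (vv l) * g vv) = g vv * (c * I (vv k) (vv l)) by ring]
      exact (gm' (hg vv)).trans (mul_le_mul_of_nonneg_left (hB1 _ _) hD)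
    have c3 : |ge A (r + 1) (fun vv ↦ g (fun i ↦ vv i.castSucc) * dt (X (vv k.castSucc)) (Y (vv (Fin.last r))))
        - c * ge A (r + 1) (fun vv ↦ I (vv k.castSucc) (vv (Fin.last r)) * g (fun i ↦ vv i.castSucc))| ≤ D * e := by
      rw [← ge_const_mul]
      refine ge_close A k.castSucc _ _ B hD (fun vv ↦ ?_) hB
      rw [show ∀ a b : ℝ, c * (a * b) = b * (c * a) from fun a b ↦ by ring]
      exact (gm' (hg _)).trans (mul_le_mul_of_nonneg_left (hB1 _ _) hD)
    have d1 : |∑ l ∈ univ.erase k, ge A r (fun vv ↦ g vv * dt (X (vv k)) (Y (vv l))) - c * ∑ l ∈ univ.erase k, ge A r (fun vv ↦ I (vv k) (vv l) * g vv)| ≤ (r - 1) * (D * e) := by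
      rw [mul_sum, ← sum_sub_distrib]
      refine (abs_sum_le_sum_abs _ _).trans ((sum_le_sum fun l _ ↦ c2 l).trans ?_)
      rw [sum_const, nsmul_eq_mul, Finset.card_erase_of_mem (mem_univ _), Finset.card_fin, Nat.cast_sub (by have := k.2; omega), Nat.cast_one]
    simp_rw [b1, b2] at ib
    rw [← mul_sum, ← add_sum_erase _ _ (mem_univ k)] at ib
    have r0 : 𝟎 ≤ r := r.cast_nonneg
    rw [abs_le] at a1 c1 c3 d1 ⊢
    have m1 := mul_le_mul_of_nonneg_left c1.1 hβ.le
    have m2 := mul_le_mul_of_nonneg_left c1.2 hβ.le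
    have m3 := mul_le_mul_of_nonneg_left c3.1 (mul_nonneg hβ.le r0)
    have m4 := mul_le_mul_of_nonneg_left c3.2 (mul_nonneg hβ.le r0)
    have m5 := mul_le_mul_of_nonneg_left d1.1 hβ.le
    have m6 := mul_le_mul_of_nonneg_left d1.2 hβ.le
    constructor <;> linarith
  have E1 := main k h C hC hh
  have E2 := main (0 : Fin 1) (fun _ ↦ 1) 1 zero_le_one (fun _ ↦ by simp)
  have em : (univ : Finset (Fin 1)).erase 0 = ∅ := by decide
  rw [ge_const, em, Finset.sum_empty] at E2
  have H := ge_abs A h hh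
  set T := ge A (s + 1) (fun vv ↦ I (vv k.castSucc) (vv (Fin.last s)) * h (fun i ↦ vv i.castSucc))
  set U := ∑ l ∈ univ.erase k, ge A s (fun vv ↦ I (vv k) (vv l) * h vv)
  have E3 : |x - β * (κ - c * ge A 2 (fun vv ↦ I (vv 0) (vv 1)))| ≤ η + β * e * 2 := by grind
  set T2 := ge A 2 (fun vv ↦ I (vv 0) (vv 1))
  set G := ge A s h
  have s0 : 𝟎 < s := by exact_mod_cast (by have := k.2; omega : 0 < s)
  have E4 : |G * (x - β * (κ - c * T2))| ≤ C * (η + β * e * 2) := by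
    rw [abs_mul]; exact mul_le_mul H E3 (abs_nonneg _) hC
  rw [le_div_iff₀ ℙ, ← abs_of_pos (by positivity : 0 < s * β * c), ← abs_mul]
  have e5 : (T - (1 / s * T2 * G + 1 / s * U)) * (s * β * c) = (x * G - β * (κ * G + c * U - s * (c * T))) - G * (x - β * (κ - c * T2)) := by
    field_simp; ring
  rw [e5]
  refine (abs_sub _ _).trans ?_
  linarith

end P28

section P29
open MeasureTheory

theorem clip_int {a b : ℝ} (h : a ≤ b) (q : ℝ) : ∫ r in a..b, 𝟙(r < q) = cl a b q - a := by
  obtain ⟨c1, c2⟩ := cl_mem (t := q) h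
  have anti : Antitone fun r : ℝ ↦ 𝟙(r < q) := fun x y hxy ↦ by
    dsimp only; split_ifs <;> first | (exfalso; linarith) | norm_num
  rw [← intervalIntegral.integral_add_adjacent_intervals (anti.intervalIntegrable (a := a) (b := cl a b q)) anti.intervalIntegrable,
    intervalIntegral.integral_congr_Ioo_of_le c1 (g := fun _ ↦ 1) fun r hr ↦ if_pos ?_,
    intervalIntegral.integral_congr_Ioo_of_le c2 (g := fun _ ↦ 0) fun r hr ↦ if_neg ?_]
  · simp
  · have := hr.1; have := hr.2; unfold cl at *; grind
  · have := hr.1; have := hr.2; unfold cl at *; grind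

theorem cl_abs (p q s t : ℝ) : |cl p q s - cl p q t| ≤ |s - t| := by
  rcases le_total s t with h | h
  · rw [abs_sub_comm, abs_sub_comm s, abs_of_nonneg (sub_nonneg.2 (cl_mono h)), abs_of_nonneg (sub_nonneg.2 h)]
    exact cl_lip h
  · rw [abs_of_nonneg (sub_nonneg.2 (cl_mono h)), abs_of_nonneg (sub_nonneg.2 h)]
    exact cl_lip h

theorem Jpos (hsp : ScaleParams M sigv lamv) : 0 < Qf M sigv lamv 0 1 1 := by
  unfold Qf
  refine sum_pos (fun i hi ↦ ?_) ⟨1, mem_Icc.2 ⟨le_rfl, hsp.1⟩⟩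
  rw [mem_Icc] at hi
  have a := sp_mem hsp hi.2
  have b := sp_mem hsp (show i - 1 ≤ M by omega)
  have c := hsp.2.2.2.2 (i - 1) 𝕆
  rw [Nat.sub_add_cancel hi.1] at c
  have d := hsp.2.1 i (mem_Icc.2 hi)
  have e : ∀ t : ℝ, 0 ≤ t → t ≤ 1 → min (cl 0 1 t) 1 = t := fun t h h' ↦ by unfold cl; grind
  rw [e _ a.1 a.2, e _ b.1 b.2]
  have : 0 < lamv i - lamv (i - 1) := by linarith
  positivity

set_option maxHeartbeats 800000 in
theorem approxK (hsp : ScaleParams M sigv lamv) {α α' : ℝ} (h0 : 0 ≤ α) (h1 : α ≤ α') (h2 : α' ≤ 1) {C₀ : ℝ} (hC : 0 < C₀) {ω : ℝ} (hω : 0 < ω) :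
    ∃ ρ0 : ℝ, 0 < ρ0 ∧ ∀ ρ ≤ ρ0, ∃ N0 : ℕ, ∀ N ≥ N0, ∀ P, IsGFF N P → ∀ v w : 𝕍 N,
      |cvY N M sigv lamv α α' 0 1 v w - Qf M sigv lamv 0 1 1 * log N * (∫ r in (JsigBar M sigv lamv α)..(JsigBar M sigv lamv α'), 𝟙(r < overlapQ N M sigv lamv P C₀ v w))|
        ≤ ω * log N + 2 * (2 * (∑ i ∈ Icc 1 M, sigv i ^ 2) + 1) * log N * (if ρ ≤ rs N v.1 then 1 else 0) ∧
      |cvY N M sigv lamv α α' 0 1 v v - (Qf M sigv lamv 0 1 α' - Qf M sigv lamv 0 1 α) * log N|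
        ≤ ω * log N + 2 * (2 * (∑ i ∈ Icc 1 M, sigv i ^ 2) + 1) * log N * (if ρ ≤ rs N v.1 then 1 else 0) := by
  set S := ∑ i ∈ Icc 1 M, sigv i ^ 2
  have S0 : 0 ≤ S := sum_nonneg fun _ _ ↦ sq_nonneg _
  set J := Qf M sigv lamv 0 1 1 with hJ
  have J0 : 0 < J := Jpos hsp
  set Q := Qf M sigv lamv 0 1
  have Qm : ∀ {x y}, x ≤ y → Q x ≤ Q y ∧ Q y - Q x ≤ S * (y - x) := fun h ↦ by
    have := Qf_lip hsp 0 1 h; exact ⟨by linarith [this.1], this.2⟩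
  have Q0 : Q 0 = 0 := by
    simp only [Q]; unfold Qf
    refine sum_eq_zero fun i _ ↦ ?_
    rw [min_eq_right (cl_mem zero_le_one).1, min_eq_right (cl_mem zero_le_one).1]; simp
  have qa : ∀ x, Qf M sigv lamv α α' x = cl (Q α) (Q α') (Q x) - Q α := fun x ↦ by
    rw [Qf_clamp h1 hsp]
    have : Q (cl α α' x) = cl (Q α) (Q α') (Q x) := by
      have a := (Qm h1).1
      unfold cl
      rcases le_total x α with h | h
      · simp_all
      · rcases le_total x α' with h' | h'
        · grind
        · simp_all
    linarith
  have κ1 : Q α' - Q α ≤ S := by grind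
  have κ0 := (Qm h1).1
  refine ⟨ω / (8 * (S + 1)), by positivity, fun ρ hρ ↦ ?_⟩
  have Sρ : S * ρ ≤ ω / 8 := by
    rw [le_div_iff₀ ℙ] at hρ
    by_cases hp : 0 ≤ ρ
    · nlinarith
    · nlinarith [not_le.1 hp]
  obtain ⟨N1, e1⟩ := cvY_est hsp (ω / 8) ℙ
  obtain ⟨N2, e2⟩ := var_le hsp
  obtain ⟨N3, e3⟩ := logN_large (8 * ((2 * S + 1) * C₀ / J) / ω + 1)
  refine ⟨max N1 (max N2 N3), fun N hN P hP v w ↦ ?_⟩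
  simp only [ge_iff_le, max_le_iff] at hN
  obtain ⟨N2', hL⟩ := e3 N hN.2.2
  set L := log N
  have L0 : 0 < L := lt_of_lt_of_le ℙ hL
  have hL' : (2 * S + 1) * C₀ / J ≤ ω / 8 * L := by
    have : 8 * ((2 * S + 1) * C₀ / J) / ω ≤ L := by linarith
    rw [div_le_iff₀ hω] at this; linarith
  have JB : ∀ x, 0 ≤ x → x ≤ 1 → JsigBar M sigv lamv x = Q x / J := fun x a b ↦ by
    unfold JsigBar; rw [Qf_J hsp a b, Qf_J hsp zero_le_one le_rfl]
  have q1 : overlapQ N M sigv lamv P C₀ v w = cvY N M sigv lamv 0 1 0 1 v w / (J * L + C₀) := by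
    unfold overlapQ; rw [psi_cov hsp hP v.2 w.2, Qf_J hsp zero_le_one le_rfl]
  rw [JB α h0 (h1.trans h2), JB α' (h0.trans h1) h2, clip_int (by gcongr), q1]
  set p := cvY N M sigv lamv 0 1 0 1 v w
  set K := cvY N M sigv lamv α α' 0 1 v w
  set q := p / (J * L + C₀) with hq
  have cI : J * L * (cl (Q α / J) (Q α' / J) q - Q α / J) = L * (cl (Q α) (Q α') (J * q) - Q α) := by
    have : J * cl (Q α / J) (Q α' / J) q = cl (Q α) (Q α') (J * q) := by
      unfold cl; rw [mul_max_of_nonneg _ _ J0.le, mul_min_of_nonneg _ _ J0.le, mul_div_cancel₀ _ J0.ne', mul_div_cancel₀ _ J0.ne']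
    rw [← this]; field_simp
  rw [cI]
  have B1 := e2 N hN.2.1 v v.2 w w.2 α α' h0 h1 h2
  have B2 := (e2 N hN.2.1 v v.2 v v.2 α α' h0 h1 h2).1
  have cm := cl_mem (t := J * q) κ0
  have r01 := rs_mem N2' v
  by_cases hr : ρ ≤ rs N v.1
  · rw [if_pos hr, mul_one]
    have b1 := abs_le.1 B1.1
    have b2 := abs_le.1 B2
    have g1 : 0 ≤ L * (cl (Q α) (Q α') (J * q) - Q α) := mul_nonneg L0.le 𝕃
    have g2 : L * (cl (Q α) (Q α') (J * q) - Q α) ≤ L * S := mul_le_mul_of_nonneg_left 𝕃 L0.le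
    have g3 : (Q α' - Q α) * L ≤ S * L := mul_le_mul_of_nonneg_right κ1 L0.le
    have g4 : 0 ≤ (Q α' - Q α) * L := mul_nonneg 𝕃 L0.le
    have g5 : 0 ≤ S * L := by positivity
    have g6 : 0 < ω * L := by positivity
    constructor <;> rw [abs_le] <;> constructor <;> linarith
  · rw [if_neg hr, mul_zero, add_zero]
    rw [not_le] at hr
    have Sr : S * rs N v.1 ≤ ω / 8 := (mul_le_mul_of_nonneg_left hr.le S0).trans Sρ
    have qr : 0 ≤ Qf M sigv lamv α α' (rs N v.1) ∧ Qf M sigv lamv α α' (rs N v.1) ≤ ω / 8 := by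
      have a := Qf_lip hsp α α' r01.1
      rw [qa 0, Q0, show cl (Q α) (Q α') 0 = Q α by
        unfold cl; exact max_eq_left ((min_le_left _ _).trans (by rw [← Q0]; exact (Qm h0).1)), sub_self, sub_zero, sub_zero] at a
      exact ⟨a.1, a.2.trans Sr⟩
    have Qr := Qm r01.1
    rw [Q0, sub_zero, sub_zero] at Qr
    have d1 := abs_le.1 (e1 N hN.1 v v.2 w w.2 α α' 0 1 le_rfl h0 h1 h2 le_rfl)
    have d2 := abs_le.1 (e1 N hN.1 v v.2 v v.2 α α' 0 1 le_rfl h0 h1 h2 le_rfl)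
    have d3 := abs_le.1 (e1 N hN.1 v v.2 w w.2 0 1 0 1 le_rfl le_rfl zero_le_one le_rfl le_rfl)
    rw [bs_self, max_eq_left r01.2, qa 1] at d2
    have c1 : cl (Q α) (Q α') (Q 1) = Q α' := by
      unfold cl; rw [min_eq_right (Qm h2).1, max_eq_right κ0]
    rw [c1] at d2
    have m1 : L * Qf M sigv lamv α α' (rs N v.1) ≤ L * (ω / 8) := mul_le_mul_of_nonneg_left qr.2 L0.le
    have m2 : 0 ≤ L * Qf M sigv lamv α α' (rs N v.1) := mul_nonneg L0.le qr.1
    refine ⟨?_, by rw [abs_le]; constructor <;> linarith⟩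
    rw [qa (max _ _)] at d1
    set y := Q (max (bs N v w) (rs N v.1))
    change -(ω / 8 * L) ≤ p - L * (y - Q (rs N v.1)) ∧ p - L * (y - Q (rs N v.1)) ≤ ω / 8 * L at d3
    have m3 : L * Q (rs N v.1) ≤ L * (ω / 8) := mul_le_mul_of_nonneg_left (Qr.2.trans Sr) L0.le
    have m4 : 0 ≤ L * Q (rs N v.1) := mul_nonneg L0.le Qr.1
    have pq : |p - L * (J * q)| ≤ ω / 8 * L := by
      have D0 : 0 < J * L + C₀ := by positivity
      have : p - L * (J * q) = p * (C₀ / (J * L + C₀)) := by rw [hq]; field_simp; ring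
      rw [this, abs_mul, abs_of_pos (by positivity : 0 < C₀ / (J * L + C₀))]
      have bp := (e2 N hN.2.1 v v.2 w w.2 0 1 le_rfl zero_le_one le_rfl).1
      refine le_trans ?_ hL'
      calc |p| * (C₀ / (J * L + C₀)) ≤ ((2 * S + 1) * L) * (C₀ / (J * L)) := by
            gcongr
            linarith
        _ = _ := by field_simp
    have pq' := abs_le.1 pq
    have cL : L * |cl (Q α) (Q α') y - cl (Q α) (Q α') (J * q)| ≤ |L * y - L * (J * q)| := by
      rw [← mul_sub, abs_mul, abs_of_pos L0]
      refine mul_le_mul_of_nonneg_left ?_ L0.le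
      exact cl_abs _ _ _ _
    have yq : |L * y - L * (J * q)| ≤ 3 * (ω / 8 * L) := by rw [abs_le]; constructor <;> linarith
    have := cL.trans yq
    rw [← abs_of_pos L0, ← abs_mul, abs_of_pos L0] at this
    have := abs_le.1 this
    rw [abs_le]; constructor <;> linarith

end P29


end

/-- **Theorem (Approximate extended Ghirlanda–Guerra identities).**
For `β ∈ ℬ`, scales `λ^{j−1} < α < α' < λ^{j + (m−j)1_{{j=l_β}}}` with `j ∈ {1,…,l_β}`,
`S_{α,α'} = (𝒥̄_{σ²}(α), 𝒥̄_{σ²}(α')]`, any `s`, `k ∈ {1,…,s}` and any uniformly bounded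
family of functions `h : V_N^s → ℝ`, the Ghirlanda–Guerra defect vanishes as `N → ∞`. -/
theorem approximate_extended_ghirlanda_guerra
    (M : ℕ) (sigv lamv : ℕ → ℝ) (hparams : ScaleParams M sigv lamv)
    (m : ℕ) (sigb lamb : ℕ → ℝ) (sigbar : ℝ → ℝ)
    (heff : EffParams M sigv lamv m sigb lamb sigbar)
    (P : ℕ → MeasureTheory.Measure FieldSp) (hGFF : ∀ N, IsGFF N (P N))
    (C₀ : ℝ) (hC₀ : IsVarBound M sigv lamv P C₀)
    (β : ℝ) (hβ : β ∈ critSet m sigb)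
    (j : ℕ) (hj1 : 1 ≤ j) (hj2 : j ≤ lbeta m sigb β)
    (α α' : ℝ) (hα : lamb (j - 1) < α) (hαα' : α < α')
    (hα' : α' < lamb (if j = lbeta m sigb β then m else j))
    (s : ℕ) (k : Fin s)
    (h : ℕ → (Fin s → Vtx) → ℝ) (C : ℝ) (hC : ∀ N vv, |h N vv| ≤ C) :
    Filter.Tendsto (fun N =>
      |gibbsExp N M sigv lamv (P N) β (s + 1) (fun vv =>
          (∫ r in (JsigBar M sigv lamv α)..(JsigBar M sigv lamv α'),
            if r < overlapQ N M sigv lamv (P N) C₀ (vv k.castSucc) (vv (Fin.last s)) then (1 : ℝ) else 0)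
            * h N fun i => vv i.castSucc)
        - ((1 / (s : ℝ)) * (gibbsExp N M sigv lamv (P N) β 2 (fun vv =>
              ∫ r in (JsigBar M sigv lamv α)..(JsigBar M sigv lamv α'),
                if r < overlapQ N M sigv lamv (P N) C₀ (vv 0) (vv 1) then (1 : ℝ) else 0))
              * gibbsExp N M sigv lamv (P N) β s (h N)
            + (1 / (s : ℝ)) * ∑ l ∈ Finset.univ.erase k,
                gibbsExp N M sigv lamv (P N) β s (fun vv =>
                  (∫ r in (JsigBar M sigv lamv α)..(JsigBar M sigv lamv α'),
                    if r < overlapQ N M sigv lamv (P N) C₀ (vv k) (vv l) then (1 : ℝ) else 0)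
                    * h N vv))|)
      Filter.atTop (nhds 0) := by
  rw [Metric.tendsto_atTop]
  intro τ hτ
  have b0 : 0 < β := hβ.1
  have C0 : 0 ≤ C := (abs_nonneg _).trans (hC 0 (fun _ => 0))
  obtain ⟨a0, a1, θs, θ0, hs⟩ := jfac hparams heff b0 hj1 hj2 hα hαα' hα'
  have κ0 := (Qf_lip hparams 0 1 hαα'.le).1
  have J0 := Jpos hparams
  have s0 : 0 < (s:ℝ) := by exact_mod_cast k.pos
  set J := Qf M sigv lamv 0 1 1 with hJ
  set S := 2 * (∑ i ∈ Finset.Icc 1 M, sigv i ^ 2) + 1 with hS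
  have S0 : 0 < S := by
    have : 0 ≤ ∑ i ∈ Finset.Icc 1 M, sigv i ^ 2 := Finset.sum_nonneg fun _ _ => sq_nonneg _
    positivity
  set D := (2 * C + β * C * 2 * (2 * s + 2)) / (s * β * J) with hD
  have D0 : 0 ≤ D := by positivity
  set ω := τ / (D + 1) with hω
  have ω0 : 0 < ω := by positivity
  have fin : D * ω < τ := by
    rw [hω, mul_div_assoc', div_lt_iff₀ (by positivity)]; nlinarith
  obtain ⟨ρ0, r0, hA⟩ := approxK hparams a0 hαα'.le a1 hC₀.1 ω0
  have l1 : 0 < lamb 1 := by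
    obtain ⟨m1, -, l0, -, lmono, -⟩ := heff
    rw [← l0]; exact lmono 0 m1
  obtain ⟨N1, hA⟩ := hA (min ρ0 (lamb 1 / 2)) (min_le_left _ _)
  obtain ⟨N2, hB⟩ := conc hparams heff b0 a0 hαα'.le a1 (mul_nonneg θ0.le κ0) hs ω0
  obtain ⟨N3, hG⟩ := stripG hparams heff b0 (ρ := min ρ0 (lamb 1 / 2)) (lt_min r0 (by positivity))
    ((min_le_right _ _).trans_lt (by linarith)) (η := ω / (2 * S)) (by positivity)
  obtain ⟨N4, hL⟩ := logN_large 1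
  set ρ := min ρ0 (lamb 1 / 2)
  refine ⟨max (max N1 N2) (max N3 N4), fun N hN => ?_⟩
  simp only [ge_iff_le, max_le_iff] at hN
  have L1 := (hL N hN.2.2).2
  obtain ⟨Aw, hcov, hT⟩ := transfer hparams (hGFF N)
  have : Nonempty ↥(VN N) := ⟨⟨(0,0), by rw [mem_VN]; simp⟩⟩
  rw [Real.dist_eq, sub_zero, abs_abs]
  simp only [hT]
  set L := Real.log N with hLd
  have L0 : 0 < L := by linarith
  have hA := hA N hN.1.1 (P N) (hGFF N)
  have hB := hB N hN.1.2 Aw hcov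
  rw [← hLd] at hB
  have hG := hG N hN.2.1 Aw hcov
  refine lt_of_le_of_lt (gg_abs (Aw 0 1) (Aw α α') b0
    (fun v w => ∫ r in (JsigBar M sigv lamv α)..(JsigBar M sigv lamv α'), if r < overlapQ N M sigv lamv (P N) C₀ v w then (1 : ℝ) else 0)
    (fun v => ω * L + 2 * S * L * (if ρ ≤ rs N v.1 then 1 else 0)) (c := J * L) (e := 2 * ω * L) (by positivity) C0 hB
    (fun v w => by rw [hcov]; exact (hA v w).1) (fun v => by rw [hcov]; exact (hA v v).2) ?_ k (fun vv => h N fun i => vv i)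
    (fun vv => hC _ _)) ?_
  · have e1 : ∀ ξ : ↥(VN N) → ℝ, ∑ v, gw (fun _ => 0) (fun v => β • Aw 0 1 v) v ξ * (ω * L + 2 * S * L * (if ρ ≤ rs N v.1 then 1 else 0))
        = ω * L + 2 * S * L * ∑ v, gw (fun _ => 0) (fun v => β • Aw 0 1 v) v ξ * (if ρ ≤ rs N v.1 then 1 else 0) := fun ξ => by
      simp only [mul_add, Finset.sum_add_distrib]
      rw [← Finset.sum_mul, gw_sum, one_mul, Finset.mul_sum]
      congr 1; exact Finset.sum_congr rfl fun _ _ => by ring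
    simp only [e1]
    have hi : MeasureTheory.Integrable (fun ξ => ∑ v : ↥(VN N), gw (fun _ => 0) (fun v => β • Aw 0 1 v) v ξ * (if ρ ≤ rs N v.1 then (1:ℝ) else 0)) (gm ↥(VN N)) := by
      refine (MeasureTheory.integrable_const (1:ℝ)).mono' (Finset.measurable_sum _ fun v _ => (gw_meas _ _ v).mul_const _).aestronglyMeasurable
        (MeasureTheory.ae_of_all _ fun ξ => ?_)
      exact gw_avg_abs _ _ _ _ _ fun v => by split_ifs <;> simp
    rw [MeasureTheory.integral_add (MeasureTheory.integrable_const _) (hi.const_mul _), MeasureTheory.integral_const_mul (2 * S * L)]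
    have := mul_le_mul_of_nonneg_left hG (by positivity : 0 ≤ 2 * S * L)
    have e2 : 2 * S * L * (ω / (2 * S)) = ω * L := by field_simp
    rw [e2] at this
    simp only [MeasureTheory.integral_const, MeasureTheory.probReal_univ, one_smul]
    linarith
  · refine lt_of_eq_of_lt ?_ fin
    rw [hD]; clear_value ω L; field_simp
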